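/- Generalized Cherednik–Macdonald identity for Σ of type B_n, case (ii): let n ≥ 2, ω₊,ω₋ ∈ ℂ₊ with Im(ω₊ω₋) < 0, and k_s, k_l ∈ ℂ₋ ∩ ω₊ω₋ℂ₊. Then ∫_{ℝⁿ} ∏_{α∈R_s} G(ω₊,ω₋;⟨α,v⟩+iω)/G(ω₊,ω₋;⟨α,v⟩+i(k_s+ω)) · ∏_{β∈R_l} G(ω₊,ω₋/2; ⟨β,v⟩/2+i(ω₊/2+ω₋/4)) / G(ω₊,ω₋/2; ⟨β,v⟩/2+i(k_l+ω₊/2+ω₋/4)) d′v converges absolutely and equals N_BC evaluated with quasi-periods (2ω₊, ω₋) and parameters γ = (k_s, k_s−ω₊, −ω₋/2, −ω₊−ω₋/2), κ = 2k_l. -/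

import Mathlib

open MeasureTheory Set
open scoped BigOperators Classical

noncomputable section

/-- Ruijsenaars' hyperbolic gamma function `G(ω₊,ω₋;z)`, defined by the integral
representation, valid on the strip `|Im z| < Re((ω₊+ω₋)/2)`. -/
def hypGammaInt (op om z : ℂ) : ℂ :=
  Complex.exp (Complex.I * ∫ y in Set.Ioi (0:ℝ),
    (1/(y:ℂ)) * (Complex.sin (2*(y:ℂ)*z) /
        (2 * Complex.sinh (op*(y:ℂ)) * Complex.sinh (om*(y:ℂ)))
      - z/(op*om*(y:ℂ))))

/-- The locus `-iω - Λ` (with `ω = (ω₊+ω₋)/2`, `Λ = ℤ≥0·iω₊ + ℤ≥0·iω₋`) containing the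
poles of the hyperbolic gamma function; off this set the meromorphic extension is defined. -/
def hypGammaPoles (op om : ℂ) : Set ℂ :=
  {z | ∃ m n : ℕ, z = -Complex.I*(op+om)/2 - (m:ℂ)*Complex.I*op - (n:ℂ)*Complex.I*om}

/-- Predicate expressing that `G : ℂ → ℂ` is the meromorphic extension in `z` of
Ruijsenaars' hyperbolic gamma function with quasi-periods `ω₊ = op`, `ω₋ = om`:
it agrees with the integral representation on the strip `|Im z| < Re((ω₊+ω₋)/2)`,
satisfies both functional equations (away from the zeros of the `cosh` factor, where
the two sides have poles), and is continuous away from the pole locus. -/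
structure IsHypGamma (op om : ℂ) (G : ℂ → ℂ) : Prop where
  strip : ∀ z : ℂ, |z.im| < ((op+om)/2).re → G z = hypGammaInt op om z
  funEqm : ∀ z : ℂ, Complex.cosh (Real.pi * z / op) ≠ 0 →
    G (z + Complex.I * om/2) = 2 * Complex.cosh (Real.pi * z / op) * G (z - Complex.I * om/2)
  funEqp : ∀ z : ℂ, Complex.cosh (Real.pi * z / om) ≠ 0 →
    G (z + Complex.I * op/2) = 2 * Complex.cosh (Real.pi * z / om) * G (z - Complex.I * op/2)
  cont : ContinuousOn G (hypGammaPoles op om)ᶜ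

/-- `∏_{α ∈ R_s} f(⟨α,v⟩)` where `R_s = {±ε_j}_{j=1}^n`. -/
def bcShort {n : ℕ} (f : ℝ → ℂ) (v : Fin n → ℝ) : ℂ :=
  ∏ j : Fin n, (f (v j) * f (-v j))

/-- `∏_{β ∈ R_l} f(⟨β,v⟩)` where `R_l = {±(ε_r ± ε_s)}_{1 ≤ r < s ≤ n}` (empty for `n = 1`). -/
def bcLong {n : ℕ} (f : ℝ → ℂ) (v : Fin n → ℝ) : ℂ :=
  ∏ p ∈ Finset.univ.filter (fun p : Fin n × Fin n => p.1 < p.2),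
    (f (v p.1 + v p.2) * f (-(v p.1 + v p.2)) * f (v p.1 - v p.2) * f (v p.2 - v p.1))

/-- The evaluation `N_BC` of the hyperbolic `BC_n` (Koornwinder-type) integral. -/
def NBC (G : ℂ → ℂ → ℂ → ℂ) (n : ℕ) (op om : ℂ) (γ : Fin 4 → ℂ) (κ : ℂ) : ℂ :=
  2^n * (Nat.factorial n : ℂ) * ((op*om) ^ ((1:ℂ)/2))^n *
    ∏ j ∈ Finset.range n,
      (G op om (Complex.I*((op+om)/2 + κ)) *
          G op om (Complex.I*((op+om)/2 + (2*(n:ℂ) - (j:ℂ) - 2)*κ + (γ 0 + γ 1 + γ 2 + γ 3)))) /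
        (G op om (Complex.I*((op+om)/2 + ((j:ℂ)+1)*κ)) *
          ∏ p ∈ Finset.univ.filter (fun p : Fin 4 × Fin 4 => p.1 < p.2),
            G op om (Complex.I*((op+om)/2 + (j:ℂ)*κ + γ p.1 + γ p.2)))

/-- Membership in the parameter space `𝒮_BC`. -/
def inSBC (op om : ℂ) (γ : Fin 4 → ℂ) (κ : ℂ) : Prop :=
  0 < op.re ∧ 0 < om.re ∧ (op*om).im < 0 ∧ (∀ r, (γ r).re < 0) ∧
    (∃ w : ℂ, 0 < w.re ∧ op + om + (γ 0 + γ 1 + γ 2 + γ 3) = op*om*w) ∧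
    κ.re < 0 ∧ ∃ w : ℂ, 0 < w.re ∧ κ = op*om*w

open Filter Topology Metric

/-- Differentiation under the integral sign for a holomorphic family with a local bound. -/
theorem hasDerivAt_integral_of_holo {α : Type*} [MeasurableSpace α] {μ : Measure α}
    {F : ℂ → α → ℂ} {p0 : ℂ} {ε : ℝ} (hε : 0 < ε) {bound : α → ℝ}
    (hmeas : ∀ p ∈ ball p0 ε, AEStronglyMeasurable (F p) μ)
    (hd : ∀ᵐ x ∂μ, DifferentiableOn ℂ (F · x) (ball p0 ε))
    (hb : ∀ᵐ x ∂μ, ∀ p ∈ ball p0 ε, ‖F p x‖ ≤ bound x) (hbi : Integrable bound μ) :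
    HasDerivAt (fun p => ∫ x, F p x ∂μ) (∫ x, deriv (F · x) p0 ∂μ) p0 := by
  have h2 : 0 < ε / 2 := by positivity
  have h4 : 0 < ε / 4 := by positivity
  have hp0 : p0 ∈ ball p0 ε := mem_ball_self hε
  refine (hasDerivAt_integral_of_dominated_loc_of_deriv_le (s := ball p0 (ε/2))
    (F' := fun p x => deriv (F · x) p) (bound := fun x => bound x / (ε/4))
    (ball_mem_nhds p0 h2) ?_ ?_ ?_ ?_ ?_ ?_).2
  · filter_upwards [ball_mem_nhds p0 hε] with p hp using hmeas p hp
  · exact Integrable.mono' hbi (hmeas p0 hp0) (hb.mono fun x hx => hx p0 hp0)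
  · let u : ℕ → ℂ := fun n => ((ε / (n + 2) : ℝ) : ℂ)
    have hu0 : Tendsto (fun n : ℕ => ε / ((n:ℝ) + 2)) atTop (𝓝 0) := by
      apply Tendsto.div_atTop tendsto_const_nhds
      exact tendsto_atTop_add_const_right _ _ tendsto_natCast_atTop_atTop
    have hu : Tendsto u atTop (𝓝[≠] 0) := by
      rw [tendsto_nhdsWithin_iff]
      refine ⟨?_, Eventually.of_forall fun n => ?_⟩
      · have := (Complex.continuous_ofReal.tendsto 0).comp hu0
        simpa [u, Function.comp_def] using this
      · simp only [u, mem_compl_iff, mem_singleton_iff, Complex.ofReal_eq_zero]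
        positivity
    refine aestronglyMeasurable_of_tendsto_ae atTop
      (f := fun n x => (u n)⁻¹ * (F (p0 + u n) x - F p0 x)) ?_ ?_
    · intro n
      refine AEStronglyMeasurable.const_mul ((hmeas _ ?_).sub (hmeas _ hp0)) _
      rw [mem_ball_iff_norm, add_sub_cancel_left]
      simp only [u, Complex.norm_real, Real.norm_eq_abs]
      rw [abs_of_pos (by positivity), div_lt_iff₀ (by positivity)]
      nlinarith [(Nat.cast_nonneg n : (0:ℝ) ≤ n)]
    · filter_upwards [hd] with x hx
      have : HasDerivAt (F · x) (deriv (F · x) p0) p0 :=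
        (hx.differentiableAt (ball_mem_nhds p0 hε)).hasDerivAt
      exact this.tendsto_slope_zero.comp hu
  · filter_upwards [hd, hb] with x hx hbx p hp
    apply Complex.norm_deriv_le_of_forall_mem_sphere_norm_le h4
    · refine DifferentiableOn.diffContOnCl ?_
      refine hx.mono (closure_ball_subset_closedBall.trans ?_)
      refine closedBall_subset_ball' ?_
      rw [mem_ball] at hp; linarith
    · intro w hw
      apply hbx
      rw [mem_ball] at hp ⊢
      rw [mem_sphere] at hw
      linarith [dist_triangle w p p0]
  · exact hbi.div_const _
  · filter_upwards [hd] with x hx p hp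
    refine (hx.differentiableAt (isOpen_ball.mem_nhds ?_)).hasDerivAt
    rw [mem_ball] at hp ⊢; linarith

theorem differentiableOn_integral_of_holo {α : Type*} [MeasurableSpace α] {μ : Measure α}
    {F : ℂ → α → ℂ} {U : Set ℂ} (hU : IsOpen U)
    (hmeas : ∀ p ∈ U, AEStronglyMeasurable (F p) μ)
    (hd : ∀ᵐ x ∂μ, DifferentiableOn ℂ (F · x) U)
    (hb : ∀ p0 ∈ U, ∃ bound : α → ℝ, Integrable bound μ ∧
      ∀ᶠ p in 𝓝 p0, ∀ x, ‖F p x‖ ≤ bound x) :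
    DifferentiableOn ℂ (fun p => ∫ x, F p x ∂μ) U := by
  intro p0 hp0
  obtain ⟨bound, hbi, hbd⟩ := hb p0 hp0
  obtain ⟨ε, hε, hball⟩ := Metric.mem_nhds_iff.1 (inter_mem hbd (hU.mem_nhds hp0))
  refine (hasDerivAt_integral_of_holo hε (bound := bound) (fun p hp => hmeas p (hball hp).2)
    (hd.mono fun x hx => hx.mono fun p hp => (hball hp).2)
    (Eventually.of_forall fun x p hp => (hball hp).1 x) hbi).differentiableAt.differentiableWithinAt

/-- `sinh w / w`, extended by `1` at `0`. -/
def shc (w : ℂ) : ℂ := if w = 0 then 1 else Complex.sinh w / w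

/-- The third-order remainder of `shc`. -/
def shr (w : ℂ) : ℂ := if w = 0 then 1/120 else (shc w - 1 - w^2/6) / w^4

theorem shc_zero : shc 0 = 1 := by simp [shc]

theorem shc_mul (w : ℂ) : w * shc w = Complex.sinh w := by
  unfold shc; split_ifs with h
  · simp [h]
  · field_simp

theorem shc_eq (w : ℂ) : shc w = 1 + w^2/6 + w^4 * shr w := by
  unfold shr; split_ifs with h
  · simp [h, shc]
  · field_simp; ring

theorem shc_neg (w : ℂ) : shc (-w) = shc w := by
  unfold shc; simp

theorem continuous_shr : Continuous shr := by
  rw [continuous_iff_continuousAt]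
  intro w
  by_cases hw : w = 0
  · subst hw
    have key : ∀ w : ℂ, ‖w‖ ≤ 1 → ‖shr w - shr 0‖ ≤ ‖w‖ := by
      intro w hw
      by_cases h0 : w = 0
      · simp [h0]
      have e1 := Complex.exp_bound hw (n := 6) (by norm_num)
      have e2 := Complex.exp_bound (x := -w) (by simpa using hw) (n := 6) (by norm_num)
      have hh : shr w - shr 0 = ((Complex.exp w - ∑ m ∈ Finset.range 6, w ^ m / m.factorial) -
          (Complex.exp (-w) - ∑ m ∈ Finset.range 6, (-w) ^ m / m.factorial)) / (2 * w^5) := by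
        simp only [shr, shc, if_neg h0, if_true, Complex.sinh]
        simp only [Finset.sum_range_succ, Finset.sum_range_zero, Nat.factorial]
        field_simp
        push_cast
        ring
      rw [hh, norm_div]
      have hw0 : 0 < ‖w‖ := norm_pos_iff.2 h0
      rw [div_le_iff₀ (by rw [norm_mul, norm_pow, Complex.norm_ofNat]; positivity)]
      refine (norm_sub_le _ _).trans ((add_le_add e1 e2).trans ?_)
      simp only [norm_neg, norm_mul, norm_pow, Complex.norm_ofNat]
      have : (0:ℝ) ≤ ‖w‖^6 := by positivity
      norm_num [Nat.factorial]
      nlinarith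
    unfold ContinuousAt
    rw [tendsto_iff_norm_sub_tendsto_zero]
    refine squeeze_zero' (Eventually.of_forall fun _ => norm_nonneg _)
      (g := fun w => ‖w‖) ?_ (by simpa using (continuous_norm (E := ℂ)).tendsto 0)
    filter_upwards [Metric.closedBall_mem_nhds (0:ℂ) one_pos] with w hw
    exact key w (by simpa using hw)
  · have : (fun w => ((Complex.sinh w / w) - 1 - w^2/6) / w^4) =ᶠ[𝓝 w] shr := by
      filter_upwards [isOpen_ne.mem_nhds hw] with v hv
      have hv : v ≠ 0 := hv
      simp [shr, shc, hv]
    refine ContinuousAt.congr ?_ this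
    have h4 : w^4 ≠ 0 := pow_ne_zero _ hw
    fun_prop (disch := assumption)

theorem continuous_shc : Continuous shc := by
  have : shc = fun w => 1 + w^2/6 + w^4 * shr w := funext shc_eq
  rw [this]
  have := continuous_shr
  fun_prop

theorem norm_sinh_ge (w : ℂ) : Real.sinh w.re ≤ ‖Complex.sinh w‖ := by
  have h1 : Complex.sinh w = (Real.sinh w.re * Real.cos w.im : ℝ) +
      (Real.cosh w.re * Real.sin w.im : ℝ) * Complex.I := by
    conv_lhs => rw [← Complex.re_add_im w, Complex.sinh_add, Complex.sinh_mul_I, Complex.cosh_mul_I]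
    push_cast; ring
  rw [h1, Complex.norm_add_mul_I]
  apply Real.le_sqrt_of_sq_le
  have h2 := Real.cosh_sq w.re
  have h3 := Real.sin_sq_add_cos_sq w.im
  nlinarith [sq_nonneg (Real.sin w.im)]

theorem shc_ne_zero {w : ℂ} (hw : 0 < w.re ∨ w = 0) : shc w ≠ 0 := by
  rcases hw with hw | hw
  · intro h
    have := shc_mul w
    rw [h, mul_zero] at this
    have h2 := norm_sinh_ge w
    rw [← this, norm_zero] at h2
    have := Real.sinh_pos_iff.2 hw
    linarith
  · simp [hw, shc]

theorem norm_shc_I_mul_le (w : ℂ) : ‖shc (Complex.I * w)‖ ≤ Real.exp |w.im| := by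
  by_cases h0 : w = 0
  · simp [h0, shc]
  have hw0 : 0 < ‖w‖ := norm_pos_iff.2 h0
  have h1 : shc (Complex.I * w) = Complex.sin w / w := by
    rw [shc, if_neg (by simp [h0]), mul_comm Complex.I w, Complex.sinh_mul_I]
    field_simp
  rw [h1, norm_div, div_le_iff₀ hw0]
  have : ‖Complex.sin w - Complex.sin 0‖ ≤ Real.exp |w.im| * ‖w - 0‖ := by
    apply Convex.norm_image_sub_le_of_norm_hasDerivWithin_le (𝕜 := ℂ) (f := Complex.sin)
      (f' := Complex.cos) (s := {v : ℂ | |v.im| ≤ |w.im|})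
    · intro v _; exact (Complex.hasDerivAt_sin v).hasDerivWithinAt
    · intro v hv
      have hv : |v.im| ≤ |w.im| := hv
      rw [Complex.cos]
      rw [norm_div, Complex.norm_ofNat, div_le_iff₀ two_pos]
      refine (norm_add_le _ _).trans ?_
      rw [Complex.norm_exp, Complex.norm_exp]
      have e1 : (v * Complex.I).re ≤ |w.im| := by
        simp; exact (neg_le_abs _).trans hv
      have e2 : (-v * Complex.I).re ≤ |w.im| := by
        simp; exact (le_abs_self _).trans hv
      linarith [Real.exp_le_exp.2 e1, Real.exp_le_exp.2 e2]
    · have : {v : ℂ | |v.im| ≤ |w.im|} = Complex.imLm ⁻¹' (Set.Icc (-|w.im|) |w.im|) := by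
        ext v; simp [abs_le]
      rw [this]
      exact (convex_Icc _ _).linear_preimage _
    · simp
    · simp
  simpa using this

theorem div_sinh_le {x : ℝ} (hx : 0 < x) : x / Real.sinh x ≤ (1 + 2*x) * Real.exp (-x) := by
  have hs := Real.sinh_pos_iff.2 hx
  rw [div_le_iff₀ hs, Real.sinh_eq]
  have h1 : 1 + 2*x ≤ Real.exp (2*x) := by linarith [Real.add_one_le_exp (2*x)]
  have h2 : Real.exp (-x) * Real.exp x = 1 := by rw [← Real.exp_add]; simp
  have h3 : Real.exp (2*x) * (Real.exp (-x) * Real.exp (-x)) = 1 := by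
    rw [← Real.exp_add, ← Real.exp_add]; ring_nf; simp
  have h4 : (1 + 2*x) * (Real.exp (-x) * Real.exp (-x)) ≤ 1 :=
    (mul_le_mul_of_nonneg_right h1 (by positivity)).trans h3.le
  have h5 : (1 + 2*x) * Real.exp (-x) * ((Real.exp x - Real.exp (-x))/2) =
      ((1+2*x) * (Real.exp (-x) * Real.exp x) - (1 + 2*x) * (Real.exp (-x) * Real.exp (-x)))/2 := by
    ring
  rw [h5, h2]
  linarith

/-- Local uniform exponential decay of `1 / shc (a y)`. -/
theorem shc_inv_bound {a0 : ℂ} {r : ℝ} (ha : 0 < a0.re) (hr : r < a0.re) :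
    ∃ C : ℝ, 0 < C ∧ ∀ᶠ a in 𝓝 a0, 0 < a.re ∧ ∀ y : ℝ, 0 ≤ y →
      ‖(shc (a*y))⁻¹‖ ≤ C * Real.exp (-r*y) := by
  obtain ⟨r', hr1, hr2⟩ : ∃ r', max r 0 < r' ∧ r' < a0.re := exists_between (max_lt hr ha)
  have hrr : r < r' := (le_max_left _ _).trans_lt hr1
  have hr0 : 0 < r' := (le_max_right _ _).trans_lt hr1
  set d := 1 - r/r' with hd
  have hd0 : 0 < d := by rw [hd, sub_pos, div_lt_one hr0]; exact hrr
  refine ⟨max 1 ((‖a0‖+1) / r' * (1 + 2/d)), by positivity, ?_⟩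
  have e1 : ∀ᶠ a : ℂ in 𝓝 a0, r' < a.re :=
    (Complex.continuous_re.tendsto a0).eventually (lt_mem_nhds hr2)
  have e2 : ∀ᶠ a : ℂ in 𝓝 a0, ‖a‖ < ‖a0‖ + 1 :=
    (continuous_norm.tendsto a0).eventually (gt_mem_nhds (by linarith))
  filter_upwards [e1, e2] with a ha1 ha2
  refine ⟨by linarith, fun y hy => ?_⟩
  rcases hy.eq_or_lt with rfl | hy
  · simp [shc_zero]
  have hre : (a*y).re = a.re * y := by simp
  have hay : 0 < a.re * y := mul_pos (by linarith) hy
  have hane : a * y ≠ 0 := by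
    intro h; rw [h] at hre; simp at hre; rcases hre with h | h <;> linarith
  have h1 : ‖(shc (a*y))⁻¹‖ ≤ (‖a‖*y) / Real.sinh (r'*y) := by
    have hs : 0 < Real.sinh (r'*y) := Real.sinh_pos_iff.2 (by positivity)
    rw [shc, if_neg hane, inv_div, norm_div, norm_mul, Complex.norm_real, Real.norm_eq_abs,
      abs_of_pos hy]
    gcongr
    refine le_trans ?_ (norm_sinh_ge _)
    rw [hre]
    apply Real.sinh_le_sinh.2
    gcongr
  refine h1.trans ?_
  have h2 := div_sinh_le (x := r'*y) (by positivity)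
  have h3 : ‖a‖ * y / Real.sinh (r'*y) = ‖a‖/r' * ((r'*y)/Real.sinh (r'*y)) := by
    field_simp
  rw [h3]
  have h4 : 1 + 2*(r'*y) ≤ (1+2/d) * Real.exp (d*(r'*y)) := by
    have e := Real.add_one_le_exp (d*(r'*y))
    have : (1+2/d) * (d*(r'*y) + 1) ≤ (1+2/d) * Real.exp (d*(r'*y)) := by gcongr
    refine le_trans ?_ this
    have : (1+2/d) * (d*(r'*y) + 1) = d*(r'*y) + 1 + 2*(r'*y) + 2/d := by
      field_simp; ring
    rw [this]
    have : 0 < d*(r'*y) := by positivity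
    have : 0 < 2/d := by positivity
    linarith
  have h5 : Real.exp (-r*y) = Real.exp (d*(r'*y)) * Real.exp (-(r'*y)) := by
    rw [← Real.exp_add]; congr 1; rw [hd]; field_simp; ring
  calc ‖a‖/r' * ((r'*y)/Real.sinh (r'*y))
      ≤ (‖a0‖+1)/r' * (((1+2/d) * Real.exp (d*(r'*y))) * Real.exp (-(r'*y))) := by
        gcongr
        exact h2.trans (by gcongr)
    _ = ((‖a0‖+1) / r' * (1 + 2/d)) * Real.exp (-r*y) := by rw [h5]; ring
    _ ≤ _ := by gcongr; exact le_max_right _ _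

section
/-- The regularised kernel of the logarithm of the hyperbolic gamma function. -/
def kk (a b z : ℂ) (y : ℝ) : ℂ :=
  z / (y:ℂ)^2 * (shc (Complex.I * (2*y*z)) / (shc (a*y) * shc (b*y)) - 1)

/-- `a b` times the logarithm of the hyperbolic gamma function (up to a factor `i`). -/
def hK (a b z : ℂ) : ℂ := ∫ y in Ioi (0:ℝ), kk a b z y

theorem shc_inv_bound' {b : ℂ} {r : ℝ} (hb : 0 < b.re ∨ b = 0) (hr : r < b.re) :
    ∃ C : ℝ, 0 < C ∧ ∀ y : ℝ, 0 ≤ y → ‖(shc (b*y))⁻¹‖ ≤ C * Real.exp (-r*y) := by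
  rcases hb with hb | rfl
  · obtain ⟨C, hC, h⟩ := shc_inv_bound hb hr
    exact ⟨C, hC, h.self_of_nhds.2⟩
  · refine ⟨1, one_pos, fun y hy => ?_⟩
    simp only [Complex.zero_re] at hr
    simp only [zero_mul, shc_zero, inv_one, norm_one, one_mul, Real.one_le_exp_iff]
    nlinarith

theorem kk_bound {a0 b : ℂ} (ha : 0 < a0.re) (hb : 0 < b.re ∨ b = 0) {M : ℝ} (R : ℝ)
    (hM0 : 0 ≤ M) (hM : 2*M < a0.re + b.re) :
    ∃ C : ℝ, ∀ᶠ a in 𝓝 a0, 0 < a.re ∧ ∀ z : ℂ, |z.im| ≤ M → ‖z‖ ≤ R → ∀ y : ℝ, 0 < y →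
      ‖kk a b z y‖ ≤ C * (1 + y^2)⁻¹ := by
  set d := (a0.re + b.re - 2*M)/3 with hd
  have hd0 : 0 < d := by rw [hd]; linarith
  obtain ⟨Ca, hCa, hA⟩ := shc_inv_bound ha (r := a0.re - d) (by linarith)
  obtain ⟨Cb, hCb, hB⟩ := shc_inv_bound' hb (r := b.re - d) (by linarith)
  let N : ℂ × ℂ × ℝ → ℂ := fun p =>
    -(4*p.2.1^2)/6 + 16*(p.2.2:ℂ)^2*p.2.1^4 * shr (Complex.I*(2*p.2.2*p.2.1)) -
      ((p.1^2/6 + p.1^4*(p.2.2:ℂ)^2*shr (p.1*p.2.2)) + (b^2/6 + b^4*(p.2.2:ℂ)^2*shr (b*p.2.2)) +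
        (p.2.2:ℂ)^2 * (p.1^2/6 + p.1^4*(p.2.2:ℂ)^2*shr (p.1*p.2.2)) *
          (b^2/6 + b^4*(p.2.2:ℂ)^2*shr (b*p.2.2)))
  have hNc : Continuous N := by
    have := continuous_shr
    fun_prop
  obtain ⟨B, hB0⟩ := ((isCompact_closedBall a0 1).prod
    ((isCompact_closedBall (0:ℂ) R).prod (isCompact_Icc (a := (0:ℝ)) (b := 1)))).exists_bound_of_continuousOn
    hNc.continuousOn
  refine ⟨max (2 * (|R| * (Ca*Cb+1))) (2 * (|R| * |B| * (Ca*Cb))), ?_⟩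
  filter_upwards [hA, closedBall_mem_nhds a0 one_pos] with a hA ha1
  refine ⟨hA.1, fun z hz hzR y hy => ?_⟩
  have hR : ‖z‖ ≤ |R| := hzR.trans (le_abs_self R)
  have hprod : ‖(shc (a*y) * shc (b*y))⁻¹‖ ≤ Ca*Cb*Real.exp (-(2*M+d)*y) := by
    rw [mul_inv, norm_mul]
    calc _ ≤ (Ca * Real.exp (-(a0.re-d)*y)) * (Cb * Real.exp (-(b.re-d)*y)) := by
          gcongr
          · exact hA.2 y hy.le
          · exact hB y hy.le
      _ = Ca*Cb*(Real.exp (-(a0.re-d)*y) * Real.exp (-(b.re-d)*y)) := by ring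
      _ = _ := by rw [← Real.exp_add]; congr 2; rw [hd]; ring
  have hexp1 : Real.exp (-(2*M+d)*y) ≤ 1 := by
    rw [Real.exp_le_one_iff]; nlinarith [mul_pos hd0 hy, mul_nonneg hM0 hy.le]
  have hS : ‖shc (Complex.I * (2*y*z))‖ ≤ Real.exp (2*M*y) := by
    refine (norm_shc_I_mul_le _).trans (Real.exp_le_exp.2 ?_)
    have : (2*(y:ℂ)*z).im = 2*y*z.im := by
      rw [show (2*(y:ℂ)*z) = ((2*y:ℝ):ℂ) * z by push_cast; ring, Complex.im_ofReal_mul]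
    rw [this, abs_mul, abs_of_pos (by positivity)]
    nlinarith
  rcases le_total y 1 with hy1 | hy1
  · have hkk : kk a b z y = z * N (a, z, y) * (shc (a*y) * shc (b*y))⁻¹ := by
      have hyc : (y:ℂ) ≠ 0 := by exact_mod_cast hy.ne'
      have hne : shc (a*y) * shc (b*y) ≠ 0 := by
        refine mul_ne_zero (shc_ne_zero (Or.inl ?_)) (shc_ne_zero ?_)
        · simp; exact mul_pos hA.1 hy
        · rcases hb with hb | hb
          · left; simp; exact mul_pos hb hy
          · right; simp [hb]
      have key : shc (Complex.I * (2*y*z)) - shc (a*y) * shc (b*y) = (y:ℂ)^2 * N (a, z, y) := by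
        rw [shc_eq, shc_eq (a*y), shc_eq (b*y)]
        simp only [N, mul_pow, Complex.I_sq, Complex.I_pow_four]
        ring
      rw [kk, div_sub_one hne, key]
      field_simp
    rw [hkk, norm_mul, norm_mul]
    have hN : ‖N (a,z,y)‖ ≤ |B| :=
      (hB0 (a,z,y) ⟨ha1, by simpa using hzR, hy.le, hy1⟩).trans (le_abs_self B)
    calc ‖z‖ * ‖N (a,z,y)‖ * ‖(shc (a*y) * shc (b*y))⁻¹‖ ≤ |R| * |B| * (Ca*Cb*1) := by
          gcongr
          exact hprod.trans (by gcongr)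
      _ ≤ (2 * (|R| * |B| * (Ca*Cb))) * (1+y^2)⁻¹ := by
          rw [mul_one, ← div_eq_mul_inv, le_div_iff₀ (by positivity)]
          have : 0 ≤ |R| * |B| * (Ca*Cb) := by positivity
          have : 1 + y^2 ≤ 2 := by nlinarith
          nlinarith
      _ ≤ _ := by gcongr; exact le_max_right _ _
  · rw [kk, norm_mul, norm_div, norm_pow, Complex.norm_real, Real.norm_eq_abs, abs_of_pos hy,
      div_eq_mul_inv (shc _)]
    have h1 : ‖shc (Complex.I * (2*y*z)) * (shc (a*y) * shc (b*y))⁻¹ - 1‖ ≤ Ca*Cb+1 := by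
      refine (norm_sub_le _ _).trans ?_
      rw [norm_one, norm_mul]
      refine add_le_add_left ?_ 1
      calc _ ≤ Real.exp (2*M*y) * (Ca*Cb*Real.exp (-(2*M+d)*y)) := by gcongr
        _ = Ca*Cb*(Real.exp (2*M*y) * Real.exp (-(2*M+d)*y)) := by ring
        _ ≤ Ca*Cb*1 := by
          gcongr
          rw [← Real.exp_add, Real.exp_le_one_iff]; nlinarith
        _ = _ := mul_one _
    calc _ ≤ |R|/y^2 * (Ca*Cb+1) := by gcongr
      _ ≤ (2 * (|R| * (Ca*Cb+1))) * (1+y^2)⁻¹ := by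
        rw [← div_eq_mul_inv, div_mul_eq_mul_div, div_le_div_iff₀ (by positivity) (by positivity)]
        have : 0 ≤ |R| * (Ca*Cb+1) := by positivity
        have : 1 ≤ y^2 := by nlinarith
        nlinarith
      _ ≤ _ := by gcongr; exact le_max_left _ _

theorem continuousOn_kk {a b : ℂ} (ha : 0 < a.re) (hb : 0 < b.re ∨ b = 0) (z : ℂ) :
    ContinuousOn (kk a b z) (Ioi 0) := by
  intro y hy
  have hy : 0 < y := hy
  have hyc : (y:ℂ)^2 ≠ 0 := pow_ne_zero _ (by exact_mod_cast hy.ne')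
  have hne : shc (a*y) * shc (b*y) ≠ 0 := by
    refine mul_ne_zero (shc_ne_zero (Or.inl ?_)) (shc_ne_zero ?_)
    · simp; exact mul_pos ha hy
    · rcases hb with hb | hb
      · left; simp; exact mul_pos hb hy
      · right; simp [hb]
  have := continuous_shc
  unfold kk
  apply ContinuousAt.continuousWithinAt
  have e1 : ContinuousAt (fun y : ℝ => z / (y:ℂ)^2) y := by fun_prop (disch := assumption)
  have e2 : ContinuousAt (fun y : ℝ => shc (Complex.I * (2*y*z)) / (shc (a*y) * shc (b*y))) y := by
    refine ContinuousAt.div (Continuous.continuousAt (by fun_prop))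
      (Continuous.continuousAt (by fun_prop)) hne
  exact e1.mul (e2.sub continuousAt_const)

theorem continuousAt_kk_param {a0 b : ℂ} (ha : 0 < a0.re) (hb : 0 < b.re ∨ b = 0) (z : ℂ)
    {y : ℝ} (hy : 0 < y) : ContinuousAt (fun p : ℂ × ℂ => kk p.1 b p.2 y) (a0, z) := by
  have hne : shc (a0*y) * shc (b*y) ≠ 0 := by
    refine mul_ne_zero (shc_ne_zero (Or.inl ?_)) (shc_ne_zero ?_)
    · simp; exact mul_pos ha hy
    · rcases hb with hb | hb
      · left; simp; exact mul_pos hb hy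
      · right; simp [hb]
  have := continuous_shc
  unfold kk
  have e2 : ContinuousAt (fun p : ℂ × ℂ => shc (Complex.I * (2*y*p.2)) /
      (shc (p.1*y) * shc (b*y))) (a0, z) := by
    refine ContinuousAt.div (Continuous.continuousAt (by fun_prop))
      (Continuous.continuousAt (by fun_prop)) hne
  exact (by fun_prop : ContinuousAt (fun p : ℂ × ℂ => p.2 / (y:ℂ)^2) (a0,z)).mul
    (e2.sub continuousAt_const)

theorem hasDerivAt_kk (a b z : ℂ) {y : ℝ} (hy : 0 < y) :
    HasDerivAt (fun z => kk a b z y)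
      (((y:ℂ)^2)⁻¹ * (Complex.cos (2*y*z) / (shc (a*y) * shc (b*y)) - 1)) z := by
  have hyc : (y:ℂ) ≠ 0 := by exact_mod_cast hy.ne'
  have : (fun z => kk a b z y) = fun z => ((y:ℂ)^2)⁻¹ *
      ((Complex.sin (2*y*z) / (2*y)) / (shc (a*y) * shc (b*y)) - z) := by
    funext z
    have h1 : z * shc (Complex.I * (2*y*z)) = Complex.sin (2*y*z) / (2*y) := by
      have := shc_mul (Complex.I * (2*y*z))
      rw [show Complex.I * (2*y*z) = (2*y*z) * Complex.I by ring, Complex.sinh_mul_I] at this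
      rw [eq_div_iff (by simpa using hyc), mul_comm Complex.I]
      have h2 := mul_right_cancel₀ Complex.I_ne_zero
        ((by rw [← this]; ring : (z * shc (2*y*z*Complex.I) * (2*y)) * Complex.I =
          Complex.sin (2*y*z) * Complex.I))
      exact h2
    rw [← h1, kk]; ring
  rw [this]
  have h := ((((hasDerivAt_id z).const_mul (2*(y:ℂ))).csin.div_const (2*(y:ℂ))).div_const
    (shc (a*y) * shc (b*y))).sub (hasDerivAt_id z)
  refine (h.const_mul (((y:ℂ)^2)⁻¹)).congr_deriv ?_
  simp only [id]
  field_simp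

theorem integrable_inv_bound (C : ℝ) : Integrable (fun y : ℝ => C * (1+y^2)⁻¹) :=
  integrable_inv_one_add_sq.const_mul C

variable {a a0 b z z0 : ℂ}

theorem strip_room {t s : ℝ} (h : |t| < s/2) : ∃ M : ℝ, 0 ≤ M ∧ 2*M < s ∧ |t| < M := by
  obtain ⟨M, h1, h2⟩ := exists_between h
  exact ⟨M, (abs_nonneg _).trans h1.le, by linarith, h1⟩

theorem integrableOn_kk (ha : 0 < a.re) (hb : 0 < b.re ∨ b = 0) (hz : |z.im| < (a.re + b.re)/2) :
    IntegrableOn (kk a b z) (Ioi 0) := by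
  obtain ⟨M, hM0, hM, hzM⟩ := strip_room hz
  obtain ⟨C, hC⟩ := kk_bound ha hb ‖z‖ hM0 hM
  refine Integrable.mono' (integrable_inv_bound C).integrableOn
    ((continuousOn_kk ha hb z).aestronglyMeasurable measurableSet_Ioi) ?_
  exact (ae_restrict_mem measurableSet_Ioi).mono fun y hy =>
    hC.self_of_nhds.2 z hzM.le le_rfl y hy

theorem continuousAt_hK (ha : 0 < a0.re) (hb : 0 < b.re ∨ b = 0)
    (hz : |z0.im| < (a0.re + b.re)/2) :
    ContinuousAt (fun p : ℂ × ℂ => hK p.1 b p.2) (a0, z0) := by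
  obtain ⟨M, hM0, hM, hzM⟩ := strip_room hz
  obtain ⟨C, hC⟩ := kk_bound ha hb (‖z0‖+1) hM0 hM
  have e1 : ∀ᶠ p : ℂ × ℂ in 𝓝 (a0, z0), |p.2.im| < M :=
    (by fun_prop : Continuous fun p : ℂ × ℂ => |p.2.im|).continuousAt.eventually (gt_mem_nhds hzM)
  have e2 : ∀ᶠ p : ℂ × ℂ in 𝓝 (a0, z0), ‖p.2‖ < ‖z0‖+1 :=
    (by fun_prop : Continuous fun p : ℂ × ℂ => ‖p.2‖).continuousAt.eventually
      (gt_mem_nhds (by simp))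
  have e3 := (continuous_fst.tendsto (a0, z0)).eventually hC
  refine continuousAt_of_dominated (bound := fun y => C * (1+y^2)⁻¹) ?_ ?_
    (integrable_inv_bound C).integrableOn ?_
  · filter_upwards [e3] with p hp
    exact (continuousOn_kk hp.1 hb _).aestronglyMeasurable measurableSet_Ioi
  · filter_upwards [e1, e2, e3] with p h1 h2 h3
    exact (ae_restrict_mem measurableSet_Ioi).mono fun y hy => h3.2 _ h1.le h2.le y hy
  · exact (ae_restrict_mem measurableSet_Ioi).mono fun y hy => continuousAt_kk_param ha hb _ hy

theorem hasDerivAt_hK (ha : 0 < a.re) (hb : 0 < b.re ∨ b = 0)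
    (hz : |z.im| < (a.re + b.re)/2) :
    HasDerivAt (hK a b) (∫ y in Ioi (0:ℝ), ((y:ℂ)^2)⁻¹ *
      (Complex.cos (2*y*z) / (shc (a*y) * shc (b*y)) - 1)) z := by
  obtain ⟨M, hM0, hM, hzM⟩ := strip_room hz
  obtain ⟨C, hC⟩ := kk_bound ha hb (‖z‖+1) hM0 hM
  have h := hasDerivAt_integral_of_holo (μ := volume.restrict (Ioi (0:ℝ))) (F := kk a b) (p0 := z)
    (ε := min 1 (M - |z.im|)) (lt_min one_pos (by linarith)) (bound := fun y => C * (1+y^2)⁻¹)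
    (fun p _ => (continuousOn_kk ha hb _).aestronglyMeasurable measurableSet_Ioi)
    ((ae_restrict_mem measurableSet_Ioi).mono fun y hy p _ =>
      (hasDerivAt_kk a b p hy).differentiableAt.differentiableWithinAt)
    ((ae_restrict_mem measurableSet_Ioi).mono fun y hy p hp => ?_)
    (integrable_inv_bound C).integrableOn
  · refine h.congr_deriv ?_
    refine setIntegral_congr_fun measurableSet_Ioi fun y hy => ?_
    exact (hasDerivAt_kk a b z hy).deriv
  · rw [mem_ball_iff_norm, lt_min_iff] at hp
    refine hC.self_of_nhds.2 p ?_ ?_ y hy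
    · have h1 := Complex.abs_im_le_norm (p - z)
      rw [Complex.sub_im] at h1
      have h2 := abs_sub_abs_le_abs_sub p.im z.im
      linarith
    · have := norm_sub_norm_le p z
      linarith

theorem hK_neg (a b z : ℂ) : hK a b (-z) = -hK a b z := by
  unfold hK
  rw [← integral_neg]
  congr 1
  funext y
  unfold kk
  rw [show Complex.I * (2*y*-z) = -(Complex.I * (2*y*z)) by ring, shc_neg]
  ring

theorem hK_symm (a b z : ℂ) : hK a b z = hK b a z := by
  unfold hK kk
  simp only [mul_comm (shc (a * _))]

theorem hypGammaInt_eq (ha : a ≠ 0) (hb : b ≠ 0) (z : ℂ) :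
    hypGammaInt a b z = Complex.exp (Complex.I * (hK a b z / (a*b))) := by
  unfold hypGammaInt hK
  rw [← integral_div]
  congr 2
  refine setIntegral_congr_fun measurableSet_Ioi fun y hy => ?_
  have hy : 0 < y := hy
  have hyc : (y:ℂ) ≠ 0 := by exact_mod_cast hy.ne'
  simp only [kk]
  rw [← shc_mul (a*y), ← shc_mul (b*y)]
  have h1 : Complex.sin (2*y*z) = 2*y*z * shc (Complex.I * (2*y*z)) := by
    have := shc_mul (Complex.I * (2*y*z))
    rw [show Complex.I * (2*y*z) = (2*y*z) * Complex.I by ring, Complex.sinh_mul_I] at this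
    rw [mul_comm Complex.I]
    refine mul_right_cancel₀ Complex.I_ne_zero ?_
    rw [← this]; ring
  rw [h1]
  generalize shc (a*y) = A
  generalize shc (b*y) = B
  by_cases hA : A = 0
  · subst hA; simp; field_simp
  by_cases hB : B = 0
  · subst hB; simp; field_simp
  field_simp

end

/-- The reciprocal of the hyperbolic gamma function on its defining strip. -/
def eS (a b z : ℂ) : ℂ := Complex.exp (-(Complex.I * (hK a b z / (a*b))))

/-- The functional equation of `eS` within its strip. -/
def HypFE : Prop := ∀ a b : ℂ, 0 < a.re → 0 < b.re → ∀ z : ℂ, |z.im| < a.re/2 →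
  eS a b (z - Complex.I*b/2) = 2 * Complex.cosh (Real.pi*z/a) * eS a b (z + Complex.I*b/2)

theorem re_ne {a : ℂ} (ha : 0 < a.re) : a ≠ 0 := by rintro rfl; simp at ha

theorem cosh_ne_zero_of_strip {a z : ℂ} (ha : 0 < a.re) (hz : |z.im| < a.re/2) :
    Complex.cosh (Real.pi*z/a) ≠ 0 := by
  intro h
  have ha0 := re_ne ha
  have hpi : (Real.pi:ℂ) ≠ 0 := by exact_mod_cast Real.pi_ne_zero
  rw [← Complex.cos_mul_I, Complex.cos_eq_zero_iff] at h
  obtain ⟨k, hk⟩ := h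
  have hz2 : z = -(Complex.I * a * ((2*k+1)/2)) := by
    have h1 : z * Complex.I = a * ((2*k+1)/2) := by
      field_simp at hk ⊢
      linear_combination hk
    linear_combination (-Complex.I) * h1 + z * Complex.I_sq
  have him : z.im = -(a.re * ((2*k+1:ℝ)/2)) := by
    rw [hz2]
    have : Complex.I * a * ((2*k+1)/2) = (Complex.I * a) * (((2*k+1:ℝ)/2 : ℝ) : ℂ) := by
      push_cast; ring
    rw [this, Complex.neg_im, Complex.im_mul_ofReal]
    simp
  rw [him, abs_neg, abs_mul, abs_of_pos ha, abs_div, abs_two] at hz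
  have h1 : (1:ℝ) ≤ |(2*k+1:ℝ)| := by
    have : (1:ℤ) ≤ |2*k+1| := Int.one_le_abs (by omega)
    exact_mod_cast this
  nlinarith

theorem hypFE_of_isHypGamma {G : ℂ → ℂ → ℂ → ℂ}
    (hG : ∀ a b : ℂ, 0 < a.re → 0 < b.re → IsHypGamma a b (G a b)) : HypFE := by
  intro a b ha hb z hz
  have h := (hG a b ha hb).funEqm z (cosh_ne_zero_of_strip ha hz)
  have hIb : (Complex.I*b/2).im = b.re/2 := by
    rw [show Complex.I*b/2 = (Complex.I*b) * ((1/2:ℝ):ℂ) by push_cast; ring, Complex.im_mul_ofReal]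
    simp; ring
  have hlt := abs_lt.1 hz
  have hp : |(z + Complex.I*b/2).im| < ((a+b)/2).re := by
    rw [Complex.add_im, hIb, abs_lt]; simp; constructor <;> linarith
  have hm : |(z - Complex.I*b/2).im| < ((a+b)/2).re := by
    rw [Complex.sub_im, hIb, abs_lt]; simp; constructor <;> linarith
  rw [(hG a b ha hb).strip _ hp, (hG a b ha hb).strip _ hm,
    hypGammaInt_eq (re_ne ha) (re_ne hb), hypGammaInt_eq (re_ne ha) (re_ne hb)] at h
  unfold eS
  rw [Complex.exp_neg, Complex.exp_neg, ← div_eq_mul_inv, eq_div_iff (Complex.exp_ne_zero _), h]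
  rw [mul_comm (2 * _), ← mul_assoc, inv_mul_cancel₀ (Complex.exp_ne_zero _), one_mul]

/-- The derivative of `hK μ 0`. -/
def refD (μ : ℝ) (z : ℂ) : ℂ := ∫ y in Ioi (0:ℝ), ((y:ℂ)^2)⁻¹ *
      (Complex.cos (2*y*z) / (shc (μ*y) * shc (0*y)) - 1)

theorem hasDerivAt_hK_ref {μ : ℝ} (hμ : 0 < μ) {z : ℂ} (hz : |z.im| < μ/2) :
    HasDerivAt (hK μ 0) (refD μ z) z :=
  hasDerivAt_hK (by simpa using hμ) (Or.inr rfl) (by simpa using hz)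

theorem exp_refD (h : HypFE) {μ : ℝ} (hμ : 0 < μ) {z : ℂ} (hz : |z.im| < μ/2) :
    Complex.exp (-(refD μ z + Real.pi * z)/μ) = 1 + Complex.exp (-(2*Real.pi*z/μ)) := by
  have hre : 0 < (μ:ℂ).re := by simpa using hμ
  have hμc : (μ:ℂ) ≠ 0 := by exact_mod_cast hμ.ne'
  have hfe := h μ μ hre hre z (by simpa using hz)
  have hlt := abs_lt.1 hz
  have hI : (Complex.I*μ/2).im = μ/2 := by
    rw [show Complex.I*μ/2 = Complex.I * ((μ/2:ℝ):ℂ) by push_cast; ring, Complex.im_mul_ofReal]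
    simp
  have i1 : IntegrableOn (kk μ μ (z + Complex.I*μ/2)) (Ioi 0) := by
    refine integrableOn_kk hre (Or.inl hre) ?_
    rw [Complex.add_im, hI, abs_lt]; simp; constructor <;> linarith
  have i2 : IntegrableOn (kk μ μ (z - Complex.I*μ/2)) (Ioi 0) := by
    refine integrableOn_kk hre (Or.inl hre) ?_
    rw [Complex.sub_im, hI, abs_lt]; simp; constructor <;> linarith
  have hdiff : hK μ μ (z + Complex.I*μ/2) - hK μ μ (z - Complex.I*μ/2) =
      Complex.I * μ * refD μ z := by
    unfold hK refD
    rw [← integral_sub i1 i2, ← integral_const_mul]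
    refine setIntegral_congr_fun measurableSet_Ioi fun y hy => ?_
    have hy : 0 < y := hy
    have hyc : (y:ℂ) ≠ 0 := by exact_mod_cast hy.ne'
    have hsin : ∀ w : ℂ, w * shc (Complex.I * (2*y*w)) = Complex.sin (2*y*w) / (2*y) := by
      intro w
      have := shc_mul (Complex.I * (2*y*w))
      rw [show Complex.I * (2*y*w) = (2*y*w) * Complex.I by ring, Complex.sinh_mul_I] at this
      rw [eq_div_iff (by simpa using hyc), mul_comm Complex.I]
      refine mul_right_cancel₀ Complex.I_ne_zero ?_
      rw [← this]; ring
    have hS : shc (μ*y) ≠ 0 := shc_ne_zero (Or.inl (by simp; exact mul_pos hμ hy))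
    have e : ∀ w : ℂ, kk μ μ w y = ((y:ℂ)^2)⁻¹ *
        ((Complex.sin (2*y*w) / (2*y)) / (shc (μ*y) * shc (μ*y)) - w) := by
      intro w; rw [← hsin, kk]; ring
    simp only [e]
    have hs2 : Complex.sin (2*y*(z + Complex.I*μ/2)) - Complex.sin (2*y*(z - Complex.I*μ/2)) =
        2 * Complex.I * Complex.cos (2*y*z) * (μ*y*shc (μ*y)) := by
      rw [shc_mul, show 2*y*(z + Complex.I*μ/2) = 2*y*z + μ*y*Complex.I by ring,
        show 2*y*(z - Complex.I*μ/2) = 2*y*z - μ*y*Complex.I by ring, Complex.sin_add,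
        Complex.sin_sub, Complex.sin_mul_I]
      ring
    have : ((y:ℂ)^2)⁻¹ * ((Complex.sin (2*y*(z + Complex.I*μ/2)) / (2*y)) /
        (shc (μ*y) * shc (μ*y)) - (z + Complex.I*μ/2)) - ((y:ℂ)^2)⁻¹ *
        ((Complex.sin (2*y*(z - Complex.I*μ/2)) / (2*y)) / (shc (μ*y) * shc (μ*y)) -
          (z - Complex.I*μ/2)) = ((y:ℂ)^2)⁻¹ * ((Complex.sin (2*y*(z + Complex.I*μ/2)) -
          Complex.sin (2*y*(z - Complex.I*μ/2))) / (2*y) / (shc (μ*y) * shc (μ*y)) -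
          Complex.I*μ) := by
      ring
    rw [this, hs2, zero_mul, shc_zero]
    field_simp
  have h1 : Complex.exp (-refD μ z/μ) = 2 * Complex.cosh (Real.pi*z/μ) := by
    unfold eS at hfe
    rw [← div_eq_iff (Complex.exp_ne_zero _), ← Complex.exp_sub] at hfe
    rw [← hfe]
    congr 1
    have : -(Complex.I * (hK μ μ (z - Complex.I*μ/2) / (μ*μ))) -
        -(Complex.I * (hK μ μ (z + Complex.I*μ/2) / (μ*μ))) =
        Complex.I * (hK μ μ (z + Complex.I*μ/2) - hK μ μ (z - Complex.I*μ/2)) / (μ*μ) := by ring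
    rw [this, hdiff]
    field_simp
    rw [Complex.I_sq]; ring
  rw [show -(refD μ z + Real.pi * z)/μ = -refD μ z/μ + -(Real.pi*z/μ) by ring, Complex.exp_add, h1,
    Complex.cosh, mul_div_cancel₀ _ two_ne_zero, add_mul, ← Complex.exp_add, ← Complex.exp_add]
  simp only [add_neg_cancel, Complex.exp_zero]
  congr 2; ring

theorem refD_ofReal (μ x : ℝ) : ∃ r : ℝ, refD μ x = r := by
  refine ⟨∫ y in Ioi (0:ℝ), (y^2)⁻¹ * (Real.cos (2*y*x) / ((shc ((μ*y:ℝ):ℂ)).re) - 1), ?_⟩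
  rw [← integral_complex_ofReal]
  unfold refD
  congr 1
  funext y
  have : shc ((μ*y:ℝ):ℂ) = (((shc ((μ*y:ℝ):ℂ)).re : ℝ) : ℂ) := by
    unfold shc
    split_ifs
    · simp
    · rw [← Complex.ofReal_sinh, ← Complex.ofReal_div, Complex.ofReal_re]
  rw [Complex.ofReal_mul] at this
  rw [zero_mul, shc_zero, mul_one, this]
  push_cast
  rfl

theorem ref_asymp (h : HypFE) {μ M : ℝ} (hμ : 0 < μ) (hM0 : 0 ≤ M) (hM : 4*M < μ) :
    ∃ C : ℝ, ∀ z : ℂ, |z.im| ≤ M → 0 ≤ z.re → ‖hK μ 0 z + Real.pi*z^2/2‖ ≤ C := by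
  have hμc : (μ:ℂ) ≠ 0 := by exact_mod_cast hμ.ne'
  set D : ℂ → ℂ := fun z => refD μ z + Real.pi * z with hD
  have hZ : ∀ z : ℂ, |z.im| < μ/2 →
      HasDerivAt (fun z => hK μ 0 z + Real.pi*z^2/2) (D z) z := by
    intro z hz
    have h2 := (((hasDerivAt_id z).pow 2).const_mul (Real.pi:ℂ)).div_const 2
    refine ((hasDerivAt_hK_ref hμ hz).add h2).congr_deriv ?_
    simp [hD]; ring
  have hopen : IsOpen {z : ℂ | |z.im| < μ/2} :=
    isOpen_lt (by fun_prop) continuous_const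
  have hDdiff : ∀ z : ℂ, |z.im| < μ/2 → DifferentiableAt ℂ D z := by
    intro z hz
    have h1 : DifferentiableOn ℂ (deriv (fun z => hK μ 0 z + Real.pi*z^2/2))
        {z : ℂ | |z.im| < μ/2} :=
      DifferentiableOn.deriv (fun w hw => (hZ w hw).differentiableAt.differentiableWithinAt) hopen
    refine (h1.differentiableAt (hopen.mem_nhds hz)).congr_of_eventuallyEq ?_
    filter_upwards [hopen.mem_nhds hz] with w hw
    exact (hZ w hw).deriv.symm
  have hD' : ∀ z : ℂ, |z.im| ≤ M → ‖deriv D z‖ ≤ 2*Real.pi := by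
    intro z hz
    have hz' : |z.im| < μ/2 := by linarith
    have h1 : HasDerivAt (fun z => Complex.exp (-(D z)/μ))
        (Complex.exp (-(D z)/μ) * (-(deriv D z)/μ)) z :=
      ((hDdiff z hz').hasDerivAt.neg.div_const _).cexp
    have h2 : HasDerivAt (fun z => 1 + Complex.exp (-(2*Real.pi*z/μ)))
        (Complex.exp (-(2*Real.pi*z/μ)) * (-(2*Real.pi/μ))) z := by
      have := ((((hasDerivAt_id z).const_mul (2*Real.pi:ℂ)).div_const (μ:ℂ)).neg.cexp).const_add 1
      simpa using this
    have h3 : Complex.exp (-(D z)/μ) * (-(deriv D z)/μ) =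
        Complex.exp (-(2*Real.pi*z/μ)) * (-(2*Real.pi/μ)) := by
      refine h1.unique (h2.congr_of_eventuallyEq ?_)
      filter_upwards [hopen.mem_nhds hz'] with w hw
      exact exp_refD h hμ hw
    have h4 : Complex.exp (-(D z)/μ) = 1 + Complex.exp (-(2*Real.pi*z/μ)) := exp_refD h hμ hz'
    rw [h4] at h3
    set E := Complex.exp (-(2*Real.pi*z/μ)) with hE
    have hEre : 0 ≤ E.re := by
      rw [hE, Complex.exp_re]
      apply mul_nonneg (Real.exp_pos _).le
      have : (-(2*Real.pi*z/μ)).im = -(2*Real.pi*z.im/μ) := by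
        rw [show -(2*Real.pi*z/μ) = ((-(2*Real.pi/μ):ℝ):ℂ) * z by push_cast; ring,
          Complex.im_ofReal_mul]
        ring
      rw [this, Real.cos_neg]
      have h5 := abs_le.1 hz
      have hpi := Real.pi_pos
      apply Real.cos_nonneg_of_neg_pi_div_two_le_of_le
      · rw [le_div_iff₀ hμ]; nlinarith
      · rw [div_le_iff₀ hμ]; nlinarith
    have h5 : (1 + E) * deriv D z = 2*Real.pi*E := by
      field_simp at h3
      linear_combination -h3
    have h6 : ‖E‖ ≤ ‖1 + E‖ := by
      rw [Complex.norm_def, Complex.norm_def]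
      apply Real.sqrt_le_sqrt
      rw [Complex.normSq_apply, Complex.normSq_apply]
      simp; nlinarith
    have h7 : 0 < ‖1+E‖ := by
      refine lt_of_lt_of_le one_pos (le_trans ?_ (Complex.re_le_norm _))
      simp; exact hEre
    have h8 : ‖1+E‖ * ‖deriv D z‖ = 2*Real.pi*‖E‖ := by
      rw [← norm_mul, h5]; simp [abs_of_pos Real.pi_pos]
    have hpi := Real.pi_pos
    by_contra hcon
    push Not at hcon
    nlinarith
  have hDx : ∀ x : ℝ, ‖D x‖ ≤ μ * Real.exp (-(2*Real.pi*x/μ)) := by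
    intro x
    obtain ⟨r, hr⟩ := refD_ofReal μ x
    have h1 := exp_refD h hμ (z := x) (by simpa using hμ)
    have hDr : D x = ((r + Real.pi*x : ℝ) : ℂ) := by simp [hD, hr]
    rw [hr] at h1
    have h2 : Real.exp (-(r + Real.pi*x)/μ) = 1 + Real.exp (-(2*Real.pi*x/μ)) := by
      exact_mod_cast h1
    rw [hDr, Complex.norm_real, Real.norm_eq_abs]
    set s := r + Real.pi*x
    have hE := Real.exp_pos (-(2*Real.pi*x/μ))
    have h3 : 0 ≤ -s/μ := by
      rw [← Real.one_le_exp_iff, h2]; linarith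
    have h4 : -s/μ + 1 ≤ 1 + Real.exp (-(2*Real.pi*x/μ)) := by
      rw [← h2]; exact Real.add_one_le_exp _
    have h5 : s ≤ 0 := by
      by_contra hs; push Not at hs
      have : -s/μ < 0 := div_neg_of_neg_of_pos (by linarith) hμ
      linarith
    rw [abs_of_nonpos h5]
    have : -s/μ ≤ Real.exp (-(2*Real.pi*x/μ)) := by linarith
    rw [div_le_iff₀ hμ] at this
    linarith
  have hDxy : ∀ z : ℂ, |z.im| ≤ M → 0 ≤ z.re → ‖D z‖ ≤ μ + 2*Real.pi*M := by
    intro z hz hz0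
    have h1 : ‖D z - D z.re‖ ≤ 2*Real.pi * ‖z - z.re‖ := by
      apply Convex.norm_image_sub_le_of_norm_deriv_le (𝕜 := ℂ) (s := {v : ℂ | |v.im| ≤ M})
      · intro v hv
        have hv : |v.im| ≤ M := hv
        exact hDdiff v (by linarith)
      · intro v hv; exact hD' v hv
      · have : {v : ℂ | |v.im| ≤ M} = Complex.imLm ⁻¹' (Set.Icc (-M) M) := by
          ext v; simp [abs_le]
        rw [this]
        exact (convex_Icc _ _).linear_preimage _
      · simpa using hM0
      · exact hz
    have h2 : ‖z - z.re‖ ≤ M := by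
      have : z - z.re = z.im * Complex.I := by
        nth_rewrite 1 [← Complex.re_add_im z]; ring
      rw [this]; simpa using hz
    have h3 : ‖D z.re‖ ≤ μ := by
      refine (hDx z.re).trans ?_
      have : Real.exp (-(2*Real.pi*z.re/μ)) ≤ 1 := by
        rw [Real.exp_le_one_iff, neg_nonpos]
        have := Real.pi_pos
        positivity
      nlinarith
    have hpi := Real.pi_pos
    calc ‖D z‖ = ‖D z.re + (D z - D z.re)‖ := by ring_nf
      _ ≤ _ := norm_add_le _ _
      _ ≤ μ + 2*Real.pi*M := by nlinarith
  set Z : ℂ → ℂ := fun z => hK μ 0 z + Real.pi*z^2/2 with hZdef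
  have hZx : ∀ x : ℝ, 0 ≤ x → ‖Z x‖ ≤ μ^2/(2*Real.pi) := by
    intro x hx
    have hpi := Real.pi_pos
    have key := image_norm_le_of_norm_deriv_right_le_deriv_boundary
      (f := fun t : ℝ => Z t) (f' := fun t : ℝ => D t) (a := 0) (b := x)
      (B := fun t => μ^2/(2*Real.pi) * (1 - Real.exp (-(2*Real.pi*t/μ))))
      (B' := fun t => μ * Real.exp (-(2*Real.pi*t/μ)))
      (fun t _ => ((hZ t (by simpa using hμ)).comp_ofReal).continuousAt.continuousWithinAt)
      (fun t _ => ((hZ t (by simpa using hμ)).comp_ofReal).hasDerivWithinAt)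
      (by
        have : hK μ 0 0 = 0 := by
          have := hK_neg μ 0 0
          rw [neg_zero] at this
          exact self_eq_neg.1 this
        simp [hZdef, this])
      (fun t => by
        have := ((((hasDerivAt_id t).const_mul (2*Real.pi)).div_const μ).neg.exp.const_sub 1).const_mul
          (μ^2/(2*Real.pi))
        refine this.congr_deriv ?_
        simp only [id, Pi.neg_apply]
        field_simp)
      (fun t _ => hDx t) ⟨hx, le_rfl⟩
    refine key.trans ?_
    have := Real.exp_pos (-(2*Real.pi*x/μ))
    have h0 : 0 ≤ μ^2/(2*Real.pi) := by positivity
    nlinarith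
  refine ⟨μ^2/(2*Real.pi) + (μ + 2*Real.pi*M) * M, fun z hz hz0 => ?_⟩
  have h1 : ‖Z z - Z z.re‖ ≤ (μ + 2*Real.pi*M) * ‖z - z.re‖ := by
    apply Convex.norm_image_sub_le_of_norm_hasDerivWithin_le (𝕜 := ℂ) (f' := D)
      (s := {v : ℂ | |v.im| ≤ M} ∩ {v | 0 ≤ v.re})
    · intro v hv
      have hv : |v.im| ≤ M := hv.1
      exact (hZ v (by linarith)).hasDerivWithinAt
    · intro v hv; exact hDxy v hv.1 hv.2
    · refine Convex.inter ?_ (convex_halfSpace_re_ge 0)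
      have : {v : ℂ | |v.im| ≤ M} = Complex.imLm ⁻¹' (Set.Icc (-M) M) := by
        ext v; simp [abs_le]
      rw [this]
      exact (convex_Icc _ _).linear_preimage _
    · exact ⟨by simpa using hM0, by simpa using hz0⟩
    · exact ⟨hz, hz0⟩
  have h2 : ‖z - z.re‖ ≤ M := by
    have : z - z.re = z.im * Complex.I := by
      nth_rewrite 1 [← Complex.re_add_im z]; ring
    rw [this]; simpa using hz
  have hpi := Real.pi_pos
  calc ‖Z z‖ = ‖Z z.re + (Z z - Z z.re)‖ := by ring_nf
    _ ≤ _ := norm_add_le _ _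
    _ ≤ _ := by
      refine add_le_add (hZx _ hz0) (h1.trans ?_)
      gcongr

set_option maxHeartbeats 1600000 in
/-- Uniform asymptotics of `hK` in closed substrips. -/
theorem hK_asymp (h : HypFE) {a0 b : ℂ} (ha : 0 < a0.re) (hb : 0 < b.re) {M : ℝ}
    (hM0 : 0 ≤ M) (hM : 2*M < a0.re + b.re) :
    ∃ C : ℝ, ∀ᶠ a in 𝓝 a0, 0 < a.re ∧ ∀ z : ℂ, |z.im| ≤ M → 0 ≤ z.re →
      ‖hK a b z + Real.pi*z^2/2‖ ≤ C := by
  set d := (a0.re + b.re - 2*M)/3 with hd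
  have hd0 : 0 < d := by rw [hd]; linarith
  set μ₁ : ℝ := 4*M + 1 + d with hμ₁
  set μ₂ : ℝ := 4*M + 2 + d with hμ₂
  have h1p : 0 < μ₁ := by rw [hμ₁]; linarith
  have h2p : 0 < μ₂ := by rw [hμ₂]; linarith
  obtain ⟨R₁, hR₁⟩ := ref_asymp h h1p hM0 (by rw [hμ₁]; linarith)
  obtain ⟨R₂, hR₂⟩ := ref_asymp h h2p hM0 (by rw [hμ₂]; linarith)
  obtain ⟨Ca, hCa, hA⟩ := shc_inv_bound ha (r := a0.re - d) (by linarith)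
  obtain ⟨Cb, hCb, hB⟩ := shc_inv_bound' (Or.inl hb) (r := b.re - d) (by linarith)
  obtain ⟨C₁, hC₁, hB₁⟩ := shc_inv_bound' (b := μ₁) (Or.inl (by simpa using h1p)) (r := 2*M+d)
    (by simp [hμ₁]; linarith)
  obtain ⟨C₂, hC₂, hB₂⟩ := shc_inv_bound' (b := μ₂) (Or.inl (by simpa using h2p)) (r := 2*M+d)
    (by simp [hμ₂]; linarith)
  let w₁ : ℂ → ℂ := fun a => (a^2 + b^2 - μ₂^2) / (μ₁^2 - μ₂^2)
  have hμne : (μ₁:ℂ)^2 - μ₂^2 ≠ 0 := by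
    have : μ₁^2 - μ₂^2 ≠ 0 := by rw [hμ₁, hμ₂]; nlinarith
    exact_mod_cast this
  have hw₁ : ∀ a, w₁ a * (μ₁^2 - μ₂^2) = a^2 + b^2 - μ₂^2 := fun a => div_mul_cancel₀ _ hμne
  have hw1c : Continuous w₁ := by
    have : (fun a : ℂ => (a^2 + b^2 - μ₂^2) * ((μ₁:ℂ)^2 - μ₂^2)⁻¹) = w₁ := by
      funext a; simp only [w₁, div_eq_mul_inv]
    rw [← this]; fun_prop
  -- product of two factors `1 + p Y + q Y²`, second-order part
  let P : ℂ → ℂ → ℂ → ℂ → ℂ → ℂ := fun Y p q p' q' =>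
    p*p' + q + q' + Y*(p*q' + p'*q) + Y^2*(q*q')
  have hP : ∀ Y p q p' q' : ℂ, (1 + Y*p + Y^2*q) * (1 + Y*p' + Y^2*q') =
      1 + Y*(p+p') + Y^2 * P Y p q p' q' := by
    intro Y p q p' q'; simp only [P]; ring
  let N : ℂ × ℝ → ℂ := fun s =>
    let Y : ℂ := (s.2:ℂ)^2
    let qa := s.1^4 * shr (s.1*s.2)
    let qb := b^4 * shr (b*s.2)
    let q₁ := (μ₁:ℂ)^4 * shr (μ₁*s.2)
    let q₂ := (μ₂:ℂ)^4 * shr (μ₂*s.2)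
    let pab := P Y (s.1^2/6) qa (b^2/6) qb
    P Y (μ₁^2/6) q₁ (μ₂^2/6) q₂ - w₁ s.1 * P Y (s.1^2/6+b^2/6) pab (μ₂^2/6) q₂
      - (1 - w₁ s.1) * P Y (s.1^2/6+b^2/6) pab (μ₁^2/6) q₁
  have hNc : Continuous N := by
    have := continuous_shr
    simp only [N, P]
    fun_prop
  let K : ℂ → ℝ → ℂ := fun a y => (shc (a*y) * shc (b*y))⁻¹ - w₁ a * (shc (μ₁*y))⁻¹ -
    (1 - w₁ a) * (shc (μ₂*y))⁻¹
  have hK0 : ∀ a : ℂ, 0 < a.re → ∀ y : ℝ, 0 < y →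
      K a y = (y:ℂ)^4 * N (a, y) * ((shc (a*y) * shc (b*y))⁻¹ * ((shc (μ₁*y))⁻¹ * (shc (μ₂*y))⁻¹)) := by
    intro a ha y hy
    have ea := shc_ne_zero (w := a*y) (Or.inl (by simp; exact mul_pos ha hy))
    have eb := shc_ne_zero (w := b*y) (Or.inl (by simp; exact mul_pos hb hy))
    have e1 := shc_ne_zero (w := μ₁*y) (Or.inl (by simp; exact mul_pos h1p hy))
    have e2 := shc_ne_zero (w := μ₂*y) (Or.inl (by simp; exact mul_pos h2p hy))
    have key : shc (μ₁*y) * shc (μ₂*y) - w₁ a * (shc (a*y) * shc (b*y) * shc (μ₂*y)) -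
        (1 - w₁ a) * (shc (a*y) * shc (b*y) * shc (μ₁*y)) = (y:ℂ)^4 * N (a, y) := by
      have f : ∀ c : ℂ, shc (c*y) = 1 + (y:ℂ)^2 * (c^2/6) + ((y:ℂ)^2)^2 * (c^4 * shr (c*y)) := by
        intro c; rw [shc_eq]; ring
      rw [f a, f b, f μ₁, f μ₂, hP, hP, hP, hP]
      simp only [N]
      have := hw₁ a
      generalize w₁ a = w at this ⊢
      linear_combination ((y:ℂ)^2/6) * this
    rw [← key]
    simp only [K]
    clear_value w₁
    generalize shc (a*y) = A at *
    generalize shc (b*y) = B at *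
    generalize shc (μ₁*y) = A₁ at *
    generalize shc (μ₂*y) = A₂ at *
    field_simp
  obtain ⟨B, hB0⟩ := ((isCompact_closedBall a0 1).prod
    (isCompact_Icc (a := (0:ℝ)) (b := 1))).exists_bound_of_continuousOn hNc.continuousOn
  obtain ⟨W, hW0⟩ := (isCompact_closedBall a0 1).exists_bound_of_continuousOn hw1c.continuousOn
  set X := |B| * (Ca*Cb*(C₁*C₂)) with hX
  set X' := Ca*Cb + |W| * C₁ + (1+|W|) * C₂ with hX'
  let Cr := max (2*(Real.exp (2*M) * X)) (2*X')
  let rem : ℂ → ℂ → ℝ → ℂ := fun a z y => z * shc (Complex.I*(2*y*z)) / (y:ℂ)^2 * K a y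
  refine ⟨|W| * |R₁| + (1+|W|) * |R₂| + ∫ y in Ioi (0:ℝ), Cr * (1+y^2)⁻¹, ?_⟩
  filter_upwards [hA, closedBall_mem_nhds a0 one_pos] with a hA ha1
  refine ⟨hA.1, fun z hz hz0 => ?_⟩
  have hW : ‖w₁ a‖ ≤ |W| := (hW0 a ha1).trans (le_abs_self W)
  have hW' : ‖1 - w₁ a‖ ≤ 1 + |W| := by
    refine (norm_sub_le _ _).trans ?_
    rw [norm_one]; linarith
  have hrem : ∀ y ∈ Ioi (0:ℝ), ‖rem a z y‖ ≤ Cr * (1+y^2)⁻¹ := by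
    intro y hy
    have hy : 0 < y := hy
    have hyc : (y:ℂ) ≠ 0 := by exact_mod_cast hy.ne'
    have hsin : z * shc (Complex.I * (2*y*z)) = Complex.sin (2*y*z) / (2*y) := by
      have := shc_mul (Complex.I * (2*y*z))
      rw [show Complex.I * (2*y*z) = (2*y*z) * Complex.I by ring, Complex.sinh_mul_I] at this
      rw [eq_div_iff (by simpa using hyc), mul_comm Complex.I]
      refine mul_right_cancel₀ Complex.I_ne_zero ?_
      rw [← this]; ring
    have hsb : ‖Complex.sin (2*y*z)‖ ≤ Real.exp (2*M*y) := by
      have him : (2*(y:ℂ)*z).im = 2*y*z.im := by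
        rw [show (2*(y:ℂ)*z) = ((2*y:ℝ):ℂ) * z by push_cast; ring, Complex.im_ofReal_mul]
      have hv : |(2*(y:ℂ)*z).im| ≤ 2*M*y := by
        rw [him, abs_mul, abs_of_pos (by positivity)]
        nlinarith
      set v := 2*(y:ℂ)*z
      rw [Complex.sin, norm_div, Complex.norm_ofNat, div_le_iff₀ two_pos, norm_mul, Complex.norm_I,
        mul_one]
      refine (norm_sub_le _ _).trans ?_
      rw [Complex.norm_exp, Complex.norm_exp]
      have e1 : (v * Complex.I).re ≤ 2*M*y := by
        simp; exact (neg_le_abs _).trans hv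
      have e2 : (-v * Complex.I).re ≤ 2*M*y := by
        simp; exact (le_abs_self _).trans hv
      linarith [Real.exp_le_exp.2 e1, Real.exp_le_exp.2 e2]
    have hpref : ‖z * shc (Complex.I*(2*y*z)) / (y:ℂ)^2‖ ≤ Real.exp (2*M*y) / (2*y^3) := by
      rw [hsin, div_div, norm_div, show 2*(y:ℂ)*(y:ℂ)^2 = ((2*y^3:ℝ):ℂ) by push_cast; ring,
        Complex.norm_real, Real.norm_eq_abs, abs_of_pos (by positivity : 0 < 2*y^3)]
      gcongr
    have hab : ‖(shc (a*y) * shc (b*y))⁻¹‖ ≤ Ca*Cb*Real.exp (-(2*M+d)*y) := by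
      rw [mul_inv, norm_mul]
      calc _ ≤ (Ca * Real.exp (-(a0.re-d)*y)) * (Cb * Real.exp (-(b.re-d)*y)) := by
            gcongr
            · exact hA.2 y hy.le
            · exact hB y hy.le
        _ = Ca*Cb*(Real.exp (-(a0.re-d)*y) * Real.exp (-(b.re-d)*y)) := by ring
        _ = _ := by rw [← Real.exp_add]; congr 2; rw [hd]; ring
    have hE1 : Real.exp (-(2*M+d)*y) ≤ 1 := by
      rw [Real.exp_le_one_iff]; nlinarith [mul_pos hd0 hy, mul_nonneg hM0 hy.le]
    have hy1 := hB₁ y hy.le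
    have hy2 := hB₂ y hy.le
    rcases le_total y 1 with hle | hle
    · have hN : ‖N (a,y)‖ ≤ |B| := (hB0 (a,y) ⟨ha1, hy.le, hle⟩).trans (le_abs_self B)
      have hKb : ‖K a y‖ ≤ y^4 * X := by
        rw [hK0 a hA.1 y hy, norm_mul, norm_mul, norm_pow, Complex.norm_real, Real.norm_eq_abs,
          abs_of_pos hy, hX, mul_assoc]
        gcongr
        rw [norm_mul, norm_mul]
        calc _ ≤ (Ca*Cb*1) * ((C₁*1)*(C₂*1)) := by
              gcongr
              · exact hab.trans (by gcongr)
              · exact hy1.trans (by gcongr)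
              · exact hy2.trans (by gcongr)
          _ = _ := by ring
      have hX0 : 0 ≤ X := by positivity
      calc ‖rem a z y‖ ≤ Real.exp (2*M*y) / (2*y^3) * (y^4 * X) := by
            simp only [rem]; rw [norm_mul]; gcongr
        _ = Real.exp (2*M*y) * (y/2) * X := by field_simp
        _ ≤ Real.exp (2*M) * 1 * X := by
            have : Real.exp (2*M*y) ≤ Real.exp (2*M) := Real.exp_le_exp.2 (by nlinarith)
            have : y/2 ≤ 1 := by linarith
            gcongr
        _ ≤ (2*(Real.exp (2*M) * X)) * (1+y^2)⁻¹ := by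
            rw [mul_one, ← div_eq_mul_inv, le_div_iff₀ (by positivity)]
            have : 0 ≤ Real.exp (2*M) * X := by positivity
            have : 1 + y^2 ≤ 2 := by nlinarith
            nlinarith
        _ ≤ _ := by gcongr; exact le_max_left _ _
    · have hKb : ‖K a y‖ ≤ X' * Real.exp (-(2*M+d)*y) := by
        simp only [K]
        refine (norm_sub_le _ _).trans ((add_le_add_left (norm_sub_le _ _) _).trans ?_)
        rw [norm_mul, norm_mul]
        calc _ ≤ Ca*Cb*Real.exp (-(2*M+d)*y) + |W| * (C₁ * Real.exp (-(2*M+d)*y)) +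
              (1+|W|) * (C₂ * Real.exp (-(2*M+d)*y)) := by gcongr
          _ = _ := by rw [hX']; ring
      have hX0 : 0 ≤ X' := by positivity
      calc ‖rem a z y‖ ≤ Real.exp (2*M*y) / (2*y^3) * (X' * Real.exp (-(2*M+d)*y)) := by
            simp only [rem]; rw [norm_mul]; gcongr
        _ = (Real.exp (2*M*y) * Real.exp (-(2*M+d)*y)) * X' / (2*y^3) := by ring
        _ ≤ 1 * X' / y^2 := by
            rw [← Real.exp_add]
            gcongr
            · rw [Real.exp_le_one_iff]; nlinarith
            · nlinarith [sq_nonneg y]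
        _ ≤ (2*X') * (1+y^2)⁻¹ := by
            rw [one_mul, ← div_eq_mul_inv, div_le_div_iff₀ (by positivity) (by positivity)]
            have : 1 ≤ y^2 := by nlinarith
            nlinarith
        _ ≤ _ := by gcongr; exact le_max_right _ _
  have hdec : hK a b z = w₁ a * hK μ₁ 0 z + (1 - w₁ a) * hK μ₂ 0 z +
      ∫ y in Ioi (0:ℝ), rem a z y := by
    have i1 : IntegrableOn (kk μ₁ 0 z) (Ioi 0) :=
      integrableOn_kk (by simpa using h1p) (Or.inr rfl) (by simp; linarith)
    have i2 : IntegrableOn (kk μ₂ 0 z) (Ioi 0) :=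
      integrableOn_kk (by simpa using h2p) (Or.inr rfl) (by simp; linarith)
    have i3 : IntegrableOn (rem a z) (Ioi 0) := by
      refine Integrable.mono' (integrable_inv_bound Cr).integrableOn ?_
        ((ae_restrict_mem measurableSet_Ioi).mono hrem)
      refine ContinuousOn.aestronglyMeasurable ?_ measurableSet_Ioi
      intro y hy
      have hy : 0 < y := hy
      have hyc : (y:ℂ) ^ 2 ≠ 0 := pow_ne_zero _ (by exact_mod_cast hy.ne')
      have ea := shc_ne_zero (w := a*y) (Or.inl (by simp; exact mul_pos hA.1 hy))
      have eb := shc_ne_zero (w := b*y) (Or.inl (by simp; exact mul_pos hb hy))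
      have e1 := shc_ne_zero (w := μ₁*y) (Or.inl (by simp; exact mul_pos h1p hy))
      have e2 := shc_ne_zero (w := μ₂*y) (Or.inl (by simp; exact mul_pos h2p hy))
      have hc := continuous_shc
      apply ContinuousAt.continuousWithinAt
      have c1 : ContinuousAt (fun y : ℝ => (shc (a*y) * shc (b*y))⁻¹) y :=
        ContinuousAt.inv₀ (Continuous.continuousAt (by fun_prop)) (mul_ne_zero ea eb)
      have c2 : ContinuousAt (fun y : ℝ => (shc (μ₁*y))⁻¹) y :=
        ContinuousAt.inv₀ (Continuous.continuousAt (by fun_prop)) e1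
      have c3 : ContinuousAt (fun y : ℝ => (shc (μ₂*y))⁻¹) y :=
        ContinuousAt.inv₀ (Continuous.continuousAt (by fun_prop)) e2
      have c4 : ContinuousAt (fun y : ℝ => z * shc (Complex.I*(2*y*z)) / (y:ℂ)^2) y :=
        ContinuousAt.div (Continuous.continuousAt (by fun_prop))
          (Continuous.continuousAt (by fun_prop)) hyc
      exact c4.mul ((c1.sub (continuousAt_const.mul c2)).sub (continuousAt_const.mul c3))
    unfold hK
    rw [← integral_const_mul, ← integral_const_mul, ← integral_add (i1.const_mul _) (i2.const_mul _),
      ← integral_add (f := fun y => w₁ a * kk μ₁ 0 z y + (1 - w₁ a) * kk μ₂ 0 z y)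
        ((i1.const_mul _).add (i2.const_mul _)) i3]
    refine setIntegral_congr_fun measurableSet_Ioi fun y hy => ?_
    simp only [rem, K, kk, zero_mul, shc_zero, mul_one]
    ring
  have h_integ : ‖∫ y in Ioi (0:ℝ), rem a z y‖ ≤ ∫ y in Ioi (0:ℝ), Cr * (1+y^2)⁻¹ :=
    norm_integral_le_of_norm_le (integrable_inv_bound Cr).integrableOn
      ((ae_restrict_mem measurableSet_Ioi).mono hrem)
  have hfin : hK a b z + Real.pi*z^2/2 = w₁ a * (hK μ₁ 0 z + Real.pi*z^2/2) +
      (1 - w₁ a) * (hK μ₂ 0 z + Real.pi*z^2/2) + ∫ y in Ioi (0:ℝ), rem a z y := by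
    rw [hdec]; ring
  rw [hfin]
  refine (norm_add_le _ _).trans (add_le_add ((norm_add_le _ _).trans (add_le_add ?_ ?_)) h_integ)
  · rw [norm_mul]
    gcongr
    exact (hR₁ z hz hz0).trans (le_abs_self _)
  · rw [norm_mul]
    gcongr
    exact (hR₂ z hz hz0).trans (le_abs_self _)

/-- Continuation of `eS` by `m` steps of size `I*b`. -/
def eM (a b : ℂ) (m : ℕ) (z : ℂ) : ℂ :=
  eS a b (z + m*(Complex.I*b)) *
    ∏ k ∈ Finset.range m, (2 * Complex.cosh (Real.pi*(z + Complex.I*b/2 + k*(Complex.I*b))/a))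

/-- The reciprocal of the hyperbolic gamma function, on the half-plane `Im z < Re (a+b)/2`. -/
def eX (a b z : ℂ) : ℂ := eM a b ⌈-z.im/b.re - 1/2⌉₊ z

section
variable {a b z : ℂ}

theorem im_add_mul_I (m : ℕ) : (z + m*(Complex.I*b)).im = z.im + m * b.re := by
  simp

theorem im_I_mul_div_two : (Complex.I*b/2).im = b.re/2 := by
  rw [show Complex.I*b/2 = (Complex.I*b) * ((1/2:ℝ):ℂ) by push_cast; ring, Complex.im_mul_ofReal]
  simp; ring

theorem eX_index_spec (ha : 0 < a.re) (hb : 0 < b.re) (hz : z.im < (a.re+b.re)/2) :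
    |(z + (⌈-z.im/b.re - 1/2⌉₊ : ℕ)*(Complex.I*b)).im| < (a.re+b.re)/2 := by
  rw [im_add_mul_I]
  set x := -z.im/b.re - 1/2 with hx
  have hxz : z.im = -(x + 1/2) * b.re := by rw [hx]; field_simp; ring
  rcases le_or_gt x 0 with h | h
  · rw [Nat.ceil_eq_zero.2 h]
    rw [abs_lt]; simp
    constructor <;> nlinarith
  · have h1 := Nat.le_ceil x
    have h2 := Nat.ceil_lt_add_one h.le
    rw [abs_lt, hxz]
    constructor <;> nlinarith

theorem eM_succ (h : HypFE) (ha : 0 < a.re) (hb : 0 < b.re) {m : ℕ}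
    (h1 : |(z + m*(Complex.I*b)).im| < (a.re+b.re)/2)
    (h2 : |(z + ((m+1:ℕ):ℂ)*(Complex.I*b)).im| < (a.re+b.re)/2) :
    eM a b (m+1) z = eM a b m z := by
  unfold eM
  rw [im_add_mul_I] at h1 h2
  have h3 := abs_lt.1 h1
  have h4 := abs_lt.1 h2
  push_cast at h4
  have := h a b ha hb (z + Complex.I*b/2 + m*(Complex.I*b)) (by
    rw [im_add_mul_I, Complex.add_im, im_I_mul_div_two, abs_lt]; constructor <;> nlinarith)
  rw [Finset.prod_range_succ, show z + m*(Complex.I*b) =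
    z + Complex.I*b/2 + m*(Complex.I*b) - Complex.I*b/2 by ring, this]
  rw [show z + ((m+1:ℕ):ℂ)*(Complex.I*b) =
    z + Complex.I*b/2 + m*(Complex.I*b) + Complex.I*b/2 by push_cast; ring]
  ring

theorem eM_add (h : HypFE) (ha : 0 < a.re) (hb : 0 < b.re) {m : ℕ} (j : ℕ)
    (h1 : |(z + m*(Complex.I*b)).im| < (a.re+b.re)/2)
    (h2 : |(z + ((m+j:ℕ):ℂ)*(Complex.I*b)).im| < (a.re+b.re)/2) :
    eM a b (m+j) z = eM a b m z := by
  induction j with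
  | zero => rfl
  | succ j ih =>
    have h3 : |(z + ((m+j:ℕ):ℂ)*(Complex.I*b)).im| < (a.re+b.re)/2 := by
      rw [im_add_mul_I] at h1 h2 ⊢
      rw [abs_lt] at *
      push_cast at *
      have : 0 ≤ (j:ℝ) * b.re := by positivity
      constructor <;> nlinarith
    rw [← ih h3, ← Nat.add_assoc, eM_succ h ha hb h3 h2]

theorem eX_eq_eM (h : HypFE) (ha : 0 < a.re) (hb : 0 < b.re) {m : ℕ}
    (h1 : |(z + m*(Complex.I*b)).im| < (a.re+b.re)/2) : eX a b z = eM a b m z := by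
  have hz : z.im < (a.re+b.re)/2 := by
    rw [im_add_mul_I] at h1
    have := (abs_lt.1 h1).2
    have : 0 ≤ (m:ℝ) * b.re := by positivity
    linarith
  have h2 := eX_index_spec ha hb hz
  unfold eX
  set k := ⌈-z.im/b.re - 1/2⌉₊
  rcases le_total m k with hk | hk
  · obtain ⟨j, hj⟩ := Nat.exists_eq_add_of_le hk
    rw [hj] at h2 ⊢
    exact eM_add h ha hb j h1 h2
  · obtain ⟨j, rfl⟩ := Nat.exists_eq_add_of_le hk
    exact (eM_add h ha hb j h2 h1).symm

theorem eX_eq_eS (h : HypFE) (ha : 0 < a.re) (hb : 0 < b.re)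
    (hz : |z.im| < (a.re+b.re)/2) : eX a b z = eS a b z := by
  rw [eX_eq_eM h ha hb (m := 0) (by simpa using hz)]
  simp [eM]

/-- Downward functional equation. -/
theorem eX_sub (h : HypFE) (ha : 0 < a.re) (hb : 0 < b.re) (hz : z.im < (a.re+b.re)/2) :
    eX a b (z - Complex.I*b) = 2 * Complex.cosh (Real.pi*(z - Complex.I*b/2)/a) * eX a b z := by
  have h1 := eX_index_spec ha hb hz
  set k := ⌈-z.im/b.re - 1/2⌉₊ with hk
  rw [eX_eq_eM h ha hb h1, eX_eq_eM h ha hb (m := k+1) (by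
    convert h1 using 3; push_cast; ring)]
  unfold eM
  rw [Finset.prod_range_succ']
  have e1 : z - Complex.I*b + ((k+1:ℕ):ℂ)*(Complex.I*b) = z + k*(Complex.I*b) := by push_cast; ring
  have e2 : z - Complex.I*b + Complex.I*b/2 + ((0:ℕ):ℂ)*(Complex.I*b) = z - Complex.I*b/2 := by
    push_cast; ring
  have e3 : ∀ j : ℕ, z - Complex.I*b + Complex.I*b/2 + ((j+1:ℕ):ℂ)*(Complex.I*b) =
    z + Complex.I*b/2 + j*(Complex.I*b) := by intro j; push_cast; ring
  rw [e1, e2]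
  simp only [e3]
  ring

theorem eS_ne_zero : eS a b z ≠ 0 := Complex.exp_ne_zero _

theorem eS_symm (a b z : ℂ) : eS a b z = eS b a z := by
  unfold eS; rw [hK_symm, mul_comm a b]

theorem eS_mul_neg (a b z : ℂ) : eS a b z * eS a b (-z) = 1 := by
  unfold eS
  rw [← Complex.exp_add, hK_neg, ← Complex.exp_zero]
  congr 1; ring

theorem differentiableAt_eS (ha : 0 < a.re) (hb : 0 < b.re) (hz : |z.im| < (a.re+b.re)/2) :
    DifferentiableAt ℂ (eS a b) z := by
  have := (hasDerivAt_hK ha (Or.inl hb) hz).differentiableAt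
  unfold eS
  fun_prop

theorem continuousAt_eS (ha : 0 < a.re) (hb : 0 < b.re) (hz : |z.im| < (a.re+b.re)/2) :
    ContinuousAt (fun p : ℂ × ℂ => eS p.1 b p.2) (a, z) := by
  have h1 := continuousAt_hK ha (Or.inl hb) hz
  have h2 : ContinuousAt (fun p : ℂ × ℂ => p.1 * b) (a, z) := by fun_prop
  have := (continuousAt_const (y := Complex.I)).mul (h1.div h2 (mul_ne_zero (re_ne ha) (re_ne hb)))
  exact this.neg.cexp

theorem eX_eventually (h : HypFE) (ha : 0 < a.re) (hb : 0 < b.re) (hz : z.im < (a.re+b.re)/2) :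
    ∃ m : ℕ, |(z + m*(Complex.I*b)).im| < (a.re+b.re)/2 ∧ ∀ᶠ p : ℂ × ℂ in 𝓝 (a, z),
      0 < p.1.re ∧ |(p.2 + m*(Complex.I*b)).im| < (p.1.re+b.re)/2 ∧ eX p.1 b p.2 = eM p.1 b m p.2 := by
  refine ⟨_, eX_index_spec ha hb hz, ?_⟩
  have h1 := eX_index_spec ha hb hz
  set m := ⌈-z.im/b.re - 1/2⌉₊ with hm
  clear_value m
  have e1 : ∀ᶠ p : ℂ × ℂ in 𝓝 (a, z), 0 < p.1.re :=
    (by fun_prop : Continuous fun p : ℂ × ℂ => p.1.re).continuousAt.eventually (lt_mem_nhds ha)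
  have e2 : ∀ᶠ p : ℂ × ℂ in 𝓝 (a, z), |(p.2 + m*(Complex.I*b)).im| < (p.1.re+b.re)/2 :=
    ContinuousAt.eventually_lt (Continuous.continuousAt (by fun_prop))
      (Continuous.continuousAt (by fun_prop)) h1
  filter_upwards [e1, e2] with p h1 h2
  exact ⟨h1, h2, eX_eq_eM h h1 hb h2⟩

theorem continuousAt_eX (h : HypFE) (ha : 0 < a.re) (hb : 0 < b.re) (hz : z.im < (a.re+b.re)/2) :
    ContinuousAt (fun p : ℂ × ℂ => eX p.1 b p.2) (a, z) := by
  obtain ⟨m, h1, h2⟩ := eX_eventually h ha hb hz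
  have h3 : ContinuousAt (fun p : ℂ × ℂ => eM p.1 b m p.2) (a, z) := by
    unfold eM
    refine ContinuousAt.mul ?_ ?_
    · have := continuousAt_eS ha hb h1
      exact ContinuousAt.comp (x := (a, z)) (f := fun p : ℂ × ℂ => (p.1, p.2 + m*(Complex.I*b)))
        (g := fun p : ℂ × ℂ => eS p.1 b p.2) this (Continuous.continuousAt (by fun_prop))
    · refine tendsto_finsetProd _ fun k _ => ?_
      have : ContinuousAt (fun p : ℂ × ℂ =>
          Real.pi*(p.2 + Complex.I*b/2 + k*(Complex.I*b))/p.1) (a, z) :=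
        ContinuousAt.div (Continuous.continuousAt (by fun_prop))
          (Continuous.continuousAt (by fun_prop)) (re_ne ha)
      exact continuousAt_const.mul (Complex.continuous_cosh.continuousAt.comp this)
  exact h3.congr (h2.mono fun p hp => hp.2.2.symm)

theorem differentiableAt_eX (h : HypFE) (ha : 0 < a.re) (hb : 0 < b.re)
    (hz : z.im < (a.re+b.re)/2) : DifferentiableAt ℂ (eX a b) z := by
  obtain ⟨m, h1, h2⟩ := eX_eventually h ha hb hz
  have h3 : DifferentiableAt ℂ (eM a b m) z := by
    unfold eM
    refine DifferentiableAt.mul ?_ ?_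
    · have := differentiableAt_eS ha hb h1
      exact DifferentiableAt.comp (f := fun z : ℂ => z + m*(Complex.I*b)) z this (by fun_prop)
    · fun_prop
  have h4 : Tendsto (fun w : ℂ => (a, w)) (𝓝 z) (𝓝 (a, z)) :=
    Continuous.tendsto (by fun_prop) z
  exact h3.congr_of_eventuallyEq ((h4.eventually h2).mono fun p hp => hp.2.2)

theorem isOpen_im_lt (r : ℝ) : IsOpen {z : ℂ | z.im < r} :=
  isOpen_lt Complex.continuous_im continuous_const

theorem differentiableOn_eX (h : HypFE) (ha : 0 < a.re) (hb : 0 < b.re) :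
    DifferentiableOn ℂ (eX a b) {z | z.im < (a.re+b.re)/2} := fun _ hz =>
  (differentiableAt_eX h ha hb hz).differentiableWithinAt

theorem isPreconnected_im_lt (r : ℝ) : IsPreconnected {z : ℂ | z.im < r} :=
  (convex_halfSpace_im_lt r).isPreconnected

theorem eX_symm (h : HypFE) (ha : 0 < a.re) (hb : 0 < b.re) (hz : z.im < (a.re+b.re)/2) :
    eX a b z = eX b a z := by
  have hsum := add_comm b.re a.re
  have h1 := (differentiableOn_eX h ha hb).analyticOnNhd (isOpen_im_lt _)
  have h2 := (differentiableOn_eX h hb ha).analyticOnNhd (isOpen_im_lt _)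
  rw [hsum] at h2
  refine h1.eqOn_of_preconnected_of_eventuallyEq h2 (isPreconnected_im_lt _) (z₀ := 0)
    (by simp; linarith) ?_ hz
  have : ∀ᶠ w : ℂ in 𝓝 0, |w.im| < (a.re+b.re)/2 :=
    (by fun_prop : Continuous fun w : ℂ => |w.im|).continuousAt.eventually
      (gt_mem_nhds (by simp; linarith))
  filter_upwards [this] with w hw
  rw [eX_eq_eS h ha hb hw, eX_eq_eS h hb ha (by rwa [hsum]), eS_symm]

theorem eX_sub' (h : HypFE) (ha : 0 < a.re) (hb : 0 < b.re) (hz : z.im < (a.re+b.re)/2) :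
    eX a b (z - Complex.I*a) = 2 * Complex.cosh (Real.pi*(z - Complex.I*a/2)/b) * eX a b z := by
  rw [eX_symm h ha hb hz, eX_symm h ha hb (by simp; linarith), eX_sub h hb ha (by rwa [add_comm])]

theorem eX_mul_neg (h : HypFE) (ha : 0 < a.re) (hb : 0 < b.re) (hz : |z.im| < (a.re+b.re)/2) :
    eX a b z * eX a b (-z) = 1 := by
  rw [eX_eq_eS h ha hb hz, eX_eq_eS h ha hb (by simpa using hz), eS_mul_neg]

theorem eX_ne_zero (h : HypFE) (ha : 0 < a.re) (hb : 0 < b.re) (hz : |z.im| < (a.re+b.re)/2) :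
    eX a b z ≠ 0 := by
  rw [eX_eq_eS h ha hb hz]; exact eS_ne_zero

/-- Functional equation in the form `e(z+iτ-ib) = 2i sinh(πz/a) e(z+iτ)`. -/
theorem eX_shift (h : HypFE) (ha : 0 < a.re) (hb : 0 < b.re) (hz : z.im < 0) :
    eX a b (z + Complex.I*((a+b)/2) - Complex.I*b) =
      2 * Complex.I * Complex.sinh (Real.pi*z/a) * eX a b (z + Complex.I*((a+b)/2)) := by
  rw [eX_sub h ha hb]
  · have : (Real.pi:ℂ)*(z + Complex.I*((a+b)/2) - Complex.I*b/2)/a = Real.pi*z/a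
        + Real.pi/2*Complex.I := by
      have := re_ne ha
      field_simp; ring
    rw [this, Complex.cosh_add, Complex.cosh_mul_I, Complex.sinh_mul_I, Complex.cos_pi_div_two,
      Complex.sin_pi_div_two]
    ring
  · rw [mul_div_assoc', Complex.add_im, im_I_mul_div_two]
    simp; linarith

end

set_option maxHeartbeats 1000000 in
theorem eS_bound (h : HypFE) {a0 b d0 : ℂ} (ha : 0 < a0.re) (hb : 0 < b.re)
    (hd : |d0.im| < (a0.re+b.re)/2) :
    ∃ C : ℝ, 0 ≤ C ∧ ∀ᶠ p : ℂ × ℂ in 𝓝 (a0, d0), 0 < p.1.re ∧ ∀ x : ℝ, ‖eS p.1 b (x + p.2)‖ ≤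
      C * Real.exp ((Complex.I*Real.pi/(2*(p.1*b))).re * (x*|x|) +
        (Complex.I*Real.pi*p.2/(p.1*b)).re * |x|) := by
  obtain ⟨M, hM0, hM, hdM⟩ := strip_room hd
  obtain ⟨C0, hC0⟩ := hK_asymp h ha hb hM0 hM
  have hC0' : ∀ᶠ p : ℂ × ℂ in 𝓝 (a0, d0), 0 < p.1.re ∧ ∀ z : ℂ, |z.im| ≤ M → 0 ≤ z.re →
      ‖hK p.1 b z + Real.pi*z^2/2‖ ≤ C0 := (continuous_fst.tendsto (a0, d0)).eventually hC0
  set R := ‖d0‖ + 1 with hR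
  have hR0 : 0 ≤ R := by positivity
  have hab0 : a0 * b ≠ 0 := mul_ne_zero (re_ne ha) (re_ne hb)
  set B := ‖(a0*b)⁻¹‖ + 1 with hB
  have hB0 : 0 ≤ B := by positivity
  have e1 : ∀ᶠ p : ℂ × ℂ in 𝓝 (a0, d0), ‖p.2‖ < R :=
    (by fun_prop : Continuous fun p : ℂ × ℂ => ‖p.2‖).continuousAt.eventually
      (gt_mem_nhds (by simp [hR]))
  have e2 : ∀ᶠ p : ℂ × ℂ in 𝓝 (a0, d0), |p.2.im| < M :=
    (by fun_prop : Continuous fun p : ℂ × ℂ => |p.2.im|).continuousAt.eventually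
      (gt_mem_nhds hdM)
  have e3 : ∀ᶠ p : ℂ × ℂ in 𝓝 (a0, d0), ‖(p.1*b)⁻¹‖ < B := by
    have : ContinuousAt (fun p : ℂ × ℂ => ‖(p.1*b)⁻¹‖) (a0, d0) :=
      (ContinuousAt.inv₀ (f := fun p : ℂ × ℂ => p.1*b) (Continuous.continuousAt (by fun_prop)) hab0).norm
    exact this.eventually (gt_mem_nhds (by simp [hB]))
  refine ⟨Real.exp (6*(Real.pi*R^2*B) + |C0| * B), (Real.exp_pos _).le, ?_⟩
  filter_upwards [hC0', e1, e2, e3] with p hC e1 e2 e3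
  obtain ⟨a, d⟩ := p
  simp only at hC e1 e2 e3 ⊢
  refine ⟨hC.1, fun x => ?_⟩
  have hpi := Real.pi_pos
  set A := (Complex.I*Real.pi/(2*(a*b))).re with hA
  set D := (Complex.I*Real.pi*d/(a*b)).re with hD
  have hAb : |A| ≤ Real.pi * B := by
    refine (Complex.abs_re_le_norm _).trans ?_
    rw [show Complex.I*Real.pi/(2*(a*b)) = Complex.I*Real.pi/2*(a*b)⁻¹ by
      rw [div_eq_mul_inv, mul_inv]; ring, norm_mul]
    simp only [norm_div, norm_mul, Complex.norm_I, Complex.norm_real, Real.norm_eq_abs,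
      abs_of_pos hpi, Complex.norm_ofNat, one_mul]
    have : Real.pi/2 ≤ Real.pi := by linarith
    gcongr
  have hDb : |D| ≤ Real.pi * R * B := by
    refine (Complex.abs_re_le_norm _).trans ?_
    rw [div_eq_mul_inv, norm_mul]
    simp only [norm_mul, Complex.norm_I, Complex.norm_real, Real.norm_eq_abs, abs_of_pos hpi, one_mul]
    gcongr
  set E := (Complex.I*Real.pi*d^2/(2*(a*b))).re with hE
  have hEb : |E| ≤ Real.pi * R^2 * B := by
    refine (Complex.abs_re_le_norm _).trans ?_
    rw [show Complex.I*Real.pi*d^2/(2*(a*b)) = Complex.I*(Real.pi*d^2)/2*(a*b)⁻¹ by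
      rw [div_eq_mul_inv, mul_inv]; ring, norm_mul]
    simp only [norm_div, norm_mul, Complex.norm_I, Complex.norm_real, Real.norm_eq_abs,
      abs_of_pos hpi, Complex.norm_ofNat, one_mul, norm_pow]
    have : Real.pi * ‖d‖^2/2 ≤ Real.pi * R^2 := by
      have : ‖d‖^2 ≤ R^2 := by gcongr
      nlinarith [sq_nonneg ‖d‖]
    gcongr
  have hquad : (Complex.I*(Real.pi*((x:ℂ)+d)^2/2)/(a*b)).re = A*x^2 + D*x + E := by
    rw [hA, hD, hE, show Complex.I*(Real.pi*((x:ℂ)+d)^2/2)/(a*b) =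
      Complex.I*Real.pi/(2*(a*b)) * ((x^2:ℝ):ℂ) + Complex.I*Real.pi*d/(a*b) * (x:ℂ) +
      Complex.I*Real.pi*d^2/(2*(a*b)) by push_cast; field_simp; ring]
    simp only [Complex.add_re, Complex.re_mul_ofReal]
  have hdre : |d.re| ≤ R := (Complex.abs_re_le_norm _).trans e1.le
  have hdr := abs_le.1 hdre
  have hA2 := abs_le.1 hAb
  have hD2 := abs_le.1 hDb
  have hE2 := abs_le.1 hEb
  have hrem : ∀ r : ℂ, ‖r‖ ≤ C0 → |(Complex.I * r/(a*b)).re| ≤ |C0| * B := by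
    intro r hr
    refine (Complex.abs_re_le_norm _).trans ?_
    rw [div_eq_mul_inv, norm_mul, norm_mul, Complex.norm_I, one_mul]
    have := hr.trans (le_abs_self C0)
    gcongr
  have small : |x| ≤ R → ∀ σ : ℝ, |σ| = 1 → σ*(A*x^2+D*x) ≤ A*(x*|x|) + D*|x| + 4*(Real.pi*R^2*B) := by
    intro hx σ hσ
    have h1 : |σ*(A*x^2+D*x)| ≤ Real.pi*B*R^2 + Real.pi*R*B*R := by
      rw [abs_mul, hσ, one_mul]
      refine (abs_add_le _ _).trans ?_
      rw [abs_mul, abs_mul, abs_pow]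
      gcongr
    have h2 : |(A*(x*|x|) + D*|x|)| ≤ Real.pi*B*(R*R) + Real.pi*R*B*R := by
      refine (abs_add_le _ _).trans ?_
      rw [abs_mul, abs_mul, abs_mul, abs_abs]
      gcongr
    have := abs_le.1 h1
    have := abs_le.1 h2
    nlinarith
  unfold eS
  rw [Complex.norm_exp, ← Real.exp_add, Real.exp_le_exp]
  rcases le_total 0 (x + d.re) with hx | hx
  · have hr := hC.2 (x+d) (by simpa using e2.le) (by simpa using hx)
    have hr' := abs_le.1 (hrem _ hr)
    have : -(Complex.I*(hK a b (x+d)/(a*b))) = Complex.I*(Real.pi*((x:ℂ)+d)^2/2)/(a*b) -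
      Complex.I * (hK a b (x+d) + Real.pi*((x:ℂ)+d)^2/2)/(a*b) := by ring
    rw [this, Complex.sub_re, hquad]
    have : A*x^2+D*x ≤ A*(x*|x|) + D*|x| + 4*(Real.pi*R^2*B) := by
      rcases le_total 0 x with hx0 | hx0
      · rw [abs_of_nonneg hx0]
        have : 0 ≤ Real.pi*R^2*B := by positivity
        nlinarith
      · have := small (by rw [abs_of_nonpos hx0]; linarith) 1 (by simp)
        linarith
    linarith
  · have hr := hC.2 (-(x+d)) (by
      rw [Complex.neg_im, abs_neg]; simpa using e2.le) (by simp; linarith)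
    have hr' := abs_le.1 (hrem _ hr)
    have : -(Complex.I*(hK a b (x+d)/(a*b))) = -(Complex.I*(Real.pi*((x:ℂ)+d)^2/2)/(a*b)) +
      Complex.I * (hK a b (-(x+d)) + Real.pi*(-((x:ℂ)+d))^2/2)/(a*b) := by rw [hK_neg]; ring
    rw [this, Complex.add_re, Complex.neg_re, hquad]
    have : -(A*x^2+D*x) ≤ A*(x*|x|) + D*|x| + 4*(Real.pi*R^2*B) := by
      rcases le_total 0 x with hx0 | hx0
      · have := small (by rw [abs_of_nonneg hx0]; linarith) (-1) (by simp)
        linarith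
      · rw [abs_of_nonpos hx0]
        have : 0 ≤ Real.pi*R^2*B := by positivity
        nlinarith
    linarith

theorem norm_two_cosh_le (w : ℂ) : ‖2 * Complex.cosh w‖ ≤ 2 * Real.exp |w.re| := by
  rw [Complex.two_cosh]
  refine (norm_add_le _ _).trans ?_
  rw [Complex.norm_exp, Complex.norm_exp, Complex.neg_re]
  linarith [Real.exp_le_exp.2 (le_abs_self w.re), Real.exp_le_exp.2 (neg_le_abs w.re)]

theorem norm_two_sinh_le (w : ℂ) : ‖2 * Complex.sinh w‖ ≤ 2 * Real.exp |w.re| := by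
  rw [Complex.two_sinh]
  refine (norm_sub_le _ _).trans ?_
  rw [Complex.norm_exp, Complex.norm_exp, Complex.neg_re]
  linarith [Real.exp_le_exp.2 (le_abs_self w.re), Real.exp_le_exp.2 (neg_le_abs w.re)]

theorem inv_re_pos {a : ℂ} (ha : 0 < a.re) : 0 < (a⁻¹).re := by
  rw [Complex.inv_re]; exact div_pos ha (Complex.normSq_pos.2 (re_ne ha))

theorem eX_bound (h : HypFE) {a0 b d0 : ℂ} (ha : 0 < a0.re) (hb : 0 < b.re)
    (hd : d0.im < (a0.re+b.re)/2) :
    ∃ C : ℝ, 0 ≤ C ∧ ∀ᶠ p : ℂ × ℂ in 𝓝 (a0, d0), 0 < p.1.re ∧ ∀ x : ℝ, ‖eX p.1 b (x + p.2)‖ ≤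
      C * Real.exp ((Complex.I*Real.pi/(2*(p.1*b))).re * (x*|x|) +
        (Complex.I*Real.pi*p.2/(p.1*b)).re * |x|) := by
  obtain ⟨m, h1, h2⟩ := eX_eventually h ha hb hd
  obtain ⟨C, hC0, hC⟩ := eS_bound h (d0 := d0 + m*(Complex.I*b)) ha hb h1
  have hC' : ∀ᶠ p : ℂ × ℂ in 𝓝 (a0, d0), 0 < p.1.re ∧ ∀ x : ℝ,
      ‖eS p.1 b (x + (p.2 + m*(Complex.I*b)))‖ ≤
      C * Real.exp ((Complex.I*Real.pi/(2*(p.1*b))).re * (x*|x|) +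
        (Complex.I*Real.pi*(p.2 + m*(Complex.I*b))/(p.1*b)).re * |x|) :=
    (Continuous.tendsto (f := fun p : ℂ × ℂ => (p.1, p.2 + m*(Complex.I*b)))
      (by fun_prop) (a0, d0)).eventually hC
  -- the constants of the cosh factors
  let f : ℕ → ℂ × ℂ → ℝ := fun k p => |(Real.pi*(p.2 + Complex.I*b/2 + k*(Complex.I*b))/p.1).re|
  have hf : ∀ k, ContinuousAt (f k) (a0, d0) := by
    intro k
    have : ContinuousAt (fun p : ℂ × ℂ =>
        Real.pi*(p.2 + Complex.I*b/2 + k*(Complex.I*b))/p.1) (a0, d0) :=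
      ContinuousAt.div (Continuous.continuousAt (by fun_prop))
        (Continuous.continuousAt (by fun_prop)) (re_ne ha)
    exact (Complex.continuous_re.continuousAt.comp this).abs
  have hf2 : ∀ᶠ p : ℂ × ℂ in 𝓝 (a0, d0), ∀ k ∈ Finset.range m, f k p < f k (a0,d0) + 1 := by
    rw [Filter.eventually_all_finset]
    intro k _
    exact (hf k).eventually (gt_mem_nhds (by linarith))
  refine ⟨C * ∏ k ∈ Finset.range m, (2 * Real.exp (f k (a0,d0) + 1)),
    mul_nonneg hC0 (Finset.prod_nonneg fun _ _ => by positivity), ?_⟩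
  filter_upwards [h2, hC', hf2, h2.eventually_nhds] with p h2 hC hf hnh
  obtain ⟨a, d⟩ := p
  simp only at h2 hC hf ⊢
  refine ⟨h2.1, fun x => ?_⟩
  have hx : eX a b (x+d) = eM a b m (x+d) := eX_eq_eM h h2.1 hb (by
    have := h2.2.1
    rw [im_add_mul_I] at this ⊢
    simpa using this)
  rw [hx]
  unfold eM
  rw [norm_mul, norm_prod]
  have hr : 0 < ((Real.pi:ℂ)/a).re := by
    rw [div_eq_mul_inv, Complex.re_ofReal_mul]; exact mul_pos Real.pi_pos (inv_re_pos h2.1)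
  have hprod : ∏ k ∈ Finset.range m,
      ‖2 * Complex.cosh (Real.pi*(x + d + Complex.I*b/2 + k*(Complex.I*b))/a)‖ ≤
      ∏ k ∈ Finset.range m, (2 * Real.exp (f k (a0,d0) + 1) * Real.exp (((Real.pi:ℂ)/a).re * |x|)) := by
    refine Finset.prod_le_prod (fun _ _ => norm_nonneg _) fun k hk => ?_
    refine (norm_two_cosh_le _).trans ?_
    rw [mul_assoc, ← Real.exp_add]
    gcongr
    rw [show Real.pi*(x + d + Complex.I*b/2 + k*(Complex.I*b))/a =
      (Real.pi:ℂ)/a * (x:ℂ) + Real.pi*(d + Complex.I*b/2 + k*(Complex.I*b))/a by ring,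
      Complex.add_re, Complex.re_mul_ofReal]
    refine (abs_add_le _ _).trans ?_
    rw [abs_mul, abs_of_pos hr]
    have := hf k hk
    simp only [f] at this ⊢
    linarith
  refine (mul_le_mul (by simpa only [add_assoc] using hC.2 x) hprod
    (Finset.prod_nonneg fun _ _ => norm_nonneg _) (by positivity)).trans ?_
  rw [Finset.prod_mul_distrib, Finset.prod_const, Finset.card_range, ← Real.exp_nat_mul]
  have hae := re_ne h2.1
  have hbe := re_ne hb
  have key : (Complex.I*Real.pi*(d + m*(Complex.I*b))/(a*b)).re =
      (Complex.I*Real.pi*d/(a*b)).re - m*((Real.pi:ℂ)/a).re := by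
    rw [show Complex.I*Real.pi*(d + m*(Complex.I*b))/(a*b) =
      Complex.I*Real.pi*d/(a*b) - ((m:ℝ):ℂ)*((Real.pi:ℂ)/a) by
        push_cast
        field_simp
        linear_combination (m * b) * Complex.I_sq, Complex.sub_re, Complex.re_ofReal_mul]
  rw [key]
  apply le_of_eq
  rw [show ∀ u v w : ℝ, C * u * (v * w) = C * v * (u * w) by intros; ring, ← Real.exp_add]
  congr 2; ring

/-- Products `e(x+d) e(-x+d')` decay or grow at most exponentially. -/
theorem eX_pair_bound (h : HypFE) {a0 b d0 d0' : ℂ} (ha : 0 < a0.re) (hb : 0 < b.re)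
    (hd : d0.im < (a0.re+b.re)/2) (hd' : d0'.im < (a0.re+b.re)/2) :
    ∃ C : ℝ, 0 ≤ C ∧ ∀ᶠ p : ℂ × ℂ × ℂ in 𝓝 (a0, d0, d0'), 0 < p.1.re ∧ ∀ x : ℝ,
      ‖eX p.1 b (x + p.2.1) * eX p.1 b (-x + p.2.2)‖ ≤
      C * Real.exp ((Complex.I*Real.pi*(p.2.1 + p.2.2)/(p.1*b)).re * |x|) := by
  obtain ⟨C1, h10, h1⟩ := eX_bound h ha hb hd
  obtain ⟨C2, h20, h2⟩ := eX_bound h ha hb hd'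
  have h1' := (Continuous.tendsto (f := fun p : ℂ × ℂ × ℂ => (p.1, p.2.1))
      (by fun_prop) (a0, d0, d0')).eventually h1
  have h2' := (Continuous.tendsto (f := fun p : ℂ × ℂ × ℂ => (p.1, p.2.2))
      (by fun_prop) (a0, d0, d0')).eventually h2
  refine ⟨C1*C2, by positivity, ?_⟩
  filter_upwards [h1', h2'] with p h1 h2
  refine ⟨h1.1, fun x => ?_⟩
  rw [norm_mul]
  have h3 := h2.2 (-x)
  push_cast at h3
  refine (mul_le_mul (h1.2 x) h3 (norm_nonneg _) (by positivity)).trans (le_of_eq ?_)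
  rw [show ∀ u v : ℝ, C1 * u * (C2 * v) = C1 * C2 * (u * v) by intros; ring, ← Real.exp_add]
  congr 2
  rw [mul_add, add_div, Complex.add_re, abs_neg]
  ring

section
/-- One-variable factor of the sign sum. -/
def aphi (al be x : ℂ) : ℂ := Complex.sinh (x+al) * Complex.sinh (x+be) / Complex.sinh (2*x)

/-- Two-variable factor of the sign sum. -/
def apsi (k x : ℂ) : ℂ := Complex.sinh (x+k) / Complex.sinh x

/-- Hyperbolic cotangent. -/
def ccoth (x : ℂ) : ℂ := Complex.cosh x / Complex.sinh x

theorem ccoth_neg (x : ℂ) : ccoth (-x) = -ccoth x := by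
  simp [ccoth, div_neg]

theorem apsi_eq (k : ℂ) {x : ℂ} (hx : Complex.sinh x ≠ 0) :
    apsi k x = Complex.cosh k + Complex.sinh k * ccoth x := by
  unfold apsi ccoth
  rw [Complex.sinh_add]
  field_simp

theorem ccoth_mul {u v : ℂ} (hu : Complex.sinh u ≠ 0) (hv : Complex.sinh v ≠ 0)
    (huv : Complex.sinh (v-u) ≠ 0) :
    ccoth u * ccoth v = 1 + ccoth (v-u) * (ccoth u - ccoth v) := by
  unfold ccoth
  field_simp
  rw [Complex.sinh_sub, Complex.cosh_sub]
  ring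

theorem tanh_mul_ccoth {u v : ℂ} (hu : Complex.cosh u ≠ 0) (hv : Complex.sinh v ≠ 0)
    (huv : Complex.cosh (v-u) ≠ 0) :
    Complex.tanh u * ccoth v = 1 + Complex.tanh (v-u) * (Complex.tanh u - ccoth v) := by
  unfold ccoth
  rw [Complex.tanh_eq_sinh_div_cosh, Complex.tanh_eq_sinh_div_cosh]
  field_simp
  rw [Complex.sinh_sub, Complex.cosh_sub]
  ring

theorem sinh_two_ne {x : ℂ} (h : Complex.sinh (2*x) ≠ 0) :
    Complex.sinh x ≠ 0 ∧ Complex.cosh x ≠ 0 := by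
  rw [Complex.sinh_two_mul] at h
  constructor
  · intro h0; exact h (by rw [h0]; ring)
  · intro h0; exact h (by rw [h0]; ring)

theorem aphi_eq (al be : ℂ) {x : ℂ} (hx : Complex.sinh (2*x) ≠ 0) :
    aphi al be x = Complex.sinh (al+be)/2 + Complex.sinh al * Complex.sinh be/2 * ccoth x +
      Complex.cosh al * Complex.cosh be/2 * Complex.tanh x := by
  obtain ⟨h1, h2⟩ := sinh_two_ne hx
  unfold aphi ccoth
  rw [Complex.tanh_eq_sinh_div_cosh, Complex.sinh_two_mul, Complex.sinh_add, Complex.sinh_add,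
    Complex.sinh_add]
  field_simp
  ring

variable {ι : Type*}

/-- Residue coefficients of the partial fraction expansion. -/
def ares (al be k : ℂ) (y : ι → ℂ) (s : Finset ι) (j : ι) : ℂ :=
  Complex.sinh k * aphi al be (-y j) * ∏ l ∈ s.erase j, apsi k (y l - y j)

theorem partial_fractions (al be k : ℂ) (y : ι → ℂ) (s : Finset ι)
    (h1 : ∀ i ∈ s, Complex.sinh (2*y i) ≠ 0)
    (h2 : ∀ i ∈ s, ∀ j ∈ s, i ≠ j → Complex.sinh (y i - y j) ≠ 0) :
    ∃ p q : ℂ, p + q + ∑ j ∈ s, ares al be k y s j = Complex.cosh (al+be+s.card*k)/2 ∧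
      ∀ x : ℂ, Complex.sinh (2*x) ≠ 0 → (∀ j ∈ s, Complex.sinh (x + y j) ≠ 0) →
        aphi al be x * ∏ j ∈ s, apsi k (x + y j) =
          Complex.sinh (al+be+s.card*k)/2 + p * ccoth x + q * Complex.tanh x +
            ∑ j ∈ s, ares al be k y s j * ccoth (x + y j) := by
  induction s using Finset.induction_on with
  | empty =>
    refine ⟨Complex.sinh al * Complex.sinh be/2, Complex.cosh al * Complex.cosh be/2, ?_, ?_⟩
    · simp [Complex.cosh_add]; ring
    · intro x hx _
      simp [aphi_eq al be hx]
  | insert m s hm ih =>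
    obtain ⟨p, q, hpq, hf⟩ := ih (fun i hi => h1 i (Finset.mem_insert_of_mem hi))
      (fun i hi j hj => h2 i (Finset.mem_insert_of_mem hi) j (Finset.mem_insert_of_mem hj))
    have hms : ∀ j ∈ s, j ≠ m := fun j hj h => hm (h ▸ hj)
    have hym := h1 m (Finset.mem_insert_self _ _)
    obtain ⟨hym1, hym2⟩ := sinh_two_ne hym
    have hmj : ∀ j ∈ s, Complex.sinh (y m - y j) ≠ 0 := fun j hj =>
      h2 m (Finset.mem_insert_self _ _) j (Finset.mem_insert_of_mem hj) (hms j hj).symm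
    have hrm : ares al be k y (insert m s) m = Complex.sinh k *
        (Complex.sinh (al+be+s.card*k)/2 - p * ccoth (y m) - q * Complex.tanh (y m) -
          ∑ j ∈ s, ares al be k y s j * ccoth (y m - y j)) := by
      have := hf (-y m) (by rw [mul_neg, Complex.sinh_neg]; exact neg_ne_zero.2 hym) (fun j hj => by
        have := hmj j hj
        rw [← neg_sub, Complex.sinh_neg] at this
        rw [neg_add_eq_sub]; exact neg_ne_zero.1 this)
      rw [ares, Finset.erase_insert hm]
      simp only [neg_add_eq_sub] at this
      rw [mul_assoc, this, ccoth_neg, Complex.tanh_neg]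
      congr 1
      rw [show ∑ j ∈ s, ares al be k y s j * ccoth (y j - y m) =
        -∑ j ∈ s, ares al be k y s j * ccoth (y m - y j) by
          rw [← Finset.sum_neg_distrib]
          refine Finset.sum_congr rfl fun j _ => ?_
          rw [← neg_sub (y m), ccoth_neg]; ring]
      ring
    have hrj : ∀ j ∈ s, ares al be k y (insert m s) j = ares al be k y s j *
        (Complex.cosh k + Complex.sinh k * ccoth (y m - y j)) := by
      intro j hj
      rw [ares, ares, Finset.erase_insert_of_ne (hms j hj).symm,
        Finset.prod_insert (fun h => hm (Finset.mem_of_mem_erase h)), apsi_eq k (hmj j hj)]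
      ring
    have hcard : ((insert m s).card : ℂ) = s.card + 1 := by
      rw [Finset.card_insert_of_notMem hm]; push_cast; ring
    refine ⟨p * (Complex.cosh k + Complex.sinh k * ccoth (y m)),
      q * (Complex.cosh k + Complex.sinh k * Complex.tanh (y m)), ?_, ?_⟩
    · rw [Finset.sum_insert hm, Finset.sum_congr rfl hrj, hrm, hcard,
        show al+be+((s.card:ℂ)+1)*k = al+be+s.card*k + k by ring, Complex.cosh_add (al+be+s.card*k) k]
      simp only [mul_add, Finset.sum_add_distrib, ← Finset.sum_mul]
      have e : ∑ j ∈ s, ares al be k y s j * (Complex.sinh k * ccoth (y m - y j)) =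
        Complex.sinh k * ∑ j ∈ s, ares al be k y s j * ccoth (y m - y j) := by
          rw [Finset.mul_sum]; exact Finset.sum_congr rfl fun j _ => by ring
      rw [e]
      linear_combination Complex.cosh k * hpq
    · intro x hx hxy
      have hxm := hxy m (Finset.mem_insert_self _ _)
      obtain ⟨hx1, hx2⟩ := sinh_two_ne hx
      have hxs : ∀ j ∈ s, Complex.sinh (x + y j) ≠ 0 := fun j hj =>
        hxy j (Finset.mem_insert_of_mem hj)
      rw [Finset.prod_insert hm, Finset.sum_insert hm, Finset.sum_congr rfl fun j hj => by
        rw [hrj j hj], hrm, mul_left_comm, hf x hx hxs, apsi_eq k hxm, hcard,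
        show al+be+((s.card:ℂ)+1)*k = al+be+s.card*k + k by ring, Complex.sinh_add (al+be+s.card*k) k]
      have c1 := ccoth_mul hx1 hxm (by simpa using hym1)
      have c2 := tanh_mul_ccoth hx2 hxm (by simpa using hym2)
      have c3 : ∀ j ∈ s, ccoth (x + y j) * ccoth (x + y m) =
          1 + ccoth (y m - y j) * (ccoth (x + y j) - ccoth (x + y m)) := by
        intro j hj
        have := ccoth_mul (hxs j hj) hxm (by
          rw [show x + y m - (x + y j) = y m - y j by ring]; exact hmj j hj)
        rwa [show x + y m - (x + y j) = y m - y j by ring] at this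
      simp only [add_sub_cancel_left] at c1 c2
      have c4 : (∑ j ∈ s, ares al be k y s j * ccoth (x + y j)) * ccoth (x + y m) =
          ∑ j ∈ s, ares al be k y s j +
          ∑ j ∈ s, ares al be k y s j * ccoth (y m - y j) * ccoth (x + y j) -
          (∑ j ∈ s, ares al be k y s j * ccoth (y m - y j)) * ccoth (x + y m) := by
        rw [Finset.sum_mul, Finset.sum_mul, ← Finset.sum_add_distrib, ← Finset.sum_sub_distrib]
        refine Finset.sum_congr rfl fun j hj => ?_
        rw [mul_assoc, c3 j hj]; ring
      have c5 : ∑ j ∈ s, ares al be k y s j * (Complex.cosh k + Complex.sinh k * ccoth (y m - y j))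
          * ccoth (x + y j) = Complex.cosh k * ∑ j ∈ s, ares al be k y s j * ccoth (x + y j) +
          Complex.sinh k *
            ∑ j ∈ s, ares al be k y s j * ccoth (y m - y j) * ccoth (x + y j) := by
        rw [Finset.mul_sum, Finset.mul_sum, ← Finset.sum_add_distrib]
        exact Finset.sum_congr rfl fun j _ => by ring
      rw [c5]
      linear_combination Complex.sinh k * (p * c1 + q * c2 + c4) + Complex.sinh k * hpq

/-- Signs as complex numbers. -/
def sgn (b : Bool) : ℝ := if b then 1 else -1

/-- Product over pairs `i < j`. -/
def pairProd {n : ℕ} (f : Fin n → Fin n → ℂ) : ℂ := ∏ i : Fin n, ∏ j ∈ Finset.Ioi i, f i j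

theorem pairProd_succ {n : ℕ} (f : Fin (n+1) → Fin (n+1) → ℂ) :
    pairProd f = (∏ j : Fin n, f 0 j.succ) * pairProd (fun i j => f i.succ j.succ) := by
  unfold pairProd
  rw [Fin.prod_univ_succ, Fin.prod_Ioi_zero]
  congr 1
  refine Finset.prod_congr rfl fun i _ => ?_
  rw [Fin.prod_Ioi_succ]

theorem pairProd_mul {n : ℕ} (f g : Fin n → Fin n → ℂ) :
    pairProd (fun i j => f i j * g i j) = pairProd f * pairProd g := by
  simp only [pairProd, Finset.prod_mul_distrib]

theorem pairProd_congr {n : ℕ} {f g : Fin n → Fin n → ℂ} (h : ∀ i j, i < j → f i j = g i j) :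
    pairProd f = pairProd g :=
  Finset.prod_congr rfl fun i _ => Finset.prod_congr rfl fun j hj => h i j (Finset.mem_Ioi.1 hj)

theorem pairProd_split {n : ℕ} (m : Fin n) (g : Fin n → Fin n → ℂ) (hg : ∀ i j, g i j = g j i) :
    pairProd g = (∏ l ∈ Finset.univ.erase m, g m l) *
      pairProd (fun i j => if i = m ∨ j = m then 1 else g i j) := by
  have h1 : pairProd g = pairProd (fun i j => (if i = m ∨ j = m then g i j else 1) *
      (if i = m ∨ j = m then 1 else g i j)) :=
    pairProd_congr fun i j _ => by split_ifs <;> simp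
  rw [h1, pairProd_mul]
  congr 1
  have h2 : ∀ i : Fin n, ∏ j ∈ Finset.Ioi i, (if i = m ∨ j = m then g i j else 1) =
      if i = m then ∏ j ∈ Finset.Ioi m, g m j else if i < m then g m i else 1 := by
    intro i
    by_cases him : i = m
    · subst him; simp
    · simp only [him, false_or, if_false]
      rw [Finset.prod_ite_eq']
      simp only [Finset.mem_Ioi]
      rw [hg i m]
  unfold pairProd
  have h5 : ∏ x ∈ Finset.univ.erase m,
      (if x = m then ∏ j ∈ Finset.Ioi m, g m j else if x < m then g m x else 1) =
      ∏ x ∈ Finset.univ.erase m, if x < m then g m x else 1 :=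
    Finset.prod_congr rfl fun i hi => if_neg (Finset.ne_of_mem_erase hi)
  rw [Finset.prod_congr rfl fun i _ => h2 i,
    ← Finset.mul_prod_erase _ _ (Finset.mem_univ m), if_pos rfl, h5]
  have h3 : (Finset.univ.erase m : Finset (Fin n)) = Finset.Ioi m ∪ Finset.Iio m := by
    ext i; simp; omega
  have h4 : Disjoint (Finset.Ioi m) (Finset.Iio m) := by
    rw [Finset.disjoint_left]; intro i; simp; omega
  rw [h3, Finset.prod_union h4, Finset.prod_union h4]
  rw [Finset.prod_congr rfl (s₁ := Finset.Ioi m) (f := fun i => if i < m then g m i else 1)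
      (g := fun _ => 1) (fun i hi => if_neg (by have := Finset.mem_Ioi.1 hi; omega)),
    Finset.prod_congr rfl (s₁ := Finset.Iio m) (f := fun i => if i < m then g m i else 1)
      (g := fun i => g m i) (fun i hi => if_pos (Finset.mem_Iio.1 hi))]
  simp

end

/-- The summand of the sign sum. -/
def asum {n : ℕ} (al be k : ℂ) (y : Fin n → ℂ) : ℂ :=
  (∏ i, aphi al be (y i)) * pairProd fun i j => apsi k (y i + y j)

theorem ares_fin {n : ℕ} (al be k : ℂ) (y : Fin n → ℂ) (j : Fin n) :
    ares al be k y Finset.univ j = Complex.sinh k * aphi al be (-y j) *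
      ∏ l ∈ Finset.univ.erase j, apsi k (y l - y j) := by
  unfold ares; congr!

theorem asum_mul_ares_update {n : ℕ} (al be k : ℂ) (y : Fin n → ℂ) (j : Fin n) :
    asum al be k (Function.update y j (-y j)) *
      ares al be k (Function.update y j (-y j)) Finset.univ j =
    asum al be k y * ares al be k y Finset.univ j := by
  set y' := Function.update y j (-y j) with hy'
  have e1 : y' j = -y j := by simp [hy']
  have e2 : ∀ l, l ≠ j → y' l = y l := fun l hl => by simp [hy', hl]
  have key : ∀ z : Fin n → ℂ, asum al be k z * ares al be k z Finset.univ j =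
      Complex.sinh k * (aphi al be (z j) * aphi al be (-z j)) *
        (∏ l ∈ Finset.univ.erase j, aphi al be (z l)) *
        ((∏ l ∈ Finset.univ.erase j, apsi k (z j + z l)) *
          ∏ l ∈ Finset.univ.erase j, apsi k (z l - z j)) *
        pairProd (fun i l => if i = j ∨ l = j then 1 else apsi k (z i + z l)) := by
    intro z
    rw [asum, ares_fin, pairProd_split j _ (fun i l => by rw [add_comm]),
      ← Finset.mul_prod_erase _ _ (Finset.mem_univ j)]
    ring
  rw [key, key, e1, neg_neg]
  have e3 : ∏ l ∈ Finset.univ.erase j, aphi al be (y' l) =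
      ∏ l ∈ Finset.univ.erase j, aphi al be (y l) :=
    Finset.prod_congr rfl fun l hl => by rw [e2 l (Finset.ne_of_mem_erase hl)]
  have e4 : ∏ l ∈ Finset.univ.erase j, apsi k (-y j + y' l) =
      ∏ l ∈ Finset.univ.erase j, apsi k (y l - y j) :=
    Finset.prod_congr rfl fun l hl => by
      rw [e2 l (Finset.ne_of_mem_erase hl)]; congr 1; ring
  have e5 : ∏ l ∈ Finset.univ.erase j, apsi k (y' l - -y j) =
      ∏ l ∈ Finset.univ.erase j, apsi k (y j + y l) :=
    Finset.prod_congr rfl fun l hl => by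
      rw [e2 l (Finset.ne_of_mem_erase hl)]; congr 1; ring
  have e6 : pairProd (fun i l => if i = j ∨ l = j then 1 else apsi k (y' i + y' l)) =
      pairProd (fun i l => if i = j ∨ l = j then 1 else apsi k (y i + y l)) :=
    pairProd_congr fun i l _ => by
      split_ifs with h
      · rfl
      · push Not at h
        rw [e2 i h.1, e2 l h.2]
  rw [e3, e4, e5, e6]
  ring

/-- Flip the sign at index `j`. -/
def flipAt {n : ℕ} (j : Fin n) : (Fin n → Bool) ≃ (Fin n → Bool) :=
  Function.Involutive.toPerm (fun s => Function.update s j (!s j)) fun s => by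
    funext i
    by_cases h : i = j
    · subst h; simp
    · simp [h]

theorem flipAt_apply {n : ℕ} (j : Fin n) (s : Fin n → Bool) :
    flipAt j s = Function.update s j (!s j) := rfl

theorem sgn_not (b : Bool) : sgn (!b) = -sgn b := by cases b <;> simp [sgn]

theorem sgn_cases (b : Bool) : sgn b = 1 ∨ sgn b = -1 := by cases b <;> simp [sgn]

theorem sinh_sign_sum (al be k : ℂ) : ∀ (n : ℕ) (x : Fin n → ℂ),
    (∀ i, Complex.sinh (2*x i) ≠ 0) → (∀ i j, i ≠ j → Complex.sinh (x i + x j) ≠ 0) →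
    (∀ i j, i ≠ j → Complex.sinh (x i - x j) ≠ 0) →
    ∑ s : Fin n → Bool, asum al be k (fun i => sgn (s i) * x i) =
      ∏ j ∈ Finset.range n, Complex.sinh (al + be + j*k) := by
  intro n
  induction n with
  | zero => intro x _ _ _; simp [asum, pairProd]
  | succ n ih =>
    intro x h1 h2 h3
    have hs2 : ∀ (i : Fin (n+1)) (b : Bool), Complex.sinh (2*(sgn b * x i)) ≠ 0 := by
      intro i b
      rcases sgn_cases b with h | h <;> rw [h]
      · simpa using h1 i
      · have := h1 i
        simpa using this
    have hadd : ∀ i j, i ≠ j → ∀ b c : Bool, Complex.sinh (sgn b * x i + sgn c * x j) ≠ 0 := by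
      intro i j hij b c
      have ha := h2 i j hij
      have hb := h3 i j hij
      rcases sgn_cases b with h | h <;> rcases sgn_cases c with h' | h' <;> rw [h, h'] <;> push_cast
      · simpa using ha
      · simpa [← sub_eq_add_neg] using hb
      · rw [show (-1:ℂ) * x i + 1 * x j = -(x i - x j) by ring, Complex.sinh_neg]
        exact neg_ne_zero.2 hb
      · rw [show (-1:ℂ) * x i + -1 * x j = -(x i + x j) by ring, Complex.sinh_neg]
        exact neg_ne_zero.2 ha
    have hsub : ∀ i j, i ≠ j → ∀ b c : Bool, Complex.sinh (sgn b * x i - sgn c * x j) ≠ 0 := by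
      intro i j hij b c
      have := hadd i j hij b (!c)
      rw [sgn_not] at this
      convert this using 2; push_cast; ring
    have hih := ih (fun i => x i.succ) (fun i => h1 _)
      (fun i j hij => h2 _ _ (by simpa using hij)) (fun i j hij => h3 _ _ (by simpa using hij))
    let y : (Fin n → Bool) → Fin n → ℂ := fun s i => sgn (s i) * x i.succ
    have hsplit : ∑ s : Fin (n+1) → Bool, asum al be k (fun i => sgn (s i) * x i) =
        ∑ s : Fin n → Bool, asum al be k (y s) *
          (aphi al be (x 0) * ∏ j, apsi k (x 0 + y s j) +
            aphi al be (-x 0) * ∏ j, apsi k (-x 0 + y s j)) := by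
      rw [← (Fin.consEquiv fun _ : Fin (n+1) => Bool).sum_comp, Fintype.sum_prod_type,
        Fintype.sum_bool, ← Finset.sum_add_distrib]
      refine Finset.sum_congr rfl fun s _ => ?_
      simp only [asum, Fin.consEquiv_apply, Fin.prod_univ_succ, pairProd_succ, Fin.cons_zero,
        Fin.cons_succ, y]
      simp only [sgn, if_true, Bool.false_eq_true, if_false, Complex.ofReal_one,
        Complex.ofReal_neg, one_mul, neg_mul]
      ring
    have hpf : ∀ s : Fin n → Bool, aphi al be (x 0) * ∏ j, apsi k (x 0 + y s j) +
            aphi al be (-x 0) * ∏ j, apsi k (-x 0 + y s j) = Complex.sinh (al+be+n*k) +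
          ∑ j, ares al be k (y s) Finset.univ j * (ccoth (x 0 + y s j) + ccoth (-x 0 + y s j)) := by
      intro s
      obtain ⟨p, q, -, hf⟩ := partial_fractions al be k (y s) Finset.univ (fun i _ => hs2 _ _)
        (fun i _ j _ hij => hsub _ _ (by simpa using hij) _ _)
      have g1 := hf (x 0) (h1 0) (fun j _ => by
        have := hadd 0 j.succ (Fin.succ_ne_zero j).symm true (s j)
        simpa [sgn, y] using this)
      have g2 := hf (-x 0) (by simpa using h1 0) (fun j _ => by
        have := hadd 0 j.succ (Fin.succ_ne_zero j).symm false (s j)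
        simpa [sgn, y] using this)
      rw [g1, g2, ccoth_neg, Complex.tanh_neg, Finset.card_univ, Fintype.card_fin]
      simp only [mul_add, Finset.sum_add_distrib]
      ring
    have hzero : ∀ j : Fin n, ∑ s : Fin n → Bool, asum al be k (y s) *
        (ares al be k (y s) Finset.univ j * (ccoth (x 0 + y s j) + ccoth (-x 0 + y s j))) = 0 := by
      intro j
      set T := ∑ s : Fin n → Bool, asum al be k (y s) *
        (ares al be k (y s) Finset.univ j * (ccoth (x 0 + y s j) + ccoth (-x 0 + y s j))) with hT
      have hneg : T = -T := by
        conv_lhs => rw [hT, ← (flipAt j).sum_comp]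
        rw [hT, ← Finset.sum_neg_distrib]
        refine Finset.sum_congr rfl fun s _ => ?_
        have hys : y (flipAt j s) = Function.update (y s) j (-y s j) := by
          funext i
          by_cases h : i = j
          · subst h; simp [y, flipAt_apply, sgn_not]
          · simp [y, flipAt_apply, h]
        rw [hys, ← mul_assoc, ← mul_assoc, asum_mul_ares_update]
        simp only [Function.update_self]
        rw [show x 0 + -y s j = -(-x 0 + y s j) by ring, show -x 0 + -y s j = -(x 0 + y s j) by ring,
          ccoth_neg, ccoth_neg]
        ring
      exact self_eq_neg.1 hneg
    rw [hsplit, Finset.prod_range_succ, ← hih, Finset.sum_mul]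
    have : ∀ s : Fin n → Bool, asum al be k (y s) *
          (aphi al be (x 0) * ∏ j, apsi k (x 0 + y s j) +
            aphi al be (-x 0) * ∏ j, apsi k (-x 0 + y s j)) =
          asum al be k (y s) * Complex.sinh (al+be+n*k) + ∑ j, asum al be k (y s) *
        (ares al be k (y s) Finset.univ j * (ccoth (x 0 + y s j) + ccoth (-x 0 + y s j))) := by
      intro s
      rw [hpf, mul_add, Finset.mul_sum]
    have hz : ∑ s : Fin n → Bool, ∑ j, asum al be k (y s) *
        (ares al be k (y s) Finset.univ j * (ccoth (x 0 + y s j) + ccoth (-x 0 + y s j))) = 0 := by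
      rw [Finset.sum_comm]
      exact Finset.sum_eq_zero fun j _ => hzero j
    rw [Finset.sum_congr rfl fun s _ => this s, Finset.sum_add_distrib, hz, add_zero]

section growth
variable {P : Type*} [TopologicalSpace P]

/-- Locally uniform exponential bound of order `lam`. -/
def LBd (F : P → ℝ → ℂ) (lam : P → ℝ) (p0 : P) : Prop :=
  ∃ C, 0 ≤ C ∧ ∀ᶠ p in 𝓝 p0, ∀ x : ℝ, ‖F p x‖ ≤ C * Real.exp (lam p * |x|)

variable {F F' : P → ℝ → ℂ} {lam lam' : P → ℝ} {p0 : P}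

theorem LBd.mul (h : LBd F lam p0) (h' : LBd F' lam' p0) :
    LBd (fun p x => F p x * F' p x) (fun p => lam p + lam' p) p0 := by
  obtain ⟨C, hC, h⟩ := h
  obtain ⟨C', hC', h'⟩ := h'
  refine ⟨C*C', mul_nonneg hC hC', ?_⟩
  filter_upwards [h, h'] with p h1 h2 x
  rw [norm_mul, add_mul, Real.exp_add]
  calc _ ≤ (C * Real.exp (lam p * |x|)) * (C' * Real.exp (lam' p * |x|)) :=
        mul_le_mul (h1 x) (h2 x) (norm_nonneg _) (by positivity)
    _ = _ := by ring

theorem LBd.congr (h : LBd F lam p0) (hF : ∀ p x, F' p x = F p x)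
    (hl : ∀ᶠ p in 𝓝 p0, lam' p = lam p) : LBd F' lam' p0 := by
  obtain ⟨C, hC, h⟩ := h
  refine ⟨C, hC, ?_⟩
  filter_upwards [h, hl] with p h1 h2 x
  rw [hF, h2]; exact h1 x

theorem LBd.const_mul (h : LBd F lam p0) (c : ℂ) : LBd (fun p x => c * F p x) lam p0 := by
  obtain ⟨C, hC, h⟩ := h
  refine ⟨‖c‖*C, by positivity, ?_⟩
  filter_upwards [h] with p h1 x
  rw [norm_mul, mul_assoc]
  exact mul_le_mul_of_nonneg_left (h1 x) (norm_nonneg _)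

theorem LBd.prod {ι : Type*} (s : Finset ι) {F : ι → P → ℝ → ℂ} {lam : ι → P → ℝ}
    (h : ∀ i ∈ s, LBd (F i) (lam i) p0) :
    LBd (fun p x => ∏ i ∈ s, F i p x) (fun p => ∑ i ∈ s, lam i p) p0 := by
  induction s using Finset.induction_on with
  | empty => exact ⟨1, zero_le_one, by simp⟩
  | insert m s hm ih =>
    simp only [Finset.prod_insert hm, Finset.sum_insert hm]
    exact (h m (Finset.mem_insert_self _ _)).mul
      (ih fun i hi => h i (Finset.mem_insert_of_mem hi))

theorem LBd.decay (h : LBd F lam p0) (hl : ContinuousAt lam p0) (hl0 : lam p0 < 0) :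
    ∃ C η, 0 ≤ C ∧ 0 < η ∧ ∀ᶠ p in 𝓝 p0, ∀ x : ℝ, ‖F p x‖ ≤ C * Real.exp (-(η * |x|)) := by
  obtain ⟨C, hC, h⟩ := h
  refine ⟨C, -(lam p0/2), hC, by linarith, ?_⟩
  filter_upwards [h, hl.eventually_lt (continuousAt_const (y := lam p0/2)) (by linarith)] with p h1 h2 x
  refine (h1 x).trans (mul_le_mul_of_nonneg_left (Real.exp_le_exp.2 ?_) hC)
  nlinarith [abs_nonneg x]

theorem LBd.bounded (h : LBd F lam p0) (hl : ContinuousAt lam p0) (hl0 : lam p0 < 0) :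
    ∃ C, 1 ≤ C ∧ ∀ᶠ p in 𝓝 p0, ∀ x : ℝ, ‖F p x‖ ≤ C := by
  obtain ⟨C, η, hC, hη, h⟩ := h.decay hl hl0
  refine ⟨C+1, by linarith, ?_⟩
  filter_upwards [h] with p h1 x
  have : Real.exp (-(η*|x|)) ≤ 1 := Real.exp_le_one_iff.2 (by
    have := mul_nonneg hη.le (abs_nonneg x); linarith)
  nlinarith [h1 x, Real.exp_pos (-(η*|x|))]

theorem LBd_sinh {κ t : P → ℂ} (hκ : ContinuousAt κ p0) (ht : ContinuousAt t p0)
    (h0 : 0 < (κ p0).re) :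
    LBd (fun p x => 2 * Complex.sinh (κ p * (x + t p))) (fun p => (κ p).re) p0 := by
  refine ⟨2 * Real.exp (|(κ p0 * t p0).re| + 1), by positivity, ?_⟩
  have h1 : ContinuousAt (fun p => |(κ p * t p).re|) p0 :=
    (Complex.continuous_re.continuousAt.comp (hκ.mul ht)).abs
  have h2 : ContinuousAt (fun p => (κ p).re) p0 := Complex.continuous_re.continuousAt.comp hκ
  filter_upwards [h1.eventually_lt (continuousAt_const (y := |(κ p0 * t p0).re| + 1)) (by linarith),
    h2.eventually (lt_mem_nhds h0)] with p hp1 hp2 x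
  refine (norm_two_sinh_le _).trans ?_
  rw [mul_assoc, ← Real.exp_add]
  refine mul_le_mul_of_nonneg_left (Real.exp_le_exp.2 ?_) zero_le_two
  rw [mul_add, Complex.add_re, Complex.re_mul_ofReal]
  refine (abs_add_le _ _).trans ?_
  rw [abs_mul, abs_of_pos hp2]
  linarith

theorem LBd_pair (h : HypFE) {a d d' : P → ℂ} {b : ℂ} (hb : 0 < b.re) (ha : ContinuousAt a p0)
    (hd : ContinuousAt d p0) (hd' : ContinuousAt d' p0) (ha0 : 0 < (a p0).re)
    (hd0 : (d p0).im < ((a p0).re + b.re)/2) (hd0' : (d' p0).im < ((a p0).re + b.re)/2) :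
    LBd (fun p x => eX (a p) b (x + d p) * eX (a p) b (-x + d' p))
      (fun p => (Complex.I*Real.pi*(d p + d' p)/(a p*b)).re) p0 := by
  obtain ⟨C, hC, hb⟩ := eX_pair_bound h ha0 hb hd0 hd0'
  refine ⟨C, hC, ?_⟩
  have := (ha.prodMk (hd.prodMk hd')).eventually hb
  filter_upwards [this] with p hp x
  exact hp.2 x

end growth

theorem integrable_exp_neg_abs {η : ℝ} (hη : 0 < η) : Integrable fun x : ℝ => Real.exp (-(η*|x|)) := by
  have h1 : IntegrableOn (fun x : ℝ => Real.exp (-(η*|x|))) (Ioi 0) := by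
    refine (exp_neg_integrableOn_Ioi 0 hη).congr_fun ?_ measurableSet_Ioi
    intro x hx
    simp only [abs_of_pos (mem_Ioi.1 hx), neg_mul]
  have h2 : IntegrableOn (fun x : ℝ => Real.exp (-(η*|x|))) (Iic 0) := by
    have := (integrableOn_Iic_iff_integrableOn_Iio (μ := volume) (f := fun x : ℝ => Real.exp (-(η*|x|))) (b := 0))
    rw [this]
    have := h1.comp_neg
    simpa using this
  have := h2.union h1
  rwa [Iic_union_Ioi, integrableOn_univ] at this

section multi
variable {n : ℕ}

/-- Product integrand with one-body factor `A` and two-body factors `B`, `D`. -/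
def IntG (n : ℕ) (A B D : ℝ → ℂ) (v : Fin n → ℝ) : ℂ :=
  (∏ j, A (v j)) * pairProd fun i j => B (v i + v j) * D (v i - v j)

theorem norm_pairProd_le {f : Fin n → Fin n → ℂ} {K : ℝ} (h : ∀ i j, ‖f i j‖ ≤ K) :
    ‖pairProd f‖ ≤ ∏ i : Fin n, ∏ _j ∈ Finset.Ioi i, K := by
  unfold pairProd
  rw [norm_prod]
  refine Finset.prod_le_prod (fun i _ => norm_nonneg _) fun i _ => ?_
  rw [norm_prod]
  exact Finset.prod_le_prod (fun i _ => norm_nonneg _) fun j _ => h i j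

theorem norm_IntG_le {A B D : ℝ → ℂ} {C K η : ℝ}
    (hA : ∀ x, ‖A x‖ ≤ C * Real.exp (-(η * |x|))) (hB : ∀ x, ‖B x‖ ≤ K) (hD : ∀ x, ‖D x‖ ≤ K)
    (v : Fin n → ℝ) :
    ‖IntG n A B D v‖ ≤ (∏ j, C * Real.exp (-(η*|v j|))) *
      ∏ i : Fin n, ∏ _j ∈ Finset.Ioi i, K*K := by
  unfold IntG
  rw [norm_mul]
  refine mul_le_mul ?_ (norm_pairProd_le fun i j => ?_) (norm_nonneg _)
    (Finset.prod_nonneg fun j _ => (norm_nonneg _).trans (hA (v j)))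
  · rw [norm_prod]
    exact Finset.prod_le_prod (fun i _ => norm_nonneg _) fun j _ => hA (v j)
  · rw [norm_mul]
    exact mul_le_mul (hB _) (hD _) (norm_nonneg _) ((norm_nonneg _).trans (hB 0))

theorem integrable_IntG_bound {η : ℝ} (hη : 0 < η) (C L : ℝ) :
    Integrable fun v : Fin n → ℝ => (∏ j, C * Real.exp (-(η*|v j|))) * L :=
  (Integrable.fintype_prod (f := fun (_ : Fin n) (x : ℝ) => C * Real.exp (-(η*|x|)))
    fun _ => (integrable_exp_neg_abs hη).const_mul C).mul_const L

theorem continuous_pairProd {X : Type*} [TopologicalSpace X] {f : X → Fin n → Fin n → ℂ}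
    (h : ∀ i j, Continuous fun x => f x i j) : Continuous fun x => pairProd (f x) := by
  unfold pairProd
  exact continuous_finsetProd _ fun i _ => continuous_finsetProd _ fun j _ => h i j

theorem continuous_IntG {A B D : ℝ → ℂ} (hA : Continuous A) (hB : Continuous B)
    (hD : Continuous D) : Continuous (IntG n A B D) := by
  unfold IntG
  refine (continuous_finsetProd _ fun j _ => hA.comp (continuous_apply j)).mul
    (continuous_pairProd fun i j => ?_)
  exact (hB.comp ((continuous_apply i).add (continuous_apply j))).mul
    (hD.comp ((continuous_apply i).sub (continuous_apply j)))

theorem IntG_dominated {P : Type*} [TopologicalSpace P] {A B D : P → ℝ → ℂ}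
    {lA lB lD : P → ℝ} {p0 : P} (hA : LBd A lA p0) (hB : LBd B lB p0) (hD : LBd D lD p0)
    (cA : ContinuousAt lA p0) (cB : ContinuousAt lB p0) (cD : ContinuousAt lD p0)
    (nA : lA p0 < 0) (nB : lB p0 < 0) (nD : lD p0 < 0) :
    ∃ bound : (Fin n → ℝ) → ℝ, Integrable bound ∧
      ∀ᶠ p in 𝓝 p0, ∀ v, ‖IntG n (A p) (B p) (D p) v‖ ≤ bound v := by
  obtain ⟨C, η, hC, hη, h1⟩ := hA.decay cA nA
  obtain ⟨K, hK, h2⟩ := hB.bounded cB nB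
  obtain ⟨K', hK', h3⟩ := hD.bounded cD nD
  refine ⟨_, integrable_IntG_bound hη C (∏ i : Fin n, ∏ _j ∈ Finset.Ioi i, (max K K')*(max K K')), ?_⟩
  filter_upwards [h1, h2, h3] with p p1 p2 p3 v
  exact norm_IntG_le p1 (fun x => (p2 x).trans (le_max_left _ _))
    (fun x => (p3 x).trans (le_max_right _ _)) v

theorem IntG_continuousAt {P : Type*} [TopologicalSpace P] [FirstCountableTopology P]
    {A B D : P → ℝ → ℂ} {lA lB lD : P → ℝ} {p0 : P}
    (hA : LBd A lA p0) (hB : LBd B lB p0) (hD : LBd D lD p0)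
    (cA : ContinuousAt lA p0) (cB : ContinuousAt lB p0) (cD : ContinuousAt lD p0)
    (nA : lA p0 < 0) (nB : lB p0 < 0) (nD : lD p0 < 0)
    (mA : ∀ᶠ p in 𝓝 p0, Continuous (A p)) (mB : ∀ᶠ p in 𝓝 p0, Continuous (B p))
    (mD : ∀ᶠ p in 𝓝 p0, Continuous (D p))
    (pA : ∀ x, ContinuousAt (fun p => A p x) p0) (pB : ∀ x, ContinuousAt (fun p => B p x) p0)
    (pD : ∀ x, ContinuousAt (fun p => D p x) p0) :
    ContinuousAt (fun p => ∫ v, IntG n (A p) (B p) (D p) v) p0 := by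
  obtain ⟨bound, hb, h⟩ := IntG_dominated (n := n) hA hB hD cA cB cD nA nB nD
  refine continuousAt_of_dominated ?_ ?_ hb ?_
  · filter_upwards [mA, mB, mD] with p h1 h2 h3
    exact (continuous_IntG h1 h2 h3).aestronglyMeasurable
  · filter_upwards [h] with p hp
    exact Eventually.of_forall hp
  · refine Eventually.of_forall fun v => ?_
    unfold IntG pairProd
    refine ContinuousAt.mul (tendsto_finsetProd _ fun j _ => pA (v j)) ?_
    exact tendsto_finsetProd _ fun i _ => tendsto_finsetProd _ fun j _ => (pB _).mul (pD _)

theorem IntG_integrable {A B D : ℝ → ℂ} {lA lB lD : ℝ}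
    (hA : LBd (fun _ : Unit => A) (fun _ => lA) ()) (hB : LBd (fun _ : Unit => B) (fun _ => lB) ())
    (hD : LBd (fun _ : Unit => D) (fun _ => lD) ())
    (nA : lA < 0) (nB : lB < 0) (nD : lD < 0)
    (mA : Continuous A) (mB : Continuous B) (mD : Continuous D) :
    Integrable (IntG n A B D) := by
  obtain ⟨bound, hb, h⟩ := IntG_dominated (n := n) hA hB hD continuousAt_const continuousAt_const
    continuousAt_const nA nB nD
  exact hb.mono' (continuous_IntG mA mB mD).aestronglyMeasurable
    (Eventually.of_forall (h.self_of_nhds))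

theorem IntG_differentiableOn {A B D : ℂ → ℝ → ℂ} {lA lB lD : ℂ → ℝ} {U : Set ℂ}
    (hU : IsOpen U)
    (hA : ∀ p ∈ U, LBd A lA p) (hB : ∀ p ∈ U, LBd B lB p) (hD : ∀ p ∈ U, LBd D lD p)
    (cA : ∀ p ∈ U, ContinuousAt lA p) (cB : ∀ p ∈ U, ContinuousAt lB p)
    (cD : ∀ p ∈ U, ContinuousAt lD p)
    (nA : ∀ p ∈ U, lA p < 0) (nB : ∀ p ∈ U, lB p < 0) (nD : ∀ p ∈ U, lD p < 0)
    (mA : ∀ p ∈ U, Continuous (A p)) (mB : ∀ p ∈ U, Continuous (B p))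
    (mD : ∀ p ∈ U, Continuous (D p))
    (dA : ∀ x, DifferentiableOn ℂ (fun p => A p x) U)
    (dB : ∀ x, DifferentiableOn ℂ (fun p => B p x) U)
    (dD : ∀ x, DifferentiableOn ℂ (fun p => D p x) U) :
    DifferentiableOn ℂ (fun p => ∫ v, IntG n (A p) (B p) (D p) v) U := by
  refine differentiableOn_integral_of_holo hU
    (fun p hp => (continuous_IntG (mA p hp) (mB p hp) (mD p hp)).aestronglyMeasurable) ?_ ?_
  · refine Eventually.of_forall fun v => ?_
    unfold IntG pairProd
    refine DifferentiableOn.mul (DifferentiableOn.fun_finsetProd fun j _ => dA (v j)) ?_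
    exact DifferentiableOn.fun_finsetProd fun i _ => DifferentiableOn.fun_finsetProd fun j _ =>
      (dB _).mul (dD _)
  · intro p hp
    exact IntG_dominated (hA p hp) (hB p hp) (hD p hp) (cA p hp) (cB p hp) (cD p hp)
      (nA p hp) (nB p hp) (nD p hp)

end multi

section
/-- One-body weight of the hyperbolic Koornwinder integral. -/
def wt (a b : ℂ) (g : Fin 4 → ℂ) (v : ℂ) : ℂ :=
  4 * Complex.sinh (2*Real.pi*v/a) * Complex.sinh (2*Real.pi*v/b) *
    ∏ r, (eX a b (v + Complex.I*((a+b)/2 + g r)) * eX a b (-v + Complex.I*((a+b)/2 + g r)))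

/-- Two-body weight of the hyperbolic Koornwinder integral. -/
def vt (a b k z : ℂ) : ℂ :=
  4 * Complex.sinh (Real.pi*z/a) * Complex.sinh (Real.pi*z/b) *
    (eX a b (z + Complex.I*((a+b)/2 + k)) * eX a b (-z + Complex.I*((a+b)/2 + k)))

/-- The hyperbolic Koornwinder integral. -/
def IBC (n : ℕ) (a b : ℂ) (g : Fin 4 → ℂ) (k : ℂ) : ℂ :=
  ∫ v : Fin n → ℝ, IntG n (fun x => wt a b g x) (fun x => vt a b k x) (fun x => vt a b k x) v

/-- Admissible parameters. -/
structure Adm (a b : ℂ) (g : Fin 4 → ℂ) (k : ℂ) : Prop where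
  ha : 0 < a.re
  hb : 0 < b.re
  hg : ∀ r, (g r).re < 0
  hc : 0 < ((a+b+∑ r, g r)/(a*b)).re
  hk : k.re < 0
  hkab : 0 < (k/(a*b)).re

theorem im_I_mul_tau (a b g : ℂ) : (Complex.I*((a+b)/2+g)).im = (a.re+b.re)/2 + g.re := by
  simp

theorem im_add_tau {a b g : ℂ} (x : ℝ) : ((x:ℂ) + Complex.I*((a+b)/2+g)).im = (a.re+b.re)/2 + g.re := by
  simp

theorem im_neg_add_tau {a b g : ℂ} (x : ℝ) : (-(x:ℂ) + Complex.I*((a+b)/2+g)).im = (a.re+b.re)/2 + g.re := by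
  simp

theorem wt_neg (a b : ℂ) (g : Fin 4 → ℂ) (v : ℂ) : wt a b g (-v) = wt a b g v := by
  unfold wt
  rw [mul_neg, neg_div, neg_div, Complex.sinh_neg, Complex.sinh_neg, neg_neg]
  simp only [mul_comm (eX a b (-v + _))]
  ring

theorem vt_neg (a b k z : ℂ) : vt a b k (-z) = vt a b k z := by
  unfold vt
  rw [mul_neg, neg_div, neg_div, Complex.sinh_neg, Complex.sinh_neg, neg_neg]
  ring

section bounds
variable {P : Type*} [TopologicalSpace P] {p0 : P} {a k : P → ℂ} {b : ℂ} {g : P → Fin 4 → ℂ}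

theorem LBd_wt (h : HypFE) (ca : ContinuousAt a p0) (hb : 0 < b.re) (ha0 : 0 < (a p0).re)
    (cg : ContinuousAt g p0) (hg : ∀ r, (g p0 r).re < 0) :
    LBd (fun p x => wt (a p) b (g p) x)
      (fun p => -(2*Real.pi*(a p + b + ∑ r, g p r)/(a p*b)).re) p0 := by
  have hbne := re_ne hb
  have hane := re_ne ha0
  have cgr : ∀ r, ContinuousAt (fun p => g p r) p0 := fun r => (continuousAt_pi.1 cg) r
  have cd : ∀ r, ContinuousAt (fun p => Complex.I*((a p+b)/2 + g p r)) p0 := fun r =>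
    continuousAt_const.mul (((ca.add continuousAt_const).div_const 2).add (cgr r))
  have hr : ∀ r, LBd (fun p x => eX (a p) b (x + Complex.I*((a p+b)/2 + g p r)) *
      eX (a p) b (-x + Complex.I*((a p+b)/2 + g p r))) _ p0 := fun r =>
    LBd_pair h hb ca (cd r) (cd r) ha0 (by rw [im_I_mul_tau]; linarith [hg r])
      (by rw [im_I_mul_tau]; linarith [hg r])
  have s1 := LBd_sinh (κ := fun p => 2*Real.pi/a p) (t := fun _ => 0)
    (continuousAt_const.div ca hane) (p0 := p0) continuousAt_const (by
      rw [div_eq_mul_inv, show (2*Real.pi:ℂ) = ((2*Real.pi:ℝ):ℂ) by push_cast; ring, Complex.re_ofReal_mul]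
      exact mul_pos (by positivity) (inv_re_pos ha0))
  have s2 := LBd_sinh (κ := fun _ : P => 2*Real.pi/b) (t := fun _ => 0)
    continuousAt_const (p0 := p0) continuousAt_const (by
      rw [div_eq_mul_inv, show (2*Real.pi:ℂ) = ((2*Real.pi:ℝ):ℂ) by push_cast; ring, Complex.re_ofReal_mul]
      exact mul_pos (by positivity) (inv_re_pos hb))
  refine ((s1.mul s2).mul (LBd.prod Finset.univ fun r _ => hr r)).congr ?_ ?_
  · intro p x
    unfold wt
    rw [add_zero, mul_div_right_comm, mul_div_right_comm _ _ b]
    ring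
  · filter_upwards [ca.eventually_ne hane] with p hp
    rw [← Complex.re_sum, ← Complex.add_re, ← Complex.add_re, ← Complex.neg_re]
    congr 1
    simp only [Fin.sum_univ_four]
    field_simp
    linear_combination (-2*(4*a p + 4*b + 2*(g p 0 + g p 1 + g p 2 + g p 3))) * Complex.I_sq

theorem LBd_vt (h : HypFE) (ca : ContinuousAt a p0) (hb : 0 < b.re) (ha0 : 0 < (a p0).re)
    (ck : ContinuousAt k p0) (hk : (k p0).re < 0) :
    LBd (fun p x => vt (a p) b (k p) x)
      (fun p => -(2*Real.pi*k p/(a p*b)).re) p0 := by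
  have hbne := re_ne hb
  have hane := re_ne ha0
  have cd : ContinuousAt (fun p => Complex.I*((a p+b)/2 + k p)) p0 :=
    continuousAt_const.mul (((ca.add continuousAt_const).div_const 2).add ck)
  have hr : LBd (fun p x => eX (a p) b (x + Complex.I*((a p+b)/2 + k p)) *
      eX (a p) b (-x + Complex.I*((a p+b)/2 + k p))) _ p0 :=
    LBd_pair h hb ca cd cd ha0 (by rw [im_I_mul_tau]; linarith) (by rw [im_I_mul_tau]; linarith)
  have s1 := LBd_sinh (κ := fun p => Real.pi/a p) (t := fun _ => 0)
    (continuousAt_const.div ca hane) (p0 := p0) continuousAt_const (by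
      rw [div_eq_mul_inv, Complex.re_ofReal_mul]
      exact mul_pos (by positivity) (inv_re_pos ha0))
  have s2 := LBd_sinh (κ := fun _ : P => Real.pi/b) (t := fun _ => 0)
    continuousAt_const (p0 := p0) continuousAt_const (by
      rw [div_eq_mul_inv, Complex.re_ofReal_mul]
      exact mul_pos (by positivity) (inv_re_pos hb))
  refine ((s1.mul s2).mul hr).congr ?_ ?_
  · intro p x
    unfold vt
    rw [add_zero, mul_div_right_comm, mul_div_right_comm _ _ b]
    ring
  · filter_upwards [ca.eventually_ne hane] with p hp
    rw [← Complex.add_re, ← Complex.add_re, ← Complex.neg_re]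
    congr 1
    field_simp
    linear_combination (-2*(a p + b + 2*k p)) * Complex.I_sq

theorem continuousAt_wt (h : HypFE) (ca : ContinuousAt a p0) (hb : 0 < b.re) (ha0 : 0 < (a p0).re)
    (cg : ContinuousAt g p0) (hg : ∀ r, (g p0 r).re < 0) (x : ℝ) :
    ContinuousAt (fun p => wt (a p) b (g p) x) p0 := by
  have hane := re_ne ha0
  unfold wt
  have cgr : ∀ r, ContinuousAt (fun p => g p r) p0 := fun r => (continuousAt_pi.1 cg) r
  refine ContinuousAt.mul (ContinuousAt.mul (continuousAt_const.mul
    (Complex.continuous_sinh.continuousAt.comp (continuousAt_const.div ca hane))) continuousAt_const) ?_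
  refine tendsto_finsetProd _ fun r _ => ?_
  have cd : ContinuousAt (fun p => Complex.I*((a p+b)/2 + g p r)) p0 :=
    continuousAt_const.mul (((ca.add continuousAt_const).div_const 2).add (cgr r))
  refine ContinuousAt.mul (f := fun p => eX (a p) b (x + Complex.I*((a p+b)/2 + g p r))) ?_ ?_
  · exact ContinuousAt.comp (f := fun p => (a p, (x:ℂ) + Complex.I*((a p+b)/2 + g p r)))
      (g := fun q : ℂ × ℂ => eX q.1 b q.2) (continuousAt_eX h ha0 hb (by
      rw [im_add_tau]; linarith [hg r])) (ca.prodMk (continuousAt_const.add cd))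
  · exact ContinuousAt.comp (f := fun p => (a p, -(x:ℂ) + Complex.I*((a p+b)/2 + g p r)))
      (g := fun q : ℂ × ℂ => eX q.1 b q.2) (continuousAt_eX h ha0 hb (by
      rw [im_neg_add_tau]; linarith [hg r])) (ca.prodMk (continuousAt_const.add cd))

theorem continuousAt_vt (h : HypFE) (ca : ContinuousAt a p0) (hb : 0 < b.re) (ha0 : 0 < (a p0).re)
    (ck : ContinuousAt k p0) (hk : (k p0).re < 0) (x : ℝ) :
    ContinuousAt (fun p => vt (a p) b (k p) x) p0 := by
  have hane := re_ne ha0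
  unfold vt
  refine ContinuousAt.mul (ContinuousAt.mul (continuousAt_const.mul
    (Complex.continuous_sinh.continuousAt.comp (continuousAt_const.div ca hane))) continuousAt_const) ?_
  have cd : ContinuousAt (fun p => Complex.I*((a p+b)/2 + k p)) p0 :=
    continuousAt_const.mul (((ca.add continuousAt_const).div_const 2).add ck)
  refine ContinuousAt.mul (f := fun p => eX (a p) b (x + Complex.I*((a p+b)/2 + k p))) ?_ ?_
  · exact ContinuousAt.comp (f := fun p => (a p, (x:ℂ) + Complex.I*((a p+b)/2 + k p)))
      (g := fun q : ℂ × ℂ => eX q.1 b q.2) (continuousAt_eX h ha0 hb (by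
      rw [im_add_tau]; linarith)) (ca.prodMk (continuousAt_const.add cd))
  · exact ContinuousAt.comp (f := fun p => (a p, -(x:ℂ) + Complex.I*((a p+b)/2 + k p)))
      (g := fun q : ℂ × ℂ => eX q.1 b q.2) (continuousAt_eX h ha0 hb (by
      rw [im_neg_add_tau]; linarith)) (ca.prodMk (continuousAt_const.add cd))

end bounds

section smooth
variable {a b : ℂ}

theorem differentiableAt_wt (h : HypFE) (ha : 0 < a.re) (hb : 0 < b.re) {g : ℂ → Fin 4 → ℂ}
    {u : ℂ → ℂ} {p : ℂ} (hg : ∀ r, DifferentiableAt ℂ (fun p => g p r) p)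
    (hu : DifferentiableAt ℂ u p) (hg0 : ∀ r, (g p r).re < -|(u p).im|) :
    DifferentiableAt ℂ (fun p => wt a b (g p) (u p)) p := by
  have := re_ne ha
  have := re_ne hb
  unfold wt
  refine DifferentiableAt.mul (by fun_prop) (DifferentiableAt.fun_finsetProd fun r _ => ?_)
  have h1 := hg0 r
  have h2 := abs_lt.1 (show |(u p).im| < -(g p r).re by linarith)
  refine DifferentiableAt.mul ?_ ?_
  · exact DifferentiableAt.comp (f := fun p => u p + Complex.I*((a+b)/2 + g p r)) p
      (differentiableAt_eX h ha hb (by rw [Complex.add_im, im_I_mul_tau]; linarith))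
      (hu.add (((hg r).const_add _).const_mul _))
  · exact DifferentiableAt.comp (f := fun p => -u p + Complex.I*((a+b)/2 + g p r)) p
      (differentiableAt_eX h ha hb (by rw [Complex.add_im, im_I_mul_tau, Complex.neg_im]; linarith))
      (hu.neg.add (((hg r).const_add _).const_mul _))

theorem differentiableAt_vt (h : HypFE) (ha : 0 < a.re) (hb : 0 < b.re) {k : ℂ → ℂ}
    {u : ℂ → ℂ} {p : ℂ} (hk : DifferentiableAt ℂ k p)
    (hu : DifferentiableAt ℂ u p) (hk0 : (k p).re < -|(u p).im|) :
    DifferentiableAt ℂ (fun p => vt a b (k p) (u p)) p := by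
  have := re_ne ha
  have := re_ne hb
  unfold vt
  have h2 := abs_lt.1 (show |(u p).im| < -(k p).re by linarith)
  refine DifferentiableAt.mul (by fun_prop) (DifferentiableAt.mul ?_ ?_)
  · exact DifferentiableAt.comp (f := fun p => u p + Complex.I*((a+b)/2 + k p)) p
      (differentiableAt_eX h ha hb (by rw [Complex.add_im, im_I_mul_tau]; linarith))
      (hu.add ((hk.const_add _).const_mul _))
  · exact DifferentiableAt.comp (f := fun p => -u p + Complex.I*((a+b)/2 + k p)) p
      (differentiableAt_eX h ha hb (by rw [Complex.add_im, im_I_mul_tau, Complex.neg_im]; linarith))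
      (hu.neg.add ((hk.const_add _).const_mul _))

theorem continuous_wt (h : HypFE) (ha : 0 < a.re) (hb : 0 < b.re) {g : Fin 4 → ℂ}
    (hg : ∀ r, (g r).re < 0) : Continuous fun x : ℝ => wt a b g x := by
  refine continuous_iff_continuousAt.2 fun x => ?_
  exact ContinuousAt.comp (g := fun z => wt a b g z) (f := fun x : ℝ => (x:ℂ))
    (differentiableAt_wt h ha hb (g := fun _ => g) (u := fun z => z)
      (fun r => differentiableAt_const _) differentiableAt_id (by simpa using hg)).continuousAt
    Complex.continuous_ofReal.continuousAt

theorem continuous_vt (h : HypFE) (ha : 0 < a.re) (hb : 0 < b.re) {k : ℂ}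
    (hk : k.re < 0) : Continuous fun x : ℝ => vt a b k x := by
  refine continuous_iff_continuousAt.2 fun x => ?_
  exact ContinuousAt.comp (g := fun z => vt a b k z) (f := fun x : ℝ => (x:ℂ))
    (differentiableAt_vt h ha hb (k := fun _ => k) (u := fun z => z)
      (differentiableAt_const _) differentiableAt_id (by simpa using hk)).continuousAt
    Complex.continuous_ofReal.continuousAt

end smooth

theorem two_pi_mul_re {w s : ℂ} (h : 0 < (w/s).re) : -(2*Real.pi*w/s).re < 0 := by
  rw [mul_div_assoc, show (2*Real.pi:ℂ) = ((2*Real.pi:ℝ):ℂ) by push_cast; ring, Complex.re_ofReal_mul]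
  exact neg_neg_of_pos (mul_pos (by positivity) h)

variable {n : ℕ}

theorem integrable_IBC (h : HypFE) {a b k : ℂ} {g : Fin 4 → ℂ} (H : Adm a b g k) :
    Integrable (IntG n (fun x => wt a b g x) (fun x => vt a b k x) (fun x => vt a b k x)) :=
  IntG_integrable (LBd_wt h (a := fun _ : Unit => a) (g := fun _ => g) continuousAt_const H.hb H.ha
      continuousAt_const H.hg)
    (LBd_vt h (a := fun _ : Unit => a) (k := fun _ => k) continuousAt_const H.hb H.ha
      continuousAt_const H.hk)
    (LBd_vt h (a := fun _ : Unit => a) (k := fun _ => k) continuousAt_const H.hb H.ha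
      continuousAt_const H.hk) (two_pi_mul_re H.hc) (two_pi_mul_re H.hkab) (two_pi_mul_re H.hkab)
    (continuous_wt h H.ha H.hb H.hg) (continuous_vt h H.ha H.hb H.hk) (continuous_vt h H.ha H.hb H.hk)

theorem continuousAt_IBC (h : HypFE) {P : Type*} [TopologicalSpace P] [FirstCountableTopology P]
    {p0 : P} {a k : P → ℂ} {b : ℂ} {g : P → Fin 4 → ℂ} (H : Adm (a p0) b (g p0) (k p0))
    (ca : ContinuousAt a p0) (cg : ContinuousAt g p0) (ck : ContinuousAt k p0) :
    ContinuousAt (fun p => IBC n (a p) b (g p) (k p)) p0 := by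
  have hb := H.hb
  have hab : a p0 * b ≠ 0 := mul_ne_zero (re_ne H.ha) (re_ne hb)
  have cgr : ∀ r, ContinuousAt (fun p => g p r) p0 := fun r => (continuousAt_pi.1 cg) r
  have cab : ContinuousAt (fun p => a p * b) p0 := ca.mul continuousAt_const
  have c1 : ContinuousAt (fun p => -(2*Real.pi*(a p + b + ∑ r, g p r)/(a p*b)).re) p0 :=
    (Complex.continuous_re.continuousAt.comp (f := fun p => 2*Real.pi*(a p + b + ∑ r, g p r)/(a p*b))
      ((continuousAt_const.mul ((ca.add continuousAt_const).add
      (tendsto_finsetSum _ fun r _ => cgr r))).div cab hab)).neg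
  have c2 : ContinuousAt (fun p => -(2*Real.pi*k p/(a p*b)).re) p0 :=
    (Complex.continuous_re.continuousAt.comp (f := fun p => 2*Real.pi*k p/(a p*b))
      ((continuousAt_const.mul ck).div cab hab)).neg
  have ea : ∀ᶠ p in 𝓝 p0, 0 < (a p).re :=
    (Complex.continuous_re.continuousAt.comp ca).eventually (lt_mem_nhds H.ha)
  have eg : ∀ᶠ p in 𝓝 p0, ∀ r, (g p r).re < 0 := eventually_all.2 fun r =>
    (Complex.continuous_re.continuousAt.comp (cgr r)).eventually (gt_mem_nhds (H.hg r))
  have ek : ∀ᶠ p in 𝓝 p0, (k p).re < 0 :=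
    (Complex.continuous_re.continuousAt.comp ck).eventually (gt_mem_nhds H.hk)
  have mV : ∀ᶠ p in 𝓝 p0, Continuous fun x : ℝ => vt (a p) b (k p) x := by
    filter_upwards [ea, ek] with p h1 h2
    exact continuous_vt h h1 hb h2
  have bV := LBd_vt h ca hb H.ha ck H.hk
  have pV := continuousAt_vt h ca hb H.ha ck H.hk
  refine IntG_continuousAt (LBd_wt h ca hb H.ha cg H.hg) bV bV c1 c2 c2
    (two_pi_mul_re H.hc) (two_pi_mul_re H.hkab) (two_pi_mul_re H.hkab) ?_ mV mV
    (continuousAt_wt h ca hb H.ha cg H.hg) pV pV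
  filter_upwards [ea, eg] with p h1 h2
  exact continuous_wt h h1 hb h2

theorem differentiableOn_IBC (h : HypFE) {a b : ℂ} {g : ℂ → Fin 4 → ℂ} {k : ℂ → ℂ} {U : Set ℂ}
    (hU : IsOpen U) (H : ∀ p ∈ U, Adm a b (g p) (k p))
    (dg : ∀ r, DifferentiableOn ℂ (fun p => g p r) U) (dk : DifferentiableOn ℂ k U) :
    DifferentiableOn ℂ (fun p => IBC n a b (g p) (k p)) U := by
  have cg : ∀ p ∈ U, ∀ r, ContinuousAt (fun p => g p r) p := fun p hp r =>
    (dg r).continuousOn.continuousAt (hU.mem_nhds hp)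
  have cg' : ∀ p ∈ U, ContinuousAt g p := fun p hp => continuousAt_pi.2 (cg p hp)
  have ck : ∀ p ∈ U, ContinuousAt k p := fun p hp => dk.continuousOn.continuousAt (hU.mem_nhds hp)
  have c1 : ∀ p ∈ U, ContinuousAt (fun p => -(2*Real.pi*(a + b + ∑ r, g p r)/(a*b)).re) p :=
    fun p hp => (Complex.continuous_re.continuousAt.comp
      (f := fun p => 2*Real.pi*(a + b + ∑ r, g p r)/(a*b))
      ((continuousAt_const.mul (continuousAt_const.add
      (tendsto_finsetSum _ fun r _ => cg p hp r))).div_const _)).neg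
  have c2 : ∀ p ∈ U, ContinuousAt (fun p => -(2*Real.pi*k p/(a*b)).re) p := fun p hp =>
    (Complex.continuous_re.continuousAt.comp (f := fun p => 2*Real.pi*k p/(a*b))
      ((continuousAt_const.mul (ck p hp)).div_const _)).neg
  have bV : ∀ p ∈ U, LBd (fun p x => vt a b (k p) x) _ p := fun p hp =>
    LBd_vt h (a := fun _ => a) continuousAt_const (H p hp).hb (H p hp).ha (ck p hp) (H p hp).hk
  have mV : ∀ p ∈ U, Continuous fun x : ℝ => vt a b (k p) x := fun p hp =>
    continuous_vt h (H p hp).ha (H p hp).hb (H p hp).hk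
  have dV : ∀ x : ℝ, DifferentiableOn ℂ (fun p => vt a b (k p) x) U := fun x p hp =>
    (differentiableAt_vt h (H p hp).ha (H p hp).hb (u := fun _ => (x:ℂ))
      (dk.differentiableAt (hU.mem_nhds hp)) (differentiableAt_const _)
      (by simpa using (H p hp).hk)).differentiableWithinAt
  refine IntG_differentiableOn hU (fun p hp => LBd_wt h (a := fun _ => a) continuousAt_const
    (H p hp).hb (H p hp).ha (cg' p hp) (H p hp).hg) bV bV c1 c2 c2
    (fun p hp => two_pi_mul_re (H p hp).hc) (fun p hp => two_pi_mul_re (H p hp).hkab)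
    (fun p hp => two_pi_mul_re (H p hp).hkab) (fun p hp => continuous_wt h (H p hp).ha (H p hp).hb
      (H p hp).hg) mV mV (fun x p hp => ?_) dV dV
  exact (differentiableAt_wt h (H p hp).ha (H p hp).hb (u := fun _ => (x:ℂ))
      (fun r => (dg r).differentiableAt (hU.mem_nhds hp)) (differentiableAt_const _)
      (by simpa using (H p hp).hg)).differentiableWithinAt

theorem wt_symm (h : HypFE) {a b : ℂ} {g : Fin 4 → ℂ} (ha : 0 < a.re) (hb : 0 < b.re)
    (hg : ∀ r, (g r).re < 0) (x : ℝ) : wt a b g x = wt b a g x := by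
  unfold wt
  rw [mul_right_comm (4:ℂ), add_comm b a]
  congr 1
  refine Finset.prod_congr rfl fun r _ => ?_
  rw [eX_symm h ha hb (by rw [im_add_tau]; linarith [hg r]),
    eX_symm h ha hb (by rw [im_neg_add_tau]; linarith [hg r])]

theorem vt_symm (h : HypFE) {a b k : ℂ} (ha : 0 < a.re) (hb : 0 < b.re)
    (hk : k.re < 0) (x : ℝ) : vt a b k x = vt b a k x := by
  unfold vt
  rw [mul_right_comm (4:ℂ), add_comm b a]
  congr 1
  rw [eX_symm h ha hb (by rw [im_add_tau]; linarith),
    eX_symm h ha hb (by rw [im_neg_add_tau]; linarith)]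

theorem IBC_symm (h : HypFE) {a b k : ℂ} {g : Fin 4 → ℂ} (ha : 0 < a.re) (hb : 0 < b.re)
    (hg : ∀ r, (g r).re < 0) (hk : k.re < 0) : IBC n a b g k = IBC n b a g k := by
  unfold IBC
  simp only [wt_symm h ha hb hg, vt_symm h ha hb hk]

theorem IBC_perm (σ : Equiv.Perm (Fin 4)) (a b k : ℂ) (g : Fin 4 → ℂ) :
    IBC n a b (fun r => g (σ r)) k = IBC n a b g k := by
  unfold IBC
  have : ∀ x, wt a b (fun r => g (σ r)) x = wt a b g x := fun x => by
    unfold wt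
    congr 1
    exact Fintype.prod_equiv σ _ _ fun r => rfl
  simp only [this]

end

/-- The shift pattern of the contiguity relation. -/
def ee : Fin 4 → ℂ := ![1, 1, 0, 0]

/-- Shifted one-body weight. -/
def wM (a b : ℂ) (g : Fin 4 → ℂ) (v : ℂ) : ℂ :=
  -Complex.sinh (2*Real.pi*v/b) *
    ∏ r, (eX a b (v + (Complex.I*((a+b)/2 + g r) - ee r*(Complex.I*b))) *
      eX a b (-v + Complex.I*((a+b)/2 + g r)))

/-- Shifted two-body weight. -/
def vM (a b k z : ℂ) : ℂ :=
  -2*Complex.I*Complex.sinh (Real.pi*z/b) *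
    (eX a b (z + (Complex.I*((a+b)/2 + k) - Complex.I*b)) *
      eX a b (-z + Complex.I*((a+b)/2 + k)))

/-- Parameters after the shift. -/
def gS (b : ℂ) (g : Fin 4 → ℂ) : Fin 4 → ℂ := fun r => g r + b/2 - ee r*b

section
variable {a b k : ℂ} {g : Fin 4 → ℂ}

theorem ee_cases (r : Fin 4) : ee r = 0 ∨ ee r = 1 := by
  fin_cases r <;> simp [ee]

theorem shift_alg {S Sb s0 s1 E0 E1 E2 E3 F0 F1 F2 F3 : ℂ} (hS : S ≠ 0) :
    -Sb * (2*Complex.I*s0*E0*F0 * (2*Complex.I*s1*E1*F1) * (E2*F2) * (E3*F3)) =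
      s0*s1/S * (4*S*Sb*(E0*F0*(E1*F1)*(E2*F2)*(E3*F3))) := by
  rw [div_mul_eq_mul_div, eq_div_iff hS]
  linear_combination (-4*Sb*s0*s1*E0*E1*E2*E3*F0*F1*F2*F3*S) * Complex.I_sq

theorem shift_alg' {S Sb s0 s1 E0 E1 E2 E3 F0 F1 F2 F3 : ℂ} (hS : S ≠ 0) :
    Sb * (E0*F0*(E1*F1)*(E2*(2*Complex.I*s0*F2)) * (E3*(2*Complex.I*s1*F3))) =
      s0*s1/(-S) * (4*S*Sb*(E0*F0*(E1*F1)*(E2*F2)*(E3*F3))) := by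
  rw [div_mul_eq_mul_div, eq_div_iff (neg_ne_zero.2 hS)]
  linear_combination (-4*Sb*s0*s1*E0*E1*E2*E3*F0*F1*F2*F3*S) * Complex.I_sq

theorem aphi_wt (h : HypFE) (ha : 0 < a.re) (hb : 0 < b.re) (hg : ∀ r, (g r).re < 0) {x : ℝ}
    (hx : Complex.sinh (2*(Real.pi*x/a)) ≠ 0) :
    wM a b g x = aphi (Complex.I*Real.pi*g 0/a) (Complex.I*Real.pi*g 1/a) (Real.pi*x/a) *
      wt a b g x := by
  have key : ∀ r, eX a b (x + (Complex.I*((a+b)/2 + g r) - 1*(Complex.I*b))) =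
      2*Complex.I*Complex.sinh (Real.pi*x/a + Complex.I*Real.pi*g r/a) *
        eX a b (x + Complex.I*((a+b)/2 + g r)) := fun r => by
    have := eX_shift (z := x + Complex.I*g r) h ha hb (by simpa using hg r)
    rw [show (x:ℂ) + (Complex.I*((a+b)/2 + g r) - 1*(Complex.I*b)) =
      x + Complex.I*g r + Complex.I*((a+b)/2) - Complex.I*b by ring, this]
    congr 2
    · congr 1; ring
    · ring
  unfold wM wt aphi
  simp only [Fin.prod_univ_four]
  rw [show ee 0 = 1 from rfl, show ee 1 = 1 from rfl, show ee 2 = 0 from rfl,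
    show ee 3 = 0 from rfl, key, key]
  rw [show 2*(Real.pi:ℂ)*x/a = 2*(Real.pi*x/a) by ring]
  simp only [zero_mul, sub_zero]
  exact shift_alg hx

theorem apsi_vt (h : HypFE) (ha : 0 < a.re) (hb : 0 < b.re) (hk : k.re < 0) {x : ℝ}
    (hx : Complex.sinh (Real.pi*x/a) ≠ 0) :
    vM a b k x = apsi (Complex.I*Real.pi*k/a) (Real.pi*x/a) * vt a b k x := by
  have key : eX a b (x + (Complex.I*((a+b)/2 + k) - Complex.I*b)) =
      2*Complex.I*Complex.sinh (Real.pi*x/a + Complex.I*Real.pi*k/a) *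
        eX a b (x + Complex.I*((a+b)/2 + k)) := by
    have := eX_shift (z := x + Complex.I*k) h ha hb (by simpa using hk)
    rw [show (x:ℂ) + (Complex.I*((a+b)/2 + k) - Complex.I*b) =
      x + Complex.I*k + Complex.I*((a+b)/2) - Complex.I*b by ring, this]
    congr 2
    · congr 1; ring
    · ring
  unfold vM vt apsi
  rw [key]
  field_simp
  ring_nf
  simp only [Complex.I_sq]
  ring

theorem aphi_wt_shift (h : HypFE) (ha : 0 < a.re) (hb : 0 < b.re)
    (hg : ∀ r, (gS b g r).re < 0) {x : ℝ} (hx : Complex.sinh (2*(Real.pi*x/a)) ≠ 0) :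
    wM a b g (x + Complex.I*b/2) =
      aphi (Complex.I*Real.pi*gS b g 2/a) (Complex.I*Real.pi*gS b g 3/a) (-(Real.pi*x/a)) *
      wt a b (gS b g) x := by
  have hbne := re_ne hb
  have key : ∀ r, eX a b (-x + Complex.I*((a+b)/2 + gS b g r) - Complex.I*b) =
      2*Complex.I*Complex.sinh (-(Real.pi*x/a) + Complex.I*Real.pi*gS b g r/a) *
        eX a b (-x + Complex.I*((a+b)/2 + gS b g r)) := fun r => by
    have := eX_shift (z := -x + Complex.I*gS b g r) h ha hb (by simpa using hg r)
    rw [show -(x:ℂ) + Complex.I*((a+b)/2 + gS b g r) - Complex.I*b =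
      -x + Complex.I*gS b g r + Complex.I*((a+b)/2) - Complex.I*b by ring, this]
    congr 2
    · congr 1; ring
    · ring
  have e1 : ∀ r, (x:ℂ) + Complex.I*b/2 + (Complex.I*((a+b)/2 + g r) - ee r*(Complex.I*b)) =
      x + Complex.I*((a+b)/2 + gS b g r) := fun r => by unfold gS; ring
  have e2 : ∀ r, -((x:ℂ) + Complex.I*b/2) + Complex.I*((a+b)/2 + g r) =
      -x + Complex.I*((a+b)/2 + gS b g r) - (1 - ee r)*(Complex.I*b) := fun r => by unfold gS; ring
  unfold wM wt aphi
  simp only [e1, e2, Fin.prod_univ_four]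
  rw [show ee 0 = 1 from rfl, show ee 1 = 1 from rfl, show ee 2 = 0 from rfl,
    show ee 3 = 0 from rfl]
  simp only [sub_self, zero_mul, sub_zero, one_mul]
  rw [key, key]
  rw [show 2*(Real.pi:ℂ)*((x:ℂ) + Complex.I*b/2)/b = 2*Real.pi*x/b + Real.pi*Complex.I by
      field_simp, Complex.sinh_add, Complex.sinh_mul_I, Complex.cosh_mul_I]
  rw [show 2*(Real.pi:ℂ)*x/a = 2*(Real.pi*x/a) by ring, mul_neg, Complex.sinh_neg]
  simp only [Complex.sin_pi, Complex.cos_pi, zero_mul, mul_zero, add_zero,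
    mul_neg, mul_one, neg_neg]
  exact shift_alg' hx

theorem apsi_vt_shift (h : HypFE) (ha : 0 < a.re) (hb : 0 < b.re) (hk : k.re < 0) {x : ℝ}
    (hx : Complex.sinh (Real.pi*x/a) ≠ 0) :
    vM a b k (x + Complex.I*b) = apsi (Complex.I*Real.pi*k/a) (-(Real.pi*x/a)) * vt a b k x := by
  have hbne := re_ne hb
  have key : eX a b (-x + Complex.I*((a+b)/2 + k) - Complex.I*b) =
      2*Complex.I*Complex.sinh (-(Real.pi*x/a) + Complex.I*Real.pi*k/a) *
        eX a b (-x + Complex.I*((a+b)/2 + k)) := by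
    have := eX_shift (z := -x + Complex.I*k) h ha hb (by simpa using hk)
    rw [show -(x:ℂ) + Complex.I*((a+b)/2 + k) - Complex.I*b =
      -x + Complex.I*k + Complex.I*((a+b)/2) - Complex.I*b by ring, this]
    congr 2
    · congr 1; ring
    · ring
  unfold vM vt apsi
  rw [show (x:ℂ) + Complex.I*b + (Complex.I*((a+b)/2 + k) - Complex.I*b) =
      x + Complex.I*((a+b)/2 + k) by ring,
    show -((x:ℂ) + Complex.I*b) + Complex.I*((a+b)/2 + k) =
      -x + Complex.I*((a+b)/2 + k) - Complex.I*b by ring, key,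
    show (Real.pi:ℂ)*((x:ℂ) + Complex.I*b)/b = Real.pi*x/b + Real.pi*Complex.I by field_simp,
    Complex.sinh_add, Complex.sinh_mul_I, Complex.cosh_mul_I, Complex.sinh_neg]
  simp only [Complex.sin_pi, Complex.cos_pi]
  field_simp
  ring_nf
  simp only [Complex.I_sq]
  ring

theorem sinh_pi_mul_ne {x : ℝ} (ha : 0 < a.re) (hx : x ≠ 0) : Complex.sinh (Real.pi*x/a) ≠ 0 := by
  intro h0
  have hane := re_ne ha
  have h1 : Complex.sin (Real.pi*x/a*Complex.I) = 0 := by rw [Complex.sin_mul_I, h0, zero_mul]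
  obtain ⟨m, hm⟩ := Complex.sin_eq_zero_iff.1 h1
  have hpi : (Real.pi:ℂ) ≠ 0 := by exact_mod_cast Real.pi_ne_zero
  have h2 : (x:ℂ)*Complex.I = m*a := by
    have : (Real.pi:ℂ)*(x*Complex.I) = Real.pi*(m*a) := by
      field_simp at hm
      linear_combination Real.pi*hm
    exact mul_left_cancel₀ hpi this
  have h3 := congrArg Complex.re h2
  simp at h3
  rcases h3 with h3 | h3
  · rw [h3] at h2
    simp at h2
    exact hx h2
  · exact ha.ne' h3

end

section
variable {n : ℕ}

/-- Coordinatewise sign flip. -/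
def signEquiv (s : Fin n → Bool) : (Fin n → ℝ) ≃ᵐ (Fin n → ℝ) :=
  MeasurableEquiv.ofInvolutive (fun v i => sgn (s i) * v i)
    (fun v => by
      funext i
      rcases sgn_cases (s i) with h | h <;> simp [h])
    (by fun_prop)

theorem signEquiv_apply (s : Fin n → Bool) (v : Fin n → ℝ) (i : Fin n) :
    signEquiv s v i = sgn (s i) * v i := rfl

theorem measurePreserving_signEquiv (s : Fin n → Bool) :
    MeasurePreserving (signEquiv s) volume volume := by
  refine volume_preserving_pi (f := fun i (x : ℝ) => sgn (s i) * x) fun i => ?_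
  rcases sgn_cases (s i) with h | h
  · simp only [h, one_mul]
    exact MeasurePreserving.id (volume : Measure ℝ)
  · simpa [h] using Measure.measurePreserving_neg (volume : Measure ℝ)

theorem IntG_sign {A B : ℝ → ℂ} (hA : ∀ x, A (-x) = A x) (hB : ∀ x, B (-x) = B x)
    (s : Fin n → Bool) (v : Fin n → ℝ) : IntG n A B B (signEquiv s v) = IntG n A B B v := by
  unfold IntG
  simp only [signEquiv_apply]
  congr 1
  · refine Finset.prod_congr rfl fun j _ => ?_
    rcases sgn_cases (s j) with h | h <;> simp [h, hA]
  · refine pairProd_congr fun i j _ => ?_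
    rcases sgn_cases (s i) with h | h <;> rcases sgn_cases (s j) with h' | h' <;>
      simp only [h, h', one_mul, neg_one_mul]
    · rw [sub_neg_eq_add, mul_comm]; rfl
    · rw [show -v i + v j = -(v i - v j) by ring, show -v i - v j = -(v i + v j) by ring, hB, hB,
        mul_comm]
    · rw [show -v i + -v j = -(v i + v j) by ring, show -v i - -v j = -(v i - v j) by ring, hB, hB]

theorem ae_linear_ne (l : (Fin n → ℝ) →ₗ[ℝ] ℝ) (hl : l ≠ 0) :
    ∀ᵐ v : Fin n → ℝ, l v ≠ 0 := by
  have := Measure.addHaar_submodule (volume : Measure (Fin n → ℝ)) (LinearMap.ker l)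
    (fun h => hl (LinearMap.ker_eq_top.1 h))
  rw [ae_iff]
  convert this using 2
  ext v
  simp

theorem ae_generic : ∀ᵐ v : Fin n → ℝ, (∀ i, v i ≠ 0) ∧ (∀ i j, i ≠ j → v i + v j ≠ 0) ∧
    ∀ i j, i ≠ j → v i - v j ≠ 0 := by
  refine (ae_all_iff.2 fun i => ?_).and ((ae_all_iff.2 fun i => ae_all_iff.2 fun j => ?_).and
    (ae_all_iff.2 fun i => ae_all_iff.2 fun j => ?_))
  · exact ae_linear_ne (LinearMap.proj i) fun h => by
      have := congrArg (fun l => l (Pi.single i 1)) h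
      simp at this
  · by_cases hij : i = j
    · exact Eventually.of_forall fun v h => absurd hij h
    · filter_upwards [ae_linear_ne ((LinearMap.proj i : (Fin n → ℝ) →ₗ[ℝ] ℝ) + LinearMap.proj j) fun h => by
        have : (Pi.single i 1 : Fin n → ℝ) i + (Pi.single i 1 : Fin n → ℝ) j = 0 :=
          LinearMap.congr_fun h (Pi.single i 1)
        simp [Ne.symm hij] at this] with v hv _
      exact hv
  · by_cases hij : i = j
    · exact Eventually.of_forall fun v h => absurd hij h
    · filter_upwards [ae_linear_ne ((LinearMap.proj i : (Fin n → ℝ) →ₗ[ℝ] ℝ) - LinearMap.proj j) fun h => by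
        have : (Pi.single i 1 : Fin n → ℝ) i - (Pi.single i 1 : Fin n → ℝ) j = 0 :=
          LinearMap.congr_fun h (Pi.single i 1)
        simp [Ne.symm hij] at this] with v hv _
      exact hv

theorem ae_generic_sinh {a : ℂ} (ha : 0 < a.re) : ∀ᵐ v : Fin n → ℝ,
    (∀ i, Complex.sinh (2*(Real.pi*v i/a)) ≠ 0) ∧
    (∀ i j, i ≠ j → Complex.sinh (Real.pi*v i/a + Real.pi*v j/a) ≠ 0) ∧
    ∀ i j, i ≠ j → Complex.sinh (Real.pi*v i/a - Real.pi*v j/a) ≠ 0 := by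
  filter_upwards [ae_generic] with v hv
  refine ⟨fun i => ?_, fun i j hij => ?_, fun i j hij => ?_⟩
  · have := sinh_pi_mul_ne (x := 2 * v i) ha (mul_ne_zero two_ne_zero (hv.1 i))
    rwa [show (Real.pi:ℂ)*((2*v i:ℝ):ℂ)/a = 2*(Real.pi*v i/a) by push_cast; ring] at this
  · have := sinh_pi_mul_ne ha (hv.2.1 i j hij)
    rwa [show (Real.pi:ℂ)*((v i + v j:ℝ):ℂ)/a = Real.pi*v i/a + Real.pi*v j/a by
      push_cast; ring] at this
  · have := sinh_pi_mul_ne ha (hv.2.2 i j hij)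
    rwa [show (Real.pi:ℂ)*((v i - v j:ℝ):ℂ)/a = Real.pi*v i/a - Real.pi*v j/a by
      push_cast; ring] at this

theorem symmetrized_integral {a al be k : ℂ} (ha : 0 < a.re) {A B : ℝ → ℂ}
    (hA : ∀ x, A (-x) = A x) (hB : ∀ x, B (-x) = B x) (s0 : Fin n → Bool)
    (h_integ : Integrable fun v : Fin n → ℝ =>
      asum al be k (fun i => sgn (s0 i) * (Real.pi*v i/a)) * IntG n A B B v) :
    (∏ j ∈ Finset.range n, Complex.sinh (al+be+j*k)) * ∫ v, IntG n A B B v =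
      2^n * ∫ v : Fin n → ℝ, asum al be k (fun i => sgn (s0 i) * (Real.pi*v i/a)) * IntG n A B B v := by
  set F : (Fin n → Bool) → (Fin n → ℝ) → ℂ := fun s v =>
    asum al be k (fun i => sgn (s i) * (Real.pi*v i/a)) * IntG n A B B v with hF
  have key : ∀ s, ∃ t : Fin n → Bool, F s = F s0 ∘ signEquiv t := by
    intro s
    refine ⟨fun i => s i == s0 i, ?_⟩
    funext v
    simp only [hF, Function.comp, IntG_sign hA hB]
    congr 2
    funext i
    rw [signEquiv_apply]
    have : sgn (s i) = sgn (s0 i) * sgn (s i == s0 i) := by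
      cases s i <;> cases s0 i <;> simp [sgn]
    rw [this]; push_cast; ring
  have hi : ∀ s, Integrable (F s) := fun s => by
    obtain ⟨t, ht⟩ := key s
    rw [ht]
    exact ((measurePreserving_signEquiv t).integrable_comp_emb
      (signEquiv t).measurableEmbedding).2 h_integ
  have he : ∀ s, ∫ v, F s v = ∫ v, F s0 v := fun s => by
    obtain ⟨t, ht⟩ := key s
    rw [ht]
    exact (measurePreserving_signEquiv t).integral_comp' (F s0)
  have h1 : ∫ v, ∑ s, F s v = 2^n * ∫ v, F s0 v := by
    rw [integral_finsetSum _ fun s _ => hi s, Finset.sum_congr rfl fun s _ => he s]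
    simp
  rw [← h1, ← integral_const_mul]
  refine integral_congr_ae ?_
  filter_upwards [ae_generic_sinh (n := n) ha] with v hv
  simp only [hF]
  rw [← Finset.sum_mul, sinh_sign_sum al be k n (fun i => Real.pi*v i/a) hv.1 hv.2.1 hv.2.2]

end

section
variable {n : ℕ} {a b k : ℂ} {g : Fin 4 → ℂ}

theorem differentiableAt_wM (h : HypFE) (ha : 0 < a.re) (hb : 0 < b.re) {z : ℂ}
    (h1 : ∀ r, z.im + (gS b g r).re < b.re/2) (h2 : ∀ r, (g r).re < z.im) :
    DifferentiableAt ℂ (wM a b g) z := by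
  have := re_ne hb
  unfold wM
  refine DifferentiableAt.mul (by fun_prop) (DifferentiableAt.fun_finsetProd fun r _ =>
    DifferentiableAt.mul ?_ ?_)
  · exact DifferentiableAt.comp (f := fun z => z + (Complex.I*((a+b)/2 + g r) - ee r*(Complex.I*b))) z
      (differentiableAt_eX h ha hb (by
        have := h1 r
        unfold gS at this
        rw [Complex.add_im, Complex.sub_im, im_I_mul_tau]
        rcases ee_cases r with he | he <;> rw [he] at this ⊢ <;> simp at this ⊢ <;> linarith))
      (by fun_prop)
  · exact DifferentiableAt.comp (f := fun z => -z + (Complex.I*((a+b)/2 + g r))) z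
      (differentiableAt_eX h ha hb (by
        rw [Complex.add_im, im_I_mul_tau, Complex.neg_im]; linarith [h2 r]))
      (by fun_prop)

theorem differentiableAt_vM (h : HypFE) (ha : 0 < a.re) (hb : 0 < b.re) {z : ℂ}
    (h1 : z.im + k.re < b.re) (h2 : k.re < z.im) :
    DifferentiableAt ℂ (vM a b k) z := by
  have := re_ne hb
  unfold vM
  refine DifferentiableAt.mul (by fun_prop) (DifferentiableAt.mul ?_ ?_)
  · exact DifferentiableAt.comp (f := fun z => z + (Complex.I*((a+b)/2 + k) - Complex.I*b)) z
      (differentiableAt_eX h ha hb (by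
        rw [Complex.add_im, Complex.sub_im, im_I_mul_tau]
        simp; linarith))
      (by fun_prop)
  · exact DifferentiableAt.comp (f := fun z => -z + (Complex.I*((a+b)/2 + k))) z
      (differentiableAt_eX h ha hb (by
        rw [Complex.add_im, im_I_mul_tau, Complex.neg_im]; linarith))
      (by fun_prop)

theorem LBd_wM (h : HypFE) (ha : 0 < a.re) (hb : 0 < b.re) {t0 : ℂ}
    (h1 : ∀ r, t0.im + (gS b g r).re < b.re/2) (h2 : ∀ r, (g r).re < t0.im) :
    LBd (fun t x => wM a b g (x+t)) (fun _ => -(2*Real.pi*(a + b + ∑ r, g r)/(a*b)).re) t0 := by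
  have hane := re_ne ha
  have hbne := re_ne hb
  have hr : ∀ r, LBd (fun t x => eX a b (x + (t + (Complex.I*((a+b)/2 + g r) - ee r*(Complex.I*b)))) *
      eX a b (-x + (-t + Complex.I*((a+b)/2 + g r)))) _ t0 := fun r =>
    LBd_pair h (a := fun _ => a) hb continuousAt_const (continuousAt_id.add continuousAt_const)
      (continuousAt_id.neg.add continuousAt_const) ha (by
        have := h1 r
        unfold gS at this
        rw [Complex.add_im, Complex.sub_im, im_I_mul_tau]
        rcases ee_cases r with he | he <;> rw [he] at this ⊢ <;> simp at this ⊢ <;> linarith)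
      (by rw [Complex.add_im, im_I_mul_tau, Complex.neg_im]; linarith [h2 r])
  have s2 := LBd_sinh (κ := fun _ : ℂ => 2*Real.pi/b) (t := fun t => t)
    continuousAt_const (p0 := t0) continuousAt_id (by
      rw [div_eq_mul_inv, show (2*Real.pi:ℂ) = ((2*Real.pi:ℝ):ℂ) by push_cast; ring, Complex.re_ofReal_mul]
      exact mul_pos (by positivity) (inv_re_pos hb))
  refine ((s2.mul (LBd.prod Finset.univ fun r _ => hr r)).const_mul (-1/2)).congr ?_ ?_
  · intro p x
    unfold wM
    rw [mul_div_right_comm _ _ b]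
    simp only [neg_add, ← add_assoc]
    ring
  · refine Eventually.of_forall fun p => ?_
    rw [← Complex.re_sum, ← Complex.add_re, ← Complex.neg_re]
    congr 1
    simp only [Fin.sum_univ_four]
    rw [show ee 0 = 1 from rfl, show ee 1 = 1 from rfl, show ee 2 = 0 from rfl,
      show ee 3 = 0 from rfl]
    field_simp
    linear_combination (-2*(4*a + 2*b + 2*(g 0 + g 1 + g 2 + g 3))) * Complex.I_sq

theorem LBd_vM (h : HypFE) (ha : 0 < a.re) (hb : 0 < b.re) {t0 : ℂ}
    (h1 : 2*t0.im + k.re < b.re) (h2 : k.re < 2*t0.im) :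
    LBd (fun t x => vM a b k (x+2*t)) (fun _ => -(2*Real.pi*k/(a*b)).re) t0 := by
  have hane := re_ne ha
  have hbne := re_ne hb
  have hr : LBd (fun t x => eX a b (x + (2*t + (Complex.I*((a+b)/2 + k) - Complex.I*b))) *
      eX a b (-x + (-(2*t) + Complex.I*((a+b)/2 + k)))) _ t0 :=
    LBd_pair h (a := fun _ => a) hb continuousAt_const (by fun_prop) (by fun_prop) ha (by
        rw [Complex.add_im, Complex.sub_im, im_I_mul_tau]
        simp; linarith)
      (by rw [Complex.add_im, im_I_mul_tau, Complex.neg_im]; simp; linarith)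
  have s2 := LBd_sinh (κ := fun _ : ℂ => Real.pi/b) (t := fun t => 2*t)
    continuousAt_const (p0 := t0) (by fun_prop) (by
      rw [div_eq_mul_inv, Complex.re_ofReal_mul]
      exact mul_pos (by positivity) (inv_re_pos hb))
  refine ((s2.mul hr).const_mul (-Complex.I)).congr ?_ ?_
  · intro p x
    unfold vM
    rw [mul_div_right_comm _ _ b]
    simp only [neg_add, ← add_assoc]
    ring
  · refine Eventually.of_forall fun p => ?_
    rw [← Complex.add_re, ← Complex.neg_re]
    congr 1
    field_simp
    linear_combination (-2*(a + 2*k)) * Complex.I_sq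

/-- The contour-shift integral is constant. -/
theorem integral_shift_eq (h : HypFE) (H : Adm a b g k) (hg' : ∀ r, (gS b g r).re < 0) :
    (Integrable (IntG n (fun x => wM a b g x) (fun x => vM a b k x) (fun x => vt a b k x)) ∧
    Integrable (IntG n (fun x => wM a b g (x + Complex.I*b/2))
      (fun x => vM a b k (x + Complex.I*b)) (fun x => vt a b k x))) ∧
    ∫ v : Fin n → ℝ, IntG n (fun x => wM a b g x) (fun x => vM a b k x) (fun x => vt a b k x) v =
    ∫ v : Fin n → ℝ, IntG n (fun x => wM a b g (x + Complex.I*b/2))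
      (fun x => vM a b k (x + Complex.I*b)) (fun x => vt a b k x) v := by
  have ha := H.ha
  have hb := H.hb
  obtain ⟨δ, ⟨h1, h2, h3⟩, hδ⟩ : ∃ δ : ℝ, ((∀ r, (g r).re < -δ) ∧ (∀ r, (gS b g r).re < -δ) ∧
      k.re < -(2*δ)) ∧ 0 < δ := by
    have e : ∀ (c : ℝ) (w : ℝ), w < 0 → ∀ᶠ δ : ℝ in 𝓝[>] 0, w < -(c*δ) := fun c w hw => by
      have : ContinuousAt (fun δ : ℝ => -(c*δ)) 0 := by fun_prop
      exact (this.eventually (lt_mem_nhds (by simpa using hw))).filter_mono nhdsWithin_le_nhds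
    have := ((eventually_all.2 fun r => e 1 _ (H.hg r)).and
      ((eventually_all.2 fun r => e 1 _ (hg' r)).and (e 2 _ H.hk))).and
      (eventually_mem_nhdsWithin (a := (0:ℝ)) (s := Ioi 0))
    simpa using this.exists
  set U : Set ℂ := {t | -δ < t.im} ∩ {t | t.im < b.re/2 + δ} with hU
  have oU : IsOpen U := (isOpen_lt continuous_const Complex.continuous_im).inter
    (isOpen_lt Complex.continuous_im continuous_const)
  have pU : IsPreconnected U :=
    ((convex_halfSpace_im_gt _).inter (convex_halfSpace_im_lt _)).isPreconnected
  have w1 : ∀ t ∈ U, ∀ r, t.im + (gS b g r).re < b.re/2 := fun t ht r => by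
    have := ht.2; have := h2 r; simp only [mem_ofPred_eq] at *; linarith
  have w2 : ∀ t ∈ U, ∀ r, (g r).re < t.im := fun t ht r => by
    have := ht.1; have := h1 r; simp only [mem_ofPred_eq] at *; linarith
  have v1 : ∀ t ∈ U, 2*t.im + k.re < b.re := fun t ht => by
    have := ht.2; simp only [mem_ofPred_eq] at *; linarith
  have v2 : ∀ t ∈ U, k.re < 2*t.im := fun t ht => by
    have := ht.1; simp only [mem_ofPred_eq] at *; linarith
  have bW : ∀ t ∈ U, LBd (fun t x => wM a b g (x+t)) _ t := fun t ht =>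
    LBd_wM h ha hb (w1 t ht) (w2 t ht)
  have bV : ∀ t ∈ U, LBd (fun t x => vM a b k (x+2*t)) _ t := fun t ht =>
    LBd_vM h ha hb (v1 t ht) (v2 t ht)
  have bD : ∀ t ∈ U, LBd (fun (_:ℂ) x => vt a b k x) _ t := fun t ht =>
    LBd_vt h (a := fun _ => a) (k := fun _ => k) continuousAt_const hb ha continuousAt_const H.hk
  have dW : ∀ t ∈ U, ∀ x : ℝ, DifferentiableAt ℂ (wM a b g) (x+t) := fun t ht x =>
    differentiableAt_wM h ha hb (by simpa using w1 t ht) (by simpa using w2 t ht)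
  have dV : ∀ t ∈ U, ∀ x : ℝ, DifferentiableAt ℂ (vM a b k) (x+2*t) := fun t ht x =>
    differentiableAt_vM h ha hb (by simpa using v1 t ht) (by simpa using v2 t ht)
  have cW : ∀ t ∈ U, Continuous fun x : ℝ => wM a b g (x+t) := fun t ht =>
    continuous_iff_continuousAt.2 fun x =>
      ContinuousAt.comp (f := fun x : ℝ => (x:ℂ)+t) (dW t ht x).continuousAt (by fun_prop)
  have cV : ∀ t ∈ U, Continuous fun x : ℝ => vM a b k (x+2*t) := fun t ht =>
    continuous_iff_continuousAt.2 fun x =>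
      ContinuousAt.comp (f := fun x : ℝ => (x:ℂ)+2*t) (dV t ht x).continuousAt (by fun_prop)
  set J : ℂ → ℂ := fun t => ∫ v : Fin n → ℝ, IntG n (fun x => wM a b g (x+t))
    (fun x => vM a b k (x+2*t)) (fun x => vt a b k x) v with hJ
  have hJd : DifferentiableOn ℂ J U :=
    IntG_differentiableOn oU bW bV bD (fun _ _ => continuousAt_const) (fun _ _ => continuousAt_const)
      (fun _ _ => continuousAt_const) (fun _ _ => two_pi_mul_re H.hc) (fun _ _ => two_pi_mul_re H.hkab)
      (fun _ _ => two_pi_mul_re H.hkab) cW cV (fun _ _ => continuous_vt h ha hb H.hk)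
      (fun x t ht => ((dW t ht x).comp (f := fun t => (x:ℂ)+t) t (by fun_prop)).differentiableWithinAt)
      (fun x t ht => ((dV t ht x).comp (f := fun t => (x:ℂ)+2*t) t (by fun_prop)).differentiableWithinAt)
      (fun x => differentiableOn_const _)
  have h_integ : ∀ t ∈ U, Integrable (IntG n (fun x => wM a b g (x+t))
    (fun x => vM a b k (x+2*t)) (fun x => vt a b k x)) := fun t ht => by
    obtain ⟨bound, hb1, hb2⟩ := IntG_dominated (n := n) (bW t ht) (bV t ht) (bD t ht)
      continuousAt_const continuousAt_const continuousAt_const (two_pi_mul_re H.hc)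
      (two_pi_mul_re H.hkab) (two_pi_mul_re H.hkab)
    exact hb1.mono' (continuous_IntG (cW t ht) (cV t ht)
      (continuous_vt h ha hb H.hk)).aestronglyMeasurable (Eventually.of_forall hb2.self_of_nhds)
  have hreal : ∀ r : ℝ, J r = J 0 := fun r => by
    simp only [hJ]
    rw [← integral_add_right_eq_self (fun v : Fin n → ℝ => IntG n (fun x => wM a b g (x+0))
      (fun x => vM a b k (x+2*0)) (fun x => vt a b k x) v) (fun _ => r)]
    refine integral_congr_ae (Eventually.of_forall fun v => ?_)
    simp only [IntG, Pi.add_apply, add_sub_add_right_eq_sub]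
    congr 1
    · refine Finset.prod_congr rfl fun j _ => ?_
      push_cast; rw [add_zero]
    · refine pairProd_congr fun i j _ => ?_
      congr 2; push_cast; ring
  have h0U : (0:ℂ) ∈ U := ⟨by simpa using hδ, by simp; linarith⟩
  have hcU : Complex.I*b/2 ∈ U := ⟨by simp only [mem_ofPred_eq, im_I_mul_div_two]; linarith,
    by simp only [mem_ofPred_eq, im_I_mul_div_two]; linarith⟩
  have hfreq : ∃ᶠ z in 𝓝[≠] (0:ℂ), J z = (fun _ => J 0) z := by
    have ht : Tendsto (fun r : ℝ => (r:ℂ)) (𝓝[≠] 0) (𝓝[≠] 0) := by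
      refine tendsto_nhdsWithin_iff.2 ⟨?_, ?_⟩
      · exact (Complex.continuous_ofReal.tendsto' 0 0 (by simp)).mono_left nhdsWithin_le_nhds
      · filter_upwards [self_mem_nhdsWithin] with r hr
        simpa using hr
    exact ht.frequently (Eventually.of_forall fun r => hreal r).frequently
  have hconst := AnalyticOnNhd.eqOn_of_preconnected_of_frequently_eq (hJd.analyticOnNhd oU)
    (differentiableOn_const (J 0) |>.analyticOnNhd oU) pU h0U hfreq hcU
  have i0 := h_integ 0 h0U
  have ic := h_integ _ hcU
  simp only [hJ] at hconst
  simp only [show 2*(Complex.I*b/2) = Complex.I*b by ring, add_zero, mul_zero] at hconst i0 ic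
  exact ⟨⟨i0, ic⟩, hconst.symm⟩

theorem IntG_apsi {A A' B B' D : ℝ → ℂ} {y : Fin n → ℂ} {al be k : ℂ} {v : Fin n → ℝ}
    (hA : ∀ i, A (v i) = aphi al be (y i) * A' (v i))
    (hB : ∀ i j, i ≠ j → B (v i + v j) = apsi k (y i + y j) * B' (v i + v j)) :
    IntG n A B D v = asum al be k y * IntG n A' B' D v := by
  unfold IntG asum
  rw [Finset.prod_congr rfl fun i _ => hA i, Finset.prod_mul_distrib,
    mul_mul_mul_comm, ← pairProd_mul]
  congr 1
  exact pairProd_congr fun i j hij => by rw [hB i j hij.ne, mul_assoc]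

theorem IBC_rel (h : HypFE) (H : Adm a b g k) (hg' : ∀ r, (gS b g r).re < 0) :
    (∏ j ∈ Finset.range n, Complex.sinh (Complex.I*Real.pi*(g 0 + g 1 + j*k)/a)) * IBC n a b g k =
    (∏ j ∈ Finset.range n, Complex.sinh (Complex.I*Real.pi*(gS b g 2 + gS b g 3 + j*k)/a)) *
      IBC n a b (gS b g) k := by
  obtain ⟨⟨i0, ic⟩, he⟩ := integral_shift_eq (n := n) h H hg'
  have ha := H.ha
  have hb := H.hb
  have e0 : (IntG n (fun x => wM a b g x) (fun x => vM a b k x) (fun x => vt a b k x)) =ᵐ[volume]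
      fun v => asum (Complex.I*Real.pi*g 0/a) (Complex.I*Real.pi*g 1/a) (Complex.I*Real.pi*k/a)
        (fun i => sgn ((fun _ => true) i) * (Real.pi*v i/a)) *
        IntG n (fun x => wt a b g x) (fun x => vt a b k x) (fun x => vt a b k x) v := by
    filter_upwards [ae_generic_sinh (n := n) ha, ae_generic] with v hv hv'
    refine IntG_apsi (fun i => ?_) (fun i j hij => ?_)
    · simpa [sgn] using aphi_wt h ha hb H.hg (hv.1 i)
    · have := apsi_vt h ha hb H.hk (sinh_pi_mul_ne ha (hv'.2.1 i j hij))
      simpa [sgn, mul_add, add_div] using this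
  have ec : (IntG n (fun x => wM a b g (x + Complex.I*b/2))
      (fun x => vM a b k (x + Complex.I*b)) (fun x => vt a b k x)) =ᵐ[volume]
      fun v => asum (Complex.I*Real.pi*gS b g 2/a) (Complex.I*Real.pi*gS b g 3/a)
        (Complex.I*Real.pi*k/a)
        (fun i => sgn ((fun _ => false) i) * (Real.pi*v i/a)) *
        IntG n (fun x => wt a b (gS b g) x) (fun x => vt a b k x) (fun x => vt a b k x) v := by
    filter_upwards [ae_generic_sinh (n := n) ha, ae_generic] with v hv hv'
    refine IntG_apsi (fun i => ?_) (fun i j hij => ?_)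
    · simpa [sgn] using aphi_wt_shift h ha hb hg' (hv.1 i)
    · have := apsi_vt_shift h ha hb H.hk (sinh_pi_mul_ne ha (hv'.2.1 i j hij))
      simpa [sgn, mul_add, add_div, add_comm] using this
  have ewt : ∀ (g : Fin 4 → ℂ) (x : ℝ), wt a b g ((-x:ℝ):ℂ) = wt a b g x := fun g x => by
    rw [Complex.ofReal_neg, wt_neg]
  have evt : ∀ x : ℝ, vt a b k ((-x:ℝ):ℂ) = vt a b k x := fun x => by
    rw [Complex.ofReal_neg, vt_neg]
  have s0 := symmetrized_integral ha (ewt g) evt (fun _ => true) (i0.congr e0)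
  have sc := symmetrized_integral ha (ewt (gS b g)) evt (fun _ => false) (ic.congr ec)
  rw [← integral_congr_ae e0] at s0
  rw [← integral_congr_ae ec, ← he, ← s0] at sc
  have hS : ∀ u w : ℂ, (∏ j ∈ Finset.range n, Complex.sinh (Complex.I*Real.pi*u/a +
      Complex.I*Real.pi*w/a + j*(Complex.I*Real.pi*k/a))) =
      ∏ j ∈ Finset.range n, Complex.sinh (Complex.I*Real.pi*(u + w + j*k)/a) := fun u w =>
    Finset.prod_congr rfl fun j _ => by congr 1; ring
  rw [hS, hS] at sc
  exact sc.symm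

end

/-- The reciprocal hyperbolic gamma function on the imaginary axis, centred at `i(a+b)/2`. -/
def ev (a b x : ℂ) : ℂ := eX a b (Complex.I*((a+b)/2 + x))

section
variable {a b k x : ℂ} {g : Fin 4 → ℂ}

theorem ev_symm (h : HypFE) (ha : 0 < a.re) (hb : 0 < b.re) (hx : x.re < 0) :
    ev a b x = ev b a x := by
  unfold ev
  rw [eX_symm h ha hb (by rw [im_I_mul_tau]; linarith), add_comm a b]

theorem ev_sub (h : HypFE) (ha : 0 < a.re) (hb : 0 < b.re) (hx : x.re < 0) :
    ev a b (x - b) = 2*Complex.I*Complex.sinh (Complex.I*Real.pi*x/a) * ev a b x := by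
  have := eX_shift h ha hb (z := Complex.I*x) (by simpa using hx)
  unfold ev
  rw [show Complex.I*((a+b)/2 + (x-b)) = Complex.I*x + Complex.I*((a+b)/2) - Complex.I*b by ring,
    this, show Complex.I*((a+b)/2 + x) = Complex.I*x + Complex.I*((a+b)/2) by ring,
    show (Real.pi:ℂ)*(Complex.I*x)/a = Complex.I*Real.pi*x/a by ring]

theorem ev_ne_zero (h : HypFE) (ha : 0 < a.re) (hb : 0 < b.re) (hx : x.re < 0)
    (hx' : -(a.re+b.re) < x.re) : ev a b x ≠ 0 :=
  eX_ne_zero h ha hb (by rw [im_I_mul_tau, abs_lt]; constructor <;> linarith)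

theorem continuousAt_ev (h : HypFE) {P : Type*} [TopologicalSpace P] {A X : P → ℂ} {p : P}
    (ha : 0 < (A p).re) (hb : 0 < b.re) (hx : (X p).re < 0) (cA : ContinuousAt A p)
    (cX : ContinuousAt X p) : ContinuousAt (fun p => ev (A p) b (X p)) p := by
  have := continuousAt_eX h ha hb (z := Complex.I*((A p+b)/2 + X p)) (by rw [im_I_mul_tau]; linarith)
  exact ContinuousAt.comp (f := fun p => (A p, Complex.I*((A p+b)/2 + X p))) this
    (cA.prodMk (continuousAt_const.mul (((cA.add continuousAt_const).div_const 2).add cX)))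

theorem differentiableAt_ev (h : HypFE) {X : ℂ → ℂ} {p : ℂ}
    (ha : 0 < a.re) (hb : 0 < b.re) (hx : (X p).re < 0) (dX : DifferentiableAt ℂ X p) :
    DifferentiableAt ℂ (fun p => ev a b (X p)) p := by
  have := differentiableAt_eX h ha hb (z := Complex.I*((a+b)/2 + X p)) (by rw [im_I_mul_tau]; linarith)
  exact DifferentiableAt.comp (f := fun p => Complex.I*((a+b)/2 + X p)) p this (by fun_prop)

/-- Numerator of the evaluation formula. -/
def evNum (n : ℕ) (a b : ℂ) (g : Fin 4 → ℂ) (k : ℂ) : ℂ :=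
  ∏ j ∈ Finset.range n, (ev a b (j*k + g 0 + g 1) * ev a b (j*k + g 0 + g 2) *
    ev a b (j*k + g 0 + g 3) * ev a b (j*k + g 1 + g 2) * ev a b (j*k + g 1 + g 3) *
    ev a b (j*k + g 2 + g 3)) * ev a b ((j+1)*k)

/-- Denominator of the evaluation formula. -/
def evDen (n : ℕ) (a b S k : ℂ) : ℂ :=
  ∏ j ∈ Finset.range n, ev a b k * ev a b ((2*n - j - 2)*k + S)

/-- The integral divided by its expected value, up to an elementary constant. -/
def ratio (n : ℕ) (a b : ℂ) (g : Fin 4 → ℂ) (k : ℂ) : ℂ :=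
  IBC n a b g k * evDen n a b (∑ r, g r) k / evNum n a b g k

theorem re_jk (j : ℕ) (k : ℂ) : ((j:ℂ)*k).re = j * k.re := by simp

theorem re_coeff_mul {n j : ℕ} (k : ℂ) :
    ((2*(n:ℂ) - j - 2)*k).re = (2*n - j - 2)*k.re := by
  rw [show (2*(n:ℂ) - j - 2) = ((2*n - j - 2 : ℝ):ℂ) by push_cast; ring, Complex.re_ofReal_mul]

theorem coeff_mul_re_nonpos {n j : ℕ} (hj : j < n) (hk : k.re < 0) :
    (2*(n:ℝ) - j - 2)*k.re ≤ 0 := by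
  have h1 : (j:ℝ) + 1 ≤ n := by exact_mod_cast hj
  have h2 : (0:ℝ) ≤ j := by positivity
  exact mul_nonpos_of_nonneg_of_nonpos (by linarith) hk.le

theorem jk_re_nonpos (j : ℕ) (hk : k.re < 0) : (j:ℝ)*k.re ≤ 0 :=
  mul_nonpos_of_nonneg_of_nonpos (by positivity) hk.le

theorem nk_le_jk {n j : ℕ} (hj : j < n) (hk : k.re < 0) : (n:ℝ)*k.re ≤ (j+1)*k.re :=
  mul_le_mul_of_nonpos_right (by exact_mod_cast hj) hk.le

theorem re_succ_mul (j : ℕ) (k : ℂ) : (((j:ℂ)+1)*k).re = (j+1)*k.re := by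
  rw [show (j:ℂ)+1 = ((j+1:ℝ):ℂ) by push_cast; ring, Complex.re_ofReal_mul]

theorem evNum_ne_zero (h : HypFE) (H : Adm a b g k) {n : ℕ}
    (hn : 0 < (a+b+∑ r, g r).re + 2*n*k.re) : evNum n a b g k ≠ 0 := by
  obtain ⟨ha, hb, hg, -, hk, -⟩ := H
  have hg0 := hg 0
  have hg1 := hg 1
  have hg2 := hg 2
  have hg3 := hg 3
  rw [Fin.sum_univ_four] at hn
  simp only [Complex.add_re] at hn
  refine Finset.prod_ne_zero_iff.2 fun j hj => ?_
  have hj := Finset.mem_range.1 hj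
  have h1 := jk_re_nonpos j hk
  have h2 := nk_le_jk hj hk
  have h3 := jk_re_nonpos n hk
  have key : ∀ u v : ℂ, u.re < 0 → v.re < 0 → -(a.re+b.re) < (j:ℝ)*k.re + u.re + v.re →
    ev a b (j*k + u + v) ≠ 0 := fun u v hu hv huv =>
      ev_ne_zero h ha hb (by simp only [Complex.add_re, re_jk]; linarith)
        (by simp only [Complex.add_re, re_jk]; linarith)
  have hl : ev a b ((j+1)*k) ≠ 0 := ev_ne_zero h ha hb
    (by rw [re_succ_mul]; linarith) (by rw [re_succ_mul]; linarith)
  refine mul_ne_zero (mul_ne_zero (mul_ne_zero (mul_ne_zero (mul_ne_zero (mul_ne_zero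
    (key _ _ hg0 hg1 ?_) (key _ _ hg0 hg2 ?_)) (key _ _ hg0 hg3 ?_)) (key _ _ hg1 hg2 ?_))
    (key _ _ hg1 hg3 ?_)) (key _ _ hg2 hg3 ?_)) hl <;> linarith

theorem sum_gS (b : ℂ) (g : Fin 4 → ℂ) : ∑ r, gS b g r = ∑ r, g r := by
  simp [gS, ee, Fin.sum_univ_four]; ring

theorem evNum_rel (h : HypFE) (ha : 0 < a.re) (hb : 0 < b.re) (hk : k.re < 0)
    (hg : ∀ r, (g r).re < 0) (hg' : ∀ r, (gS b g r).re < 0) (n : ℕ) :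
    (∏ j ∈ Finset.range n, 2*Complex.I*Complex.sinh (Complex.I*Real.pi*(gS b g 2 + gS b g 3 + j*k)/a)) *
      evNum n a b (gS b g) k =
    (∏ j ∈ Finset.range n, 2*Complex.I*Complex.sinh (Complex.I*Real.pi*(g 0 + g 1 + j*k)/a)) *
      evNum n a b g k := by
  unfold evNum
  rw [← Finset.prod_mul_distrib, ← Finset.prod_mul_distrib]
  refine Finset.prod_congr rfl fun j _ => ?_
  have h1 := jk_re_nonpos j hk
  have e1 := ev_sub h ha hb (x := g 0 + g 1 + j*k) (by
    simp only [Complex.add_re, re_jk]; linarith [hg 0, hg 1])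
  have e2 := ev_sub h ha hb (x := gS b g 2 + gS b g 3 + j*k) (by
    simp only [Complex.add_re, re_jk]; linarith [hg' 2, hg' 3])
  have g0 : gS b g 0 = g 0 - b/2 := by simp [gS, ee]; ring
  have g1 : gS b g 1 = g 1 - b/2 := by simp [gS, ee]; ring
  have g2 : gS b g 2 = g 2 + b/2 := by simp [gS, ee]
  have g3 : gS b g 3 = g 3 + b/2 := by simp [gS, ee]
  rw [g2, g3] at e2 ⊢
  rw [g0, g1]
  rw [show (j:ℂ)*k + (g 0 - b/2) + (g 1 - b/2) = g 0 + g 1 + j*k - b by ring, e1,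
    show (j:ℂ)*k + (g 0 - b/2) + (g 2 + b/2) = j*k + g 0 + g 2 by ring,
    show (j:ℂ)*k + (g 0 - b/2) + (g 3 + b/2) = j*k + g 0 + g 3 by ring,
    show (j:ℂ)*k + (g 1 - b/2) + (g 2 + b/2) = j*k + g 1 + g 2 by ring,
    show (j:ℂ)*k + (g 1 - b/2) + (g 3 + b/2) = j*k + g 1 + g 3 by ring,
    show (j:ℂ)*k + g 2 + g 3 = g 2 + b/2 + (g 3 + b/2) + j*k - b by ring, e2,
    show (j:ℂ)*k + (g 2 + b/2) + (g 3 + b/2) = g 2 + b/2 + (g 3 + b/2) + j*k by ring,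
    show (j:ℂ)*k + g 0 + g 1 = g 0 + g 1 + j*k by ring]
  ring

theorem ratio_gS (h : HypFE) (H : Adm a b g k) {n : ℕ}
    (hn : 0 < (a+b+∑ r, g r).re + 2*n*k.re) (hg' : ∀ r, (gS b g r).re < 0) :
    ratio n a b (gS b g) k = ratio n a b g k := by
  have N0 := evNum_ne_zero h H hn
  have N1 := evNum_ne_zero h (g := gS b g) (n := n)
    ⟨H.ha, H.hb, hg', by rw [sum_gS]; exact H.hc, H.hk, H.hkab⟩ (by rwa [sum_gS])
  have r1 := IBC_rel (n := n) h H hg'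
  have r2 := evNum_rel h H.ha H.hb H.hk H.hg hg' n
  simp only [Finset.prod_mul_distrib] at r2
  have hS : (∏ j ∈ Finset.range n,
      Complex.sinh (Complex.I*Real.pi*(gS b g 2 + gS b g 3 + j*k)/a)) ≠ 0 := by
    refine Finset.prod_ne_zero_iff.2 fun j hj => ?_
    intro hs
    have h1 := jk_re_nonpos j H.hk
    have e2 := ev_sub h H.ha H.hb (x := gS b g 2 + gS b g 3 + j*k) (by
      simp only [Complex.add_re, re_jk]; linarith [hg' 2, hg' 3])
    rw [hs, mul_zero, zero_mul] at e2
    have g2 : gS b g 2 = g 2 + b/2 := by simp [gS, ee]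
    have g3 : gS b g 3 = g 3 + b/2 := by simp [gS, ee]
    rw [g2, g3, show g 2 + b/2 + (g 3 + b/2) + j*k - b = j*k + g 2 + g 3 by ring] at e2
    have := Finset.prod_ne_zero_iff.1 N0 j hj
    rw [e2] at this
    simp at this
  have hc : (∏ j ∈ Finset.range n, (2:ℂ)) * (∏ j ∈ Finset.range n, Complex.I) ≠ 0 := by
    simp
  unfold ratio
  rw [sum_gS, div_eq_div_iff N1 N0]
  generalize (∏ j ∈ Finset.range n,
      Complex.sinh (Complex.I*Real.pi*(gS b g 2 + gS b g 3 + j*k)/a)) = S' at *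
  generalize (∏ j ∈ Finset.range n,
      Complex.sinh (Complex.I*Real.pi*(g 0 + g 1 + j*k)/a)) = S at *
  generalize (∏ j ∈ Finset.range n, (2:ℂ)) * (∏ j ∈ Finset.range n, Complex.I) = t at *
  have r3 : S' * evNum n a b (gS b g) k = S * evNum n a b g k :=
    mul_left_cancel₀ hc (by linear_combination r2)
  refine mul_left_cancel₀ hS ?_
  linear_combination (-evDen n a b (∑ r, g r) k * evNum n a b g k) * r1 -
    evDen n a b (∑ r, g r) k * IBC n a b g k * r3

theorem evNum_symm (h : HypFE) (ha : 0 < a.re) (hb : 0 < b.re) (hk : k.re < 0)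
    (hg : ∀ r, (g r).re < 0) (n : ℕ) : evNum n a b g k = evNum n b a g k := by
  unfold evNum
  refine Finset.prod_congr rfl fun j _ => ?_
  have h1 := jk_re_nonpos j hk
  have key : ∀ r s : Fin 4, ev a b (j*k + g r + g s) = ev b a (j*k + g r + g s) := fun r s =>
    ev_symm h ha hb (by simp only [Complex.add_re, re_jk]; linarith [hg r, hg s])
  rw [key, key, key, key, key, key, ev_symm h ha hb (by rw [re_succ_mul]; linarith)]

theorem evDen_symm (h : HypFE) {S : ℂ} (ha : 0 < a.re) (hb : 0 < b.re) (hk : k.re < 0)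
    (hS : S.re < 0) (n : ℕ) : evDen n a b S k = evDen n b a S k := by
  unfold evDen
  refine Finset.prod_congr rfl fun j hj => ?_
  rw [ev_symm h ha hb hk, ev_symm h ha hb (by
    rw [Complex.add_re, re_coeff_mul]
    linarith [coeff_mul_re_nonpos (Finset.mem_range.1 hj) hk])]

theorem sum_re_neg (hg : ∀ r, (g r).re < 0) : (∑ r, g r).re < 0 := by
  rw [Fin.sum_univ_four]; simp only [Complex.add_re]; linarith [hg 0, hg 1, hg 2, hg 3]

theorem ratio_symm (h : HypFE) (H : Adm a b g k) (n : ℕ) : ratio n a b g k = ratio n b a g k := by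
  unfold ratio
  rw [IBC_symm h H.ha H.hb H.hg H.hk, evNum_symm h H.ha H.hb H.hk H.hg,
    evDen_symm h H.ha H.hb H.hk (sum_re_neg H.hg)]

theorem Adm.symm (H : Adm a b g k) : Adm b a g k :=
  ⟨H.hb, H.ha, H.hg, by rw [add_comm b a, mul_comm b a]; exact H.hc, H.hk, by
    rw [mul_comm b a]; exact H.hkab⟩

theorem ratio_gS' (h : HypFE) (H : Adm a b g k) {n : ℕ}
    (hn : 0 < (a+b+∑ r, g r).re + 2*n*k.re) (hg' : ∀ r, (gS a g r).re < 0) :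
    ratio n a b (gS a g) k = ratio n a b g k := by
  rw [ratio_symm h H, ← ratio_gS h H.symm (by rwa [add_comm b a]) hg']
  exact ratio_symm h ⟨H.ha, H.hb, hg', by rw [sum_gS]; exact H.hc, H.hk, H.hkab⟩ n

end

/-- An entire function with two real-independent periods is constant. -/
theorem eq_of_two_periods {F : ℂ → ℂ} (hF : Differentiable ℂ F) {w1 w2 : ℂ} (h1 : w1 ≠ 0)
    (hind : (w2/w1).im ≠ 0) (p1 : Function.Periodic F w1) (p2 : Function.Periodic F w2) (z w : ℂ) :
    F z = F w := by
  refine hF.apply_eq_apply_of_bounded ?_ z w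
  have hK : IsCompact ((fun p : ℝ × ℝ => (p.1:ℂ)*w1 + (p.2:ℂ)*w2) '' (Icc 0 1 ×ˢ Icc 0 1)) :=
    (isCompact_Icc.prod isCompact_Icc).image (by fun_prop)
  refine (hK.image hF.continuous).isBounded.subset ?_
  rintro _ ⟨z, rfl⟩
  set y : ℝ := (z/w1).im / (w2/w1).im with hy
  set x : ℝ := (z/w1).re - y * (w2/w1).re with hx
  have hz : z = x*w1 + y*w2 := by
    have : z/w1 = x + y*(w2/w1) := by
      apply Complex.ext
      · simp [hx]
      · simp [hy, hind]
    rw [div_eq_iff h1] at this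
    rw [this]; field_simp
  refine ⟨_, ⟨(Int.fract x, Int.fract y), ⟨⟨Int.fract_nonneg _, (Int.fract_lt_one _).le⟩,
    ⟨Int.fract_nonneg _, (Int.fract_lt_one _).le⟩⟩, rfl⟩, ?_⟩
  have e : z - ⌊x⌋ • w1 - ⌊y⌋ • w2 = ((Int.fract x:ℝ):ℂ)*w1 + ((Int.fract y:ℝ):ℂ)*w2 := by
    rw [← Int.self_sub_floor x, ← Int.self_sub_floor y]
    push_cast; simp only [zsmul_eq_mul]; rw [hz]; ring
  simp only
  rw [← e, p2.sub_zsmul_eq, p1.sub_zsmul_eq]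

/-- A holomorphic function on a vertical strip with two real-independent partial periods shorter
than the width of the strip is constant. -/
theorem eq_of_strip_periods {w1 w2 : ℂ} (h1 : 0 < w1.re) (h2 : 0 < w2.re)
    (hind : (w2/w1).im ≠ 0) {H : ℝ} (hH1 : w1.re < 2*H) (hH2 : w2.re < 2*H) {f : ℂ → ℂ}
    (hf : DifferentiableOn ℂ f {z | |z.re| < H})
    (p1 : ∀ z : ℂ, |z.re| < H → |(z-w1).re| < H → f (z-w1) = f z)
    (p2 : ∀ z : ℂ, |z.re| < H → |(z-w2).re| < H → f (z-w2) = f z) :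
    ∀ z : ℂ, |z.re| < H → f z = f 0 := by
  have hw1 : w1 ≠ 0 := fun h => by simp [h] at h1
  have oS : IsOpen {z : ℂ | |z.re| < H} :=
    isOpen_lt (Complex.continuous_re.abs) continuous_const
  have hN : ∀ m : ℕ, ∀ z : ℂ, |z.re| < H → |(z - m*w1).re| < H → f (z - m*w1) = f z := by
    intro m
    induction m with
    | zero => intro z _ _; simp
    | succ m ih =>
      intro z hz hm
      have e : z - ((m+1:ℕ):ℂ)*w1 = z - m*w1 - w1 := by push_cast; ring
      have hmid : |(z - m*w1).re| < H := by
        rw [e] at hm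
        have hm0 : (0:ℝ) ≤ m * w1.re := by positivity
        simp only [Complex.sub_re, Complex.mul_re, Complex.natCast_re, Complex.natCast_im, zero_mul,
          sub_zero, abs_lt] at hm hz ⊢
        constructor <;> linarith [hm.1, hm.2, hz.1, hz.2]
      rw [e, p1 _ hmid (by rwa [← e]), ih z hz hmid]
  have hZ : ∀ m : ℤ, ∀ z : ℂ, |z.re| < H → |(z - m*w1).re| < H → f (z - m*w1) = f z := by
    intro m z hz hm
    obtain ⟨l, rfl | rfl⟩ := m.eq_nat_or_neg
    · simpa using hN l z hz (by simpa using hm)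
    · have := hN l (z - ((-(l:ℤ):ℤ):ℂ)*w1) hm (by push_cast; ring_nf; simpa using hz)
      rw [← this]; congr 1; push_cast; ring
  set F : ℂ → ℂ := fun z => f (z - (⌊z.re/w1.re + 1/2⌋ : ℤ)*w1) with hFdef
  have hidx : ∀ z : ℂ, |(z - (⌊z.re/w1.re + 1/2⌋ : ℤ)*w1).re| < H := by
    intro z
    set t := z.re/w1.re with ht
    have hz : z.re = t * w1.re := by rw [ht]; field_simp
    have e1 := Int.floor_le (t + 1/2)
    have e2 := Int.lt_floor_add_one (t + 1/2)
    have : (z - (⌊t + 1/2⌋ : ℤ)*w1).re = (t - ⌊t+1/2⌋) * w1.re := by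
      simp [hz]; ring
    rw [this, abs_lt]
    constructor <;> nlinarith
  have hFm : ∀ (m : ℤ) (z : ℂ), |(z - m*w1).re| < H → F z = f (z - m*w1) := by
    intro m z hm
    have := hZ (⌊z.re/w1.re + 1/2⌋ - m) (z - m*w1) hm (by
      have := hidx z
      rwa [show z - m*w1 - ((⌊z.re/w1.re + 1/2⌋ - m : ℤ):ℂ)*w1 =
        z - (⌊z.re/w1.re + 1/2⌋ : ℤ)*w1 by push_cast; ring])
    rw [← this, hFdef]
    simp only
    congr 1; push_cast; ring
  have hF : Differentiable ℂ F := by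
    intro z
    have hz := hidx z
    set m := ⌊z.re/w1.re + 1/2⌋
    have hev : F =ᶠ[𝓝 z] fun z => f (z - m*w1) := by
      have : ContinuousAt (fun z : ℂ => z - m*w1) z := by fun_prop
      filter_upwards [this.preimage_mem_nhds (oS.mem_nhds hz)] with y hy using hFm m y hy
    refine DifferentiableAt.congr_of_eventuallyEq ?_ hev
    exact DifferentiableAt.comp (f := fun z => z - m*w1) z
      ((hf _ hz).differentiableAt (oS.mem_nhds hz)) (by fun_prop)
  have hFp1 : Function.Periodic F w1 := fun z => by
    have hz := hidx z
    rw [hFm _ z hz, hFm (⌊z.re/w1.re + 1/2⌋ + 1) (z + w1) (by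
      convert hz using 3; push_cast; ring)]
    congr 1; push_cast; ring
  have hS : ∀ z : ℂ, |z.re| < H → F z = f z := fun z hz => by
    have := hFm 0 z (by simpa using hz)
    simpa using this
  have hFp2 : Function.Periodic F w2 := by
    have hcomp : Differentiable ℂ (fun z => F (z + w2)) := fun z =>
      DifferentiableAt.comp (f := fun z => z + w2) z (hF _) (by fun_prop)
    have he : (fun z => F (z + w2)) =ᶠ[𝓝 (-w2/2)] F := by
      have r2 : ∀ s : ℝ, ((s:ℂ)*w2).re = s*w2.re := fun s => by simp
      have c1 : |(-w2/2).re| < H := by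
        rw [show -w2/2 = ((-1/2:ℝ):ℂ)*w2 by push_cast; ring, r2, abs_lt]
        constructor <;> linarith
      have c2 : |(-w2/2 + w2).re| < H := by
        rw [show -w2/2 + w2 = ((1/2:ℝ):ℂ)*w2 by push_cast; ring, r2, abs_lt]
        constructor <;> linarith
      have : ContinuousAt (fun z : ℂ => z + w2) (-w2/2) := by fun_prop
      filter_upwards [oS.mem_nhds c1, this.preimage_mem_nhds (oS.mem_nhds c2)] with z hz1 hz2
      have hz2' : |(z+w2).re| < H := hz2
      rw [hS _ hz1, hS _ hz2', ← p2 (z+w2) hz2' (by simpa using hz1), add_sub_cancel_right]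
    have := AnalyticOnNhd.eq_of_eventuallyEq
      (hcomp.differentiableOn.analyticOnNhd isOpen_univ)
      (hF.differentiableOn.analyticOnNhd isOpen_univ) he
    exact fun z => congrFun this z
  intro z hz
  rw [← hS z hz, ← hS 0 (by simpa using by linarith)]
  exact eq_of_two_periods hF hw1 hind hFp1 hFp2 z 0

section
variable {a b k : ℂ} {n : ℕ}

theorem differentiableOn_evNum (h : HypFE) {g : ℂ → Fin 4 → ℂ} {k : ℂ → ℂ} {U : Set ℂ}
    (hU : IsOpen U) (H : ∀ p ∈ U, Adm a b (g p) (k p))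
    (dg : ∀ r, DifferentiableOn ℂ (fun p => g p r) U) (dk : DifferentiableOn ℂ k U) :
    DifferentiableOn ℂ (fun p => evNum n a b (g p) (k p)) U := by
  intro p hp
  obtain ⟨ha, hb, hg, -, hk, -⟩ := H p hp
  have dg' : ∀ r, DifferentiableAt ℂ (fun p => g p r) p := fun r =>
    (dg r p hp).differentiableAt (hU.mem_nhds hp)
  have dk' := (dk p hp).differentiableAt (hU.mem_nhds hp)
  refine DifferentiableAt.differentiableWithinAt ?_
  unfold evNum
  refine DifferentiableAt.fun_finsetProd fun j _ => ?_
  have h1 := jk_re_nonpos j hk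
  have key : ∀ r s : Fin 4, DifferentiableAt ℂ (fun p => ev a b (j*k p + g p r + g p s)) p :=
    fun r s => differentiableAt_ev h ha hb
      (by simp only [Complex.add_re, re_jk]; linarith [hg r, hg s])
      (((dk'.const_mul _).add (dg' r)).add (dg' s))
  have hl : DifferentiableAt ℂ (fun p => ev a b ((j+1)*k p)) p :=
    differentiableAt_ev h ha hb (by rw [re_succ_mul]; linarith) (dk'.const_mul _)
  exact ((((((key 0 1).mul (key 0 2)).mul (key 0 3)).mul (key 1 2)).mul (key 1 3)).mul
    (key 2 3)).mul hl

theorem differentiableOn_evDen (h : HypFE) {g : ℂ → Fin 4 → ℂ} {k : ℂ → ℂ} {U : Set ℂ}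
    (hU : IsOpen U) (H : ∀ p ∈ U, Adm a b (g p) (k p))
    (dg : ∀ r, DifferentiableOn ℂ (fun p => g p r) U) (dk : DifferentiableOn ℂ k U) :
    DifferentiableOn ℂ (fun p => evDen n a b (∑ r, g p r) (k p)) U := by
  intro p hp
  obtain ⟨ha, hb, hg, -, hk, -⟩ := H p hp
  have dg' : ∀ r, DifferentiableAt ℂ (fun p => g p r) p := fun r =>
    (dg r p hp).differentiableAt (hU.mem_nhds hp)
  have dk' := (dk p hp).differentiableAt (hU.mem_nhds hp)
  refine DifferentiableAt.differentiableWithinAt ?_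
  unfold evDen
  refine DifferentiableAt.fun_finsetProd fun j hj => ?_
  refine (differentiableAt_ev h ha hb hk dk').mul (differentiableAt_ev h ha hb ?_
    ((dk'.const_mul _).add (DifferentiableAt.fun_sum fun r _ => dg' r)))
  rw [Complex.add_re, re_coeff_mul]
  linarith [coeff_mul_re_nonpos (Finset.mem_range.1 hj) hk, sum_re_neg hg]

/-- Symmetric parametrization of the four couplings with sum `4p`. -/
def gsym (p al x : ℂ) : Fin 4 → ℂ := ![p+al+x, p+al-x, p-al+x, p-al-x]

theorem sum_gsym (p al x : ℂ) : ∑ r, gsym p al x r = 4*p := by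
  simp [gsym, Fin.sum_univ_four]; ring

theorem gS_gsym (b p al x : ℂ) : gS b (gsym p al x) = gsym p (al - b/2) x := by
  funext r
  fin_cases r <;> simp [gS, gsym, ee] <;> ring

theorem gsym_re_neg {p al x : ℂ} (hx : |al.re| + |x.re| < -p.re) : ∀ r, (gsym p al x r).re < 0 := by
  have h1 := abs_lt.1 (show |al.re| < -p.re - |x.re| by linarith)
  have h2 := le_abs_self x.re
  have h3 := neg_abs_le x.re
  intro r
  fin_cases r <;> simp [gsym] <;> linarith

/-- Parameters for which all arguments in the evaluation formula lie in the strip. -/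
structure Base (n : ℕ) (a b p k : ℂ) : Prop where
  ha : 0 < a.re
  hb : 0 < b.re
  hc : 0 < ((a+b+4*p)/(a*b)).re
  hk : k.re < 0
  hkab : 0 < (k/(a*b)).re
  hn : 0 < (a+b+4*p).re + 2*n*k.re
  hca : (a+b+4*p).re < a.re
  hcb : (a+b+4*p).re < b.re

variable {p al x : ℂ}

theorem Base.adm (B : Base n a b p k) (hx : |al.re| + |x.re| < -p.re) :
    Adm a b (gsym p al x) k :=
  ⟨B.ha, B.hb, gsym_re_neg hx, by rw [sum_gsym]; exact B.hc, B.hk, B.hkab⟩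

theorem Base.hn' (B : Base n a b p k) (al x : ℂ) :
    0 < (a+b+∑ r, gsym p al x r).re + 2*n*k.re := by
  rw [sum_gsym]; exact B.hn

theorem Base.p_neg (B : Base n a b p k) : p.re < 0 := by
  have := B.hca
  simp at this
  linarith [B.hb]

theorem Base.ratio_eq (h : HypFE) (B : Base n a b p k) (hab : (a/b).im ≠ 0)
    (hxa : 4*|x.re| + (a+b+4*p).re < a.re) (hxb : 4*|x.re| + (a+b+4*p).re < b.re)
    (hx : |al.re| + |x.re| < -p.re) :
    ratio n a b (gsym p al x) k = ratio n a b (gsym p 0 x) k := by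
  set H := -p.re - |x.re|
  have hU : IsOpen {z : ℂ | |z.re| < H} :=
    isOpen_lt (Complex.continuous_re.abs) continuous_const
  have hs : (a+b+4*p).re = a.re + b.re + 4*p.re := by simp
  have r2 : ∀ s : ℂ, (s/2).re = s.re/2 := fun s => by simp
  have hA : ∀ z ∈ {z : ℂ | |z.re| < H}, Adm a b (gsym p z x) k := fun z hz =>
    B.adm (by have : |z.re| < H := hz; linarith)
  have dg : ∀ r, DifferentiableOn ℂ (fun z => gsym p z x r) {z : ℂ | |z.re| < H} := fun r => by
    fin_cases r <;> simp [gsym] <;> fun_prop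
  refine eq_of_strip_periods (w1 := b/2) (w2 := a/2) (H := H)
    (f := fun z => ratio n a b (gsym p z x) k) ?_ ?_ ?_ ?_ ?_ ?_ ?_ ?_ al ?_
  · rw [r2]; linarith [B.hb]
  · rw [r2]; linarith [B.ha]
  · rwa [div_div_div_cancel_right₀ two_ne_zero]
  · rw [r2]; linarith
  · rw [r2]; linarith
  · refine DifferentiableOn.div ((differentiableOn_IBC h hU hA dg (differentiableOn_const _)).mul
      (differentiableOn_evDen h hU hA dg (differentiableOn_const _)))
      (differentiableOn_evNum h hU hA dg (differentiableOn_const _)) fun z hz =>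
        evNum_ne_zero h (hA z hz) (B.hn' _ _)
  · intro z hz hz'
    have := ratio_gS (n := n) h (hA z hz) (B.hn' _ _) (by rw [gS_gsym]; exact (hA _ hz').hg)
    rwa [gS_gsym] at this
  · intro z hz hz'
    have := ratio_gS' (n := n) h (hA z hz) (B.hn' _ _) (by rw [gS_gsym]; exact (hA _ hz').hg)
    rwa [gS_gsym] at this
  · linarith

theorem ratio_swap (n : ℕ) (a b p k al x : ℂ) :
    ratio n a b (gsym p al x) k = ratio n a b (gsym p x al) k := by
  have e : gsym p al x = fun r => gsym p x al (Equiv.swap 1 2 r) := by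
    have s0 : Equiv.swap (1:Fin 4) 2 0 = 0 := by decide
    have s3 : Equiv.swap (1:Fin 4) 2 3 = 3 := by decide
    funext r
    fin_cases r <;> simp [gsym, s0, s3] <;> ring
  unfold ratio
  rw [sum_gsym, sum_gsym]
  have e1 : IBC n a b (gsym p al x) k = IBC n a b (gsym p x al) k := by
    rw [e, IBC_perm]
  have e2 : evNum n a b (gsym p al x) k = evNum n a b (gsym p x al) k := by
    unfold evNum
    refine Finset.prod_congr rfl fun j _ => ?_
    simp only [gsym, Matrix.cons_val_zero, Matrix.cons_val_one, Matrix.cons_val]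
    rw [show (j:ℂ)*k + (p+al+x) + (p+al-x) = j*k + (p+x+al) + (p-x+al) by ring,
      show (j:ℂ)*k + (p+al+x) + (p-al+x) = j*k + (p+x+al) + (p+x-al) by ring,
      show (j:ℂ)*k + (p+al+x) + (p-al-x) = j*k + (p+x+al) + (p-x-al) by ring,
      show (j:ℂ)*k + (p+al-x) + (p-al+x) = j*k + (p+x-al) + (p-x+al) by ring,
      show (j:ℂ)*k + (p+al-x) + (p-al-x) = j*k + (p-x+al) + (p-x-al) by ring,
      show (j:ℂ)*k + (p-al+x) + (p-al-x) = j*k + (p+x-al) + (p-x-al) by ring]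
    ring
  rw [e1, e2]

theorem Base.ratio_eq_zero (h : HypFE) (B : Base n a b p k) (hab : (a/b).im ≠ 0)
    (hxa : 4*|x.re| + (a+b+4*p).re < a.re) (hxb : 4*|x.re| + (a+b+4*p).re < b.re)
    (hx : |al.re| + |x.re| < -p.re) :
    ratio n a b (gsym p al x) k = ratio n a b (gsym p 0 0) k := by
  rw [B.ratio_eq h hab hxa hxb hx, ratio_swap, B.ratio_eq h hab (by simpa using B.hca)
    (by simpa using B.hcb)]
  have := abs_nonneg al.re
  simp; linarith

end

section
theorem pairProd_eq_ite {n : ℕ} (f : Fin n → Fin n → ℂ) :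
    pairProd f = ∏ i, ∏ j, if i < j then f i j else 1 := by
  unfold pairProd
  refine Finset.prod_congr rfl fun i _ => ?_
  rw [Finset.prod_ite]
  simp only [Finset.prod_const_one, mul_one]
  refine Finset.prod_congr ?_ fun _ _ => rfl
  ext j; simp

theorem pairProd_succAbove {n : ℕ} (m : Fin (n+1)) (g : Fin (n+1) → Fin (n+1) → ℂ)
    (hg : ∀ i j, g i j = g j i) :
    pairProd g = (∏ j, g m (m.succAbove j)) *
      pairProd (fun i j => g (m.succAbove i) (m.succAbove j)) := by
  rw [pairProd_eq_ite, pairProd_eq_ite, Fin.prod_univ_succAbove _ m, Fin.prod_univ_succAbove _ m]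
  simp only [Fin.prod_univ_succAbove (fun j => if (_ : Fin (n+1)) < j then g _ j else 1) m,
    Fin.succAbove_lt_succAbove_iff, Finset.prod_mul_distrib, lt_irrefl, if_false, one_mul]
  rw [← mul_assoc, ← Finset.prod_mul_distrib]
  congr 1
  refine Finset.prod_congr rfl fun j _ => ?_
  rcases lt_or_gt_of_ne (Fin.succAbove_ne m j) with hj | hj
  · rw [if_neg (not_lt.2 hj.le), if_pos hj, one_mul, hg]
  · rw [if_neg (not_lt.2 hj.le), if_pos hj, mul_one]

variable {n : ℕ}

/-- The integrand in dimension `n + 1` with one distinguished coordinate. -/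
def IntS (n : ℕ) (A V : ℝ → ℂ) (x : ℝ) (w : Fin n → ℝ) : ℂ :=
  A x * (∏ j, V (x + w j) * V (x - w j)) * IntG n A V V w

theorem IntG_insertNth {A V : ℝ → ℂ} (hV : ∀ x, V (-x) = V x) (i : Fin (n+1)) (x : ℝ)
    (w : Fin n → ℝ) : IntG (n+1) A V V (i.insertNth x w) = IntS n A V x w := by
  have hs : ∀ (v : Fin (n+1) → ℝ) k l, V (v k + v l) * V (v k - v l) = V (v l + v k) * V (v l - v k) :=
    fun v k l => by rw [← hV (v k - v l), neg_sub, add_comm (v k)]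
  unfold IntG IntS
  rw [pairProd_succAbove i _ (hs _), Fin.prod_univ_succAbove _ i]
  simp only [Fin.insertNth_apply_same, Fin.insertNth_apply_succAbove]
  unfold IntG
  ring

theorem ae_abs_lt : ∀ᵐ v : Fin (n+1) → ℝ,
    ∃! i, ∀ j : Fin n, |v i| < |v (i.succAbove j)| := by
  filter_upwards [ae_generic (n := n+1)] with v hv
  obtain ⟨i, -, hi⟩ := Finset.exists_min_image Finset.univ (fun i => |v i|) ⟨0, Finset.mem_univ _⟩
  have key : ∀ k l, k ≠ l → |v k| ≠ |v l| := fun k l hkl he => by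
    rcases abs_eq_abs.1 he with h | h
    · exact hv.2.2 k l hkl (sub_eq_zero.2 h)
    · exact hv.2.1 k l hkl (by rw [h]; ring)
  refine ⟨i, fun j => lt_of_le_of_ne (hi _ (Finset.mem_univ _)) (key _ _ (Fin.succAbove_ne i j).symm),
    fun k hk => ?_⟩
  by_contra hne
  obtain ⟨j, hj⟩ := Fin.exists_succAbove_eq (show i ≠ k from fun h => hne h.symm)
  have := hk j
  rw [hj] at this
  exact absurd (hi k (Finset.mem_univ _)) (not_le.2 this)

/-- The region where the distinguished coordinate is the smallest in absolute value. -/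
def smallSet (n : ℕ) : Set (ℝ × (Fin n → ℝ)) := {p | ∀ j, |p.1| < |p.2 j|}

theorem measurableSet_smallSet : MeasurableSet (smallSet n) := by
  have : smallSet n = ⋂ j, {p : ℝ × (Fin n → ℝ) | |p.1| < |p.2 j|} := by
    ext p; simp [smallSet]
  rw [this]
  refine MeasurableSet.iInter fun j => (isOpen_lt ?_ ?_).measurableSet
  · exact continuous_fst.abs
  · exact ((continuous_apply j).comp continuous_snd).abs

theorem integrable_IntS {A V : ℝ → ℂ} (hV : ∀ x, V (-x) = V x)
    (hI : Integrable (IntG (n+1) A V V)) :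
    Integrable (fun p : ℝ × (Fin n → ℝ) => IntS n A V p.1 p.2) := by
  have := (volume_preserving_piFinSuccAbove (fun _ : Fin (n+1) => ℝ) 0).symm
  have h2 := (this.integrable_comp_emb (MeasurableEquiv.measurableEmbedding _)).2 hI
  refine h2.congr (Eventually.of_forall fun p => ?_)
  have := IntG_insertNth (A := A) hV 0 p.1 p.2
  simpa [MeasurableEquiv.piFinSuccAbove_symm_apply, Fin.insertNthEquiv] using this

theorem integral_IntG_succ {A V : ℝ → ℂ} (hV : ∀ x, V (-x) = V x)
    (hI : Integrable (IntG (n+1) A V V)) :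
    ∫ v, IntG (n+1) A V V v = (n+1) * ∫ p, (smallSet n).indicator
      (fun p : ℝ × (Fin n → ℝ) => IntS n A V p.1 p.2) p := by
  have hmp := fun i : Fin (n+1) => volume_preserving_piFinSuccAbove (fun _ : Fin (n+1) => ℝ) i
  have hsym : ∀ i (v : Fin (n+1) → ℝ), IntS n A V (v i) (fun j => v (i.succAbove j)) =
      IntG (n+1) A V V v := fun i v => by
    rw [← IntG_insertNth hV i]
    congr 1
    exact Fin.insertNth_self_removeNth i v
  have h1 : ∀ i, ∫ v : Fin (n+1) → ℝ, (smallSet n).indicator (fun p : ℝ × (Fin n → ℝ) => IntS n A V p.1 p.2)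
      (v i, fun j => v (i.succAbove j)) = ∫ p, (smallSet n).indicator
      (fun p : ℝ × (Fin n → ℝ) => IntS n A V p.1 p.2) p := fun i =>
    (hmp i).integral_comp' _
  have h2 : ∀ i, Integrable fun v : Fin (n+1) → ℝ => (smallSet n).indicator
      (fun p : ℝ × (Fin n → ℝ) => IntS n A V p.1 p.2) (v i, fun j => v (i.succAbove j)) := fun i =>
    ((hmp i).integrable_comp_emb (MeasurableEquiv.measurableEmbedding _)).2
      ((integrable_IntS hV hI).indicator measurableSet_smallSet)
  calc ∫ v, IntG (n+1) A V V v = ∫ v : Fin (n+1) → ℝ, ∑ i, (smallSet n).indicator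
        (fun p : ℝ × (Fin n → ℝ) => IntS n A V p.1 p.2) (v i, fun j => v (i.succAbove j)) := by
        refine integral_congr_ae ?_
        filter_upwards [ae_abs_lt (n := n)] with v ⟨i, hi, hu⟩
        rw [Finset.sum_eq_single i]
        · rw [indicator_of_mem (show (v i, fun j => v (i.succAbove j)) ∈ smallSet n from fun j => hi j)]
          exact (hsym i v).symm
        · intro k _ hk
          exact indicator_of_notMem (fun h : _ ∈ smallSet n => hk (hu k fun j => h j)) _
        · simp
    _ = ∑ i : Fin (n+1), ∫ v : Fin (n+1) → ℝ, (smallSet n).indicator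
        (fun p : ℝ × (Fin n → ℝ) => IntS n A V p.1 p.2) (v i, fun j => v (i.succAbove j)) :=
        integral_finsetSum _ fun i _ => h2 i
    _ = _ := by simp [h1]

end

section
variable {n : ℕ}

theorem integrable_IntG_pinch {A V : ℝ → ℂ} {C K η ε : ℝ} (hη : 0 < η) (hC : 0 ≤ C) (hε : 0 < ε)
    (cA : Continuous A) (cV : Continuous V) (hK : ∀ x, ‖V x‖ ≤ K)
    (hA : ∀ x, ‖A x‖ ≤ C * (x^2/(x^2+ε^2)^2) * Real.exp (-(η*|x|))) :
    Integrable (IntG n A V V) := by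
  have hA' : ∀ x, ‖A x‖ ≤ (C/ε^2) * Real.exp (-(η*|x|)) := fun x => by
    refine (hA x).trans (mul_le_mul_of_nonneg_right ?_ (Real.exp_pos _).le)
    rw [div_eq_mul_one_div C]
    refine mul_le_mul_of_nonneg_left ?_ hC
    rw [div_le_div_iff₀ (by positivity) (by positivity)]
    nlinarith [sq_nonneg x, sq_nonneg (x^2), sq_nonneg (ε^2), mul_nonneg (sq_nonneg x) (sq_nonneg ε)]
  refine (integrable_IntG_bound (n := n) hη (C/ε^2) (∏ i : Fin n, ∏ _j ∈ Finset.Ioi i, K*K)).mono'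
    (continuous_IntG cA cV cV).aestronglyMeasurable (Eventually.of_forall fun v => ?_)
  exact norm_IntG_le hA' hK hK v

theorem norm_IntS_scaled_le {A V : ℝ → ℂ} {C K η ε t : ℝ} (hη : 0 < η) (hC : 0 ≤ C) (hε : 0 < ε)
    (hK : ∀ x, ‖V x‖ ≤ K) (hK2 : ∀ x, ‖V x‖ ≤ K*x^2)
    (hA : ∀ x, ‖A x‖ ≤ C * (x^2/(x^2+ε^2)^2) * Real.exp (-(η*|x|))) {w : Fin n → ℝ}
    (hw : (ε*t, w) ∈ smallSet n) :
    ε^2 * ‖IntS n A V (ε*t) w‖ ≤ (C * (1+t^2)⁻¹) * ((∏ j, (4*K^2*C) * Real.exp (-(η*|w j|))) *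
      ∏ i : Fin n, ∏ _j ∈ Finset.Ioi i, K*K) := by
  have hK0 : 0 ≤ K := (norm_nonneg _).trans (hK 0)
  have h1 : ε^2 * ‖A (ε*t)‖ ≤ C * (1+t^2)⁻¹ := by
    have e1 : Real.exp (-(η*|ε*t|)) ≤ 1 := Real.exp_le_one_iff.2 (by
      have := mul_nonneg hη.le (abs_nonneg (ε*t)); linarith)
    have e2 : ‖A (ε*t)‖ ≤ C * ((ε*t)^2/((ε*t)^2+ε^2)^2) :=
      (hA _).trans (mul_le_of_le_one_right (by positivity) e1)
    have e3 : ε^2 * ((ε*t)^2/((ε*t)^2+ε^2)^2) = t^2/(t^2+1)^2 := by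
      rw [show (ε*t)^2+ε^2 = ε^2*(t^2+1) by ring]
      field_simp
    have e4 : t^2/(t^2+1)^2 ≤ (1+t^2)⁻¹ := by
      rw [inv_eq_one_div, div_le_div_iff₀ (by positivity) (by positivity)]
      nlinarith [sq_nonneg t]
    calc ε^2 * ‖A (ε*t)‖ ≤ ε^2 * (C * ((ε*t)^2/((ε*t)^2+ε^2)^2)) := by gcongr
      _ = C * (t^2/(t^2+1)^2) := by rw [← e3]; ring
      _ ≤ _ := by gcongr
  have h2 : ∀ j, ‖V (ε*t + w j)‖ * ‖V (ε*t - w j)‖ * ‖A (w j)‖ ≤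
      (4*K^2*C) * Real.exp (-(η*|w j|)) := fun j => by
    have hj : |ε*t| < |w j| := hw j
    have hne : w j ≠ 0 := fun h => by
      rw [h, abs_zero] at hj
      exact absurd (abs_nonneg _) (not_le.2 hj)
    have f1 : ‖V (ε*t + w j)‖ ≤ K * (4*(w j)^2) := by
      refine (hK2 _).trans (mul_le_mul_of_nonneg_left ?_ hK0)
      have : |ε*t + w j| ≤ 2*|w j| := (abs_add_le _ _).trans (by linarith)
      have := sq_le_sq' (by linarith [abs_nonneg (ε*t + w j), abs_nonneg (w j)]) this
      rw [sq_abs] at this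
      rw [mul_pow, sq_abs] at this
      linarith
    have f2 : (w j)^2 * ((w j)^2/((w j)^2+ε^2)^2) ≤ 1 := by
      rw [← mul_div_assoc, div_le_one (by positivity)]
      nlinarith [sq_nonneg (w j), sq_nonneg ε, mul_nonneg (sq_nonneg (w j)) (sq_nonneg ε),
        sq_nonneg (ε^2)]
    calc ‖V (ε*t + w j)‖ * ‖V (ε*t - w j)‖ * ‖A (w j)‖
        ≤ (K * (4*(w j)^2)) * K * (C * ((w j)^2/((w j)^2+ε^2)^2) * Real.exp (-(η*|w j|))) := by
          gcongr
          · exact hK _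
          · exact hA _
      _ = (4*K^2*C) * Real.exp (-(η*|w j|)) * ((w j)^2 * ((w j)^2/((w j)^2+ε^2)^2)) := by ring
      _ ≤ _ := mul_le_of_le_one_right (by positivity) f2
  have h3 : ‖pairProd fun i j => V (w i + w j) * V (w i - w j)‖ ≤
      ∏ i : Fin n, ∏ _j ∈ Finset.Ioi i, K*K := norm_pairProd_le fun i j => by
    rw [norm_mul]
    exact mul_le_mul (hK _) (hK _) (norm_nonneg _) hK0
  have h4 : ε^2 * ‖IntS n A V (ε*t) w‖ = (ε^2 * ‖A (ε*t)‖) *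
      ((∏ j, ‖V (ε*t + w j)‖ * ‖V (ε*t - w j)‖ * ‖A (w j)‖) *
      ‖pairProd fun i j => V (w i + w j) * V (w i - w j)‖) := by
    unfold IntS IntG
    rw [norm_mul, norm_mul, norm_mul, norm_prod, norm_prod, Finset.prod_mul_distrib]
    simp only [norm_mul]
    ring
  rw [h4]
  refine mul_le_mul h1 (mul_le_mul ?_ h3 (norm_nonneg _) ?_) (by positivity) (by positivity)
  · exact Finset.prod_le_prod (fun _ _ => by positivity) fun j _ => h2 j
  · exact Finset.prod_nonneg fun _ _ => by positivity

theorem integral_scale_fst {H : ℝ × (Fin n → ℝ) → ℂ} (hH : Integrable H) {ε : ℝ} (hε : 0 < ε)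
    (hH' : Integrable fun p : ℝ × (Fin n → ℝ) => H (ε * p.1, p.2)) :
    ∫ p, H p = ε * ∫ p : ℝ × (Fin n → ℝ), H (ε * p.1, p.2) := by
  rw [Measure.volume_eq_prod] at *
  rw [integral_prod_symm _ hH, integral_prod_symm _ hH', ← integral_const_mul]
  refine integral_congr_ae (Eventually.of_forall fun w => ?_)
  show ∫ x, H (x, w) = ε * ∫ x, H (ε * x, w)
  rw [Measure.integral_comp_mul_left (fun x => H (x, w)), abs_of_pos (inv_pos.2 hε),
    Complex.real_smul, ← mul_assoc]
  push_cast
  rw [mul_inv_cancel₀ (by exact_mod_cast hε.ne'), one_mul]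

/-- Degeneration of a symmetric integral whose one-body factor develops a double pole at the
origin: one of the variables localizes there. -/
theorem tendsto_pinch {A : ℝ → ℝ → ℂ} {V A0 W : ℝ → ℂ} {C K η : ℝ} (hη : 0 < η) (hC : 0 ≤ C)
    (cV : Continuous V) (hV : ∀ x, V (-x) = V x) (hK : ∀ x, ‖V x‖ ≤ K)
    (hK2 : ∀ x, ‖V x‖ ≤ K*x^2)
    (hA : ∀ᶠ ε in 𝓝[>] 0, Continuous (A ε) ∧ ∀ x, ‖A ε x‖ ≤
      C * (x^2/(x^2+ε^2)^2) * Real.exp (-(η*|x|)))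
    (h0 : ∀ t, Tendsto (fun ε : ℝ => (ε:ℂ)^2 * A ε (ε*t)) (𝓝[>] 0) (𝓝 (A0 t)))
    (hW : ∀ x, x ≠ 0 → Tendsto (fun ε => A ε x * V x^2) (𝓝[>] 0) (𝓝 (W x))) :
    Tendsto (fun ε : ℝ => (ε:ℂ) * ∫ v, IntG (n+1) (A ε) V V v) (𝓝[>] 0)
      (𝓝 ((n+1) * ((∫ t, A0 t) * ∫ w, IntG n W V V w))) := by
  have hpos : ∀ᶠ ε : ℝ in 𝓝[>] 0, 0 < ε := eventually_mem_nhdsWithin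
  set F : ℝ → ℝ × (Fin n → ℝ) → ℂ := fun ε p => (ε:ℂ)^2 * (smallSet n).indicator
    (fun p : ℝ × (Fin n → ℝ) => IntS n (A ε) V p.1 p.2) (ε*p.1, p.2) with hF
  set bd : ℝ × (Fin n → ℝ) → ℝ := fun p => (C * (1+p.1^2)⁻¹) *
    ((∏ j, (4*K^2*C) * Real.exp (-(η*|p.2 j|))) * ∏ i : Fin n, ∏ _j ∈ Finset.Ioi i, K*K) with hbd
  have hbdI : Integrable bd := by
    rw [Measure.volume_eq_prod]
    exact (integrable_inv_one_add_sq.const_mul C).mul_prod (integrable_IntG_bound hη _ _)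
  have hK0 : 0 ≤ K := (norm_nonneg _).trans (hK 0)
  have hle : ∀ᶠ ε in 𝓝[>] 0, ∀ p, ‖F ε p‖ ≤ bd p := by
    filter_upwards [hpos, hA] with ε hε hA p
    rw [hF, norm_mul, norm_pow, Complex.norm_real, Real.norm_eq_abs, abs_of_pos hε]
    by_cases hp : (ε*p.1, p.2) ∈ smallSet n
    · rw [indicator_of_mem hp]
      exact norm_IntS_scaled_le hη hC hε hK hK2 hA.2 hp
    · rw [indicator_of_notMem hp]
      simp only [norm_zero, mul_zero, hbd]
      have : 0 ≤ ∏ j, (4*K^2*C) * Real.exp (-(η*|p.2 j|)) :=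
        Finset.prod_nonneg fun _ _ => by positivity
      positivity
  have hmeas : ∀ᶠ ε in 𝓝[>] 0, AEStronglyMeasurable (F ε) := by
    filter_upwards [hA] with ε hA
    have cS : Continuous fun p : ℝ × (Fin n → ℝ) => IntS n (A ε) V p.1 p.2 := by
      unfold IntS
      refine (Continuous.mul (hA.1.comp continuous_fst) (continuous_finsetProd _ fun j _ => ?_)).mul
        ((continuous_IntG hA.1 cV cV).comp continuous_snd)
      exact (cV.comp (by fun_prop)).mul (cV.comp (by fun_prop))
    have : Measurable fun p : ℝ × (Fin n → ℝ) => (ε*p.1, p.2) := by fun_prop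
    exact (((cS.measurable.indicator measurableSet_smallSet).comp this).const_mul _).aestronglyMeasurable
  have hlim : Tendsto (fun ε => ∫ p, F ε p) (𝓝[>] 0) (𝓝 (∫ p : ℝ × (Fin n → ℝ), A0 p.1 * IntG n W V V p.2)) := by
    refine tendsto_integral_filter_of_dominated_convergence bd hmeas
      (hle.mono fun ε h => Eventually.of_forall h) hbdI ?_
    have hae : ∀ᵐ p : ℝ × (Fin n → ℝ), ∀ j, p.2 j ≠ 0 := by
      rw [Measure.volume_eq_prod]
      exact Measure.quasiMeasurePreserving_snd.ae ((ae_generic (n := n)).mono fun w hw => hw.1)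
    filter_upwards [hae] with p hp
    have hε0 : Tendsto (fun ε : ℝ => ε*p.1) (𝓝[>] 0) (𝓝 0) := by
      have : Tendsto (fun ε : ℝ => ε*p.1) (𝓝 0) (𝓝 (0*p.1)) := (continuous_id.mul continuous_const).tendsto 0
      rw [zero_mul] at this
      exact this.mono_left nhdsWithin_le_nhds
    have hmem : ∀ᶠ ε : ℝ in 𝓝[>] 0, (ε*p.1, p.2) ∈ smallSet n := by
      have := eventually_all.2 fun j => (hε0.abs).eventually_lt_const
        (show |(0:ℝ)| < |p.2 j| by rw [abs_zero]; exact abs_pos.2 (hp j))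
      exact this
    have hprod : Tendsto (fun ε : ℝ => ((ε:ℂ)^2 * A ε (ε*p.1)) *
        ((∏ j, A ε (p.2 j) * (V (ε*p.1 + p.2 j) * V (ε*p.1 - p.2 j))) *
        pairProd fun i j => V (p.2 i + p.2 j) * V (p.2 i - p.2 j))) (𝓝[>] 0)
        (𝓝 (A0 p.1 * IntG n W V V p.2)) := by
      refine (h0 p.1).mul (Tendsto.mul_const _ (tendsto_finsetProd _ fun j _ => ?_))
      have hV1 : Tendsto (fun ε : ℝ => V (ε*p.1 + p.2 j) * V (ε*p.1 - p.2 j) - V (p.2 j)^2)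
          (𝓝[>] 0) (𝓝 0) := by
        have e1 := (cV.tendsto _).comp (hε0.add_const (p.2 j))
        have e2 := (cV.tendsto _).comp (hε0.sub_const (p.2 j))
        have := (e1.mul e2).sub_const (V (p.2 j)^2)
        rw [zero_add, zero_sub, hV, ← sq, sub_self] at this
        exact this
      have hb : ∀ᶠ ε in 𝓝[>] 0, ‖A ε (p.2 j)‖ ≤ C * ((p.2 j)^2)⁻¹ := by
        filter_upwards [hA] with ε hA
        have e1 : Real.exp (-(η*|p.2 j|)) ≤ 1 := Real.exp_le_one_iff.2 (by
          have := mul_nonneg hη.le (abs_nonneg (p.2 j)); linarith)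
        refine ((hA.2 _).trans (mul_le_of_le_one_right (by positivity) e1)).trans
          (mul_le_mul_of_nonneg_left ?_ hC)
        have := hp j
        rw [inv_eq_one_div, div_le_div_iff₀ (by positivity) (by positivity)]
        nlinarith [sq_nonneg (p.2 j), sq_nonneg ε, mul_nonneg (sq_nonneg (p.2 j)) (sq_nonneg ε),
          sq_nonneg (ε^2)]
      have hz : Tendsto (fun ε : ℝ => A ε (p.2 j) *
          (V (ε*p.1 + p.2 j) * V (ε*p.1 - p.2 j) - V (p.2 j)^2)) (𝓝[>] 0) (𝓝 0) := by
        refine squeeze_zero_norm' ?_ (by simpa using (hV1.norm.const_mul (C * ((p.2 j)^2)⁻¹)))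
        filter_upwards [hb] with ε hb
        rw [norm_mul]
        gcongr
      have := (hW _ (hp j)).add hz
      rw [add_zero] at this
      exact this.congr fun ε => by ring
    refine hprod.congr' ?_
    filter_upwards [hmem] with ε hε
    rw [hF]
    simp only
    rw [indicator_of_mem hε]
    unfold IntS IntG
    rw [Finset.prod_mul_distrib]
    ring
  rw [Measure.volume_eq_prod, integral_prod_mul] at hlim
  refine (hlim.const_mul ((n:ℂ)+1)).congr' ?_
  filter_upwards [hpos, hA, hle, hmeas] with ε hε hA hle hmeas
  have hI := integrable_IntG_pinch (n := n+1) hη hC hε hA.1 cV hK hA.2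
  have hFi : Integrable (F ε) := hbdI.mono' hmeas (Eventually.of_forall hle)
  have hε' : (ε:ℂ)^2 ≠ 0 := by exact_mod_cast (pow_pos hε 2).ne'
  have hFi' : Integrable fun p : ℝ × (Fin n → ℝ) => (smallSet n).indicator
      (fun p : ℝ × (Fin n → ℝ) => IntS n (A ε) V p.1 p.2) (ε*p.1, p.2) := by
    refine (hFi.const_mul ((ε:ℂ)^2)⁻¹).congr (Eventually.of_forall fun p => ?_)
    simp only [hF]
    rw [inv_mul_cancel_left₀ hε']
  rw [integral_IntG_succ hV hI, integral_scale_fst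
    ((integrable_IntS hV hI).indicator measurableSet_smallSet) hε hFi', ← Measure.volume_eq_prod]
  simp only [hF]
  rw [integral_const_mul]
  ring

theorem hasDerivAt_pinch (t : ℝ) : HasDerivAt (fun t : ℝ => (Real.arctan t - t/(1+t^2))/2)
    (t^2/(t^2+1)^2) t := by
  have h1 : (1 + t^2 : ℝ) ≠ 0 := by positivity
  have h2 : HasDerivAt (fun t : ℝ => 1 + t^2) (2*t) t := by
    simpa using (hasDerivAt_pow 2 t).const_add 1
  have := ((Real.hasDerivAt_arctan t).sub ((hasDerivAt_id t).div h2 h1)).div_const 2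
  refine this.congr_deriv ?_
  have h3 : (t^2 + 1 : ℝ) ≠ 0 := by positivity
  simp only [id]
  field_simp
  ring

theorem integral_pinch : ∫ t : ℝ, t^2/(t^2+1)^2 = Real.pi/2 := by
  have hd : ∀ l : Filter ℝ, Tendsto (fun t : ℝ => |t|) l atTop →
      Tendsto (fun t : ℝ => t/(1+t^2)) l (𝓝 0) := fun l hl => by
    have := tendsto_inv_atTop_zero.comp hl
    refine squeeze_zero_norm' ?_ this
    filter_upwards [hl.eventually_gt_atTop 0] with t ht
    rw [norm_div, Real.norm_eq_abs, Real.norm_eq_abs, abs_of_pos (show (0:ℝ) < 1+t^2 by positivity),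
      Function.comp_apply, inv_eq_one_div, div_le_div_iff₀ (by positivity) ht]
    nlinarith [sq_abs t]
  have hi : Integrable fun t : ℝ => t^2/(t^2+1)^2 := by
    refine integrable_inv_one_add_sq.mono' ?_ (Eventually.of_forall fun t => ?_)
    · refine Continuous.aestronglyMeasurable ?_
      refine Continuous.div (by fun_prop) (by fun_prop) fun t => by positivity
    · rw [Real.norm_eq_abs, abs_of_nonneg (by positivity), inv_eq_one_div,
        div_le_div_iff₀ (by positivity) (by positivity)]
      nlinarith [sq_nonneg t]
  have h1 := ((Real.tendsto_arctan_atBot.mono_right nhdsWithin_le_nhds).sub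
    (hd _ tendsto_abs_atBot_atTop)).div_const 2
  have h2 := ((Real.tendsto_arctan_atTop.mono_right nhdsWithin_le_nhds).sub
    (hd _ tendsto_abs_atTop_atTop)).div_const 2
  rw [integral_of_hasDerivAt_of_tendsto hasDerivAt_pinch hi h1 h2]
  ring

end

theorem norm_sinh_sub_self_le {w : ℂ} (hw : ‖w‖ ≤ 1) : ‖Complex.sinh w - w‖ ≤ ‖w‖^2 := by
  have h1 := Complex.norm_exp_sub_one_sub_id_le hw
  have h2 := Complex.norm_exp_sub_one_sub_id_le (x := -w) (by rwa [norm_neg])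
  rw [norm_neg] at h2
  have e : Complex.sinh w - w = ((Complex.exp w - 1 - w) - (Complex.exp (-w) - 1 - -w))/2 := by
    rw [Complex.sinh]; ring
  rw [e, norm_div, Complex.norm_ofNat]
  linarith [norm_sub_le (Complex.exp w - 1 - w) (Complex.exp (-w) - 1 - -w)]

theorem norm_sinh_le_mul (w : ℂ) : ‖Complex.sinh w‖ ≤ 2*‖w‖*Real.exp |w.re| := by
  have he : 1 ≤ Real.exp |w.re| := Real.one_le_exp (abs_nonneg _)
  rcases le_total ‖w‖ 1 with hw | hw
  · have h1 := norm_sinh_sub_self_le hw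
    have h2 : ‖Complex.sinh w‖ ≤ ‖w‖ + ‖w‖^2 := by
      linarith [norm_sub_norm_le (Complex.sinh w) w]
    nlinarith [norm_nonneg w]
  · have := norm_two_sinh_le w
    rw [norm_mul, Complex.norm_ofNat] at this
    nlinarith [norm_nonneg (Complex.sinh w)]

theorem sinh_abs_re_le_norm_sinh (w : ℂ) : Real.sinh |w.re| ≤ ‖Complex.sinh w‖ := by
  have h : ∀ w : ℂ, Real.sinh w.re ≤ ‖Complex.sinh w‖ := fun w => by
    have := norm_sub_norm_le (Complex.exp w) (Complex.exp (-w))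
    rw [Complex.norm_exp, Complex.norm_exp, Complex.neg_re] at this
    rw [Complex.sinh, norm_div, Complex.norm_ofNat, Real.sinh_eq]
    linarith
  rcases abs_cases w.re with ⟨h1, -⟩ | ⟨h1, -⟩
  · rw [h1]; exact h w
  · rw [h1]
    have := h (-w)
    rwa [Complex.sinh_neg, norm_neg, Complex.neg_re] at this

theorem exists_sinh_lower {κ : ℂ} (hκ : 0 < κ.re) : ∃ c ε0 : ℝ, 0 < c ∧ 0 < ε0 ∧ ∀ ε : ℝ,
    |ε| ≤ ε0 → ∀ x : ℝ, c * ‖(x:ℂ) + Complex.I*ε‖ * Real.exp (κ.re * |x|) ≤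
      (1 + |x|) * ‖Complex.sinh (κ*(x + Complex.I*ε))‖ := by
  have hK : 0 < ‖κ‖ := norm_pos_iff.2 fun h => by simp [h] at hκ
  have hκK : κ.re ≤ ‖κ‖ := (le_abs_self _).trans (Complex.abs_re_le_norm κ)
  set ε0 := κ.re/(8*‖κ‖^2) with hε0
  have hε0p : 0 < ε0 := by positivity
  have hε0K : ‖κ‖*ε0 = κ.re/(8*‖κ‖) := by rw [hε0]; field_simp
  have hε0' : ε0 ≤ 1/(8*‖κ‖) := by
    rw [hε0, div_le_div_iff₀ (by positivity) (by positivity)]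
    nlinarith
  set m := κ.re/(8*‖κ‖) with hm
  have hmp : 0 < m := by positivity
  set c1 := ‖κ‖*Real.exp (-(1/2))/2 with hc1
  set c2 := (1 - Real.exp (-(2*m)))/2 * Real.exp (-m)/2 with hc2
  have hc2p : 0 < c2 := by
    have : Real.exp (-(2*m)) < 1 := Real.exp_lt_one_iff.2 (by linarith)
    have : 0 < 1 - Real.exp (-(2*m)) := by linarith
    positivity
  refine ⟨min c1 c2, ε0, lt_min (by positivity) hc2p, hε0p, fun ε hε x => ?_⟩
  set z : ℂ := (x:ℂ) + Complex.I*ε with hz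
  have hzre : z.re = x := by simp [hz]
  have hx1 : |x| ≤ ‖z‖ := by rw [← hzre]; exact Complex.abs_re_le_norm z
  have hx2 : ‖z‖ ≤ |x| + ε0 := by
    refine (norm_add_le _ _).trans ?_
    rw [norm_mul, Complex.norm_I, one_mul, Complex.norm_real, Complex.norm_real]
    exact add_le_add_right hε _
  have hx0 := abs_nonneg x
  have hwn : ‖κ*z‖ = ‖κ‖*‖z‖ := norm_mul _ _
  rcases le_total ‖κ*z‖ (1/2) with hw | hw
  · have h1 : ‖κ*z‖/2 ≤ ‖Complex.sinh (κ*z)‖ := by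
      have := norm_sinh_sub_self_le (w := κ*z) (by linarith)
      have h2 := norm_sub_norm_le (κ*z) (κ*z - Complex.sinh (κ*z))
      rw [sub_sub_cancel, norm_sub_rev (κ*z) (Complex.sinh (κ*z))] at h2
      nlinarith [norm_nonneg (κ*z)]
    have h2 : Real.exp (κ.re*|x|) ≤ Real.exp (1/2) := Real.exp_le_exp.2 (by
      calc κ.re*|x| ≤ ‖κ‖*‖z‖ := mul_le_mul hκK hx1 hx0 hK.le
        _ ≤ 1/2 := hwn ▸ hw)
    calc min c1 c2 * ‖z‖ * Real.exp (κ.re*|x|) ≤ c1 * ‖z‖ * Real.exp (1/2) := by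
          gcongr; exact min_le_left _ _
      _ = ‖κ‖*‖z‖/2 * (Real.exp (-(1/2)) * Real.exp (1/2)) := by rw [hc1]; ring
      _ = ‖κ*z‖/2 := by rw [← Real.exp_add, hwn]; simp
      _ ≤ _ := h1.trans (le_mul_of_one_le_left (norm_nonneg _) (by linarith))
  · have hzl : 1/(2*‖κ‖) ≤ ‖z‖ := by
      rw [div_le_iff₀ (by positivity)]
      nlinarith
    have hxl : 1/(4*‖κ‖) ≤ |x| := by
      have : 1/(2*‖κ‖) = 2*(1/(4*‖κ‖)) := by field_simp; norm_num
      have h8 : 1/(8*‖κ‖) = (1/(4*‖κ‖))/2 := by field_simp; norm_num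
      have : 0 < 1/(4*‖κ‖) := by positivity
      linarith
    have hre : (κ*z).re = κ.re*x - κ.im*ε := by
      rw [Complex.mul_re, hzre, show z.im = ε by simp [hz]]
    have hrel : κ.re*|x| - m ≤ |(κ*z).re| := by
      have h1 : |κ.im*ε| ≤ m := by
        rw [abs_mul, ← hε0K]
        exact mul_le_mul (Complex.abs_im_le_norm κ) hε (abs_nonneg _) hK.le
      have h2 := abs_sub_abs_le_abs_sub (κ.re*x) (κ.im*ε)
      rw [← hre, abs_mul, abs_of_pos hκ] at h2
      linarith
    have hml : 2*m ≤ κ.re*|x| := by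
      have : 2*m = κ.re*(1/(4*‖κ‖)) := by rw [hm]; field_simp; norm_num
      rw [this]; gcongr
    have hsl : (1 - Real.exp (-(2*m)))/2 * Real.exp (κ.re*|x| - m) ≤ Real.sinh |(κ*z).re| := by
      set y := |(κ*z).re|
      have hy : m ≤ y := by linarith
      rw [Real.sinh_eq]
      have e1 : Real.exp (-y) = Real.exp y * Real.exp (-(2*y)) := by rw [← Real.exp_add]; ring_nf
      have e2 : Real.exp (-(2*y)) ≤ Real.exp (-(2*m)) := Real.exp_le_exp.2 (by linarith)
      have e3 : Real.exp (κ.re*|x| - m) ≤ Real.exp y := Real.exp_le_exp.2 hrel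
      have e4 : Real.exp (-(2*m)) < 1 := Real.exp_lt_one_iff.2 (by linarith)
      rw [e1]
      have := mul_le_mul_of_nonneg_left e3 (show 0 ≤ (1 - Real.exp (-(2*m)))/2 by linarith)
      nlinarith [Real.exp_pos y]
    have hzx : ‖z‖ ≤ 2*(1+|x|) := by
      have : 1/(8*‖κ‖) = (1/(4*‖κ‖))/2 := by field_simp; norm_num
      linarith
    calc min c1 c2 * ‖z‖ * Real.exp (κ.re*|x|) ≤ c2 * (2*(1+|x|)) * Real.exp (κ.re*|x|) := by
          gcongr; exact min_le_right _ _
      _ = (1+|x|) * ((1 - Real.exp (-(2*m)))/2 * Real.exp (κ.re*|x| - m)) := by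
          rw [hc2, sub_eq_add_neg (κ.re*|x|), Real.exp_add]; ring
      _ ≤ _ := by
          gcongr
          exact hsl.trans (sinh_abs_re_le_norm_sinh _)

theorem tendsto_sinh_mul_div (κ : ℂ) :
    Tendsto (fun ε : ℝ => Complex.sinh (κ*ε)/ε) (𝓝[>] 0) (𝓝 κ) := by
  have h : HasDerivAt (fun z : ℂ => Complex.sinh (κ*z)) κ 0 := by
    have := (Complex.hasDerivAt_sinh (κ*0)).comp 0 ((hasDerivAt_id (0:ℂ)).const_mul κ)
    rw [mul_zero, Complex.cosh_zero, one_mul, mul_one] at this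
    exact this
  have h2 := hasDerivAt_iff_tendsto_slope_zero.1 h
  have h3 : Tendsto (fun ε : ℝ => (ε:ℂ)) (𝓝[>] 0) (𝓝[≠] 0) := by
    refine tendsto_nhdsWithin_iff.2 ⟨?_, ?_⟩
    · exact (Complex.continuous_ofReal.tendsto' 0 0 Complex.ofReal_zero).mono_left nhdsWithin_le_nhds
    · filter_upwards [eventually_mem_nhdsWithin] with ε hε
      simpa using (ne_of_gt hε : ε ≠ 0)
  refine (h2.comp h3).congr fun ε => ?_
  simp [div_eq_inv_mul]

section
variable {a b σ k : ℂ}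

/-- `eX` at a point shifted below its first zero. -/
def rX (a b z : ℂ) : ℂ := eX a b (z + Complex.I*((a+b)/2) - Complex.I*b)

/-- The symmetric pair product attached to a coupling. -/
def eP (a b s x : ℂ) : ℂ :=
  eX a b (x + Complex.I*((a+b)/2 + s)) * eX a b (-x + Complex.I*((a+b)/2 + s))

theorem im_rX_arg (a b z : ℂ) :
    (z + Complex.I*((a+b)/2) - Complex.I*b).im = z.im + (a.re - b.re)/2 := by
  simp; ring

theorem continuousAt_rX (h : HypFE) (ha : 0 < a.re) (hb : 0 < b.re) {z : ℂ} (hz : z.im < b.re) :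
    ContinuousAt (rX a b) z := by
  have h1 : (z + Complex.I*((a+b)/2) - Complex.I*b).im < (a.re+b.re)/2 := by
    rw [im_rX_arg]; linarith
  unfold rX
  exact ContinuousAt.comp (f := fun z => z + Complex.I*((a+b)/2) - Complex.I*b)
    (differentiableAt_eX h ha hb h1).continuousAt (by fun_prop)

theorem continuousAt_eP (h : HypFE) (ha : 0 < a.re) (hb : 0 < b.re) {P : Type*}
    [TopologicalSpace P] {p0 : P} {s x : P → ℂ} (cs : ContinuousAt s p0) (cx : ContinuousAt x p0)
    (hs : (s p0).re < -|(x p0).im|) : ContinuousAt (fun p => eP a b (s p) (x p)) p0 := by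
  have hi := abs_lt.1 (show |(x p0).im| < -(s p0).re by linarith)
  refine ContinuousAt.mul ?_ ?_
  · refine ContinuousAt.comp (f := fun p => x p + Complex.I*((a+b)/2 + s p))
      (differentiableAt_eX h ha hb ?_).continuousAt (by fun_prop)
    rw [Complex.add_im, im_I_mul_tau]; linarith
  · refine ContinuousAt.comp (f := fun p => -x p + Complex.I*((a+b)/2 + s p))
      (differentiableAt_eX h ha hb ?_).continuousAt (by fun_prop)
    rw [Complex.add_im, im_I_mul_tau, Complex.neg_im]; linarith

theorem rX_mul_neg (h : HypFE) (ha : 0 < a.re) (hb : 0 < b.re) (x : ℝ) :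
    Complex.sinh (Real.pi*x/b) * (rX a b x * rX a b (-x)) = Complex.sinh (Real.pi*x/a) := by
  have key : ∀ z : ℂ, z.im < 0 → Complex.sinh (Real.pi*z/b) * rX a b z =
      Complex.sinh (Real.pi*z/a) * rX b a z := fun z hz => by
    have e1 : rX a b z = _ := eX_shift h ha hb hz
    have e2 : rX b a z = _ := eX_shift h hb ha hz
    have e3 : eX b a (z + Complex.I*((b+a)/2)) = eX a b (z + Complex.I*((a+b)/2)) := by
      rw [add_comm b a, eX_symm h hb ha]
      simp; linarith
    rw [e1, e2, e3]
    ring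
  have hlim : Tendsto (fun ε : ℝ => (x:ℂ) - Complex.I*ε) (𝓝[>] 0) (𝓝 x) := by
    have : Continuous fun ε : ℝ => (x:ℂ) - Complex.I*ε := by fun_prop
    exact (this.tendsto' 0 (x:ℂ) (by simp)).mono_left nhdsWithin_le_nhds
  have c1 : ContinuousAt (fun z => Complex.sinh (Real.pi*z/b) * rX a b z) (x:ℂ) :=
    ContinuousAt.mul (by fun_prop) (continuousAt_rX h ha hb (by simpa using hb))
  have c2 : ContinuousAt (fun z => Complex.sinh (Real.pi*z/a) * rX b a z) (x:ℂ) :=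
    ContinuousAt.mul (by fun_prop) (continuousAt_rX h hb ha (by simpa using ha))
  have e := tendsto_nhds_unique ((c1.tendsto.comp hlim).congr' (by
    filter_upwards [eventually_mem_nhdsWithin] with ε hε
    exact key _ (by simpa using hε))) (c2.tendsto.comp hlim)
  rw [← mul_assoc, e, mul_assoc]
  have h1 : rX b a x * rX a b (-x) = 1 := by
    unfold rX
    have hs : ((x:ℂ) + Complex.I*((b+a)/2) - Complex.I*a).im < (b.re+a.re)/2 := by
      rw [im_rX_arg]; simp; linarith
    rw [eX_symm h hb ha hs]
    have : -(x:ℂ) + Complex.I*((a+b)/2) - Complex.I*b =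
      -((x:ℂ) + Complex.I*((b+a)/2) - Complex.I*a) := by ring
    rw [this]
    refine eX_mul_neg h ha hb ?_
    rw [im_rX_arg, abs_lt]
    constructor <;> simp <;> linarith
  rw [h1, mul_one]

theorem mul_rX_zero_sq (h : HypFE) (ha : 0 < a.re) (hb : 0 < b.re) : a * rX a b 0 ^ 2 = b := by
  have hane := re_ne ha
  have hbne := re_ne hb
  have hπ : (Real.pi:ℂ) ≠ 0 := by exact_mod_cast Real.pi_ne_zero
  have c0 := continuousAt_rX h ha hb (z := 0) (by simpa using hb)
  have hx : Tendsto (fun ε : ℝ => (ε:ℂ)) (𝓝[>] 0) (𝓝 0) :=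
    (Complex.continuous_ofReal.tendsto' 0 0 Complex.ofReal_zero).mono_left nhdsWithin_le_nhds
  have c1 := c0.tendsto.comp hx
  have c2 := c0.tendsto.comp (by simpa using hx.neg)
  have l1 := (tendsto_sinh_mul_div (Real.pi/b)).mul (c1.mul c2)
  have l2 := tendsto_sinh_mul_div (Real.pi/a)
  have := tendsto_nhds_unique l1 (l2.congr fun ε => by
    have := rX_mul_neg h ha hb ε
    rw [mul_div_right_comm, mul_div_right_comm] at this
    simp only [Function.comp_apply]
    rw [← this]; ring)
  field_simp at this
  linear_combination this

theorem mul_mem_slitPlane (ha : 0 < a.re) (hb : 0 < b.re) : a * b ∈ Complex.slitPlane := by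
  rw [Complex.mem_slitPlane_iff]
  by_contra! hc
  obtain ⟨h1, h2⟩ := hc
  simp only [Complex.mul_re, Complex.mul_im] at h1 h2
  have h3 : a.re * b.re * (a.re*a.re) ≤ a.im * b.im * (a.re * a.re) :=
    mul_le_mul_of_nonneg_right (by linarith) (by positivity)
  have h4 : a.im * b.im * (a.re*a.re) = - (a.im^2 * (a.re * b.re)) := by
    linear_combination a.im * a.re * h2
  have := mul_pos ha hb
  nlinarith [mul_pos ha ha, sq_nonneg a.im, mul_nonneg (sq_nonneg a.im) this.le, mul_pos this (mul_pos ha ha)]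

theorem mul_rX_zero (h : HypFE) (ha : 0 < a.re) (hb : 0 < b.re) :
    a * rX a b 0 = (a*b)^((1:ℂ)/2) := by
  have hsq : ∀ x : ℂ, (x^((1:ℂ)/2))^2 = x := fun x => by
    rw [one_div]
    exact Complex.cpow_nat_inv_pow x two_ne_zero
  have hpre : IsPreconnected {a : ℂ | 0 < a.re} := (convex_halfSpace_re_gt 0).isPreconnected
  refine hpre.eq_of_sq_eq (f := fun a => a * rX a b 0) (g := fun a => (a*b)^((1:ℂ)/2)) ?_ ?_ ?_ ?_ hb ?_ ha
  · intro a ha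
    refine ContinuousAt.continuousWithinAt (continuousAt_id.mul ?_)
    unfold rX
    exact ContinuousAt.comp (f := fun a : ℂ => (a, 0 + Complex.I*((a+b)/2) - Complex.I*b))
      (continuousAt_eX h ha hb (by
        rw [im_rX_arg]; simp; linarith)) (by fun_prop)
  · intro a ha
    refine ContinuousAt.continuousWithinAt ?_
    exact ContinuousAt.cpow (by fun_prop) continuousAt_const (mul_mem_slitPlane ha hb)
  · intro a ha
    simp only [Pi.pow_apply]
    rw [hsq, mul_pow]
    linear_combination a * mul_rX_zero_sq h ha hb
  · intro a ha h0
    have := hsq (a*b)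
    rw [h0, zero_pow two_ne_zero] at this
    exact mul_ne_zero (re_ne ha) (re_ne hb) this.symm
  · have e1 : rX b b 0 = 1 := by
      have hz : (0:ℂ) + Complex.I*((b+b)/2) - Complex.I*b = 0 := by ring
      unfold rX
      rw [hz, eX_eq_eS h hb hb (by simpa using hb)]
      have h1 : hK b b 0 = 0 := by
        have := hK_neg b b 0
        rw [neg_zero] at this
        exact self_eq_neg.1 this
      simp [eS, h1]
    show b * rX b b 0 = _
    rw [e1, mul_one, ← sq, one_div, Complex.sq_cpow_two_inv hb]

/-- Couplings approaching the pinch. -/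
def gE (σ : ℂ) (ε : ℂ) : Fin 4 → ℂ := ![-ε, -ε, σ+ε, σ+ε]

/-- Couplings of the lower-dimensional integral after the pinch. -/
def gL (σ k : ℂ) : Fin 4 → ℂ := ![k, k, σ, σ]

theorem wt_gE_mul (h : HypFE) (ha : 0 < a.re) (hb : 0 < b.re) {ε : ℝ} (hε : 0 < ε) (x : ℝ) :
    wt a b (gE σ ε) x * (4 * (Complex.sinh (Real.pi/a*(x - Complex.I*ε)) *
      Complex.sinh (Real.pi/a*(x + Complex.I*ε))))^2 =
    4 * Complex.sinh (2*Real.pi*x/a) * Complex.sinh (2*Real.pi*x/b) *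
      ((rX a b (x - Complex.I*ε) * rX a b (-x - Complex.I*ε)) * eP a b (σ+ε) x)^2 := by
  have e1 : rX a b (x - Complex.I*ε) = _ := eX_shift h ha hb (by simpa using hε)
  have e2 : rX a b (-x - Complex.I*ε) = _ := eX_shift h ha hb (by simpa using hε)
  have f1 : (x:ℂ) - Complex.I*ε + Complex.I*((a+b)/2) = x + Complex.I*((a+b)/2 + -ε) := by ring
  have f2 : -(x:ℂ) - Complex.I*ε + Complex.I*((a+b)/2) = -x + Complex.I*((a+b)/2 + -ε) := by ring
  have f3 : Complex.sinh (Real.pi*(-x - Complex.I*ε)/a) =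
      -Complex.sinh (Real.pi/a*(x + Complex.I*ε)) := by rw [← Complex.sinh_neg]; ring_nf
  have f4 : Complex.sinh (Real.pi*(x - Complex.I*ε)/a) =
      Complex.sinh (Real.pi/a*(x - Complex.I*ε)) := by ring_nf
  rw [e1, e2, f1, f2, f3, f4]
  simp only [wt, gE, Fin.prod_univ_four, eP, Matrix.cons_val]
  generalize Complex.sinh (Real.pi/a*(x - Complex.I*ε)) = s1
  generalize Complex.sinh (Real.pi/a*(x + Complex.I*ε)) = s2
  generalize eX a b (x + Complex.I*((a+b)/2 + -ε)) = u1
  generalize eX a b (-x + Complex.I*((a+b)/2 + -ε)) = u2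
  generalize eX a b (x + Complex.I*((a+b)/2 + (σ+ε))) = u3
  generalize eX a b (-x + Complex.I*((a+b)/2 + (σ+ε))) = u4
  linear_combination (64 * Complex.sinh (2*Real.pi*x/a) * Complex.sinh (2*Real.pi*x/b) *
    (s1*s2*u1*u2*u3*u4)^2) * (1 - Complex.I^2) * Complex.I_sq

end

section
variable {a b σ k : ℂ}

theorem one_add_pow_le_exp {η : ℝ} (hη : 0 < η) (x : ℝ) :
    (1+|x|)^4 ≤ (1+4/η)^4 * Real.exp (η*|x|) := by
  have h1 : 1 + |x| ≤ (1+4/η) * Real.exp (η/4*|x|) := by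
    have h2 := Real.add_one_le_exp (η/4*|x|)
    have h3 : 1 + |x| ≤ (1+4/η) * (η/4*|x| + 1) := by
      have e : (1+4/η) * (η/4*|x| + 1) = 1 + |x| + (η/4*|x| + 4/η) := by field_simp; ring
      have : 0 ≤ η/4*|x| + 4/η := by positivity
      linarith
    exact h3.trans (mul_le_mul_of_nonneg_left h2 (by positivity))
  calc (1+|x|)^4 ≤ ((1+4/η) * Real.exp (η/4*|x|))^4 := pow_le_pow_left₀ (by positivity) h1 4
    _ = _ := by rw [mul_pow, ← Real.exp_nat_mul]; congr 2; push_cast; ring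

theorem LBd_rX_eP (h : HypFE) (ha : 0 < a.re) (hb : 0 < b.re) (hσ : σ.re < 0) :
    ∃ lam : ℝ → ℝ, ContinuousAt lam 0 ∧ lam 0 = (2*Real.pi*((b-a) - (a+b+2*σ))/(a*b)).re ∧
      LBd (fun (ε : ℝ) x => ((rX a b (x - Complex.I*ε) * rX a b (-x - Complex.I*ε)) *
        eP a b (σ+ε) x)^2) lam 0 := by
  have hane := re_ne ha
  have hbne := re_ne hb
  have cd : ContinuousAt (fun ε : ℝ => -Complex.I*ε + Complex.I*((a+b)/2) - Complex.I*b) 0 := by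
    fun_prop
  have cs : ContinuousAt (fun ε : ℝ => Complex.I*((a+b)/2 + (σ+ε))) 0 := by fun_prop
  have l1 := LBd_pair h (a := fun _ : ℝ => a) hb continuousAt_const cd cd ha
    (by simp; linarith) (by simp; linarith)
  have l2 := LBd_pair h (a := fun _ : ℝ => a) hb continuousAt_const cs cs ha
    (by rw [im_I_mul_tau]; simp; linarith) (by rw [im_I_mul_tau]; simp; linarith)
  have l3 := l1.mul l2
  refine ⟨_, ?_, ?_, (l3.mul l3).congr (fun ε x => ?_) (Eventually.of_forall fun _ => rfl)⟩
  · have c1 : ContinuousAt (fun ε : ℝ => (Complex.I*Real.pi*((-Complex.I*ε + Complex.I*((a+b)/2) -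
        Complex.I*b) + (-Complex.I*ε + Complex.I*((a+b)/2) - Complex.I*b))/(a*b)).re) 0 :=
      Complex.continuous_re.continuousAt.comp (by fun_prop)
    have c2 : ContinuousAt (fun ε : ℝ => (Complex.I*Real.pi*(Complex.I*((a+b)/2 + (σ+ε)) +
        Complex.I*((a+b)/2 + (σ+ε)))/(a*b)).re) 0 :=
      Complex.continuous_re.continuousAt.comp (by fun_prop)
    exact (c1.add c2).add (c1.add c2)
  · simp only [← Complex.add_re]
    congr 1
    simp only [Complex.ofReal_zero]
    field_simp
    linear_combination (2*((a+b)/2*2-2*b)+ 2*(a+b+2*σ) + 4*a + 4*σ) * Complex.I_sq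
  · unfold rX eP
    rw [sq]
    ring_nf

theorem norm_wt_gE_le (h : HypFE) (ha : 0 < a.re) (hb : 0 < b.re) (hσ : σ.re < 0)
    (hc : 0 < ((a+b+2*σ)/(a*b)).re) : ∃ C η : ℝ, 0 ≤ C ∧ 0 < η ∧ ∀ᶠ ε : ℝ in 𝓝[>] 0, ∀ x : ℝ,
      ‖wt a b (gE σ ε) x‖ ≤ C * (x^2/(x^2+ε^2)^2) * Real.exp (-(η*|x|)) := by
  have hane := re_ne ha
  have hbne := re_ne hb
  obtain ⟨lam, cl, hl0, C, hC, hN⟩ := LBd_rX_eP h ha hb hσ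
  have hpi : ∀ {w : ℂ}, 0 < w.re → 0 < ((Real.pi:ℂ)/w).re := fun {w} hw => by
    rw [div_eq_mul_inv, Complex.re_ofReal_mul]
    exact mul_pos Real.pi_pos (inv_re_pos hw)
  obtain ⟨c, ε0, hc0, hε0, hS⟩ := exists_sinh_lower (hpi ha)
  set ρa := ((Real.pi:ℂ)/a).re with hρa
  set ρb := ((Real.pi:ℂ)/b).re with hρb
  set η := Real.pi*((a+b+2*σ)/(a*b)).re/2 with hη
  have hηp : 0 < η := by positivity
  have hval : lam 0 + 2*ρb - 2*ρa = -(4*η) := by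
    have e : (2*Real.pi*((b-a) - (a+b+2*σ))/(a*b) : ℂ) =
        ((2:ℝ):ℂ)*((Real.pi:ℂ)/a) - ((2:ℝ):ℂ)*((Real.pi:ℂ)/b) -
        (((2*Real.pi:ℝ):ℂ)) * ((a+b+2*σ)/(a*b)) := by
      push_cast; field_simp
    rw [hl0, e, Complex.sub_re, Complex.sub_re, Complex.re_ofReal_mul, Complex.re_ofReal_mul,
      Complex.re_ofReal_mul, hη]
    ring
  have hlam : ∀ᶠ ε in 𝓝 (0:ℝ), lam ε + 2*ρb - 2*ρa < -(2*η) :=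
    ((cl.add_const _).sub_const _).eventually_lt_const (by rw [hval]; linarith)
  set B := 64*Real.pi^2*C/(‖a‖*‖b‖) with hB
  have hBp : 0 ≤ B := by positivity
  refine ⟨B*(1+4/η)^4/(16*c^4), η, by positivity, hηp, ?_⟩
  have hsmall : ∀ᶠ ε : ℝ in 𝓝 0, |ε| < ε0 := by
    have := (continuous_abs : Continuous fun x : ℝ => |x|).tendsto 0
    rw [abs_zero] at this
    exact this.eventually_lt_const hε0
  filter_upwards [nhdsWithin_le_nhds hN, nhdsWithin_le_nhds hlam, nhdsWithin_le_nhds hsmall,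
    eventually_mem_nhdsWithin] with ε hN hlam hε1 hε x
  have hε' : 0 < ε := hε
  have hS1 := hS ε hε1.le x
  have hS2 := hS (-ε) (by rw [abs_neg]; exact hε1.le) x
  have em : (x:ℂ) + Complex.I*((-ε:ℝ):ℂ) = x - Complex.I*ε := by push_cast; ring
  rw [em] at hS2
  have hnn : ‖(x:ℂ) - Complex.I*ε‖ * ‖(x:ℂ) + Complex.I*ε‖ = x^2+ε^2 := by
    rw [← norm_mul]
    have : ((x:ℂ) - Complex.I*ε) * (x + Complex.I*ε) = ((x^2+ε^2 : ℝ):ℂ) := by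
      push_cast; linear_combination (-(ε:ℂ)^2) * Complex.I_sq
    rw [this, Complex.norm_real, Real.norm_eq_abs, abs_of_nonneg (by positivity)]
  set s1 := ‖Complex.sinh (Real.pi/a*(x - Complex.I*ε))‖
  set s2 := ‖Complex.sinh (Real.pi/a*(x + Complex.I*ε))‖
  set E := Real.exp (ρa*|x|) with hE
  have hS12 : c^2*(x^2+ε^2)*E^2 ≤ (1+|x|)^2*(s1*s2) := by
    have := mul_le_mul hS2 hS1 (by positivity) (by positivity)
    calc c^2*(x^2+ε^2)*E^2 = c * ‖(x:ℂ) - Complex.I*ε‖ * E * (c * ‖(x:ℂ) + Complex.I*ε‖ * E) := by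
          rw [← hnn]; ring
      _ ≤ _ := this
      _ = _ := by ring
  have hw := congrArg norm (wt_gE_mul (σ := σ) h ha hb hε' x)
  rw [norm_mul, norm_pow, norm_mul, norm_mul, norm_mul, norm_mul, norm_mul, Complex.norm_ofNat] at hw
  have hs : ∀ w : ℂ, 0 < w.re → ‖Complex.sinh (2*Real.pi*x/w)‖ ≤
      4*Real.pi*|x|/‖w‖*Real.exp (2*((Real.pi:ℂ)/w).re*|x|) := fun w hw => by
    refine (norm_sinh_le_mul _).trans (mul_le_mul (le_of_eq ?_) (Real.exp_le_exp.2 ?_)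
      (Real.exp_pos _).le (by positivity))
    · rw [norm_div, norm_mul, norm_mul, Complex.norm_ofNat, Complex.norm_real, Complex.norm_real,
        Real.norm_eq_abs, Real.norm_eq_abs, abs_of_pos Real.pi_pos]
      ring
    · have : (2*Real.pi*x/w : ℂ) = ((2*x:ℝ):ℂ) * ((Real.pi:ℂ)/w) := by push_cast; ring
      rw [this, Complex.re_ofReal_mul, abs_mul, abs_mul, abs_of_pos (hpi hw), abs_of_pos two_pos]
      exact le_of_eq (by ring)
  have hup : ‖wt a b (gE σ ε) x‖ * (4*(s1*s2))^2 ≤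
      B*x^2*Real.exp ((2*ρa+2*ρb+lam ε)*|x|) := by
    rw [hw]
    calc _ ≤ 4 * (4*Real.pi*|x|/‖a‖*Real.exp (2*ρa*|x|)) * (4*Real.pi*|x|/‖b‖*Real.exp (2*ρb*|x|)) *
          (C * Real.exp (lam ε*|x|)) := by
          gcongr
          · exact hs a ha
          · exact hs b hb
          · exact hN x
      _ = (64*Real.pi^2*C/(‖a‖*‖b‖)*|x|^2) *
          (Real.exp (2*ρa*|x|) * Real.exp (2*ρb*|x|) * Real.exp (lam ε*|x|)) := by ring
      _ = _ := by rw [← Real.exp_add, ← Real.exp_add, sq_abs, hB]; ring_nf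
  have hD : 0 < x^2+ε^2 := by positivity
  have h1 : ‖wt a b (gE σ ε) x‖ * (16*c^4*(x^2+ε^2)^2) * E^4 ≤
      B*x^2*Real.exp ((2*ρa+2*ρb+lam ε)*|x|) * (1+|x|)^4 := by
    have := pow_le_pow_left₀ (by positivity) hS12 2
    calc ‖wt a b (gE σ ε) x‖ * (16*c^4*(x^2+ε^2)^2) * E^4
        = 16 * ‖wt a b (gE σ ε) x‖ * (c^2*(x^2+ε^2)*E^2)^2 := by ring
      _ ≤ 16 * ‖wt a b (gE σ ε) x‖ * ((1+|x|)^2*(s1*s2))^2 := by gcongr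
      _ = (‖wt a b (gE σ ε) x‖ * (4*(s1*s2))^2) * (1+|x|)^4 := by ring
      _ ≤ _ := by gcongr
  have hexp : Real.exp ((2*ρa+2*ρb+lam ε)*|x|) * (1+|x|)^4 ≤
      (1+4/η)^4 * Real.exp (-(η*|x|)) * E^4 := by
    calc Real.exp ((2*ρa+2*ρb+lam ε)*|x|) * (1+|x|)^4
        ≤ Real.exp ((2*ρa+2*ρb+lam ε)*|x|) * ((1+4/η)^4 * Real.exp (η*|x|)) := by
          gcongr; exact one_add_pow_le_exp hηp x
      _ = (1+4/η)^4 * Real.exp ((2*ρa+2*ρb+lam ε)*|x| + η*|x|) := by rw [Real.exp_add]; ring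
      _ ≤ (1+4/η)^4 * Real.exp (-(η*|x|) + 4*(ρa*|x|)) := by
          refine mul_le_mul_of_nonneg_left (Real.exp_le_exp.2 ?_) (by positivity)
          have := mul_le_mul_of_nonneg_right hlam.le (abs_nonneg x)
          linarith
      _ = _ := by rw [Real.exp_add, hE, ← Real.exp_nat_mul]; push_cast; ring
  have hE4 : 0 < E^4 := by positivity
  have h2 : ‖wt a b (gE σ ε) x‖ * (16*c^4*(x^2+ε^2)^2) ≤
      B*x^2*((1+4/η)^4 * Real.exp (-(η*|x|))) := by
    refine le_of_mul_le_mul_right ?_ hE4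
    calc _ ≤ _ := h1
      _ = B*x^2*(Real.exp ((2*ρa+2*ρb+lam ε)*|x|) * (1+|x|)^4) := by ring
      _ ≤ B*x^2*((1+4/η)^4 * Real.exp (-(η*|x|)) * E^4) := by gcongr
      _ = _ := by ring
  rw [← le_div_iff₀ (by positivity)] at h2
  refine h2.trans (le_of_eq ?_)
  field_simp

end

section
variable {a b σ k : ℂ}

theorem exists_vt_bound (h : HypFE) (ha : 0 < a.re) (hb : 0 < b.re) (hk : k.re < 0)
    (hkab : 0 < (k/(a*b)).re) :
    ∃ K : ℝ, ∀ x : ℝ, ‖vt a b k x‖ ≤ K ∧ ‖vt a b k x‖ ≤ K * x^2 := by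
  have hane := re_ne ha
  have hbne := re_ne hb
  obtain ⟨K1, hK1, hN1⟩ := (LBd_vt h (a := fun _ : Unit => a) (k := fun _ => k) (p0 := ())
    continuousAt_const hb ha continuousAt_const hk).bounded continuousAt_const (two_pi_mul_re hkab)
  obtain ⟨C, hC, hN2⟩ := LBd_pair h (a := fun _ : Unit => a) (d := fun _ => Complex.I*((a+b)/2+k))
    (d' := fun _ => Complex.I*((a+b)/2+k)) (p0 := ()) hb
    continuousAt_const continuousAt_const continuousAt_const ha
    (by rw [im_I_mul_tau]; linarith) (by rw [im_I_mul_tau]; linarith)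
  have hN1 := hN1.self_of_nhds
  have hN2 := hN2.self_of_nhds
  have hpi : ∀ {w : ℂ}, 0 < w.re → 0 < ((Real.pi:ℂ)/w).re := fun {w} hw => by
    rw [div_eq_mul_inv, Complex.re_ofReal_mul]
    exact mul_pos Real.pi_pos (inv_re_pos hw)
  have hs : ∀ w : ℂ, 0 < w.re → ∀ x : ℝ, ‖Complex.sinh (Real.pi*x/w)‖ ≤
      2*Real.pi*|x|/‖w‖*Real.exp (((Real.pi:ℂ)/w).re*|x|) := fun w hw x => by
    refine (norm_sinh_le_mul _).trans (mul_le_mul (le_of_eq ?_) (Real.exp_le_exp.2 ?_)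
      (Real.exp_pos _).le (by positivity))
    · rw [norm_div, norm_mul, Complex.norm_real, Complex.norm_real,
        Real.norm_eq_abs, Real.norm_eq_abs, abs_of_pos Real.pi_pos]
      ring
    · have : (Real.pi*x/w : ℂ) = (x:ℂ) * ((Real.pi:ℂ)/w) := by ring
      rw [this, Complex.re_ofReal_mul, abs_mul, abs_of_pos (hpi hw)]
      exact le_of_eq (by ring)
  have hexp : ((Real.pi:ℂ)/a).re + ((Real.pi:ℂ)/b).re + (Complex.I*Real.pi*(Complex.I*((a+b)/2+k)
      + Complex.I*((a+b)/2+k))/(a*b)).re = -(2*Real.pi*k/(a*b)).re := by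
    rw [← Complex.add_re, ← Complex.add_re, ← Complex.neg_re]
    congr 1
    field_simp
    linear_combination (2*a+2*b+4*k) * Complex.I_sq
  set K2 := 16*Real.pi^2*C/(‖a‖*‖b‖) with hK2
  refine ⟨max K1 K2, fun x => ⟨(hN1 x).trans (le_max_left _ _), ?_⟩⟩
  refine le_trans ?_ (mul_le_mul_of_nonneg_right (le_max_right K1 K2) (sq_nonneg x))
  unfold vt
  rw [norm_mul, norm_mul, norm_mul, Complex.norm_ofNat]
  calc _ ≤ 4 * (2*Real.pi*|x|/‖a‖*Real.exp (((Real.pi:ℂ)/a).re*|x|)) *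
        (2*Real.pi*|x|/‖b‖*Real.exp (((Real.pi:ℂ)/b).re*|x|)) *
        (C * Real.exp ((Complex.I*Real.pi*(Complex.I*((a+b)/2+k)
          + Complex.I*((a+b)/2+k))/(a*b)).re*|x|)) := by
        gcongr
        · exact hs a ha x
        · exact hs b hb x
        · exact hN2 x
    _ = (16*Real.pi^2*C/(‖a‖*‖b‖)*|x|^2) * (Real.exp (((Real.pi:ℂ)/a).re*|x|) *
        Real.exp (((Real.pi:ℂ)/b).re*|x|) * Real.exp ((Complex.I*Real.pi*(Complex.I*((a+b)/2+k)
          + Complex.I*((a+b)/2+k))/(a*b)).re*|x|)) := by ring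
    _ ≤ K2 * x^2 := by
        rw [← Real.exp_add, ← Real.exp_add, ← add_mul, ← add_mul, hexp, sq_abs, ← hK2]
        refine mul_le_of_le_one_right (by positivity) (Real.exp_le_one_iff.2 ?_)
        exact mul_nonpos_of_nonpos_of_nonneg (two_pi_mul_re hkab).le (abs_nonneg _)

theorem tendsto_eP (h : HypFE) (ha : 0 < a.re) (hb : 0 < b.re) (hσ : σ.re < 0) {x : ℝ → ℂ} (x0 : ℝ)
    (hx : ContinuousAt x 0) (hx0 : x 0 = x0) :
    Tendsto (fun ε : ℝ => eP a b (σ+ε) (x ε)) (𝓝[>] 0) (𝓝 (eP a b σ x0)) := by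
  have := continuousAt_eP h ha hb (s := fun ε : ℝ => σ + ε) (x := x) (p0 := 0)
    (by fun_prop) hx (by rw [hx0]; simpa using hσ)
  have := this.tendsto
  simp only [Complex.ofReal_zero, add_zero, hx0] at this
  exact this.mono_left nhdsWithin_le_nhds

theorem tendsto_rX (h : HypFE) (ha : 0 < a.re) (hb : 0 < b.re) {x : ℝ → ℂ} (x0 : ℝ)
    (hx : ContinuousAt x 0) (hx0 : x 0 = x0) :
    Tendsto (fun ε : ℝ => rX a b (x ε)) (𝓝[>] 0) (𝓝 (rX a b x0)) := by
  have c := continuousAt_rX h ha hb (z := x 0) (by rw [hx0]; simpa using hb)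
  have := (ContinuousAt.comp (f := x) c hx).tendsto
  simp only [Function.comp_def, hx0] at this
  exact this.mono_left nhdsWithin_le_nhds

theorem tendsto_mul_ev (h : HypFE) (ha : 0 < a.re) (hb : 0 < b.re) :
    Tendsto (fun ε : ℝ => (ε:ℂ) * ev a b (-ε + -ε)) (𝓝[>] 0) (𝓝 (a * rX a b 0/(4*Real.pi))) := by
  have hane := re_ne ha
  have hπ : (Real.pi:ℂ) ≠ 0 := by exact_mod_cast Real.pi_ne_zero
  have h1 := tendsto_rX h ha hb (x := fun ε : ℝ => -2*Complex.I*ε) 0 (by fun_prop) (by simp)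
  have h2 := (tendsto_sinh_mul_div (-2*Real.pi*Complex.I/a)).const_mul (2*Complex.I)
  have h3 := h1.div h2 (by simp [hane, hπ])
  have e : rX a b ((0:ℝ):ℂ) / (2*Complex.I*(-2*Real.pi*Complex.I/a)) = a * rX a b 0/(4*Real.pi) := by
    have : (2*Complex.I*(-2*Real.pi*Complex.I/a)) = 4*Real.pi/a := by
      field_simp
      linear_combination (-4 : ℂ) * Complex.I_sq
    rw [this, Complex.ofReal_zero]
    field_simp
  rw [e] at h3
  refine h3.congr' ?_
  have hne := (tendsto_sinh_mul_div (-2*Real.pi*Complex.I/a)).eventually_ne (show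
    -2*Real.pi*Complex.I/a ≠ 0 by simp [hane, hπ])
  filter_upwards [eventually_mem_nhdsWithin, hne] with ε hε hne
  have hε' : 0 < ε := hε
  have hεc : (ε:ℂ) ≠ 0 := by exact_mod_cast hε'.ne'
  have e2 := eX_shift h ha hb (z := -2*Complex.I*ε) (by simpa using hε')
  have e3 : eX a b (-2*Complex.I*ε + Complex.I*((a+b)/2)) = ev a b (-ε + -ε) := by
    unfold ev; congr 1; ring
  rw [e3] at e2
  have hs : Complex.sinh (-2*Real.pi*Complex.I/a*ε) ≠ 0 := fun h0 => hne (by rw [h0, zero_div])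
  simp only [Pi.div_apply]
  rw [rX, e2, show Real.pi*(-2*Complex.I*ε)/a = -2*Real.pi*Complex.I/a*ε by ring]
  generalize Complex.sinh (-2*Real.pi*Complex.I/a*ε) = S at *
  generalize ev a b (-ε + -ε) = E
  field_simp

theorem tendsto_wt_gE_scaled (h : HypFE) (ha : 0 < a.re) (hb : 0 < b.re) (hσ : σ.re < 0) (t : ℝ) :
    Tendsto (fun ε : ℝ => (ε:ℂ)^2 * wt a b (gE σ ε) ((ε*t : ℝ):ℂ)) (𝓝[>] 0)
      (𝓝 (a*b/Real.pi^2 * ev a b σ^4 * ((t^2/(t^2+1)^2 : ℝ):ℂ))) := by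
  have hane := re_ne ha
  have hbne := re_ne hb
  have hπ : (Real.pi:ℂ) ≠ 0 := by exact_mod_cast Real.pi_ne_zero
  have h1 := tendsto_rX h ha hb (x := fun ε : ℝ => ((ε*t:ℝ):ℂ) - Complex.I*ε) 0 (by fun_prop) (by simp)
  have h2 := tendsto_rX h ha hb (x := fun ε : ℝ => -((ε*t:ℝ):ℂ) - Complex.I*ε) 0 (by fun_prop) (by simp)
  have h3 := tendsto_eP h ha hb hσ (x := fun ε : ℝ => ((ε*t:ℝ):ℂ)) 0 (by fun_prop) (by simp)
  have s1 := tendsto_sinh_mul_div (Real.pi/a*(t - Complex.I))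
  have s2 := tendsto_sinh_mul_div (Real.pi/a*(t + Complex.I))
  have s3 := tendsto_sinh_mul_div (2*Real.pi*t/a)
  have s4 := tendsto_sinh_mul_div (2*Real.pi*t/b)
  have ht : ((t:ℂ)^2+1) ≠ 0 := by exact_mod_cast (by positivity : t^2+1 ≠ 0)
  have htt : (t - Complex.I)*(t+Complex.I) = (t:ℂ)^2+1 := by linear_combination -Complex.I_sq
  have ht1 : (t:ℂ) - Complex.I ≠ 0 := left_ne_zero_of_mul (htt ▸ ht)
  have ht2 : (t:ℂ) + Complex.I ≠ 0 := right_ne_zero_of_mul (htt ▸ ht)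
  have hne1 : Real.pi/a*(t - Complex.I) ≠ 0 := mul_ne_zero (div_ne_zero hπ hane) ht1
  have hne2 : Real.pi/a*(t + Complex.I) ≠ 0 := mul_ne_zero (div_ne_zero hπ hane) ht2
  have num := ((s3.mul s4).const_mul 4).mul (((h1.mul h2).mul h3).pow 2)
  have den := ((s1.mul s2).const_mul 4).pow 2
  have key := num.div den (pow_ne_zero 2 (mul_ne_zero (by norm_num) (mul_ne_zero hne1 hne2)))
  have hr := mul_rX_zero_sq h ha hb
  have hev : eP a b σ 0 = ev a b σ^2 := by
    unfold eP ev; rw [neg_zero, zero_add, sq]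
  refine (key.congr' ?_).trans (le_of_eq (congrArg 𝓝 ?_))
  · filter_upwards [eventually_mem_nhdsWithin, s1.eventually_ne hne1, s2.eventually_ne hne2] with ε hε n1 n2
    have hε' : 0 < ε := hε
    have hεc : (ε:ℂ) ≠ 0 := by exact_mod_cast hε'.ne'
    have e := wt_gE_mul (σ := σ) h ha hb hε' (ε*t)
    have e1 : Real.pi/a*(((ε*t:ℝ):ℂ) - Complex.I*ε) = Real.pi/a*(t - Complex.I)*ε := by push_cast; ring
    have e2 : Real.pi/a*(((ε*t:ℝ):ℂ) + Complex.I*ε) = Real.pi/a*(t + Complex.I)*ε := by push_cast; ring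
    have e3 : 2*Real.pi*((ε*t:ℝ):ℂ)/a = 2*Real.pi*t/a*ε := by push_cast; ring
    have e4 : 2*Real.pi*((ε*t:ℝ):ℂ)/b = 2*Real.pi*t/b*ε := by push_cast; ring
    rw [e1, e2, e3, e4] at e
    have m1 : Complex.sinh (Real.pi/a*(t - Complex.I)*ε) ≠ 0 := fun h0 => n1 (by rw [h0, zero_div])
    have m2 : Complex.sinh (Real.pi/a*(t + Complex.I)*ε) ≠ 0 := fun h0 => n2 (by rw [h0, zero_div])
    simp only [Pi.div_apply]
    generalize Complex.sinh (Real.pi/a*(t - Complex.I)*ε) = S1 at *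
    generalize Complex.sinh (Real.pi/a*(t + Complex.I)*ε) = S2 at *
    generalize Complex.sinh (2*Real.pi*t/a*ε) = S3 at *
    generalize Complex.sinh (2*Real.pi*t/b*ε) = S4 at *
    generalize rX a b (((ε*t:ℝ):ℂ) - Complex.I*ε) * rX a b (-((ε*t:ℝ):ℂ) - Complex.I*ε) *
      eP a b (σ+ε) ((ε*t:ℝ):ℂ) = R at *
    generalize wt a b (gE σ ε) ((ε*t:ℝ):ℂ) = w at *
    rw [div_eq_iff (by simp [m1, m2, hεc])]
    field_simp
    linear_combination (-1/4 : ℂ) * e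
  · rw [Complex.ofReal_zero, hev]
    push_cast
    have r2 : rX a b 0 ^ 2 = b/a := by rw [eq_div_iff hane, mul_comm]; exact hr
    rw [show rX a b 0 * rX a b 0 * ev a b σ^2 = b/a * ev a b σ^2 by rw [← r2]; ring,
      show Real.pi/a*(t-Complex.I)*(Real.pi/a*(t+Complex.I)) = (Real.pi/a)^2*((t:ℂ)^2+1) by
        rw [← htt]; ring]
    generalize ev a b σ = E
    field_simp
    ring

theorem tendsto_wt_gE_mul_vt (h : HypFE) (ha : 0 < a.re) (hb : 0 < b.re) (hσ : σ.re < 0) {x : ℝ}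
    (hx : x ≠ 0) : Tendsto (fun ε : ℝ => wt a b (gE σ ε) x * vt a b k x^2) (𝓝[>] 0)
      (𝓝 (wt a b (gL σ k) x)) := by
  have hane := re_ne ha
  have hbne := re_ne hb
  have hxc : (x:ℂ) ≠ 0 := by exact_mod_cast hx
  have sa := sinh_pi_mul_ne ha hx
  have sb := sinh_pi_mul_ne hb hx
  have h1 := tendsto_rX h ha hb (x := fun ε : ℝ => (x:ℂ) - Complex.I*ε) x (by fun_prop) (by simp)
  have h2 := tendsto_rX h ha hb (x := fun ε : ℝ => -(x:ℂ) - Complex.I*ε) (-x) (by fun_prop) (by simp)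
  have h3 := tendsto_eP h ha hb hσ (x := fun ε : ℝ => (x:ℂ)) x (by fun_prop) (by simp)
  have hsin : ∀ f : ℝ → ℂ, ContinuousAt f 0 → f 0 = Real.pi*x/a →
      Tendsto (fun ε : ℝ => Complex.sinh (f ε)) (𝓝[>] 0) (𝓝 (Complex.sinh (Real.pi*x/a))) :=
    fun f hf h0 => by
      have := (ContinuousAt.comp (f := f) Complex.continuous_sinh.continuousAt hf).tendsto
      simp only [Function.comp_def, h0] at this
      exact this.mono_left nhdsWithin_le_nhds
  have s1 := hsin (fun ε => Real.pi/a*(x - Complex.I*ε)) (by fun_prop) (by simp; ring)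
  have s2 := hsin (fun ε => Real.pi/a*(x + Complex.I*ε)) (by fun_prop) (by simp; ring)
  have den := ((s1.mul s2).const_mul 4).pow 2
  have num := (((h1.mul h2).mul h3).pow 2).const_mul
    (4*Complex.sinh (2*Real.pi*x/a)*Complex.sinh (2*Real.pi*x/b))
  have key := (num.div den (by simp [sa])).mul_const (vt a b k x^2)
  have hr := rX_mul_neg h ha hb x
  refine (key.congr' ?_).trans (le_of_eq (congrArg 𝓝 ?_))
  · filter_upwards [eventually_mem_nhdsWithin, s1.eventually_ne sa, s2.eventually_ne sa] with ε hε n1 n2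
    simp only [Pi.div_apply]
    congr 1
    rw [div_eq_iff (by simp [n1, n2])]
    exact (wt_gE_mul (σ := σ) h ha hb hε x).symm
  · rw [Complex.ofReal_neg]
    have r2 : rX a b x * rX a b (-x) = Complex.sinh (Real.pi*x/a)/Complex.sinh (Real.pi*x/b) := by
      rw [eq_div_iff sb, mul_comm]; exact hr
    rw [r2]
    unfold wt vt gL eP
    rw [Fin.prod_univ_four]
    simp only [Matrix.cons_val_zero, Matrix.cons_val_one, Matrix.cons_val]
    generalize eX a b (x + Complex.I*((a+b)/2+k)) = E1
    generalize eX a b (-x + Complex.I*((a+b)/2+k)) = E2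
    generalize eX a b (x + Complex.I*((a+b)/2+σ)) = E3
    generalize eX a b (-x + Complex.I*((a+b)/2+σ)) = E4
    generalize Complex.sinh (Real.pi*x/a) = S1 at *
    generalize Complex.sinh (Real.pi*x/b) = S2 at *
    field_simp

end

section
variable {n : ℕ} {a b p σ k : ℂ}

theorem sum_gE (σ ε : ℂ) : ∑ r, gE σ ε r = 2*σ := by
  simp [gE, Fin.sum_univ_four]; ring

theorem sum_gL (σ k : ℂ) : ∑ r, gL σ k r = 2*k + 2*σ := by
  simp [gL, Fin.sum_univ_four]; ring

theorem gE_eq_gsym (p ε : ℂ) : gE (2*p) ε = gsym p (-ε-p) 0 := by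
  funext r
  fin_cases r <;> simp [gE, gsym] <;> ring

theorem gL_eq_gsym (p k : ℂ) : gL (2*p) k = gsym (p+k/2) (k/2-p) 0 := by
  funext r
  fin_cases r <;> simp [gL, gsym] <;> ring

theorem tendsto_mul_IBC_gE (h : HypFE) (ha : 0 < a.re) (hb : 0 < b.re) (hσ : σ.re < 0)
    (hc : 0 < ((a+b+2*σ)/(a*b)).re) (hk : k.re < 0) (hkab : 0 < (k/(a*b)).re) :
    Tendsto (fun ε : ℝ => (ε:ℂ) * IBC (n+1) a b (gE σ ε) k) (𝓝[>] 0)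
      (𝓝 ((n+1) * (a*b/(2*Real.pi) * ev a b σ^4 * IBC n a b (gL σ k) k))) := by
  obtain ⟨K, hK⟩ := exists_vt_bound h ha hb hk hkab
  obtain ⟨C, η, hC, hη, hA⟩ := norm_wt_gE_le h ha hb hσ hc
  have hσε : ∀ᶠ ε : ℝ in 𝓝[>] 0, σ.re + ε < 0 := by
    refine nhdsWithin_le_nhds ?_
    have : ContinuousAt (fun ε : ℝ => σ.re + ε) 0 := by fun_prop
    exact this.eventually_lt_const (by simpa using hσ)
  have hA' : ∀ᶠ ε : ℝ in 𝓝[>] 0, (Continuous fun x : ℝ => wt a b (gE σ ε) x) ∧ ∀ x : ℝ,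
      ‖wt a b (gE σ ε) x‖ ≤ C * (x^2/(x^2+ε^2)^2) * Real.exp (-(η*|x|)) := by
    filter_upwards [hA, hσε, eventually_mem_nhdsWithin] with ε h1 h2 h3
    have h3' : 0 < ε := h3
    refine ⟨continuous_wt h ha hb fun r => ?_, h1⟩
    fin_cases r <;> simp [gE] <;> linarith
  have := tendsto_pinch (n := n) (A := fun ε x => wt a b (gE σ ε) x) (V := fun x => vt a b k x)
    (A0 := fun t => a*b/Real.pi^2 * ev a b σ^4 * ((t^2/(t^2+1)^2 : ℝ):ℂ))
    (W := fun x => wt a b (gL σ k) x) hη hC (continuous_vt h ha hb hk)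
    (fun x => by rw [Complex.ofReal_neg, vt_neg]) (fun x => (hK x).1) (fun x => (hK x).2) hA'
    (fun t => tendsto_wt_gE_scaled h ha hb hσ t) (fun x hx => tendsto_wt_gE_mul_vt h ha hb hσ hx)
  rw [integral_const_mul, integral_complex_ofReal, integral_pinch] at this
  refine this.trans (le_of_eq (congrArg 𝓝 ?_))
  have hπ : (Real.pi:ℂ) ≠ 0 := by exact_mod_cast Real.pi_ne_zero
  change _ * (_ * IBC n a b (gL σ k) k) = _
  push_cast
  field_simp

theorem evDen_succ (n : ℕ) (a b σ k : ℂ) : evDen (n+1) a b (2*σ) k =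
    evDen n a b (2*k+2*σ) k * (ev a b k * ev a b (n*k+2*σ)) := by
  unfold evDen
  rw [Finset.prod_range_succ]
  congr 1
  · refine Finset.prod_congr rfl fun j _ => ?_
    congr 2; push_cast; ring
  · congr 2; push_cast; ring

theorem tendsto_ev_add (h : HypFE) (ha : 0 < a.re) (hb : 0 < b.re) {x : ℂ} (hx : x.re < 0)
    {f : ℝ → ℂ} (hf : ContinuousAt f 0) (h0 : f 0 = x) :
    Tendsto (fun ε : ℝ => ev a b (f ε)) (𝓝[>] 0) (𝓝 (ev a b x)) := by
  have := (continuousAt_ev h (A := fun _ : ℝ => a) (X := f) (p := 0) ha hb (by rw [h0]; exact hx)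
    continuousAt_const hf).tendsto
  rw [h0] at this
  exact this.mono_left nhdsWithin_le_nhds

theorem evNum_gL_mul (n : ℕ) (a b σ k : ℂ) :
    (∏ j ∈ Finset.range n, ev a b ((j+1)*k)) * (∏ j ∈ Finset.range (n+1),
      (ev a b (j*k+σ)^4 * ev a b (j*k+2*σ) * ev a b ((j+1)*k))) =
    ev a b σ^4 * ev a b (n*k+2*σ) * ev a b k * evNum n a b (gL σ k) k := by
  unfold evNum
  simp only [gL, Matrix.cons_val_zero, Matrix.cons_val_one, Matrix.cons_val]
  simp only [Finset.prod_mul_distrib, Finset.prod_pow]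
  rw [Finset.prod_range_succ' (fun j : ℕ => ev a b (j*k+σ)),
    Finset.prod_range_succ (fun j : ℕ => ev a b (j*k+2*σ)),
    Finset.prod_range_succ' (fun j : ℕ => ev a b ((j+1)*k))]
  simp only [Nat.cast_add, Nat.cast_one, Nat.cast_zero, zero_mul, zero_add, one_mul]
  have e1 : ∏ j ∈ Finset.range n, ev a b ((j+1+1)*k) = ∏ j ∈ Finset.range n, ev a b (j*k+k+k) :=
    Finset.prod_congr rfl fun j _ => by congr 1; ring
  have e2 : ∏ j ∈ Finset.range n, ev a b ((j+1)*k+σ) = ∏ j ∈ Finset.range n, ev a b (j*k+k+σ) :=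
    Finset.prod_congr rfl fun j _ => by congr 1; ring
  have e3 : ∏ j ∈ Finset.range n, ev a b (j*k+2*σ) = ∏ j ∈ Finset.range n, ev a b (j*k+σ+σ) :=
    Finset.prod_congr rfl fun j _ => by congr 1; ring
  rw [e1, e2, e3]
  ring

theorem tendsto_mul_evNum_gE (h : HypFE) (ha : 0 < a.re) (hb : 0 < b.re) (hσ : σ.re < 0)
    (hk : k.re < 0) :
    Tendsto (fun ε : ℝ => (ε:ℂ) * evNum (n+1) a b (gE σ ε) k) (𝓝[>] 0)
      (𝓝 (a * rX a b 0/(4*Real.pi) *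
        (ev a b σ^4 * ev a b (n*k+2*σ) * ev a b k * evNum n a b (gL σ k) k))) := by
  rw [← evNum_gL_mul]
  have t1 := tendsto_mul_ev h ha hb
  have t2 := tendsto_finsetProd (f := fun (j : ℕ) (ε : ℝ) => ev a b ((j+1)*k - 2*ε)) (Finset.range n)
    fun j _ => tendsto_ev_add h ha hb (x := (j+1)*k) (by
      rw [re_succ_mul]; exact mul_neg_of_pos_of_neg (by positivity) hk) (by fun_prop) (by simp)
  have t3 := tendsto_finsetProd (f := fun (j : ℕ) (ε : ℝ) => ev a b (j*k+σ)^4 * ev a b (j*k+2*σ+2*ε) *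
      ev a b ((j+1)*k)) (Finset.range (n+1))
    fun j _ => ((tendsto_ev_add h ha hb (x := j*k+2*σ) (by
      have := jk_re_nonpos j hk
      simp; linarith) (by fun_prop) (by simp)).const_mul (ev a b (j*k+σ)^4)).mul_const
        (ev a b ((j+1)*k))
  refine (t1.mul (t2.mul t3)).congr fun ε => ?_
  unfold evNum
  simp only [gE, Matrix.cons_val_zero, Matrix.cons_val_one, Matrix.cons_val]
  have e1 : ∀ j : ℕ, ev a b (j*k+-ε+-ε) * ev a b (j*k + -ε+(σ+ε)) * ev a b (j*k + -ε+(σ+ε)) *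
      ev a b (j*k + -ε+(σ+ε)) * ev a b (j*k + -ε+(σ+ε)) * ev a b (j*k + (σ+ε)+(σ+ε)) *
      ev a b ((j+1)*k) = ev a b (j*k - 2*ε) *
        (ev a b (j*k+σ)^4 * ev a b (j*k+2*σ+2*ε) * ev a b ((j+1)*k)) := fun j => by
    rw [show (j:ℂ)*k+-ε+-ε = j*k - 2*ε by ring, show (j:ℂ)*k + -ε+(σ+ε) = j*k+σ by ring,
      show (j:ℂ)*k + (σ+ε)+(σ+ε) = j*k+2*σ+2*ε by ring]
    ring
  simp only [e1]
  rw [Finset.prod_mul_distrib (f := fun j : ℕ => ev a b (j*k - 2*ε)),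
    Finset.prod_range_succ' (fun j : ℕ => ev a b (j*k - 2*ε))]
  simp only [Nat.cast_add, Nat.cast_one, Nat.cast_zero, zero_mul, zero_sub]
  rw [show (-(ε:ℂ) + -ε) = -(2*ε) by ring]
  ring

theorem Base.lower (B : Base (n+1) a b p k) : Base n a b (p+k/2) k := by
  have e : a + b + 4*(p+k/2) = (a+b+4*p) + 2*k := by ring
  have h2 : ((2:ℂ)*k).re = 2*k.re := by simp
  have hk := B.hk
  have hn := B.hn
  push_cast at hn
  refine ⟨B.ha, B.hb, ?_, hk, B.hkab, ?_, ?_, ?_⟩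
  · rw [e, add_div, Complex.add_re, mul_div_assoc, show (2:ℂ) = ((2:ℝ):ℂ) by norm_num,
      Complex.re_ofReal_mul]
    linarith [B.hc, B.hkab]
  · rw [e, Complex.add_re _ (2*k), h2]; linarith
  · rw [e, Complex.add_re _ (2*k), h2]; linarith [B.hca]
  · rw [e, Complex.add_re _ (2*k), h2]; linarith [B.hcb]

theorem Base.ratio_succ (h : HypFE) (B : Base (n+1) a b p k) (hab : (a/b).im ≠ 0) :
    ratio (n+1) a b (gsym p 0 0) k =
      2*(n+1)*(a*b)^((1:ℂ)/2) * ratio n a b (gsym (p+k/2) 0 0) k := by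
  have ha := B.ha
  have hb := B.hb
  have hk := B.hk
  have hp := B.p_neg
  have hane := re_ne ha
  have hbne := re_ne hb
  have hπ : (Real.pi:ℂ) ≠ 0 := by exact_mod_cast Real.pi_ne_zero
  have hσ : (2*p).re < 0 := by simp; linarith
  have B' := B.lower
  have hn := B.hn
  push_cast at hn
  simp only [Complex.add_re, show ((4:ℂ)*p).re = 4*p.re by simp] at hn
  have hnk : (n:ℝ)*k.re ≤ 0 := jk_re_nonpos n hk
  have hL : |(k/2-p).re| + |(0:ℂ).re| < -(p+k/2).re := by
    simp only [Complex.sub_re, Complex.add_re, Complex.zero_re, abs_zero, add_zero,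
      show ((k:ℂ)/2).re = k.re/2 by simp]
    rw [abs_lt]; constructor <;> linarith
  have hLr : ratio n a b (gL (2*p) k) k = ratio n a b (gsym (p+k/2) 0 0) k := by
    rw [gL_eq_gsym]
    exact B'.ratio_eq_zero h hab (by simpa using B'.hca) (by simpa using B'.hcb) hL
  have hN : evNum n a b (gL (2*p) k) k ≠ 0 := by
    rw [gL_eq_gsym]; exact evNum_ne_zero h (B'.adm hL) (B'.hn' _ _)
  have hevσ : ev a b (2*p) ≠ 0 := ev_ne_zero h ha hb hσ (by
    simp; linarith)
  have hevk : ev a b k ≠ 0 := ev_ne_zero h ha hb hk (by linarith)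
  have hevn : ev a b (n*k+2*(2*p)) ≠ 0 := ev_ne_zero h ha hb (by simp; linarith) (by simp; linarith)
  set R := ratio (n+1) a b (gsym p 0 0) k with hR
  have hε : ∀ᶠ ε : ℝ in 𝓝[>] 0, (ε:ℂ) * IBC (n+1) a b (gE (2*p) ε) k * evDen (n+1) a b (2*(2*p)) k =
      R * ((ε:ℂ) * evNum (n+1) a b (gE (2*p) ε) k) := by
    have hsm : ∀ᶠ ε : ℝ in 𝓝[>] 0, ε < -p.re :=
      nhdsWithin_le_nhds (eventually_lt_nhds (by linarith))
    filter_upwards [hsm, eventually_mem_nhdsWithin] with ε h1 h2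
    have h2' : 0 < ε := h2
    have hx : |(-(ε:ℂ)-p).re| + |(0:ℂ).re| < -p.re := by
      simp only [Complex.sub_re, Complex.neg_re, Complex.ofReal_re, Complex.zero_re, abs_zero, add_zero]
      rw [abs_lt]; constructor <;> linarith
    have e := B.ratio_eq_zero h hab (by simpa using B.hca) (by simpa using B.hcb) hx
    have hne := evNum_ne_zero h (B.adm hx) (B.hn' _ _)
    rw [← hR, ← gE_eq_gsym, ratio, div_eq_iff (by rwa [gE_eq_gsym]), sum_gE] at e
    rw [mul_assoc, e]; ring
  have l1 := (tendsto_mul_IBC_gE (n := n) h ha hb hσ (by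
    have := B.hc
    rwa [show a+b+2*(2*p) = a+b+4*p by ring]) hk B.hkab).mul_const (evDen (n+1) a b (2*(2*p)) k)
  have l2 := (tendsto_mul_evNum_gE (n := n) h ha hb hσ hk).const_mul R
  have e := tendsto_nhds_unique (l1.congr' hε) l2
  rw [evDen_succ] at e
  rw [← hLr, ratio, sum_gL, ← mul_rX_zero h ha hb]
  have hr : (a * rX a b 0)^2 = a*b := by
    rw [mul_pow, sq a, mul_assoc, mul_rX_zero_sq h ha hb]
  have hr0 : a * rX a b 0 ≠ 0 := fun h0 => by
    rw [h0] at hr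
    exact mul_ne_zero hane hbne (by rw [← hr]; ring)
  rw [← hr] at e
  generalize a * rX a b 0 = rt at *
  generalize IBC n a b (gL (2*p) k) k = J at *
  generalize evDen n a b (2*k+2*(2*p)) k = D at *
  generalize evNum n a b (gL (2*p) k) k = N at *
  generalize ev a b k = E1 at *
  generalize ev a b (n*k+2*(2*p)) = E2 at *
  generalize ev a b (2*p) = E3 at *
  have hm : rt * E3^4 * E2 * E1 ≠ 0 := by simp [hr0, hevσ, hevn, hevk]
  field_simp at e
  rw [← mul_div_assoc, eq_div_iff hN]
  refine mul_left_cancel₀ hm ?_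
  linear_combination (-(rt * E3^4 * E2 * E1)/2) * e

theorem Base.ratio_const (h : HypFE) (B : Base n a b p k) (hab : (a/b).im ≠ 0) :
    ratio n a b (gsym p 0 0) k = 2^n * (Nat.factorial n : ℂ) * ((a*b)^((1:ℂ)/2))^n := by
  induction n generalizing p with
  | zero =>
    simp [ratio, IBC, IntG, evDen, evNum, pairProd, integral_const, measureReal_def]
    rw [volume_pi, Measure.pi_of_empty]
    simp
  | succ n ih =>
    rw [B.ratio_succ h hab, ih B.lower, Nat.factorial_succ]
    push_cast; ring

end

section
variable {n : ℕ} {a b k : ℂ}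

theorem isOpen_affine_re (A B : ℂ) : IsOpen {t : ℂ | 0 < (A + t*B).re} :=
  isOpen_lt continuous_const (Complex.continuous_re.comp (by fun_prop))

theorem convex_affine_re (A B : ℂ) : Convex ℝ {t : ℂ | 0 < (A + t*B).re} := by
  intro x hx y hy s t hs ht hst
  simp only [mem_ofPred_eq] at hx hy ⊢
  have hst' : (s:ℂ) + t = 1 := by exact_mod_cast hst
  have e : A + (s • x + t • y)*B = (s:ℂ)*(A + x*B) + (t:ℂ)*(A+y*B) := by
    simp only [Complex.real_smul]
    linear_combination (-A) * hst'
  rw [e, Complex.add_re, Complex.re_ofReal_mul, Complex.re_ofReal_mul]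
  rcases hs.eq_or_lt with h0 | h0
  · rw [← h0, zero_add] at hst
    rw [← h0, hst]; linarith
  · linarith [mul_pos h0 hx, mul_nonneg ht hy.le]

theorem setOf_adm_segment (ha : 0 < a.re) (hb : 0 < b.re) (g0 g1 : Fin 4 → ℂ) (k0 k1 : ℂ) :
    {t : ℂ | Adm a b (fun r => g0 r + t*(g1 r - g0 r)) (k0 + t*(k1-k0))} =
      (⋂ r, {t : ℂ | 0 < (-g0 r + t*(g0 r - g1 r)).re}) ∩
      ({t : ℂ | 0 < ((a+b+∑ r, g0 r)/(a*b) + t*((∑ r, g1 r - ∑ r, g0 r)/(a*b))).re} ∩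
      ({t : ℂ | 0 < (-k0 + t*(k0-k1)).re} ∩ {t : ℂ | 0 < (k0/(a*b) + t*((k1-k0)/(a*b))).re})) := by
  ext t
  simp only [mem_ofPred_eq, mem_inter_iff, mem_iInter]
  have e1 : ∀ x y : ℂ, (x + t*(y-x)).re < 0 ↔ 0 < (-x + t*(x-y)).re := fun x y => by
    rw [show -x + t*(x-y) = -(x + t*(y-x)) by ring, Complex.neg_re, neg_pos]
  have e2 : (a+b+∑ r, (g0 r + t*(g1 r - g0 r)))/(a*b) =
      (a+b+∑ r, g0 r)/(a*b) + t*((∑ r, g1 r - ∑ r, g0 r)/(a*b)) := by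
    rw [Finset.sum_add_distrib, ← Finset.mul_sum, Finset.sum_sub_distrib]; ring
  have e3 : (k0 + t*(k1-k0))/(a*b) = k0/(a*b) + t*((k1-k0)/(a*b)) := by ring
  constructor
  · rintro ⟨-, -, hg, hc, hk, hkab⟩
    rw [e2] at hc
    rw [e3] at hkab
    exact ⟨fun r => (e1 _ _).1 (hg r), hc, (e1 _ _).1 hk, hkab⟩
  · rintro ⟨hg, hc, hk, hkab⟩
    refine ⟨ha, hb, fun r => (e1 _ _).2 (hg r), ?_, (e1 _ _).2 hk, ?_⟩
    · rw [e2]; exact hc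
    · rw [e3]; exact hkab

theorem IBC_continuation (h : HypFE) {g0 g1 : Fin 4 → ℂ} {k0 k1 C : ℂ} (H1 : Adm a b g1 k1)
    (H0 : Adm a b g0 k0) (hE : ∀ᶠ t : ℂ in 𝓝 0, IBC n a b (fun r => g0 r + t*(g1 r - g0 r)) (k0+t*(k1-k0)) *
      evDen n a b (∑ r, (g0 r + t*(g1 r - g0 r))) (k0+t*(k1-k0)) =
      C * evNum n a b (fun r => g0 r + t*(g1 r - g0 r)) (k0+t*(k1-k0))) :
    IBC n a b g1 k1 * evDen n a b (∑ r, g1 r) k1 = C * evNum n a b g1 k1 := by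
  set U := {t : ℂ | Adm a b (fun r => g0 r + t*(g1 r - g0 r)) (k0 + t*(k1-k0))} with hU
  have hUe := setOf_adm_segment H1.ha H1.hb g0 g1 k0 k1
  have hUo : IsOpen U := by
    rw [hU, hUe]
    exact (isOpen_iInter_of_finite fun r => isOpen_affine_re _ _).inter ((isOpen_affine_re _ _).inter
      ((isOpen_affine_re _ _).inter (isOpen_affine_re _ _)))
  have hUc : Convex ℝ U := by
    rw [hU, hUe]
    exact (convex_iInter fun r => convex_affine_re _ _).inter ((convex_affine_re _ _).inter
      ((convex_affine_re _ _).inter (convex_affine_re _ _)))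
  have dg : ∀ r, DifferentiableOn ℂ (fun t : ℂ => g0 r + t*(g1 r - g0 r)) U := fun r => by fun_prop
  have dk : DifferentiableOn ℂ (fun t : ℂ => k0 + t*(k1-k0)) U := by fun_prop
  have dF := ((differentiableOn_IBC (n := n) h hUo (fun t ht => ht) dg dk).mul
    (differentiableOn_evDen (n := n) h hUo (fun t ht => ht) dg dk)).sub
    ((differentiableOn_evNum (n := n) h hUo (fun t ht => ht) dg dk).const_mul C)
  have h0 : (0:ℂ) ∈ U := by simpa [hU] using H0
  have h1 : (1:ℂ) ∈ U := by simpa [hU] using H1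
  have := (dF.analyticOnNhd hUo).eqOn_zero_of_preconnected_of_eventuallyEq_zero hUc.isPreconnected h0
    (hE.mono fun t ht => sub_eq_zero.2 ht) h1
  have := sub_eq_zero.1 this
  simpa using this

/-- Couplings of the `B_n` specialization. -/
def gT (a b ks : ℂ) : Fin 4 → ℂ := ![ks, ks - a/2, -b/2, -a/2-b/2]

theorem sum_gT (a b ks : ℂ) : ∑ r, gT a b ks r = 2*ks - a - b := by
  simp [gT, Fin.sum_univ_four]; ring

variable {ks : ℂ}

theorem adm_gT (ha : 0 < a.re) (hb : 0 < b.re) (hks : ks.re < 0) (hksab : 0 < (ks/(a*b)).re)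
    (hk : k.re < 0) (hkab : 0 < (k/(a*b)).re) : Adm a b (gT a b ks) k := by
  refine ⟨ha, hb, fun r => ?_, ?_, hk, hkab⟩
  · fin_cases r <;> simp [gT] <;> linarith
  · rw [sum_gT, show (a+b+(2*ks-a-b))/(a*b) = ((2:ℝ):ℂ)*(ks/(a*b)) by push_cast; ring,
      Complex.re_ofReal_mul]
    linarith

theorem gT_eq_gsym (a b ks : ℂ) : gT a b ks = gsym ((2*ks-a-b)/4) (b/4+ks/2) (a/4) := by
  funext r
  fin_cases r <;> simp [gT, gsym] <;> ring

theorem IBC_gT_of_im_ne (h : HypFE) (ha : 0 < a.re) (hb : 0 < b.re) (hks : ks.re < 0)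
    (hksab : 0 < (ks/(a*b)).re) (hk : k.re < 0) (hkab : 0 < (k/(a*b)).re) (hab : (a/b).im ≠ 0) :
    IBC n a b (gT a b ks) k * evDen n a b (2*ks-a-b) k =
      2^n * (Nat.factorial n : ℂ) * ((a*b)^((1:ℂ)/2))^n * evNum n a b (gT a b ks) k := by
  have hane := re_ne ha
  obtain ⟨e, he0, he1, he2⟩ : ∃ e : ℝ, 0 < e ∧ e < 1 ∧ e * a.re < b.re := by
    refine ⟨min 2⁻¹ (b.re/(2*a.re)), lt_min (by norm_num) (by positivity),
      (min_le_left _ _).trans_lt (by norm_num), ?_⟩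
    calc _ ≤ b.re/(2*a.re) * a.re := mul_le_mul_of_nonneg_right (min_le_right _ _) ha.le
      _ = b.re/2 := by field_simp
      _ < _ := by linarith
  obtain ⟨d, hd0, hd1⟩ : ∃ d : ℝ, 0 < d ∧ 0 < e*a.re + 2*n*(d*k.re) := by
    refine ⟨e*a.re/(2*(n+1)*(-k.re)), by have := neg_pos.2 hk; positivity, ?_⟩
    have : e*a.re + 2*n*(e*a.re/(2*(n+1)*(-k.re))*k.re) = e*a.re/(n+1) := by
      have := hk.ne
      field_simp
      ring
    rw [this]; positivity
  set c0 : ℂ := e*a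
  set k0 : ℂ := d*k
  have hc0 : c0.re = e*a.re := Complex.re_ofReal_mul _ _
  have hk0 : k0.re = d*k.re := Complex.re_ofReal_mul _ _
  have hk0ab : 0 < (k0/(a*b)).re := by
    rw [show k0/(a*b) = (d:ℂ)*(k/(a*b)) by simp only [k0]; ring, Complex.re_ofReal_mul]
    positivity
  have hc0ab : 0 < (c0/(a*b)).re := by
    rw [show c0/(a*b) = (e:ℂ)*b⁻¹ by simp only [c0]; field_simp, Complex.re_ofReal_mul]
    exact mul_pos he0 (inv_re_pos hb)
  have hea : e*a.re < a.re := by nlinarith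
  set P : ℂ → ℂ := fun t => (c0-a-b)/4 + t*((2*ks-a-b)/4 - (c0-a-b)/4) with hP
  have hP4 : ∀ t, a+b+4*P t = c0 + t*(2*ks-c0) := fun t => by simp only [hP]; ring
  have hg : ∀ t : ℂ, (fun r => gsym ((c0-a-b)/4) 0 (a/4) r +
      t*(gT a b ks r - gsym ((c0-a-b)/4) 0 (a/4) r)) = gsym (P t) (t*(b/4+ks/2)) (a/4) := fun t => by
    funext r
    rw [gT_eq_gsym, hP]
    fin_cases r <;> simp [gsym] <;> ring
  have hpos : ∀ f : ℂ → ℂ, ContinuousAt f 0 → 0 < (f 0).re → ∀ᶠ t in 𝓝 0, 0 < (f t).re :=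
    fun f hf h0 => (Complex.continuous_re.continuousAt.comp hf).eventually_const_lt h0
  have key : ∀ᶠ t : ℂ in 𝓝 0, Base n a b (P t) (k0 + t*(k-k0)) ∧
      4*|(t*(b/4+ks/2)).re| + (a+b+4*P t).re < a.re ∧
      4*|(t*(b/4+ks/2)).re| + (a+b+4*P t).re < b.re ∧
      |(a/4).re| + |(t*(b/4+ks/2)).re| < -(P t).re := by
    have c1 : ContinuousAt (fun t : ℂ => 4*|(t*(b/4+ks/2)).re| + (c0 + t*(2*ks-c0)).re) 0 := by
      refine ContinuousAt.add (continuousAt_const.mul (ContinuousAt.abs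
        (Complex.continuous_re.continuousAt.comp (by fun_prop))))
        (Complex.continuous_re.continuousAt.comp (by fun_prop))
    filter_upwards [hpos (fun t => (c0 + t*(2*ks-c0))/(a*b)) (by fun_prop) (by simpa using hc0ab),
      hpos (fun t => -(k0 + t*(k-k0))) (by fun_prop) (by
        simp only [zero_mul, add_zero, Complex.neg_re, hk0]; nlinarith),
      hpos (fun t => (k0 + t*(k-k0))/(a*b)) (by fun_prop) (by simpa using hk0ab),
      hpos (fun t => (c0 + t*(2*ks-c0)) + 2*n*(k0 + t*(k-k0))) (by fun_prop) (by
        simp only [zero_mul, add_zero, Complex.add_re, hc0]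
        rw [show (2*(n:ℂ)*k0).re = 2*n*(d*k.re) by
          rw [← hk0, show (2*(n:ℂ)) = ((2*n:ℝ):ℂ) by push_cast; ring, Complex.re_ofReal_mul]]
        exact hd1),
      c1.eventually_lt_const (show _ < a.re by simpa [hc0] using hea),
      c1.eventually_lt_const (show _ < b.re by simpa [hc0] using he2)] with t h1 h2 h3 h4 h5 h6
    have habs := abs_nonneg (t*(b/4+ks/2)).re
    rw [← hP4] at h1 h4 h5 h6
    have hPr : (a+b+4*P t).re = a.re+b.re+4*(P t).re := by simp
    refine ⟨⟨ha, hb, h1, neg_pos.1 h2, h3, ?_, by linarith, by linarith⟩, h5, h6, ?_⟩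
    · rw [Complex.add_re, show (2*(n:ℂ)) = ((2*n:ℝ):ℂ) by push_cast; ring, Complex.re_ofReal_mul] at h4
      exact h4
    · rw [show (a/4).re = a.re/4 by simp, abs_of_pos (by linarith)]
      linarith
  have H1 := adm_gT ha hb hks hksab hk hkab
  have H0 : Adm a b (gsym ((c0-a-b)/4) 0 (a/4)) k0 := by
    obtain ⟨B, -, -, hx⟩ := key.self_of_nhds
    have := B.adm (al := 0) (x := a/4) (by simpa [add_comm] using hx)
    simpa [hP] using this
  rw [← sum_gT]
  refine IBC_continuation h H1 H0 ?_
  filter_upwards [key] with t ht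
  obtain ⟨B, h1, h2, h3⟩ := ht
  have h3' : |(t*(b/4+ks/2)).re| + |(a/4).re| < -(P t).re := by linarith
  have r := B.ratio_eq_zero h hab h1 h2 h3
  rw [ratio_swap, B.ratio_const h hab, ratio, div_eq_iff (evNum_ne_zero h (B.adm h3') (B.hn' _ _))] at r
  rw [hg t, ← r, ← hg t]

theorem IBC_gT (h : HypFE) (ha : 0 < a.re) (hb : 0 < b.re) (hks : ks.re < 0)
    (hksab : 0 < (ks/(a*b)).re) (hk : k.re < 0) (hkab : 0 < (k/(a*b)).re) :
    IBC n a b (gT a b ks) k * evDen n a b (2*ks-a-b) k =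
      2^n * (Nat.factorial n : ℂ) * ((a*b)^((1:ℂ)/2))^n * evNum n a b (gT a b ks) k := by
  by_cases hab : (a/b).im = 0
  swap
  · exact IBC_gT_of_im_ne h ha hb hks hksab hk hkab hab
  have hane := re_ne ha
  have hbne := re_ne hb
  have hre : (a/b).re ≠ 0 := fun h0 => div_ne_zero hane hbne (Complex.ext h0 hab)
  set A : ℝ → ℂ := fun s => a*(1+Complex.I*s) with hA
  have hA0 : A 0 = a := by simp [hA]
  have cA : ContinuousAt A 0 := by fun_prop
  have cg : ContinuousAt (fun s => gT (A s) b ks) 0 := by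
    refine continuousAt_pi.2 fun r => ?_
    fin_cases r <;> simp [gT] <;> fun_prop
  have cgr := continuousAt_pi.1 cg
  have H := adm_gT ha hb hks hksab hk hkab
  have cI : ContinuousAt (fun s => IBC n (A s) b (gT (A s) b ks) k) 0 :=
    continuousAt_IBC h (p0 := (0:ℝ)) (a := A) (k := fun _ => k) (g := fun s => gT (A s) b ks)
      (by rw [hA0]; exact H) cA cg continuousAt_const
  have cD : ContinuousAt (fun s => evDen n (A s) b (2*ks-A s-b) k) 0 := by
    refine tendsto_finsetProd _ fun j hj => ?_
    refine (continuousAt_ev h (A := A) (X := fun _ => k) (by rwa [hA0]) hb hk cA continuousAt_const).mul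
      (continuousAt_ev h (A := A) (by rwa [hA0]) hb ?_ cA (by fun_prop))
    rw [hA0, Complex.add_re, re_coeff_mul]
    have := coeff_mul_re_nonpos (Finset.mem_range.1 hj) hk
    simp; linarith
  have cN : ContinuousAt (fun s => evNum n (A s) b (gT (A s) b ks) k) 0 := by
    refine tendsto_finsetProd _ fun j hj => ?_
    have h1 := jk_re_nonpos j hk
    have key : ∀ r s : Fin 4, ContinuousAt (fun t => ev (A t) b (j*k + gT (A t) b ks r + gT (A t) b ks s)) 0 :=
      fun r s => continuousAt_ev h (A := A) (by rwa [hA0]) hb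
        (by rw [hA0]; simp only [Complex.add_re, re_jk]; linarith [H.hg r, H.hg s]) cA
        ((continuousAt_const.add (cgr r)).add (cgr s))
    have hl : ContinuousAt (fun t => ev (A t) b ((j+1)*k)) 0 :=
      continuousAt_ev h (A := A) (X := fun _ => (j+1)*k) (by rwa [hA0]) hb
        (by rw [re_succ_mul]; linarith) cA continuousAt_const
    exact ((((((key 0 1).mul (key 0 2)).mul (key 0 3)).mul (key 1 2)).mul (key 1 3)).mul
      (key 2 3)).mul hl
  have cS : ContinuousAt (fun s => (A s*b)^((1:ℂ)/2)) 0 := by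
    refine ContinuousAt.cpow (cA.mul continuousAt_const) continuousAt_const ?_
    rw [hA0]; exact mul_mem_slitPlane ha hb
  have l1 := (cI.mul cD).tendsto.mono_left (nhdsWithin_le_nhds (s := Ioi 0))
  have l2 := ((continuousAt_const (y := (2:ℂ)^n * (Nat.factorial n : ℂ))).mul (cS.pow n)).mul cN
  have l2 := l2.tendsto.mono_left (nhdsWithin_le_nhds (s := Ioi 0))
  simp only [Pi.mul_apply, Pi.pow_apply, hA0] at l1 l2
  refine tendsto_nhds_unique (l1.congr' ?_) l2
  have hpos : ∀ f : ℝ → ℂ, ContinuousAt f 0 → 0 < (f 0).re → ∀ᶠ t in 𝓝 0, 0 < (f t).re :=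
    fun f hf h0 => (Complex.continuous_re.continuousAt.comp hf).eventually_const_lt h0
  have hA0b : A 0 * b ≠ 0 := by rw [hA0]; exact mul_ne_zero hane hbne
  filter_upwards [nhdsWithin_le_nhds (hpos A cA (by rwa [hA0])),
    nhdsWithin_le_nhds (hpos (fun s => ks/(A s*b)) (continuousAt_const.div (by fun_prop) hA0b)
      (by rwa [hA0])),
    nhdsWithin_le_nhds (hpos (fun s => k/(A s*b)) (continuousAt_const.div (by fun_prop) hA0b)
      (by rwa [hA0])), eventually_mem_nhdsWithin] with s h1 h2 h3 h4
  have h4' : 0 < s := h4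
  refine IBC_gT_of_im_ne h h1 hb hks h2 hk h3 ?_
  rw [hA, show a*(1+Complex.I*s)/b = a/b*(1+Complex.I*s) by ring, Complex.mul_im, hab]
  simp [hre, h4'.ne']

end

section
variable {a b z x : ℂ}

theorem mem_hypGammaPoles_of_cosh_eq_zero (ha : 0 < a.re) (hz : z.im ≤ -((a.re+b.re)/2))
    (h : Complex.cosh (Real.pi*(z + Complex.I*b/2)/a) = 0) : z ∈ hypGammaPoles a b := by
  have ha0 := re_ne ha
  have hpi : (Real.pi:ℂ) ≠ 0 := by exact_mod_cast Real.pi_ne_zero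
  rw [← Complex.cos_mul_I, Complex.cos_eq_zero_iff] at h
  obtain ⟨k, hk⟩ := h
  have h1 : z = -Complex.I*(a+b)/2 - (k:ℂ)*Complex.I*a := by
    have h2 : (z + Complex.I*b/2) * Complex.I = (2*k+1)*a/2 := by
      field_simp at hk
      linear_combination hk/2
    linear_combination (-Complex.I) * h2 + (z + Complex.I*b/2) * Complex.I_mul_I
  have h3 : z.im = -((a.re+b.re)/2) - k*a.re := by
    rw [h1]
    rw [show -Complex.I*(a+b)/2 = (-Complex.I*(a+b)) * ((1/2:ℝ):ℂ) by push_cast; ring,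
      show ((k:ℂ)) = ((k:ℝ):ℂ) by push_cast; rfl]
    simp [Complex.sub_im, Complex.mul_im]; ring
  have h4 : (0:ℝ) ≤ k := by
    by_contra! hk
    rw [h3] at hz
    nlinarith
  obtain ⟨m, rfl⟩ := Int.eq_ofNat_of_zero_le (by exact_mod_cast h4 : 0 ≤ k)
  exact ⟨m, 0, by rw [h1]; push_cast; ring⟩

theorem G_mul_eX {G : ℂ → ℂ → ℂ → ℂ}
    (hG : ∀ a b : ℂ, 0 < a.re → 0 < b.re → IsHypGamma a b (G a b))
    (ha : 0 < a.re) (hb : 0 < b.re) (hz : z.im < (a.re+b.re)/2) (hp : z ∉ hypGammaPoles a b) :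
    G a b z * eX a b z = 1 := by
  have h := hypFE_of_isHypGamma hG
  have key : ∀ m : ℕ, ∀ z : ℂ, z.im < (a.re+b.re)/2 → z ∉ hypGammaPoles a b →
      -((a.re+b.re)/2) - m*b.re < z.im → G a b z * eX a b z = 1 := by
    intro m
    induction m with
    | zero =>
      intro z hz _ hm
      have hs : |z.im| < (a.re+b.re)/2 := abs_lt.2 ⟨by simpa using hm, hz⟩
      rw [eX_eq_eS h ha hb hs, (hG a b ha hb).strip z (by
        rw [show (a+b)/2 = (a+b) * ((1/2:ℝ):ℂ) by push_cast; ring, Complex.re_mul_ofReal]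
        simp; linarith), hypGammaInt_eq (re_ne ha) (re_ne hb)]
      unfold eS
      rw [← Complex.exp_add]; simp
    | succ m ih =>
      intro z hz hp hm
      rcases lt_or_ge (-((a.re+b.re)/2) - m*b.re) z.im with h1 | h1
      · exact ih z hz hp h1
      have h2 : z.im ≤ -((a.re+b.re)/2) := h1.trans (by
        have : 0 ≤ m*b.re := by positivity
        linarith)
      have hc : Complex.cosh (Real.pi*(z + Complex.I*b/2)/a) ≠ 0 := fun h0 =>
        hp (mem_hypGammaPoles_of_cosh_eq_zero ha h2 h0)
      have him : (z + Complex.I*b).im = z.im + b.re := by simp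
      have hz' : (z + Complex.I*b).im < (a.re+b.re)/2 := by rw [him]; linarith
      have e := ih (z + Complex.I*b) hz' (by
        rintro ⟨m, k, hk⟩
        exact hp ⟨m, k+1, by push_cast; linear_combination hk⟩) (by
        rw [him]; push_cast at hm; linarith)
      have f1 := (hG a b ha hb).funEqm (z + Complex.I*b/2) hc
      have f2 := eX_sub h ha hb hz'
      rw [show z + Complex.I*b/2 + Complex.I*b/2 = z + Complex.I*b by ring,
        show z + Complex.I*b/2 - Complex.I*b/2 = z by ring] at f1
      rw [show z + Complex.I*b - Complex.I*b = z by ring,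
        show z + Complex.I*b - Complex.I*b/2 = z + Complex.I*b/2 by ring] at f2
      rw [f1] at e
      rw [f2]
      linear_combination e
  obtain ⟨m, hm⟩ := exists_nat_gt ((-((a.re+b.re)/2) - z.im)/b.re)
  refine key m z hz hp ?_
  rw [div_lt_iff₀ hb] at hm
  linarith

theorem G_eq_inv {G : ℂ → ℂ → ℂ → ℂ}
    (hG : ∀ a b : ℂ, 0 < a.re → 0 < b.re → IsHypGamma a b (G a b))
    (ha : 0 < a.re) (hb : 0 < b.re) (hz : z.im < (a.re+b.re)/2) (hp : z ∉ hypGammaPoles a b) :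
    G a b z = (eX a b z)⁻¹ :=
  eq_inv_of_mul_eq_one_left (G_mul_eX hG ha hb hz hp)

theorem notMem_hypGammaPoles (ha : 0 < a.re) (hb : 0 < b.re) (h : 0 < ((x+a+b)/(a*b)).re) :
    Complex.I*((a+b)/2 + x) ∉ hypGammaPoles a b := by
  rintro ⟨m, n, hmn⟩
  have ha0 := re_ne ha
  have hb0 := re_ne hb
  have h1 : x + a + b = -(m*a) - n*b := by
    have := mul_left_cancel₀ Complex.I_ne_zero
      ((by linear_combination hmn : Complex.I * (x + a + b) = Complex.I * (-(m*a) - n*b)))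
    exact this
  rw [h1, show (-(m*a) - n*b)/(a*b) = -(((m:ℝ):ℂ) * b⁻¹) - ((n:ℝ):ℂ)*a⁻¹ by
    push_cast; field_simp] at h
  rw [Complex.sub_re, Complex.neg_re, Complex.re_ofReal_mul, Complex.re_ofReal_mul] at h
  have h2 : 0 ≤ (a⁻¹).re := by
    rw [Complex.inv_re]; have := Complex.normSq_nonneg a; positivity
  have h3 : 0 ≤ (b⁻¹).re := by
    rw [Complex.inv_re]; have := Complex.normSq_nonneg b; positivity
  have : 0 ≤ (m:ℝ) * (b⁻¹).re := by positivity
  have : 0 ≤ (n:ℝ) * (a⁻¹).re := by positivity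
  linarith

/-- On the admissible half-plane the gamma function is the reciprocal of `ev`. -/
theorem G_mul_ev {G : ℂ → ℂ → ℂ → ℂ}
    (hG : ∀ a b : ℂ, 0 < a.re → 0 < b.re → IsHypGamma a b (G a b))
    (ha : 0 < a.re) (hb : 0 < b.re) (hx : x.re < 0) (h : 0 < ((x+a+b)/(a*b)).re) :
    G a b (Complex.I*((a+b)/2 + x)) * ev a b x = 1 := by
  refine G_mul_eX hG ha hb ?_ (notMem_hypGammaPoles ha hb h)
  rw [show (a+b)/2 = (a+b) * ((1/2:ℝ):ℂ) by push_cast; ring]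
  rw [Complex.I_mul_im, Complex.add_re, Complex.re_mul_ofReal, Complex.add_re]
  linarith

end

section
variable {a b k ks x : ℂ} {n : ℕ} {G : ℂ → ℂ → ℂ → ℂ}

theorem G_mul_ev_of_eq (hG : ∀ a b : ℂ, 0 < a.re → 0 < b.re → IsHypGamma a b (G a b))
    (ha : 0 < a.re) (hb : 0 < b.re) (hks : ks.re < 0) (hksab : 0 < (ks/(a*b)).re)
    (hk : k.re < 0) (hkab : 0 < (k/(a*b)).re) (p c s t : ℝ) (hp : 0 ≤ p) (hc : 0 ≤ c)
    (hs : 0 ≤ s) (ht : 0 ≤ t) (hs1 : s ≤ 1) (ht1 : t ≤ 1) (h0 : 0 < p + c + s)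
    (h1 : 0 < p + c + (1 - s)) (hx : x = p*k + c*ks - s*a - t*b) :
    G a b (Complex.I*((a+b)/2 + x)) * ev a b x = 1 := by
  have ha0 := re_ne ha
  have hb0 := re_ne hb
  refine G_mul_ev hG ha hb ?_ ?_
  · rw [hx]
    simp only [Complex.sub_re, Complex.add_re, Complex.re_ofReal_mul]
    have e1 : p*k.re ≤ 0 := mul_nonpos_of_nonneg_of_nonpos hp hk.le
    have e2 : c*ks.re ≤ 0 := mul_nonpos_of_nonneg_of_nonpos hc hks.le
    have e3 : 0 ≤ s*a.re := by positivity
    have e4 : 0 ≤ t*b.re := by positivity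
    rcases hp.eq_or_lt with hp | hp
    · rcases hc.eq_or_lt with hc | hc
      · have : 0 < s*a.re := mul_pos (by linarith) ha
        linarith
      · have := mul_neg_of_pos_of_neg hc hks; linarith
    · have := mul_neg_of_pos_of_neg hp hk; linarith
  · rw [show (x+a+b)/(a*b) = (p:ℂ)*(k/(a*b)) + (c:ℂ)*(ks/(a*b)) + ((1-s:ℝ):ℂ)*b⁻¹
      + ((1-t:ℝ):ℂ)*a⁻¹ by rw [hx]; push_cast; field_simp; ring]
    simp only [Complex.add_re, Complex.re_ofReal_mul]
    have i1 := inv_re_pos hb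
    have i2 := inv_re_pos ha
    have e1 : 0 ≤ p*(k/(a*b)).re := by positivity
    have e2 : 0 ≤ c*(ks/(a*b)).re := by positivity
    have e3 : 0 ≤ (1-s)*(b⁻¹).re := mul_nonneg (by linarith) i1.le
    have e4 : 0 ≤ (1-t)*(a⁻¹).re := mul_nonneg (by linarith) i2.le
    rcases hp.eq_or_lt with hp | hp
    · rcases hc.eq_or_lt with hc | hc
      · have : 0 < (1-s)*(b⁻¹).re := mul_pos (by linarith) i1
        linarith
      · have := mul_pos hc hksab; linarith
    · have := mul_pos hp hkab; linarith

theorem NBC_gT (hG : ∀ a b : ℂ, 0 < a.re → 0 < b.re → IsHypGamma a b (G a b))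
    (ha : 0 < a.re) (hb : 0 < b.re) (hks : ks.re < 0) (hksab : 0 < (ks/(a*b)).re)
    (hk : k.re < 0) (hkab : 0 < (k/(a*b)).re) :
    NBC G n a b (gT a b ks) k = IBC n a b (gT a b ks) k := by
  have hv := @G_mul_ev_of_eq a b k ks
  have H := IBC_gT (n := n) (hypFE_of_isHypGamma hG) ha hb hks hksab hk hkab
  have hden : evDen n a b (2*ks-a-b) k ≠ 0 := by
    refine Finset.prod_ne_zero_iff.2 fun j hj => mul_ne_zero ?_ ?_
    · exact right_ne_zero_of_mul_eq_one (hv hG ha hb hks hksab hk hkab 1 0 0 0 (by norm_num)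
        (by norm_num) (by norm_num) (by norm_num) (by norm_num) (by norm_num) (by norm_num)
        (by norm_num) (by push_cast; ring))
    · have hj : (j:ℝ) + 1 ≤ n := by exact_mod_cast Finset.mem_range.1 hj
      have hj0 : (0:ℝ) ≤ j := Nat.cast_nonneg j
      exact right_ne_zero_of_mul_eq_one (hv hG ha hb hks hksab hk hkab (2*n-j-2) 2 1 1 (by linarith)
        (by norm_num) (by norm_num) (by norm_num) (by norm_num) (by norm_num) (by linarith)
        (by linarith) (by push_cast; ring))
  refine mul_right_cancel₀ hden (Eq.trans ?_ H.symm)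
  unfold NBC evDen evNum
  rw [mul_assoc, ← Finset.prod_mul_distrib]
  congr 1
  refine Finset.prod_congr rfl fun j hj => ?_
  have hj : (j:ℝ) + 1 ≤ n := by exact_mod_cast Finset.mem_range.1 hj
  have hj0 : (0:ℝ) ≤ j := Nat.cast_nonneg j
  have f1 := hv hG ha hb hks hksab hk hkab (x := k) 1 0 0 0 (by norm_num)
        (by norm_num) (by norm_num) (by norm_num) (by norm_num) (by norm_num) (by norm_num)
        (by norm_num) (by push_cast; ring)
  have f2 := hv hG ha hb hks hksab hk hkab (x := (2*n-j-2)*k+(2*ks-a-b)) (2*n-j-2) 2 1 1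
        (by linarith) (by norm_num) (by norm_num) (by norm_num) (by norm_num) (by norm_num)
        (by linarith) (by linarith) (by push_cast; ring)
  have f3 := hv hG ha hb hks hksab hk hkab (x := (j+1)*k) (j+1) 0 0 0 (by linarith)
        (by norm_num) (by norm_num) (by norm_num) (by norm_num) (by norm_num) (by linarith)
        (by linarith) (by push_cast; ring)
  have p01 := hv hG ha hb hks hksab hk hkab (x := j*k + gT a b ks 0 + gT a b ks 1) j 2 (1/2) 0
        hj0 (by norm_num) (by norm_num) (by norm_num) (by norm_num) (by norm_num)
        (by linarith) (by linarith) (by simp [gT]; ring)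
  have p02 := hv hG ha hb hks hksab hk hkab (x := j*k + gT a b ks 0 + gT a b ks 2) j 1 0 (1/2)
        hj0 (by norm_num) (by norm_num) (by norm_num) (by norm_num) (by norm_num)
        (by linarith) (by linarith) (by simp [gT]; ring)
  have p03 := hv hG ha hb hks hksab hk hkab (x := j*k + gT a b ks 0 + gT a b ks 3) j 1 (1/2) (1/2)
        hj0 (by norm_num) (by norm_num) (by norm_num) (by norm_num) (by norm_num)
        (by linarith) (by linarith) (by simp [gT]; ring)
  have p12 := hv hG ha hb hks hksab hk hkab (x := j*k + gT a b ks 1 + gT a b ks 2) j 1 (1/2) (1/2)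
        hj0 (by norm_num) (by norm_num) (by norm_num) (by norm_num) (by norm_num)
        (by linarith) (by linarith) (by simp [gT]; ring)
  have p13 := hv hG ha hb hks hksab hk hkab (x := j*k + gT a b ks 1 + gT a b ks 3) j 1 1 (1/2)
        hj0 (by norm_num) (by norm_num) (by norm_num) (by norm_num) (by norm_num)
        (by linarith) (by linarith) (by simp [gT]; ring)
  have p23 := hv hG ha hb hks hksab hk hkab (x := j*k + gT a b ks 2 + gT a b ks 3) j 0 (1/2) 1
        hj0 (by norm_num) (by norm_num) (by norm_num) (by norm_num) (by norm_num)
        (by linarith) (by linarith) (by simp [gT]; ring)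
  have hS : gT a b ks 0 + gT a b ks 1 + gT a b ks 2 + gT a b ks 3 = 2*ks-a-b := by
    rw [← sum_gT, Fin.sum_univ_four]
  rw [hS, Finset.prod_filter, Fintype.prod_prod_type]
  simp only [Fin.prod_univ_four, Fin.isValue, Fin.reduceLT, if_true, if_false, mul_one, one_mul,
    lt_self_iff_false]
  rw [eq_inv_of_mul_eq_one_left f1, add_assoc ((a+b)/2), eq_inv_of_mul_eq_one_left f2,
    eq_inv_of_mul_eq_one_left f3]
  simp only [add_assoc ((a+b)/2)]
  rw [eq_inv_of_mul_eq_one_left p01, eq_inv_of_mul_eq_one_left p02, eq_inv_of_mul_eq_one_left p03,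
    eq_inv_of_mul_eq_one_left p12, eq_inv_of_mul_eq_one_left p13, eq_inv_of_mul_eq_one_left p23]
  have g1 := right_ne_zero_of_mul_eq_one f1
  have g2 := right_ne_zero_of_mul_eq_one f2
  generalize ev a b k = X1 at g1 ⊢
  generalize ev a b ((2*n-j-2)*k+(2*ks-a-b)) = X2 at g2 ⊢
  field_simp

end

section
variable {a b z : ℂ}

theorem hypGammaInt_half (a b z : ℂ) : hypGammaInt a (b/2) (z/2) = hypGammaInt (2*a) b z := by
  unfold hypGammaInt
  congr 2
  have := integral_comp_mul_left_Ioi (fun y : ℝ => (1/(y:ℂ)) * (Complex.sin (2*(y:ℂ)*(z/2)) /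
        (2 * Complex.sinh (a*(y:ℂ)) * Complex.sinh (b/2*(y:ℂ)))
      - z/2/(a*(b/2)*(y:ℂ)))) 0 (b := 2) (by norm_num)
  rw [mul_zero] at this
  rw [← inv_smul_smul₀ (two_ne_zero' ℝ) (∫ y in Ioi (0:ℝ), _), smul_comm, ← this, ← integral_smul]
  refine setIntegral_congr_fun measurableSet_Ioi fun y hy => ?_
  have hy : 0 < y := hy
  have hyc : (y:ℂ) ≠ 0 := by exact_mod_cast hy.ne'
  simp only [Complex.real_smul]
  push_cast
  rw [show 2*(2*(y:ℂ))*(z/2) = 2*y*z by ring, show a*(2*(y:ℂ)) = 2*a*y by ring,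
    show b/2*(2*(y:ℂ)) = b*y by ring]
  generalize Complex.sin _ / _ = X
  rcases eq_or_ne a 0 with rfl | ha
  · simp; ring
  rcases eq_or_ne b 0 with rfl | hb
  · simp; ring
  field_simp

theorem eX_half (h : HypFE) (ha : 0 < a.re) (hb : 0 < b.re) (hz : z.im < (2*a.re+b.re)/2) :
    eX a (b/2) (z/2) = eX (2*a) b z := by
  have ha2 : 0 < (2*a).re := by simpa using ha
  have hb2 : 0 < (b/2).re := by simpa using hb
  have ra : (2*a).re = 2*a.re := by simp
  have rb : (b/2).re = b.re/2 := by simp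
  have iz : ∀ z : ℂ, (z/2).im = z.im/2 := fun z => by simp
  have h1 : DifferentiableOn ℂ (fun z => eX a (b/2) (z/2)) {z | z.im < (2*a.re+b.re)/2} := by
    intro z hz
    have hz : z.im < (2*a.re+b.re)/2 := hz
    refine (DifferentiableAt.comp (f := fun z : ℂ => z/2) z
      (differentiableAt_eX h ha hb2 ?_) (by fun_prop)).differentiableWithinAt
    rw [iz, rb]; linarith
  have h2 := differentiableOn_eX h ha2 hb
  rw [ra] at h2
  refine (h1.analyticOnNhd (isOpen_im_lt _)).eqOn_of_preconnected_of_eventuallyEq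
    (h2.analyticOnNhd (isOpen_im_lt _)) (isPreconnected_im_lt _) (z₀ := 0)
    (by simp; linarith) ?_ hz
  have : ∀ᶠ w : ℂ in 𝓝 0, |w.im| < (2*a.re+b.re)/2 :=
    (by fun_prop : Continuous fun w : ℂ => |w.im|).continuousAt.eventually
      (gt_mem_nhds (by simp; linarith))
  filter_upwards [this] with w hw
  rw [eX_eq_eS h ha hb2 (by rw [iz, rb, abs_div, abs_two]; linarith),
    eX_eq_eS h ha2 hb (by rw [ra]; exact hw)]
  have := hypGammaInt_half a b w
  rw [hypGammaInt_eq (re_ne ha) (re_ne hb2), hypGammaInt_eq (re_ne ha2) (re_ne hb)] at this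
  unfold eS
  rw [Complex.exp_neg, Complex.exp_neg, this]

theorem kk_eq (a b z : ℂ) {y : ℝ} (hy : 0 < y) : kk a b z y = ((y:ℂ)^2)⁻¹ *
      ((Complex.sin (2*y*z) / (2*y)) / (shc (a*y) * shc (b*y)) - z) := by
  have hyc : (y:ℂ) ≠ 0 := by exact_mod_cast hy.ne'
  have h1 : z * shc (Complex.I * (2*y*z)) = Complex.sin (2*y*z) / (2*y) := by
    have := shc_mul (Complex.I * (2*y*z))
    rw [show Complex.I * (2*y*z) = (2*y*z) * Complex.I by ring, Complex.sinh_mul_I] at this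
    rw [eq_div_iff (by simpa using hyc), mul_comm Complex.I]
    exact mul_right_cancel₀ Complex.I_ne_zero
      ((by rw [← this]; ring : (z * shc (2*y*z*Complex.I) * (2*y)) * Complex.I =
        Complex.sin (2*y*z) * Complex.I))
  rw [← h1, kk]; ring

theorem shc_two_mul (w : ℂ) : shc (2*w) = shc w * Complex.cosh w := by
  rcases eq_or_ne w 0 with rfl | hw
  · simp [shc_zero]
  · rw [shc, if_neg (by simpa using hw), shc, if_neg hw, Complex.sinh_two_mul]
    field_simp

theorem kk_duplication (ha : 0 < a.re) {y : ℝ} (hy : 0 < y) :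
    kk (2*a) b (z + Complex.I*a/2) y + kk (2*a) b (z - Complex.I*a/2) y = 2 * kk a b z y := by
  have hyc : (y:ℂ) ≠ 0 := by exact_mod_cast hy.ne'
  have hne : shc (2*a*y) ≠ 0 := shc_ne_zero (Or.inl (by simp; exact mul_pos (by linarith) hy))
  rw [kk_eq _ _ _ hy, kk_eq _ _ _ hy, kk_eq _ _ _ hy]
  rw [show 2*a*y = 2*(a*y) by ring, shc_two_mul] at hne ⊢
  have hc := right_ne_zero_of_mul hne
  have hs : Complex.sin (2*y*(z + Complex.I*a/2)) + Complex.sin (2*y*(z - Complex.I*a/2)) =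
      2 * Complex.sin (2*y*z) * Complex.cosh (a*y) := by
    rw [show 2*y*(z + Complex.I*a/2) = 2*y*z + a*y*Complex.I by ring,
      show 2*y*(z - Complex.I*a/2) = 2*y*z - a*y*Complex.I by ring,
      Complex.sin_add, Complex.sin_sub, Complex.cos_mul_I]
    ring
  calc _ = ((y:ℂ)^2)⁻¹ * ((Complex.sin (2*y*(z + Complex.I*a/2)) +
        Complex.sin (2*y*(z - Complex.I*a/2))) / (2*y) /
        (shc (a*y) * Complex.cosh (a*y) * shc (b*y)) - 2*z) := by ring
    _ = _ := by
      rw [hs, mul_right_comm (shc (a*y)) (Complex.cosh (a*y)), ← div_div _ _ (Complex.cosh (a*y)),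
        show 2 * Complex.sin (2*y*z) * Complex.cosh (a*y) / (2*y) / (shc (a*y) * shc (b*y)) /
          Complex.cosh (a*y) = 2 * (Complex.sin (2*y*z) / (2*y) / (shc (a*y) * shc (b*y))) *
          (Complex.cosh (a*y) / Complex.cosh (a*y)) by ring, div_self hc]
      ring

theorem eX_duplication (h : HypFE) (ha : 0 < a.re) (hb : 0 < b.re)
    (hz : z.im < (a.re+b.re)/2) :
    eX a b z = eX (2*a) b (z + Complex.I*a/2) * eX (2*a) b (z - Complex.I*a/2) := by
  have ha2 : 0 < (2*a).re := by simpa using ha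
  have ra : (2*a).re = 2*a.re := by simp
  have ip : ∀ z : ℂ, (z + Complex.I*a/2).im = z.im + a.re/2 := fun z => by
    rw [Complex.add_im, im_I_mul_div_two]
  have im : ∀ z : ℂ, (z - Complex.I*a/2).im = z.im - a.re/2 := fun z => by
    rw [Complex.sub_im, im_I_mul_div_two]
  have h1 := differentiableOn_eX h ha hb
  have h2 : DifferentiableOn ℂ (fun z => eX (2*a) b (z + Complex.I*a/2) *
      eX (2*a) b (z - Complex.I*a/2)) {z | z.im < (a.re+b.re)/2} := by
    intro z hz
    have hz : z.im < (a.re+b.re)/2 := hz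
    refine DifferentiableAt.differentiableWithinAt (DifferentiableAt.mul ?_ ?_)
    · exact DifferentiableAt.comp (f := fun z : ℂ => z + Complex.I*a/2) z
        (differentiableAt_eX h ha2 hb (by rw [ip, ra]; linarith)) (by fun_prop)
    · exact DifferentiableAt.comp (f := fun z : ℂ => z - Complex.I*a/2) z
        (differentiableAt_eX h ha2 hb (by rw [im, ra]; linarith)) (by fun_prop)
  refine (h1.analyticOnNhd (isOpen_im_lt _)).eqOn_of_preconnected_of_eventuallyEq
    (h2.analyticOnNhd (isOpen_im_lt _)) (isPreconnected_im_lt _) (z₀ := 0)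
    (by simp; linarith) ?_ hz
  have : ∀ᶠ w : ℂ in 𝓝 0, |w.im| < (a.re+b.re)/2 :=
    (by fun_prop : Continuous fun w : ℂ => |w.im|).continuousAt.eventually
      (gt_mem_nhds (by simp; linarith))
  filter_upwards [this] with w hw
  have hw' := abs_lt.1 hw
  have hp : |(w + Complex.I*a/2).im| < ((2*a).re+b.re)/2 := by
    rw [ip, ra, abs_lt]; constructor <;> linarith
  have hm : |(w - Complex.I*a/2).im| < ((2*a).re+b.re)/2 := by
    rw [im, ra, abs_lt]; constructor <;> linarith
  rw [eX_eq_eS h ha hb hw, eX_eq_eS h ha2 hb hp, eX_eq_eS h ha2 hb hm]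
  have key : hK (2*a) b (w + Complex.I*a/2) + hK (2*a) b (w - Complex.I*a/2) = 2 * hK a b w := by
    unfold hK
    rw [← integral_add (integrableOn_kk ha2 (Or.inl hb) hp)
      (integrableOn_kk ha2 (Or.inl hb) hm), ← integral_const_mul]
    exact setIntegral_congr_fun measurableSet_Ioi fun y hy => kk_duplication ha hy
  unfold eS
  rw [← Complex.exp_add]
  congr 1
  have ha0 := re_ne ha
  have hb0 := re_ne hb
  rw [eq_sub_of_add_eq key]
  field_simp
  ring

end

section
variable {a b k : ℂ} {x : ℝ} {G : ℂ → ℂ → ℂ → ℂ}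

theorem cosh_quarter_shift (ha : a ≠ 0) (z : ℂ) :
    Complex.cosh (Real.pi*(z + Complex.I*a/2)/a) = Complex.I * Complex.sinh (Real.pi*z/a) := by
  rw [show (Real.pi:ℂ)*(z + Complex.I*a/2)/a = Real.pi*z/a + Real.pi/2*Complex.I by
    field_simp, Complex.cosh_add, Complex.cosh_mul_I, Complex.sinh_mul_I]
  simp [mul_comm]

theorem G_mul_G_neg (hG : ∀ a b : ℂ, 0 < a.re → 0 < b.re → IsHypGamma a b (G a b))
    (ha : 0 < a.re) (hb : 0 < b.re) {z : ℂ} (hz : |z.im| < (a.re+b.re)/2) :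
    G a b z * G a b (-z) = 1 := by
  have hs : ((a+b)/2).re = (a.re+b.re)/2 := by
    rw [show (a+b)/2 = (a+b) * ((1/2:ℝ):ℂ) by push_cast; ring, Complex.re_mul_ofReal]
    simp; ring
  rw [(hG a b ha hb).strip z (by rwa [hs]), (hG a b ha hb).strip (-z) (by simpa [hs] using hz),
    hypGammaInt_eq (re_ne ha) (re_ne hb), hypGammaInt_eq (re_ne ha) (re_ne hb), hK_neg,
    ← Complex.exp_add, ← Complex.exp_zero]
  congr 1; ring

/-- The weight of a pair of opposite roots, in terms of the reciprocal gamma function. -/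
theorem pair_weight (hG : ∀ a b : ℂ, 0 < a.re → 0 < b.re → IsHypGamma a b (G a b))
    (ha : 0 < a.re) (hb : 0 < b.re) (hk : k.re < 0) (hx : x ≠ 0)
    (h1 : (x:ℂ) + Complex.I*(k+(a+b)/2) ∉ hypGammaPoles a b)
    (h2 : -(x:ℂ) + Complex.I*(k+(a+b)/2) ∉ hypGammaPoles a b) :
    G a b ((x:ℂ) + Complex.I*(a+b)/2) / G a b ((x:ℂ) + Complex.I*(k+(a+b)/2)) *
      (G a b (-(x:ℂ) + Complex.I*(a+b)/2) / G a b (-(x:ℂ) + Complex.I*(k+(a+b)/2))) =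
    4 * Complex.sinh (Real.pi*x/a) * Complex.sinh (Real.pi*x/b) *
      (eX a b (x + Complex.I*((a+b)/2+k)) * eX a b (-x + Complex.I*((a+b)/2+k))) := by
  have ha0 := re_ne ha
  have hb0 := re_ne hb
  have i1 : ∀ y : ℝ, ((y:ℂ) + Complex.I*(k+(a+b)/2)).im < (a.re+b.re)/2 := fun y => by
    rw [show (a+b)/2 = (a+b) * ((1/2:ℝ):ℂ) by push_cast; ring, Complex.add_im, Complex.I_mul_im,
      Complex.add_re, Complex.re_mul_ofReal]
    simp; linarith
  have i2 := i1 (-x)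
  push_cast at i2
  have e1 := (hG a b ha hb).funEqm (x + Complex.I*a/2) (by
    rw [cosh_quarter_shift ha0]; exact mul_ne_zero Complex.I_ne_zero (sinh_pi_mul_ne ha hx))
  have e2 := (hG a b ha hb).funEqp (-x + Complex.I*b/2) (by
    rw [cosh_quarter_shift hb0, show (Real.pi:ℂ)*(-x)/b = -(Real.pi*x/b) by ring, Complex.sinh_neg]
    exact mul_ne_zero Complex.I_ne_zero (neg_ne_zero.2 (sinh_pi_mul_ne hb hx)))
  rw [cosh_quarter_shift ha0] at e1
  rw [cosh_quarter_shift hb0, show (Real.pi:ℂ)*(-x)/b = -(Real.pi*x/b) by ring,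
    Complex.sinh_neg] at e2
  have e3 := G_mul_G_neg hG ha hb (z := x + Complex.I*a/2 - Complex.I*b/2) (by
    rw [Complex.sub_im, Complex.add_im, im_I_mul_div_two, im_I_mul_div_two, Complex.ofReal_im,
      abs_lt]
    constructor <;> linarith)
  rw [show -(x + Complex.I*a/2 - Complex.I*b/2) = -x + Complex.I*b/2 - Complex.I*a/2 by ring] at e3
  rw [show (x:ℂ) + Complex.I*(a+b)/2 = x + Complex.I*a/2 + Complex.I*b/2 by ring,
    show -(x:ℂ) + Complex.I*(a+b)/2 = -x + Complex.I*b/2 + Complex.I*a/2 by ring, e1, e2,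
    G_eq_inv hG ha hb (i1 x) h1, G_eq_inv hG ha hb i2 h2, div_inv_eq_mul, div_inv_eq_mul,
    add_comm k]
  linear_combination (4 * Complex.sinh (Real.pi*x/a) * Complex.sinh (Real.pi*x/b) *
      (eX a b (x + Complex.I*((a+b)/2+k)) * eX a b (-x + Complex.I*((a+b)/2+k)))) * e3
    - 4 * Complex.sinh (Real.pi*x/a) * Complex.sinh (Real.pi*x/b) *
      (eX a b (x + Complex.I*((a+b)/2+k)) * eX a b (-x + Complex.I*((a+b)/2+k))) *
      (G a b (x + Complex.I*a/2 - Complex.I*b/2) * G a b (-x + Complex.I*b/2 - Complex.I*a/2)) *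
      Complex.I_mul_I

end

section
variable {a b k : ℂ} {x : ℝ}

/-- The short-root weight as a one-body weight with the first quasi-period doubled. -/
theorem wt_gT (h : HypFE) (ha : 0 < a.re) (hb : 0 < b.re) (hk : k.re < 0) :
    4 * Complex.sinh (Real.pi*x/a) * Complex.sinh (Real.pi*x/b) *
      (eX a b (x + Complex.I*((a+b)/2+k)) * eX a b (-x + Complex.I*((a+b)/2+k))) =
    wt (2*a) b (gT (2*a) b k) x := by
  have ha2 : 0 < (2*a).re := by simpa using ha
  have ra : (2*a).re = 2*a.re := by simp
  have ia : (Complex.I*a).im = a.re := by simp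
  have ia2 : (Complex.I*(2*a)).im = 2*a.re := by simp
  have e1 := eX_duplication h ha hb (z := x + Complex.I*((a+b)/2+k)) (by
    rw [im_add_tau]; linarith)
  have e2 := eX_duplication h ha hb (z := -x + Complex.I*((a+b)/2+k)) (by
    rw [im_neg_add_tau]; linarith)
  have e3 := eX_mul_neg h ha2 hb (z := x) (by simp; linarith)
  have e4 := eX_mul_neg h ha2 hb (z := x + Complex.I*a) (by
    rw [Complex.add_im, Complex.ofReal_im, ia, ra, zero_add, abs_of_pos ha]; linarith)
  have e5 := eX_sub' h ha2 hb (z := -x + Complex.I*a) (by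
    rw [Complex.add_im, Complex.neg_im, Complex.ofReal_im, ia, ra]; linarith)
  rw [show -(x:ℂ) + Complex.I*a - Complex.I*(2*a) = -(x + Complex.I*a) by ring,
    show (Real.pi:ℂ)*(-(x:ℂ) + Complex.I*a - Complex.I*(2*a)/2)/b = -(Real.pi*x/b) by ring,
    Complex.cosh_neg] at e5
  rw [e5] at e4
  have g0 : gT (2*a) b k 0 = k := rfl
  have g1 : gT (2*a) b k 1 = k - 2*a/2 := rfl
  have g2 : gT (2*a) b k 2 = -b/2 := rfl
  have g3 : gT (2*a) b k 3 = -(2*a)/2 - b/2 := rfl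
  rw [wt, Fin.prod_univ_four, g0, g1, g2, g3]
  rw [show (2*(Real.pi:ℂ)*x/(2*a)) = Real.pi*x/a by rw [mul_assoc, mul_div_mul_left _ _ two_ne_zero],
    show (2*(Real.pi:ℂ)*x/b) = 2*(Real.pi*x/b) by ring, Complex.sinh_two_mul]
  rw [show (2*a+b)/2 + (-(2*a)/2-b/2) = 0 by ring, show (2*a+b)/2 + -b/2 = a by ring, mul_zero,
    add_zero, add_zero, e3, e1, e2]
  rw [show (x:ℂ) + Complex.I*((a+b)/2+k) + Complex.I*a/2 = x + Complex.I*((2*a+b)/2+k) by ring,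
    show (x:ℂ) + Complex.I*((a+b)/2+k) - Complex.I*a/2 = x + Complex.I*((2*a+b)/2+(k-2*a/2)) by ring,
    show -(x:ℂ) + Complex.I*((a+b)/2+k) + Complex.I*a/2 = -x + Complex.I*((2*a+b)/2+k) by ring,
    show -(x:ℂ) + Complex.I*((a+b)/2+k) - Complex.I*a/2 = -x + Complex.I*((2*a+b)/2+(k-2*a/2)) by
      ring]
  generalize eX (2*a) b (x + Complex.I*((2*a+b)/2+k)) = A1
  generalize eX (2*a) b (x + Complex.I*((2*a+b)/2+(k-2*a/2))) = A2
  generalize eX (2*a) b (-x + Complex.I*((2*a+b)/2+k)) = A3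
  generalize eX (2*a) b (-x + Complex.I*((2*a+b)/2+(k-2*a/2))) = A4
  linear_combination (-4 * Complex.sinh (Real.pi*x/a) * Complex.sinh (Real.pi*x/b) *
    (A1*A2*(A3*A4))) * e4

/-- The long-root weight as a two-body weight. -/
theorem vt_two_mul (h : HypFE) (ha : 0 < a.re) (hb : 0 < b.re) (hk : k.re < 0) :
    4 * Complex.sinh (Real.pi*(x/2:ℝ)/a) * Complex.sinh (Real.pi*(x/2:ℝ)/(b/2)) *
      (eX a (b/2) ((x/2:ℝ) + Complex.I*((a+b/2)/2+k)) *
        eX a (b/2) (-(x/2:ℝ) + Complex.I*((a+b/2)/2+k))) =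
    vt (2*a) b (2*k) x := by
  have rk : (2*k).re = 2*k.re := by simp
  have ra : (2*a).re = 2*a.re := by simp
  have e1 := eX_half h ha hb (z := x + Complex.I*((2*a+b)/2+2*k)) (by
    rw [im_add_tau, rk, ra]; linarith)
  have e2 := eX_half h ha hb (z := -x + Complex.I*((2*a+b)/2+2*k)) (by
    rw [im_neg_add_tau, rk, ra]; linarith)
  have hb0 := re_ne hb
  have ha0 := re_ne ha
  rw [vt, ← e1, ← e2]
  push_cast
  rw [show (Real.pi:ℂ)*(x/2)/a = Real.pi*x/(2*a) by field_simp,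
    show (Real.pi:ℂ)*(x/2)/(b/2) = Real.pi*x/b by field_simp,
    show ((x:ℂ) + Complex.I*((2*a+b)/2+2*k))/2 = x/2 + Complex.I*((a+b/2)/2+k) by ring,
    show (-(x:ℂ) + Complex.I*((2*a+b)/2+2*k))/2 = -(x/2) + Complex.I*((a+b/2)/2+k) by ring]

/-- Real translates avoiding the poles, for almost every value of a nonzero linear form. -/
theorem ae_notMem_hypGammaPoles {n : ℕ} (a b c : ℂ) (l : (Fin n → ℝ) →ₗ[ℝ] ℝ) (hl : l ≠ 0) :
    ∀ᵐ v : Fin n → ℝ, ((l v:ℝ):ℂ) + c ∉ hypGammaPoles a b := by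
  obtain ⟨w, hw⟩ : ∃ w, l w = 1 := by
    obtain ⟨u, hu⟩ : ∃ u, l u ≠ 0 := by
      by_contra! hu
      exact hl (LinearMap.ext hu)
    exact ⟨(l u)⁻¹ • u, by simp [hu]⟩
  have h1 : ∀ r : ℝ, ∀ᵐ v : Fin n → ℝ, l v ≠ r := fun r => by
    have := (measurePreserving_sub_right (volume : Measure (Fin n → ℝ)) (r • w)).quasiMeasurePreserving.ae
      (ae_linear_ne l hl)
    filter_upwards [this] with v hv h0
    exact hv (by simp [h0, hw])
  have h2 : ∀ p : ℕ × ℕ, ∀ᵐ v : Fin n → ℝ, l v ≠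
      (-Complex.I*(a+b)/2 - (p.1:ℂ)*Complex.I*a - (p.2:ℂ)*Complex.I*b - c).re := fun p => h1 _
  filter_upwards [ae_all_iff.2 h2] with v hv
  rintro ⟨m, k, hmk⟩
  refine hv (m, k) ?_
  rw [← hmk]; simp

end

section
variable {n : ℕ} {op om k : ℂ} {x : ℝ} {G : ℂ → ℂ → ℂ → ℂ}

theorem ae_pair (a b c : ℂ) (l : (Fin n → ℝ) →ₗ[ℝ] ℝ) (hl : l ≠ 0) :
    ∀ᵐ v : Fin n → ℝ, l v ≠ 0 ∧ ((l v:ℝ):ℂ) + c ∉ hypGammaPoles a b ∧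
      -((l v:ℝ):ℂ) + c ∉ hypGammaPoles a b := by
  filter_upwards [ae_linear_ne l hl, ae_notMem_hypGammaPoles a b c l hl,
    ae_notMem_hypGammaPoles a b c (-l) (neg_ne_zero.2 hl)] with v h1 h2 h3
  refine ⟨h1, h2, ?_⟩
  simpa using h3

theorem short_weight (hG : ∀ a b : ℂ, 0 < a.re → 0 < b.re → IsHypGamma a b (G a b))
    (hop : 0 < op.re) (hom : 0 < om.re) (hk : k.re < 0) (hx : x ≠ 0)
    (h1 : (x:ℂ) + Complex.I*(k+(op+om)/2) ∉ hypGammaPoles op om)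
    (h2 : -(x:ℂ) + Complex.I*(k+(op+om)/2) ∉ hypGammaPoles op om) :
    G op om ((x:ℂ) + Complex.I*(op+om)/2) / G op om ((x:ℂ) + Complex.I*(k+(op+om)/2)) *
      (G op om (((-x:ℝ):ℂ) + Complex.I*(op+om)/2) /
        G op om (((-x:ℝ):ℂ) + Complex.I*(k+(op+om)/2))) =
    wt (2*op) om (gT (2*op) om k) x := by
  rw [Complex.ofReal_neg, pair_weight hG hop hom hk hx h1 h2,
    wt_gT (hypFE_of_isHypGamma hG) hop hom hk]

theorem long_weight (hG : ∀ a b : ℂ, 0 < a.re → 0 < b.re → IsHypGamma a b (G a b))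
    (hop : 0 < op.re) (hom : 0 < om.re) (hk : k.re < 0) (hx : x/2 ≠ 0)
    (h1 : ((x/2:ℝ):ℂ) + Complex.I*(k+(op+om/2)/2) ∉ hypGammaPoles op (om/2))
    (h2 : -((x/2:ℝ):ℂ) + Complex.I*(k+(op+om/2)/2) ∉ hypGammaPoles op (om/2)) :
    G op (om/2) ((x:ℂ)/2 + Complex.I*(op/2+om/4)) /
        G op (om/2) ((x:ℂ)/2 + Complex.I*(k+op/2+om/4)) *
      (G op (om/2) (((-x:ℝ):ℂ)/2 + Complex.I*(op/2+om/4)) /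
        G op (om/2) (((-x:ℝ):ℂ)/2 + Complex.I*(k+op/2+om/4))) =
    vt (2*op) om (2*k) x := by
  have hom2 : 0 < (om/2).re := by simpa using hom
  rw [← vt_two_mul (hypFE_of_isHypGamma hG) hop hom hk, ← pair_weight hG hop hom2 hk hx h1 h2]
  push_cast
  rw [show Complex.I*(op/2+om/4) = Complex.I*(op+om/2)/2 by ring,
    show k+op/2+om/4 = k+(op+om/2)/2 by ring, neg_div]

theorem bcLong_eq_pairProd (f : ℝ → ℂ) (v : Fin n → ℝ) : bcLong f v = pairProd fun i j =>
    f (v i + v j) * f (-(v i + v j)) * (f (v i - v j) * f (-(v i - v j))) := by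
  rw [bcLong, Finset.prod_filter, Fintype.prod_prod_type, pairProd_eq_ite]
  refine Finset.prod_congr rfl fun i _ => Finset.prod_congr rfl fun j _ => ?_
  simp only [neg_sub]
  split_ifs
  · ring
  · rfl

/-- The integrand over the root system agrees almost everywhere with the integrand of the
hyperbolic Koornwinder integral. -/
theorem integrand_ae_eq (hG : ∀ a b : ℂ, 0 < a.re → 0 < b.re → IsHypGamma a b (G a b))
    (hop : 0 < op.re) (hom : 0 < om.re) {ks kl : ℂ} (hks : ks.re < 0) (hkl : kl.re < 0) :
    (IntG n (fun x => wt (2*op) om (gT (2*op) om ks) x) (fun x => vt (2*op) om (2*kl) x)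
      (fun x => vt (2*op) om (2*kl) x)) =ᵐ[volume]
    (fun v : Fin n → ℝ =>
      bcShort (fun x => G op om ((x:ℂ) + Complex.I*(op+om)/2) /
          G op om ((x:ℂ) + Complex.I*(ks+(op+om)/2))) v *
        bcLong (fun x => G op (om/2) ((x:ℂ)/2 + Complex.I*(op/2+om/4)) /
          G op (om/2) ((x:ℂ)/2 + Complex.I*(kl+op/2+om/4))) v) := by
  have hproj : ∀ i : Fin n, (LinearMap.proj i : (Fin n → ℝ) →ₗ[ℝ] ℝ) ≠ 0 := fun i h => by
    have := LinearMap.congr_fun h (Pi.single i 1)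
    simp at this
  have hadd : ∀ i j : Fin n, i ≠ j →
      (2⁻¹:ℝ) • ((LinearMap.proj i : (Fin n → ℝ) →ₗ[ℝ] ℝ) + LinearMap.proj j) ≠ 0 :=
    fun i j hij h => by
      have := LinearMap.congr_fun h (Pi.single i 1)
      simp [Ne.symm hij] at this
  have hsub : ∀ i j : Fin n, i ≠ j →
      (2⁻¹:ℝ) • ((LinearMap.proj i : (Fin n → ℝ) →ₗ[ℝ] ℝ) - LinearMap.proj j) ≠ 0 :=
    fun i j hij h => by
      have := LinearMap.congr_fun h (Pi.single i 1)
      simp [Ne.symm hij] at this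
  have c1 := ae_all_iff.2 fun i : Fin n =>
    ae_pair op om (Complex.I*(ks+(op+om)/2)) _ (hproj i)
  have c2 : ∀ᵐ v : Fin n → ℝ, ∀ i j : Fin n, ∀ hij : i ≠ j, _ :=
    ae_all_iff.2 fun i : Fin n => ae_all_iff.2 fun j : Fin n => ae_all_iff.2 fun hij : i ≠ j =>
      ae_pair op (om/2) (Complex.I*(kl+(op+om/2)/2)) _ (hadd i j hij)
  have c3 : ∀ᵐ v : Fin n → ℝ, ∀ i j : Fin n, ∀ hij : i ≠ j, _ :=
    ae_all_iff.2 fun i : Fin n => ae_all_iff.2 fun j : Fin n => ae_all_iff.2 fun hij : i ≠ j =>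
      ae_pair op (om/2) (Complex.I*(kl+(op+om/2)/2)) _ (hsub i j hij)
  filter_upwards [c1, c2, c3] with v h1 h2 h3
  rw [IntG, bcLong_eq_pairProd, bcShort]
  congr 1
  · refine Finset.prod_congr rfl fun i _ => ?_
    obtain ⟨e1, e2, e3⟩ := h1 i
    exact (short_weight hG hop hom hks e1 e2 e3).symm
  · refine pairProd_congr fun i j hij => ?_
    have r : ∀ y : ℝ, (2⁻¹:ℝ) * y = y/2 := fun y => by ring
    have d2 := h2 i j hij.ne
    have d3 := h3 i j hij.ne
    simp only [LinearMap.smul_apply, LinearMap.add_apply, LinearMap.sub_apply, LinearMap.proj_apply,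
      smul_eq_mul, r] at d2 d3
    rw [← long_weight hG hop hom hkl d2.1 d2.2.1 d2.2.2,
      ← long_weight hG hop hom hkl d3.1 d3.2.1 d3.2.2]

end

/-- **Generalized Cherednik–Macdonald identity for `Σ` of type `B_n`, case (ii)**:
the integral equals `N_BC` with quasi-periods `(2ω₊,ω₋)` and parameters
`γ = (k_s, k_s-ω₊, -ω₋/2, -ω₊-ω₋/2)`, `κ = 2k_l`. -/
theorem generalized_CM_Bn_case_ii (n : ℕ) (hn : 2 ≤ n)
    (G : ℂ → ℂ → ℂ → ℂ)
    (hG : ∀ a b : ℂ, 0 < a.re → 0 < b.re → IsHypGamma a b (G a b))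
    (op om ks kl : ℂ) (hop : 0 < op.re) (hom : 0 < om.re) (him : (op*om).im < 0)
    (hks1 : ks.re < 0) (hks2 : ∃ w : ℂ, 0 < w.re ∧ ks = op*om*w)
    (hkl1 : kl.re < 0) (hkl2 : ∃ w : ℂ, 0 < w.re ∧ kl = op*om*w) :
    Integrable (fun v : Fin n → ℝ =>
      bcShort (fun x => G op om ((x:ℂ) + Complex.I*(op+om)/2) /
          G op om ((x:ℂ) + Complex.I*(ks+(op+om)/2))) v *
        bcLong (fun x => G op (om/2) ((x:ℂ)/2 + Complex.I*(op/2+om/4)) /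
          G op (om/2) ((x:ℂ)/2 + Complex.I*(kl+op/2+om/4))) v) ∧
    ∫ v : Fin n → ℝ,
        (bcShort (fun x => G op om ((x:ℂ) + Complex.I*(op+om)/2) /
            G op om ((x:ℂ) + Complex.I*(ks+(op+om)/2))) v *
          bcLong (fun x => G op (om/2) ((x:ℂ)/2 + Complex.I*(op/2+om/4)) /
            G op (om/2) ((x:ℂ)/2 + Complex.I*(kl+op/2+om/4))) v) =
      NBC G n (2*op) om ![ks, ks-op, -om/2, -op-om/2] (2*kl) := by
  have h := hypFE_of_isHypGamma hG
  have ha : 0 < (2*op).re := by simpa using hop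
  have hp0 := re_ne hop
  have hm0 := re_ne hom
  have hksab : 0 < (ks/(2*op*om)).re := by
    obtain ⟨w, hw, rfl⟩ := hks2
    rw [show op*om*w/(2*op*om) = ((1/2:ℝ):ℂ)*w by push_cast; field_simp, Complex.re_ofReal_mul]
    positivity
  have hkab : 0 < (2*kl/(2*op*om)).re := by
    obtain ⟨w, hw, rfl⟩ := hkl2
    rwa [show 2*(op*om*w)/(2*op*om) = w by field_simp]
  have hk : (2*kl).re < 0 := by
    rw [show (2*kl).re = 2*kl.re by simp]; linarith
  have hae := integrand_ae_eq (n := n) hG hop hom hks1 hkl1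
  have hg : ![ks, ks-op, -om/2, -op-om/2] = gT (2*op) om ks := by
    funext r
    fin_cases r <;> simp [gT]
    ring
  refine ⟨(integrable_IBC h (adm_gT ha hom hks1 hksab hk hkab)).congr hae, ?_⟩
  rw [← integral_congr_ae hae, hg, NBC_gT hG ha hom hks1 hksab hk hkab, IBC]

end
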